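/- Assume n ≥ 2, p ∈ [2,∞), q ∈ [p,∞), s,t ∈ (0,1) with t ≤ s, 1/p' ≤ tq/(sp) ≤ 1, sp < n, a measurable symmetric with 0 ≤ a ≤ M, and ε ∈ (0, s/p) with ε < s(tq/(sp) − 1/p') and ε < 1−s. Let u ∈ W^{s,p}(ℝⁿ) ∩ L^∞(ℝⁿ) be a bounded weak solution with data f ∈ L^{p_*+δ₀}(ℝⁿ), δ₀ > 0, and fix δ_f ∈ (0,δ₀). Let 0 < ϱ₀ ≤ 1 and ϱ₀ < β < α < (3/2)ϱ₀. Then there exist constants C_α = C_α(data) > 0, C_f = C_f(data,ε) ≥ 1, C_a = C_a(data), and κ_f = κ_f(data,ε) ∈ (0,1) (data = (n,p,q,s,t,M,‖u‖_{L^∞})), such that with ϑ = 3(p'−γ)/γ, ϑ_f = (p_*+δ_f)·p_*θ/(1−p_*θ), ϑ̃_f = p_*(1+θδ_f)/(1−p_*θ), and λ₀ = (C_a/ε)(ϱ₀/(α−β))^{2n+p} Θ(x₀, 2ϱ₀), the level set estimate λ^{−p'} ∫_{𝓑(x₀,β) ∩ {H > λ}} H^{p'} dν ≤ C_α ε^{−ϑ}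 λ^{−γ} ∫_{𝓑(x₀,α) ∩ {H > λ}} H^γ dν + C_f λ₀^{ϑ_f} λ^{−ϑ̃_f} ∫_{𝓑(x₀,α) ∩ {F > κ_f λ}} F^{p_*} dν holds for every λ ≥ λ₀. -/

import Mathlib

open MeasureTheory Metric Set
open scoped ENNReal

noncomputable section

/-- `ℝⁿ` as a Euclidean space. -/
abbrev En (n : ℕ) := EuclideanSpace ℝ (Fin n)

/-- The Hölder conjugate `p' = p/(p−1)`. -/
def pC (p : ℝ) : ℝ := p / (p - 1)

/-- The lower Sobolev exponent `p_* = np'/(n+sp')`. -/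
def pStar (n : ℕ) (p s : ℝ) : ℝ := (n : ℝ) * pC p / ((n : ℝ) + s * pC p)

/-- The integrand `P(x,y,u)` of the double phase energy `ℰ(u,u)`:
`|u(x)−u(y)|^p/|x−y|^{n+sp} + a(x,y)|u(x)−u(y)|^q/|x−y|^{n+tq}`. -/
def energyIntegrand (n : ℕ) (p q s t : ℝ) (a : En n × En n → ℝ) (u : En n → ℝ)
    (z : En n × En n) : ℝ :=
  |u z.1 - u z.2| ^ p / ‖z.1 - z.2‖ ^ ((n : ℝ) + s * p)
    + a z * |u z.1 - u z.2| ^ q / ‖z.1 - z.2‖ ^ ((n : ℝ) + t * q)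

/-- The integrand of the double phase form `ℰ(u,φ)`. -/
def formIntegrand (n : ℕ) (p q s t : ℝ) (a : En n × En n → ℝ) (u φ : En n → ℝ)
    (z : En n × En n) : ℝ :=
  |u z.1 - u z.2| ^ (p - 2) * (u z.1 - u z.2) * (φ z.1 - φ z.2)
      / ‖z.1 - z.2‖ ^ ((n : ℝ) + s * p)
    + a z * (|u z.1 - u z.2| ^ (q - 2) * (u z.1 - u z.2) * (φ z.1 - φ z.2))
        / ‖z.1 - z.2‖ ^ ((n : ℝ) + t * q)

/-- `u ∈ W^{s,p}(ℝⁿ)`: `u` is measurable, `u ∈ L^p(ℝⁿ)`, and the Gagliardo seminorm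
`∬ |u(x)−u(y)|^p/|x−y|^{n+sp} dy dx` is finite. -/
def MemWsp (n : ℕ) (s p : ℝ) (u : En n → ℝ) : Prop :=
  Measurable u ∧ (∫⁻ x, ENNReal.ofReal (|u x| ^ p)) < ⊤ ∧
    (∫⁻ z : En n × En n,
      ENNReal.ofReal (|u z.1 - u z.2| ^ p / ‖z.1 - z.2‖ ^ ((n : ℝ) + s * p))) < ⊤

/-- `u` is a bounded weak solution of `ℒu = f`: the double phase energy `ℰ(u,u)` is finite
and `ℰ(u,φ) = ∫ fφ` for every test function `φ ∈ C_c^∞(ℝⁿ)`. -/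
def IsBoundedWeakSolution (n : ℕ) (p q s t : ℝ) (a : En n × En n → ℝ)
    (u f : En n → ℝ) : Prop :=
  (∫⁻ z : En n × En n, ENNReal.ofReal (energyIntegrand n p q s t a u z)) < ⊤ ∧
  ∀ φ : En n → ℝ, ContDiff ℝ (⊤ : ℕ∞) φ → HasCompactSupport φ →
    (∫ z : En n × En n, formIntegrand n p q s t a u φ z) = ∫ x, f x * φ x

/-- The dual-pair measure `ν` on `ℝⁿ × ℝⁿ`, with density `|x−y|^{−(n−εp)}`. -/
def nu (n : ℕ) (p ε : ℝ) : Measure (En n × En n) :=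
  volume.withDensity fun z => ENNReal.ofReal (‖z.1 - z.2‖ ^ (ε * p - n))

/-- The diagonal ball `𝓑(x₀,R) = B(x₀,R) × B(x₀,R) ⊂ ℝ^{2n}`. -/
def bB (n : ℕ) (x₀ : En n) (R : ℝ) : Set (En n × En n) := ball x₀ R ×ˢ ball x₀ R

/-- The exponent `η = (np + εp²)/(n + sp + εp)`. -/
def etaEx (n : ℕ) (p s ε : ℝ) : ℝ := ((n : ℝ) * p + ε * p ^ 2) / ((n : ℝ) + s * p + ε * p)

/-- The exponent `γ = η/(p−1) = p'(n+εp)/(n+sp+εp)`. -/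
def gammaEx (n : ℕ) (p s ε : ℝ) : ℝ :=
  pC p * (((n : ℝ) + ε * p) / ((n : ℝ) + s * p + ε * p))

/-- The exponent `θ = (s − ε(p−1))/(n + εp)`. -/
def thetaEx (n : ℕ) (p s ε : ℝ) : ℝ := (s - ε * (p - 1)) / ((n : ℝ) + ε * p)

/-- `U(x,y) = |u(x)−u(y)|/|x−y|^{s+ε}`. -/
def Ufun (n : ℕ) (s ε : ℝ) (u : En n → ℝ) (z : En n × En n) : ℝ :=
  |u z.1 - u z.2| / ‖z.1 - z.2‖ ^ (s + ε)

/-- `A(x,y) = a(x,y)|x−y|^{(s−t)q+ε(q−p)}`. -/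
def Afun (n : ℕ) (p q s t ε : ℝ) (a : En n × En n → ℝ) (z : En n × En n) : ℝ :=
  a z * ‖z.1 - z.2‖ ^ ((s - t) * q + ε * (q - p))

/-- `G(x,y,U) = U^p + A(x,y) U^q`. -/
def Gfun (n : ℕ) (p q s t ε : ℝ) (a : En n × En n → ℝ) (u : En n → ℝ)
    (z : En n × En n) : ℝ :=
  Ufun n s ε u z ^ p + Afun n p q s t ε a z * Ufun n s ε u z ^ q

/-- `H(x,y,U) = G(x,y,U)^{(p−1)/p}`. -/
def Hfun (n : ℕ) (p q s t ε : ℝ) (a : En n × En n → ℝ) (u : En n → ℝ)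
    (z : En n × En n) : ℝ :=
  Gfun n p q s t ε a u z ^ ((p - 1) / p)

/-- `Υ₀(x₀,R) = (⨍_{𝓑(x₀,R)} F^{pe} dν)^{1/pe}` with `F(x,y) = |f(x)|`. -/
def UpsF (n : ℕ) (p ε pe : ℝ) (f : En n → ℝ) (x₀ : En n) (R : ℝ) : ℝ :=
  (⨍ z in bB n x₀ R, |f z.1| ^ pe ∂nu n p ε) ^ (1 / pe)

/-- `Tail(x₀,R) = Σ_k 2^{−k(tq/(p−1)−s−ε)} (⨍_{𝓑(x₀,2^k R)} H^γ dν)^{1/γ}`. -/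
def TailF (n : ℕ) (p q s t ε : ℝ) (a : En n × En n → ℝ) (u : En n → ℝ)
    (x₀ : En n) (R : ℝ) : ℝ :=
  ∑' k : ℕ, (2 : ℝ) ^ (-(k : ℝ) * (t * q / (p - 1) - s - ε)) *
    (⨍ z in bB n x₀ (2 ^ k * R), Hfun n p q s t ε a u z ^ gammaEx n p s ε ∂nu n p ε) ^
      (1 / gammaEx n p s ε)

/-- `Ψ_M(x₀,R) = (⨍_{𝓑(x₀,R)} H^{p'} dν)^{1/p'}
  + M ν(𝓑(x₀,R))^θ ε^{−(1/p_*−1/p')} (⨍_{𝓑(x₀,R)} F^{p_*} dν)^{1/p_*}`. -/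
def PsiF (n : ℕ) (p q s t ε M' : ℝ) (a : En n × En n → ℝ) (u f : En n → ℝ)
    (x₀ : En n) (R : ℝ) : ℝ :=
  (⨍ z in bB n x₀ R, Hfun n p q s t ε a u z ^ pC p ∂nu n p ε) ^ (1 / pC p)
    + M' * (nu n p ε (bB n x₀ R)).toReal ^ thetaEx n p s ε
        / ε ^ (1 / pStar n p s - 1 / pC p)
        * (⨍ z in bB n x₀ R, |f z.1| ^ pStar n p s ∂nu n p ε) ^ (1 / pStar n p s)

/-- `Θ(x₀,R) = Υ₀(x₀,R) + Tail(x₀,R) + Ψ₁(x₀,R)`, with `Υ₀` taken with exponent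
`p_* + δ_f`. -/
def ThetaF (n : ℕ) (p q s t ε δf : ℝ) (a : En n × En n → ℝ) (u f : En n → ℝ)
    (x₀ : En n) (R : ℝ) : ℝ :=
  UpsF n p ε (pStar n p s + δf) f x₀ R + TailF n p q s t ε a u x₀ R
    + PsiF n p q s t ε 1 a u f x₀ R

/-- Volume of the unit ball. -/
def om (n : ℕ) : ℝ := (volume : Measure (En n)).real (ball 0 1)

lemma om_pos (n : ℕ) : 0 < om n := by
  unfold om
  rw [measureReal_def]
  exact ENNReal.toReal_pos (measure_ball_pos _ _ one_pos).ne' measure_ball_lt_top.ne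

lemma vol_ball {n : ℕ} (x : En n) {r : ℝ} (hr : 0 ≤ r) (hn : 0 < n) :
    volume (ball x r) = ENNReal.ofReal (om n * r ^ (n : ℝ)) := by
  have : Nonempty (Fin n) := ⟨⟨0, hn⟩⟩
  rw [Measure.addHaar_ball _ _ hr, om, measureReal_def, mul_comm, Real.rpow_natCast,
    ENNReal.ofReal_mul ENNReal.toReal_nonneg, ENNReal.ofReal_toReal measure_ball_lt_top.ne]
  simp

lemma lint_radial {n : ℕ} (hn : 0 < n) (x : En n) (g : ℝ → ℝ) (hg0 : ∀ y, 0 ≤ g y)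
    (hgi : IntegrableOn (fun y : ℝ => y ^ (n - 1) * g y) (Ioi 0)) :
    ∫⁻ y : En n, ENNReal.ofReal (g ‖x - y‖) =
      ENNReal.ofReal (n * om n * ∫ y in Ioi (0 : ℝ), y ^ (n - 1) * g y) := by
  have : Nonempty (Fin n) := ⟨⟨0, hn⟩⟩
  have h1 : ∫⁻ y : En n, ENNReal.ofReal (g ‖x - y‖) = ∫⁻ y : En n, ENNReal.ofReal (g ‖y‖) :=
    lintegral_sub_left_eq_self (fun y : En n => ENNReal.ofReal (g ‖y‖)) x
  have hi : Integrable (fun y : En n => g ‖y‖) := by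
    have := (integrable_fun_norm_addHaar (E := En n) volume (f := g)).2
    simp only [finrank_euclideanSpace, Fintype.card_fin, smul_eq_mul] at this
    exact this hgi
  rw [h1, ← ofReal_integral_eq_lintegral_ofReal hi (Filter.Eventually.of_forall fun y => hg0 _),
    integral_fun_norm_addHaar]
  simp only [finrank_euclideanSpace, Fintype.card_fin, smul_eq_mul, nsmul_eq_mul, om]
  ring_nf

lemma ker_in {n : ℕ} (hn : 0 < n) (x : En n) {b R : ℝ} (hb : 0 < b) (hR : 0 < R) :
    ∫⁻ y in ball x R, ENNReal.ofReal (‖x - y‖ ^ (b - n)) = ENNReal.ofReal (n * om n * (R ^ b / b)) := by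
  have h1 : ∫⁻ y in ball x R, ENNReal.ofReal (‖x - y‖ ^ (b - n))
      = ∫⁻ y : En n, ENNReal.ofReal ((Iio R).indicator (fun r => |r| ^ (b - n)) ‖x - y‖) := by
    rw [← lintegral_indicator measurableSet_ball]
    congr 1; ext y
    by_cases hy : y ∈ ball x R
    · have : ‖x - y‖ < R := by rwa [mem_ball, dist_comm, dist_eq_norm] at hy
      simp [hy, this]
    · have : ¬ ‖x - y‖ < R := by rwa [mem_ball, dist_comm, dist_eq_norm] at hy
      simp [hy, this]
  have h2 : ∀ y ∈ Ioi (0:ℝ), y ^ (n - 1) * (Iio R).indicator (fun r => |r| ^ (b - n)) y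
      = (Ioc 0 R \ {R}).indicator (fun r => r ^ (b - 1)) y := by
    intro y hy
    have hy' : 0 < y := hy
    by_cases hyR : y < R
    · have : y ∈ Ioc 0 R \ {R} := ⟨⟨hy', hyR.le⟩, by simp [hyR.ne]⟩
      simp only [indicator, mem_Iio, hyR, if_true, this]
      rw [abs_of_pos hy', ← Real.rpow_natCast, ← Real.rpow_add hy']
      congr 1
      rw [Nat.cast_sub hn]; push_cast; ring
    · have : y ∉ Ioc 0 R \ {R} := by
        rintro ⟨⟨_, h⟩, h'⟩
        exact hyR (lt_of_le_of_ne h h')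
      simp only [indicator, mem_Iio, hyR, if_false, this, mul_zero]
  have hIntg : IntegrableOn (fun r : ℝ => r ^ (b - 1)) (Ioc 0 R) :=
    (intervalIntegrable_iff_integrableOn_Ioc_of_le hR.le).1
      (intervalIntegral.intervalIntegrable_rpow' (by linarith))
  have hms : MeasurableSet (Ioc 0 R \ {R}) := measurableSet_Ioc.diff (measurableSet_singleton _)
  rw [h1, lint_radial hn]
  · congr 2
    rw [setIntegral_congr_fun measurableSet_Ioi h2, setIntegral_indicator hms]
    have : Ioi (0:ℝ) ∩ (Ioc 0 R \ {R}) = Ioc 0 R \ {R} := by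
      ext y; simp
    rw [this, setIntegral_congr_set (t := Ioc 0 R)]
    · rw [← intervalIntegral.integral_of_le hR.le, integral_rpow (Or.inl (by linarith))]
      simp [Real.zero_rpow hb.ne']
    · exact sdiff_null_ae_eq_self (by simp)
  · intro y; apply indicator_nonneg; intro r _; positivity
  · rw [integrableOn_congr_fun h2 measurableSet_Ioi]
    exact ((hIntg.mono_set sdiff_subset).integrable_indicator hms).integrableOn

lemma ker_out {n : ℕ} (hn : 0 < n) (x : En n) {b R : ℝ} (hb : 0 < b) (hR : 0 < R) :
    ∫⁻ y in (ball x R)ᶜ, ENNReal.ofReal (‖x - y‖ ^ (-(n + b))) =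
      ENNReal.ofReal (n * om n * (R ^ (-b) / b)) := by
  have h1 : ∫⁻ y in (ball x R)ᶜ, ENNReal.ofReal (‖x - y‖ ^ (-(n + b)))
      = ∫⁻ y : En n, ENNReal.ofReal ((Ici R).indicator (fun r => |r| ^ (-(n + b))) ‖x - y‖) := by
    rw [← lintegral_indicator measurableSet_ball.compl]
    congr 1; ext y
    by_cases hy : y ∈ ball x R
    · have : ‖x - y‖ < R := by rwa [mem_ball, dist_comm, dist_eq_norm] at hy
      simp [hy, this]
    · have : R ≤ ‖x - y‖ := by
        rw [mem_ball, dist_comm, dist_eq_norm] at hy; linarith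
      simp [hy, this]
  have h2 : ∀ y ∈ Ioi (0:ℝ), y ^ (n - 1) * (Ici R).indicator (fun r => |r| ^ (-(n + b))) y
      = (Ici R).indicator (fun r => r ^ (-b - 1)) y := by
    intro y hy
    have hy' : 0 < y := hy
    by_cases hyR : R ≤ y
    · simp only [indicator, mem_Ici, hyR, if_true]
      rw [abs_of_pos hy', ← Real.rpow_natCast, ← Real.rpow_add hy']
      congr 1
      rw [Nat.cast_sub hn]; push_cast; ring
    · simp only [indicator, mem_Ici, hyR, if_false, mul_zero]
  have hIntg : IntegrableOn (fun r : ℝ => r ^ (-b - 1)) (Ioi R) :=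
    integrableOn_Ioi_rpow_of_lt (by linarith) hR
  rw [h1, lint_radial hn]
  · congr 2
    rw [setIntegral_congr_fun measurableSet_Ioi h2, setIntegral_indicator measurableSet_Ici]
    have : Ioi (0:ℝ) ∩ Ici R = Ici R := by
      ext y; simp only [mem_inter_iff, mem_Ioi, mem_Ici, and_iff_right_iff_imp]
      intro h; linarith
    rw [this, integral_Ici_eq_integral_Ioi, integral_Ioi_rpow_of_lt (by linarith) hR]
    rw [show -b - 1 + 1 = -b by ring]
    field_simp
  · intro y; apply indicator_nonneg; intro r _; positivity
  · rw [integrableOn_congr_fun h2 measurableSet_Ioi]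
    exact (((integrableOn_Ici_iff_integrableOn_Ioi).2 hIntg).integrable_indicator
      measurableSet_Ici).integrableOn

/-- Jensen / Hölder for lower integrals. -/
lemma jen {α : Type*} [MeasurableSpace α] (μ : Measure α) (h : α → ℝ≥0∞) (hh : AEMeasurable h μ)
    {P : ℝ} (hP : 1 ≤ P) :
    (∫⁻ x, h x ∂μ) ^ P ≤ μ univ ^ (P - 1) * ∫⁻ x, h x ^ P ∂μ := by
  rcases hP.eq_or_lt with rfl | hP
  · simp
  have hc := Real.HolderConjugate.conjExponent hP
  have h1 := ENNReal.lintegral_mul_le_Lp_mul_Lq μ hc hh (aemeasurable_const (b := (1 : ℝ≥0∞)))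
  simp only [Pi.mul_apply, mul_one, ENNReal.one_rpow, lintegral_one] at h1
  calc (∫⁻ x, h x ∂μ) ^ P ≤ ((∫⁻ x, h x ^ P ∂μ) ^ (1 / P) * μ univ ^ (1 / P.conjExponent)) ^ P := by
        gcongr
    _ = _ := by
        rw [ENNReal.mul_rpow_of_nonneg _ _ (by linarith), ← ENNReal.rpow_mul, ← ENNReal.rpow_mul,
          one_div_mul_cancel (by linarith), ENNReal.rpow_one, mul_comm]
        congr 2
        rw [Real.conjExponent]
        have : P ≠ 0 := by linarith
        field_simp

lemma hedberg {α : Type*} [MeasurableSpace α] (μ : Measure α) (f g : α → ℝ≥0∞)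
    (hg : AEMeasurable g μ)
    {P Q σ d C : ℝ} (hP : 0 < P) (hQ : 0 < Q) (hσ : 0 < σ) (hd : 0 < d) (hC : 0 < C)
    (hPQ : d / Q + σ = d / P) (N : ℝ≥0∞) (hN : N = ∫⁻ x, f x ^ Q ∂μ) (hNt : N ≠ ⊤)
    (hpw : ∀ᵐ x ∂μ, ∀ r : ℝ, 0 < r →
      f x ≤ ENNReal.ofReal C *
        (ENNReal.ofReal (r ^ σ) * g x + ENNReal.ofReal (r ^ (-(d / Q))) * N ^ (1 / Q))) :
    N ^ (P / Q) ≤ ENNReal.ofReal ((2 * C) ^ Q) * ∫⁻ x, g x ^ P ∂μ := by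
  have hPQ1 : σ * P / d = 1 - P / Q := by
    field_simp at hPQ ⊢
    nlinarith
  have hPQlt : P / Q < 1 := by
    have : 0 < σ * P / d := by positivity
    linarith
  have hPQpos : 0 < P / Q := by positivity
  have hlt : P < Q := by rwa [div_lt_one hQ] at hPQlt
  rcases eq_or_ne N 0 with h0 | h0
  · rw [h0, ENNReal.zero_rpow_of_pos hPQpos]; exact zero_le
  set m : ℝ := (N ^ (1 / Q)).toReal with hm
  have hMt : N ^ (1 / Q) ≠ ⊤ := ENNReal.rpow_ne_top_of_nonneg (by positivity) hNt
  have hM0 : N ^ (1 / Q) ≠ 0 := by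
    intro h
    rw [ENNReal.rpow_eq_zero_iff] at h
    rcases h with h | h
    · exact h0 h.1
    · exact hNt h.1
  have hMm : N ^ (1 / Q) = ENNReal.ofReal m := (ENNReal.ofReal_toReal hMt).symm
  have hmpos : 0 < m := ENNReal.toReal_pos hM0 hMt
  have hNm : N = ENNReal.ofReal (m ^ Q) := by
    rw [← ENNReal.ofReal_rpow_of_pos hmpos, ← hMm, ← ENNReal.rpow_mul,
      one_div_mul_cancel hQ.ne', ENNReal.rpow_one]
  have key : ∀ᵐ x ∂μ, f x ^ Q ≤
      ENNReal.ofReal ((2 * C) ^ Q * m ^ (Q - P)) * g x ^ P := by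
    filter_upwards [hpw] with x hx
    rw [hMm] at hx
    rcases eq_or_ne (g x) ⊤ with hgt | hgt
    · rw [hgt, ENNReal.top_rpow_of_pos hP, ENNReal.mul_top]
      · exact le_top
      · rw [ne_eq, ENNReal.ofReal_eq_zero, not_le]; positivity
    rcases eq_or_ne (g x) 0 with hg0 | hg0
    · have : f x ≤ 0 := by
        have ht : Filter.Tendsto (fun r : ℝ => ENNReal.ofReal C * ENNReal.ofReal (r ^ (-(d / Q)) * m))
            Filter.atTop (nhds (ENNReal.ofReal C * ENNReal.ofReal (0 * m))) := by
          refine ENNReal.Tendsto.const_mul ?_ (Or.inr ENNReal.ofReal_ne_top)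
          refine ENNReal.tendsto_ofReal ?_
          exact (tendsto_rpow_neg_atTop (by positivity)).mul_const m
        simp only [zero_mul, ENNReal.ofReal_zero, mul_zero] at ht
        refine ge_of_tendsto ht ?_
        filter_upwards [Filter.eventually_gt_atTop 0] with r hr
        have := hx r hr
        rw [hg0, mul_zero, zero_add, ← ENNReal.ofReal_mul (by positivity)] at this
        exact this
      have hf0 : f x = 0 := le_antisymm this (zero_le)
      rw [hf0, ENNReal.zero_rpow_of_pos hQ]; exact zero_le
    · set γ : ℝ := (g x).toReal with hγ
      have hgγ : g x = ENNReal.ofReal γ := (ENNReal.ofReal_toReal hgt).symm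
      have hγp : 0 < γ := ENNReal.toReal_pos hg0 hgt
      have hr : 0 < (m / γ) ^ (P / d) := by positivity
      have h1 := hx _ hr
      have e1 : ((m / γ) ^ (P / d)) ^ σ * γ = γ ^ (P / Q) * m ^ (1 - P / Q) := by
        rw [← Real.rpow_mul (by positivity), show P / d * σ = 1 - P / Q by rw [← hPQ1]; ring,
          Real.div_rpow hmpos.le hγp.le, div_mul_eq_mul_div, mul_comm, div_eq_iff (by positivity)]
        rw [mul_right_comm, ← Real.rpow_add hγp]
        simp
      have e2 : ((m / γ) ^ (P / d)) ^ (-(d / Q)) * m = γ ^ (P / Q) * m ^ (1 - P / Q) := by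
        rw [← Real.rpow_mul (by positivity), show P / d * (-(d / Q)) = - (P / Q) by field_simp,
          Real.rpow_neg (by positivity), Real.div_rpow hmpos.le hγp.le, Real.rpow_sub hmpos,
          Real.rpow_one]
        field_simp
      rw [hgγ, ← ENNReal.ofReal_mul (by positivity), ← ENNReal.ofReal_mul (by positivity), e1, e2,
        ← ENNReal.ofReal_add (by positivity) (by positivity),
        ← ENNReal.ofReal_mul (by positivity)] at h1
      calc f x ^ Q ≤ (ENNReal.ofReal (C * (γ ^ (P / Q) * m ^ (1 - P / Q) + γ ^ (P / Q) * m ^ (1 - P / Q)))) ^ Q := by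
            gcongr
        _ = _ := by
          rw [hgγ, ENNReal.ofReal_rpow_of_pos (by positivity), ENNReal.ofReal_rpow_of_pos hγp,
            ← ENNReal.ofReal_mul (by positivity)]
          congr 1
          rw [← two_mul, show C * (2 * (γ ^ (P / Q) * m ^ (1 - P / Q)))
            = (2 * C) * (γ ^ (P / Q) * m ^ (1 - P / Q)) by ring, Real.mul_rpow (by positivity)
            (by positivity), Real.mul_rpow (x := γ ^ (P / Q)) (by positivity) (by positivity),
            ← Real.rpow_mul hγp.le,
            ← Real.rpow_mul hmpos.le, div_mul_cancel₀ _ hQ.ne',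
            show (1 - P / Q) * Q = Q - P by field_simp]
          ring
  have h2 : N ≤ ENNReal.ofReal ((2 * C) ^ Q * m ^ (Q - P)) * ∫⁻ x, g x ^ P ∂μ := by
    rw [← lintegral_const_mul'' _ (hg.pow_const P)]
    conv_lhs => rw [hN]
    exact lintegral_mono_ae key
  have h3 : N ^ (P / Q) = ENNReal.ofReal (m ^ (P - Q)) * N := by
    rw [hNm, ENNReal.ofReal_rpow_of_pos (by positivity), ← ENNReal.ofReal_mul (by positivity),
      ← Real.rpow_mul hmpos.le, ← Real.rpow_add hmpos, mul_div_cancel₀ _ hQ.ne']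
    congr 2; ring
  rw [h3]
  calc _ ≤ ENNReal.ofReal (m ^ (P - Q)) *
        (ENNReal.ofReal ((2 * C) ^ Q * m ^ (Q - P)) * ∫⁻ x, g x ^ P ∂μ) := by gcongr
    _ = _ := by
      rw [← mul_assoc, ← ENNReal.ofReal_mul (by positivity)]
      congr 2
      rw [mul_left_comm, ← Real.rpow_add hmpos]
      simp

/-- Local Gagliardo function `g`. -/
def gag (n : ℕ) (P σ : ℝ) (S : Set (En n)) (w : En n → ℝ) (x : En n) : ℝ≥0∞ :=
  (∫⁻ y in S, ENNReal.ofReal (|w x - w y| ^ P * ‖x - y‖ ^ (-(n + σ * P)))) ^ (1 / P)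

/-- constant in the pointwise estimate -/
def c1 (n : ℕ) : ℝ := max 1 (2 ^ (n : ℝ) / om n)

lemma c1_one (n : ℕ) : 1 ≤ c1 n := le_max_left _ _

lemma one_le_mul_c1 (n : ℕ) {r : ℝ} (hr : 0 < r) :
    r ^ (n : ℝ) ≤ c1 n * (om n * (r / 2) ^ (n : ℝ)) := by
  have h := om_pos n
  have h2 : 2 ^ (n : ℝ) / om n ≤ c1 n := le_max_right _ _
  rw [Real.div_rpow hr.le (by norm_num)]
  rw [div_le_iff₀ h] at h2
  have h3 : (0:ℝ) < 2 ^ (n : ℝ) := by positivity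
  calc r ^ (n : ℝ) = 2 ^ (n : ℝ) * (r ^ (n : ℝ) / 2 ^ (n : ℝ)) := by field_simp
    _ ≤ (c1 n * om n) * (r ^ (n : ℝ) / 2 ^ (n : ℝ)) := by gcongr
    _ = _ := by ring

/-- averages over a fat set `T`: if `a ≤ h` on average then ... -/
lemma avg_bound {n : ℕ} (T : Set (En n)) {r : ℝ} (hr : 0 < r)
    (hT : ENNReal.ofReal (om n * (r / 2) ^ (n : ℝ)) ≤ volume T) (hTt : volume T ≠ ⊤)
    (h : En n → ℝ≥0∞) (hh : Measurable h) {P : ℝ} (hP : 1 ≤ P) (a : ℝ≥0∞)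
    (ha : a * volume T ≤ ∫⁻ y in T, h y) :
    a ^ P ≤ ENNReal.ofReal (c1 n * r ^ (-(n : ℝ))) * ∫⁻ y in T, h y ^ P := by
  have hT0 : volume T ≠ 0 := by
    intro h0
    rw [h0, nonpos_iff_eq_zero, ENNReal.ofReal_eq_zero] at hT
    have : 0 < om n * (r / 2) ^ (n : ℝ) := by have := om_pos n; positivity
    linarith
  have h1 := jen (volume.restrict T) h hh.aemeasurable hP
  rw [Measure.restrict_apply_univ] at h1
  have h2 : a ^ P * volume T ^ P ≤ volume T ^ (P - 1) * ∫⁻ y in T, h y ^ P := by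
    rw [← ENNReal.mul_rpow_of_nonneg _ _ (by linarith)]
    exact le_trans (by gcongr) h1
  have h3 : a ^ P * volume T ≤ ∫⁻ y in T, h y ^ P := by
    have e : volume T ^ P = volume T ^ (P - 1) * volume T := by
      conv_lhs => rw [show P = (P - 1) + 1 by ring]
      rw [ENNReal.rpow_add _ _ hT0 hTt, ENNReal.rpow_one]
    rw [e, mul_left_comm] at h2
    exact (ENNReal.mul_le_mul_iff_right (ENNReal.rpow_pos (pos_iff_ne_zero.2 hT0) hTt).ne'
      (ENNReal.rpow_ne_top_of_nonneg (by linarith) hTt)).1 h2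
  calc a ^ P = ENNReal.ofReal (r ^ (-(n:ℝ))) * (ENNReal.ofReal (r ^ (n : ℝ)) * a ^ P) := by
        rw [← mul_assoc, ← ENNReal.ofReal_mul (by positivity), ← Real.rpow_add hr]; simp
    _ ≤ ENNReal.ofReal (r ^ (-(n:ℝ))) * (ENNReal.ofReal (c1 n) * (volume T * a ^ P)) := by
        rw [← mul_assoc (ENNReal.ofReal (c1 n))]
        refine mul_le_mul' le_rfl (mul_le_mul' ?_ le_rfl)
        calc _ ≤ ENNReal.ofReal (c1 n * (om n * (r / 2) ^ (n : ℝ))) :=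
              ENNReal.ofReal_le_ofReal (one_le_mul_c1 n hr)
          _ = ENNReal.ofReal (c1 n) * ENNReal.ofReal (om n * (r / 2) ^ (n : ℝ)) :=
              ENNReal.ofReal_mul (by linarith [c1_one n])
          _ ≤ _ := by gcongr
    _ ≤ ENNReal.ofReal (r ^ (-(n:ℝ))) * (ENNReal.ofReal (c1 n) * ∫⁻ y in T, h y ^ P) := by
        rw [mul_comm (volume T)]; gcongr
    _ = _ := by
        rw [← mul_assoc, ← ENNReal.ofReal_mul (by positivity)]; congr 2; ring

lemma c1_pos (n : ℕ) : 0 < c1 n := lt_of_lt_of_le one_pos (c1_one n)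

lemma kin_meas {n : ℕ} {w : En n → ℝ} (hw : Measurable w) (P b : ℝ) :
    Measurable fun z : En n × En n => ENNReal.ofReal (|w z.1 - w z.2| ^ P * ‖z.1 - z.2‖ ^ b) := by
  have h1 : Measurable fun z : En n × En n => w z.1 - w z.2 :=
    (hw.comp measurable_fst).sub (hw.comp measurable_snd)
  have h2 : Measurable fun z : En n × En n => ‖z.1 - z.2‖ :=
    (measurable_fst.sub measurable_snd).norm
  have h3 : Measurable fun z : En n × En n => |w z.1 - w z.2| := h1.norm
  exact ((h3.pow_const _).mul (h2.pow_const _)).ennreal_ofReal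

/-- cancel a singular weight on a bounded range -/
lemma wt_le {δ K r P b : ℝ} (hb : 0 ≤ b) (hδ : 0 ≤ δ) (hK : 0 ≤ K) (hKr : K ≤ r)
    (h0 : K = 0 → δ = 0) (hP : 0 < P) :
    δ ^ P ≤ r ^ b * (δ ^ P * K ^ (-b)) := by
  rcases hK.eq_or_lt with h | h
  · rw [h0 h.symm, Real.zero_rpow hP.ne']; simp
  · have : 1 ≤ r ^ b * K ^ (-b) := by
      rw [Real.rpow_neg hK, ← div_eq_mul_inv, one_le_div (by positivity)]
      exact Real.rpow_le_rpow hK hKr hb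
    calc δ ^ P = δ ^ P * 1 := by ring
      _ ≤ δ ^ P * (r ^ b * K ^ (-b)) := by gcongr
      _ = _ := by ring

lemma ptw_a {n : ℕ} {S T : Set (En n)} (hTm : MeasurableSet T) (hTS : T ⊆ S)
    {w : En n → ℝ} (hw : Measurable w) (x : En n) {r P σ : ℝ} (hr : 0 < r) (hP : 1 ≤ P)
    (hσ : 0 < σ) (hTr : ∀ y ∈ T, ‖x - y‖ ≤ r)
    (hT : ENNReal.ofReal (om n * (r / 2) ^ (n : ℝ)) ≤ volume T) (hTt : volume T ≠ ⊤)
    (a : ℝ≥0∞) (ha : a * volume T ≤ ∫⁻ y in T, ENNReal.ofReal |w x - w y|) :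
    a ≤ ENNReal.ofReal (c1 n) * (ENNReal.ofReal (r ^ σ) * gag n P σ S w x) := by
  have hP0 : 0 < P := by linarith
  have hc := c1_one n
  have hm : Measurable fun y => ENNReal.ofReal |w x - w y| := by
    have : Measurable fun y => |w x - w y| := (measurable_const.sub hw).norm
    exact this.ennreal_ofReal
  have h1 := avg_bound T hr hT hTt _ hm hP a ha
  have h2 : ∫⁻ y in T, ENNReal.ofReal |w x - w y| ^ P ≤
      ENNReal.ofReal (r ^ (n + σ * P)) * gag n P σ S w x ^ P := by
    rw [gag, ← ENNReal.rpow_mul, one_div_mul_cancel hP0.ne', ENNReal.rpow_one,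
      ← lintegral_const_mul' _ _ ENNReal.ofReal_ne_top]
    calc _ ≤ ∫⁻ y in T, ENNReal.ofReal (r ^ (n + σ * P)) *
          ENNReal.ofReal (|w x - w y| ^ P * ‖x - y‖ ^ (-(n + σ * P))) := by
          refine setLIntegral_mono' hTm fun y hy => ?_
          rw [ENNReal.ofReal_rpow_of_nonneg (abs_nonneg _) hP0.le,
            ← ENNReal.ofReal_mul (by positivity)]
          refine ENNReal.ofReal_le_ofReal (wt_le (by positivity) (abs_nonneg _) (norm_nonneg _)
            (hTr y hy) ?_ hP0)
          intro h
          rw [norm_eq_zero, sub_eq_zero] at h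
          simp [h]
      _ ≤ _ := lintegral_mono_set hTS
  have h3 : a ^ P ≤ (ENNReal.ofReal (c1 n) * (ENNReal.ofReal (r ^ σ) * gag n P σ S w x)) ^ P := by
    refine h1.trans ?_
    rw [← mul_assoc, ENNReal.mul_rpow_of_nonneg _ _ hP0.le, ← ENNReal.ofReal_mul (by positivity),
      ENNReal.ofReal_rpow_of_nonneg (by positivity) hP0.le]
    refine (mul_le_mul' le_rfl h2).trans ?_
    rw [← mul_assoc, ← ENNReal.ofReal_mul (by positivity)]
    refine mul_le_mul' (ENNReal.ofReal_le_ofReal ?_) le_rfl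
    rw [mul_assoc, ← Real.rpow_add hr, Real.mul_rpow (by positivity) (by positivity),
      ← Real.rpow_mul hr.le, neg_add_cancel_left]
    have : c1 n ≤ c1 n ^ P := Real.self_le_rpow_of_one_le hc hP
    gcongr
  exact (ENNReal.rpow_le_rpow_iff hP0).1 h3

lemma ptw_b {n : ℕ} {S T : Set (En n)} (hTS : T ⊆ S)
    {w : En n → ℝ} (hw : Measurable w) {r Q : ℝ} (hr : 0 < r) (hQ : 1 ≤ Q)
    (hT : ENNReal.ofReal (om n * (r / 2) ^ (n : ℝ)) ≤ volume T) (hTt : volume T ≠ ⊤)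
    (a : ℝ≥0∞) (ha : a * volume T ≤ ∫⁻ y in T, ENNReal.ofReal |w y|) :
    a ≤ ENNReal.ofReal (c1 n) * (ENNReal.ofReal (r ^ (-(n / Q))) *
      (∫⁻ y in S, ENNReal.ofReal |w y| ^ Q) ^ (1 / Q)) := by
  have hP0 : 0 < Q := by linarith
  have hc := c1_one n
  have hm : Measurable fun y => ENNReal.ofReal |w y| := by
    have : Measurable fun y => |w y| := hw.norm
    exact this.ennreal_ofReal
  have h1 := avg_bound T hr hT hTt _ hm hQ a ha
  refine (ENNReal.rpow_le_rpow_iff hP0).1 (h1.trans ?_)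
  rw [← mul_assoc, ENNReal.mul_rpow_of_nonneg _ _ hP0.le, ← ENNReal.ofReal_mul (by positivity),
      ENNReal.ofReal_rpow_of_nonneg (by positivity) hP0.le, ← ENNReal.rpow_mul,
      one_div_mul_cancel hP0.ne', ENNReal.rpow_one]
  refine mul_le_mul' (ENNReal.ofReal_le_ofReal ?_) (lintegral_mono_set hTS)
  rw [Real.mul_rpow (by positivity) (by positivity), ← Real.rpow_mul hr.le,
    show -((n:ℝ) / Q) * Q = -n by field_simp]
  have : c1 n ≤ c1 n ^ Q := Real.self_le_rpow_of_one_le hc hQ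
  gcongr

/-- combined pointwise estimate with a fat set -/
lemma ptw_c {n : ℕ} {S T : Set (En n)} (hTm : MeasurableSet T) (hTS : T ⊆ S)
    {w : En n → ℝ} (hw : Measurable w) (x : En n) {r P Q σ : ℝ} (hr : 0 < r) (hP : 1 ≤ P)
    (hQ : 1 ≤ Q) (hσ : 0 < σ) (hTr : ∀ y ∈ T, ‖x - y‖ ≤ r)
    (hT : ENNReal.ofReal (om n * (r / 2) ^ (n : ℝ)) ≤ volume T) (hTt : volume T ≠ ⊤) :
    ENNReal.ofReal |w x| ≤ ENNReal.ofReal (2 * c1 n) * (ENNReal.ofReal (r ^ σ) * gag n P σ S w x +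
      ENNReal.ofReal (r ^ (-(n / Q))) * (∫⁻ y in S, ENNReal.ofReal |w y| ^ Q) ^ (1 / Q)) := by
  have hm : Measurable fun y => ENNReal.ofReal |w x - w y| := by
    have : Measurable fun y => |w x - w y| := (measurable_const.sub hw).norm
    exact this.ennreal_ofReal
  have h0 : ENNReal.ofReal |w x| * volume T ≤ (∫⁻ y in T, ENNReal.ofReal |w x - w y|) +
      ∫⁻ y in T, ENNReal.ofReal |w y| := by
    rw [← lintegral_add_left hm, ← setLIntegral_const]
    refine lintegral_mono fun y => ?_
    rw [← ENNReal.ofReal_add (abs_nonneg _) (abs_nonneg _)]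
    refine ENNReal.ofReal_le_ofReal ?_
    calc |w x| = |(w x - w y) + w y| := by ring_nf
      _ ≤ _ := abs_add_le _ _
  set a := ENNReal.ofReal |w x| with ha
  have hsplit : a * volume T = a / 2 * volume T + a / 2 * volume T := by
    rw [← add_mul, ENNReal.add_halves]
  have h2 : a / 2 ≤ ENNReal.ofReal (c1 n) * (ENNReal.ofReal (r ^ σ) * gag n P σ S w x +
      ENNReal.ofReal (r ^ (-(n / Q))) * (∫⁻ y in S, ENNReal.ofReal |w y| ^ Q) ^ (1 / Q)) := by
    by_cases hA : a / 2 * volume T ≤ ∫⁻ y in T, ENNReal.ofReal |w x - w y|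
    · exact (ptw_a hTm hTS hw x hr hP hσ hTr hT hTt _ hA).trans (by gcongr; exact le_self_add)
    · have hB : a / 2 * volume T ≤ ∫⁻ y in T, ENNReal.ofReal |w y| := by
        by_contra hB
        push Not at hA hB
        rw [hsplit] at h0
        exact absurd h0 (not_le.2 (ENNReal.add_lt_add hA hB))
      exact (ptw_b hTS hw hr hQ hT hTt _ hB).trans (by gcongr; exact le_add_self)
  rw [ENNReal.ofReal_mul (by norm_num), mul_assoc]
  calc a = a / 2 + a / 2 := (ENNReal.add_halves a).symm
    _ = 2 * (a / 2) := by rw [two_mul]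
    _ ≤ _ := by
      rw [show ENNReal.ofReal (2:ℝ) = 2 by simp]; gcongr

lemma gag_meas {n : ℕ} {w : En n → ℝ} (hw : Measurable w) (P σ : ℝ) (S : Set (En n)) :
    Measurable (gag n P σ S w) := by
  unfold gag
  exact (Measurable.lintegral_prod_right' (kin_meas hw P (-(n + σ * P)))).pow_const _

/-- Gagliardo energy on a set of pairs -/
def ee (n : ℕ) (P σ : ℝ) (u : En n → ℝ) (S : Set (En n × En n)) : ℝ≥0∞ :=
  ∫⁻ z in S, ENNReal.ofReal (|u z.1 - u z.2| ^ P * ‖z.1 - z.2‖ ^ (-((n:ℝ) + σ * P)))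

lemma gag_int {n : ℕ} {w : En n → ℝ} (hw : Measurable w) {P : ℝ} (σ : ℝ) (hP : 0 < P)
    (S : Set (En n)) : ∫⁻ x in S, gag n P σ S w x ^ P = ee n P σ w (S ×ˢ S) := by
  unfold gag ee
  rw [Measure.volume_eq_prod, ← Measure.prod_restrict,
    lintegral_prod _ (kin_meas hw P _).aemeasurable]
  refine lintegral_congr fun x => ?_
  rw [← ENNReal.rpow_mul, one_div_mul_cancel hP.ne', ENNReal.rpow_one]

/-- whole space Sobolev inequality -/
lemma sob_whole {n : ℕ} (hn : 0 < n) {P Q σ : ℝ} (hP : 1 ≤ P) (hQ : 1 ≤ Q) (hσ : 0 < σ)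
    (hPQ : n / Q + σ = n / P) {w : En n → ℝ} (hw : Measurable w)
    (hN : ∫⁻ y, ENNReal.ofReal |w y| ^ Q ≠ ⊤) :
    (∫⁻ y, ENNReal.ofReal |w y| ^ Q) ^ (P / Q) ≤
      ENNReal.ofReal ((2 * (2 * c1 n)) ^ Q) * ee n P σ w univ := by
  have h1 := hedberg volume (fun x => ENNReal.ofReal |w x|) (gag n P σ univ w)
    (gag_meas hw P σ univ).aemeasurable (P := P) (Q := Q) (σ := σ) (d := n) (C := 2 * c1 n)
    (by linarith) (by linarith) hσ (by exact_mod_cast hn) (by have := c1_pos n; positivity) hPQ _ rfl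
    hN (Filter.Eventually.of_forall fun x r hr => by
      have := ptw_c (S := univ) (T := ball x r) measurableSet_ball (subset_univ _) hw x hr hP hQ hσ
        (fun y hy => by rw [mem_ball, dist_comm, dist_eq_norm] at hy; exact hy.le)
        (by
          rw [vol_ball x hr.le hn]
          have := om_pos n
          gcongr; linarith) measure_ball_lt_top.ne
      simpa using this)
  have h2 := gag_int hw σ (P := P) (by linarith) univ
  rw [Measure.restrict_univ] at h2
  rw [h2, univ_prod_univ] at h1
  exact h1

/-- averages -/
def av (n : ℕ) (u : En n → ℝ) (c : En n) (r : ℝ) : ℝ := ⨍ y in ball c r, u y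

lemma vol_pos {n : ℕ} (c : En n) {r : ℝ} (hr : 0 < r) : 0 < volume (ball c r) :=
  measure_ball_pos _ _ hr

lemma integrableOn_bdd {n : ℕ} {u : En n → ℝ} (hu : Measurable u) {Λ : ℝ} (hb : ∀ x, |u x| ≤ Λ)
    (S : Set (En n)) (hS : volume S ≠ ⊤) : IntegrableOn u S :=
  Measure.integrableOn_of_bounded hS hu.aestronglyMeasurable (M := Λ)
    (Filter.Eventually.of_forall fun x => by simpa using hb x)

lemma av_sub_le {n : ℕ} {u : En n → ℝ} (hu : Measurable u) {Λ : ℝ} (hb : ∀ x, |u x| ≤ Λ)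
    (c : En n) {r : ℝ} (hr : 0 < r) (k : ℝ) :
    ENNReal.ofReal |k - av n u c r| * volume (ball c r) ≤
      ∫⁻ y in ball c r, ENNReal.ofReal |k - u y| := by
  have hi := integrableOn_bdd hu hb (ball c r) measure_ball_lt_top.ne
  have hv := vol_pos c hr
  have hvt : volume (ball c r) ≠ ⊤ := measure_ball_lt_top.ne
  have hk : IntegrableOn (fun _ : En n => k) (ball c r) := integrableOn_const hvt
  have h1 : (k - av n u c r) * (volume (ball c r)).toReal = ∫ y in ball c r, (k - u y) := by
    rw [integral_sub hk hi, av, setAverage_eq, setIntegral_const, measureReal_def, smul_eq_mul,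
      smul_eq_mul]
    have : (volume (ball c r)).toReal ≠ 0 := (ENNReal.toReal_pos hv.ne' hvt).ne'
    field_simp
  calc ENNReal.ofReal |k - av n u c r| * volume (ball c r)
      = ENNReal.ofReal |(k - av n u c r) * (volume (ball c r)).toReal| := by
        rw [abs_mul, abs_of_nonneg ENNReal.toReal_nonneg, ENNReal.ofReal_mul (abs_nonneg _),
          ENNReal.ofReal_toReal hvt]
    _ = ENNReal.ofReal |∫ y in ball c r, (k - u y)| := by rw [h1]
    _ ≤ _ := by
      have := ofReal_integral_norm_eq_lintegral_enorm (hk.sub hi)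
      have h2 := enorm_integral_le_lintegral_enorm (μ := volume.restrict (ball c r))
        (fun y => k - u y)
      simpa only [← ofReal_norm, Real.norm_eq_abs] using h2

lemma av_pow {n : ℕ} (hn : 0 < n) {u : En n → ℝ} (hu : Measurable u) {Λ : ℝ}
    (hb : ∀ x, |u x| ≤ Λ) (c : En n) {r : ℝ} (hr : 0 < r) (k : ℝ) {P : ℝ} (hP : 1 ≤ P) :
    ENNReal.ofReal (|k - av n u c r| ^ P) ≤
      ENNReal.ofReal (c1 n * r ^ (-(n:ℝ))) * ∫⁻ y in ball c r, ENNReal.ofReal (|k - u y| ^ P) := by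
  have hm : Measurable fun y => ENNReal.ofReal |k - u y| := by
    have : Measurable fun y => |k - u y| := (measurable_const.sub hu).norm
    exact this.ennreal_ofReal
  have := avg_bound (ball c r) hr (by
      rw [vol_ball c hr.le hn]
      have := om_pos n
      gcongr; linarith) measure_ball_lt_top.ne _ hm hP _ (av_sub_le hu hb c hr k)
  simpa only [ENNReal.ofReal_rpow_of_nonneg (abs_nonneg _) (zero_le_one.trans hP)] using this

lemma fat_ball {n : ℕ} (hn : 0 < n) (c x : En n) {r R : ℝ} (hx : x ∈ ball c R) (hr : 0 < r)
    (hrR : r ≤ 2 * R) :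
    ENNReal.ofReal (om n * (r / 2) ^ (n : ℝ)) ≤ volume (ball x r ∩ ball c R) := by
  have hR : 0 < R := by linarith
  rw [← vol_ball (x + (r / (2 * R)) • (c - x)) (by positivity) hn]
  have hx' : ‖c - x‖ < R := by rwa [mem_ball, dist_comm, dist_eq_norm] at hx
  have h0 : r / (2 * R) ≤ 1 := by rw [div_le_one (by positivity)]; exact hrR
  have h00 : 0 < r / (2 * R) := by positivity
  refine measure_mono (subset_inter ?_ ?_)
  · refine ball_subset_ball' ?_
    rw [dist_eq_norm, add_sub_cancel_left, norm_smul, Real.norm_of_nonneg h00.le]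
    have : r / (2 * R) * ‖c - x‖ ≤ r / (2 * R) * R := by gcongr
    have e : r / (2 * R) * R = r / 2 := by field_simp
    linarith
  · refine ball_subset_ball' ?_
    rw [dist_eq_norm, show x + (r / (2 * R)) • (c - x) - c = (r / (2 * R) - 1) • (c - x) by
      rw [sub_smul, one_smul]; abel, norm_smul, Real.norm_of_nonpos (by linarith)]
    have : -(r / (2 * R) - 1) * ‖c - x‖ ≤ -(r / (2 * R) - 1) * R :=
      mul_le_mul_of_nonneg_left hx'.le (by linarith)
    have e : -(r / (2 * R) - 1) * R = R - r / 2 := by field_simp; ring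
    linarith

lemma ee_sub_const {n : ℕ} (P σ k : ℝ) (u : En n → ℝ) (S : Set (En n × En n)) :
    ee n P σ (fun x => u x - k) S = ee n P σ u S := by
  simp [ee]

/-- Sobolev–Poincaré on balls -/
lemma sob_ball {n : ℕ} (hn : 0 < n) {P Q σ : ℝ} (hP : 1 ≤ P) (hQ : 1 ≤ Q) (hσ : 0 < σ)
    (hPQ : n / Q + σ = n / P) {u : En n → ℝ} (hu : Measurable u) {Λ : ℝ}
    (hb : ∀ x, |u x| ≤ Λ) (c : En n) {R : ℝ} (hR : 0 < R) :
    (∫⁻ y in ball c R, ENNReal.ofReal (|u y - av n u c R| ^ Q)) ^ (P / Q) ≤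
      ENNReal.ofReal ((2 * (2 * c1 n)) ^ Q) * ee n P σ u (ball c R ×ˢ ball c R) := by
  set k := av n u c R with hk
  set w : En n → ℝ := fun x => u x - k with hw
  have hwm : Measurable w := hu.sub_const k
  have hQ0 : 0 < Q := by linarith
  have hwb : ∀ x, |w x| ≤ Λ + |k| := fun x => (abs_sub _ _).trans (by have := hb x; gcongr)
  have hN : ∫⁻ y in ball c R, ENNReal.ofReal |w y| ^ Q ≠ ⊤ := by
    refine ne_of_lt (lt_of_le_of_lt (b := ∫⁻ y in ball c R, ENNReal.ofReal (Λ + |k|) ^ Q) ?_ ?_)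
    · refine lintegral_mono fun y => ?_
      have := hwb y
      gcongr
    · rw [setLIntegral_const]
      exact ENNReal.mul_lt_top (ENNReal.rpow_lt_top_of_nonneg hQ0.le ENNReal.ofReal_ne_top)
        measure_ball_lt_top
  have hcp := c1_pos n
  have h1 := hedberg (volume.restrict (ball c R)) (fun x => ENNReal.ofReal |w x|)
    (gag n P σ (ball c R) w)
    (gag_meas hwm P σ _).aemeasurable (P := P) (Q := Q) (σ := σ) (d := n) (C := 2 * c1 n)
    (by linarith) (by linarith) hσ (by exact_mod_cast hn) (by positivity) hPQ _ rfl
    hN (by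
      refine (ae_restrict_iff' measurableSet_ball).2 (Filter.Eventually.of_forall fun x hx r hr => ?_)
      by_cases hrR : r ≤ 2 * R
      · exact ptw_c (S := ball c R) (T := ball x r ∩ ball c R)
          (measurableSet_ball.inter measurableSet_ball) inter_subset_right hwm x hr hP hQ hσ
          (fun y hy => by
            have hy := hy.1
            rw [mem_ball, dist_comm, dist_eq_norm] at hy; exact hy.le)
          (fat_ball hn c x hx hr hrR)
          (measure_inter_lt_top_of_left_ne_top measure_ball_lt_top.ne).ne
      · push Not at hrR
        have hx' : ‖x - c‖ < R := by rwa [mem_ball, dist_eq_norm] at hx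
        have := ptw_a (S := ball c R) (T := ball c R) measurableSet_ball subset_rfl hwm x
          (r := 2 * R) (by positivity) hP hσ (fun y hy => by
            rw [mem_ball, dist_comm, dist_eq_norm] at hy
            calc ‖x - y‖ = ‖(x - c) + (c - y)‖ := by congr 1; abel
              _ ≤ _ := (norm_add_le _ _).trans (by linarith))
          (by
            rw [vol_ball c hR.le hn]
            have := om_pos n
            gcongr; linarith) measure_ball_lt_top.ne (ENNReal.ofReal |w x|) (by
            have := av_sub_le hu hb c hR (u x)
            simpa [hw] using this)
        refine this.trans ?_
        refine le_trans ?_ (mul_le_mul' (ENNReal.ofReal_le_ofReal (by linarith : c1 n ≤ 2 * c1 n))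
          le_self_add)
        gcongr)
  rw [gag_int hwm σ (by linarith) (ball c R), ee_sub_const] at h1
  simpa only [ENNReal.ofReal_rpow_of_nonneg (abs_nonneg _) (zero_le_one.trans hQ)] using h1

/-- Poincaré on balls -/
lemma poin {n : ℕ} (hn : 0 < n) {P σ : ℝ} (hP : 1 ≤ P) (hσ : 0 < σ)
    {u : En n → ℝ} (hu : Measurable u) {Λ : ℝ}
    (hb : ∀ x, |u x| ≤ Λ) (c : En n) {R : ℝ} (hR : 0 < R) :
    ∫⁻ y in ball c R, ENNReal.ofReal (|u y - av n u c R| ^ P) ≤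
      ENNReal.ofReal (c1 n * 2 ^ (n + σ * P) * R ^ (σ * P)) * ee n P σ u (ball c R ×ˢ ball c R) := by
  have hP0 : 0 < P := by linarith
  have hcp := c1_pos n
  have e : ee n P σ u (ball c R ×ˢ ball c R) = ∫⁻ x in ball c R, ∫⁻ y in ball c R,
      ENNReal.ofReal (|u x - u y| ^ P * ‖x - y‖ ^ (-((n:ℝ) + σ * P))) := by
    unfold ee
    rw [Measure.volume_eq_prod, ← Measure.prod_restrict,
      lintegral_prod _ (kin_meas hu P _).aemeasurable]
  rw [e, ← lintegral_const_mul' _ _ ENNReal.ofReal_ne_top]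
  refine setLIntegral_mono' measurableSet_ball fun x hx => ?_
  refine (av_pow hn hu hb c hR (u x) hP).trans ?_
  rw [← lintegral_const_mul' _ _ ENNReal.ofReal_ne_top,
    ← lintegral_const_mul' _ _ ENNReal.ofReal_ne_top]
  refine setLIntegral_mono' measurableSet_ball fun y hy => ?_
  have hx' : ‖x - c‖ < R := by rwa [mem_ball, dist_eq_norm] at hx
  have hK : ‖x - y‖ ≤ 2 * R := by
    rw [mem_ball, dist_comm, dist_eq_norm] at hy
    calc ‖x - y‖ = ‖(x - c) + (c - y)‖ := by congr 1; abel
      _ ≤ _ := (norm_add_le _ _).trans (by linarith)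
  rw [← ENNReal.ofReal_mul (by positivity), ← ENNReal.ofReal_mul (by positivity)]
  refine ENNReal.ofReal_le_ofReal ?_
  have h1 := wt_le (P := P) (b := n + σ * P) (by positivity) (abs_nonneg (u x - u y))
    (norm_nonneg (x - y)) hK
    (by
      intro h
      rw [norm_eq_zero, sub_eq_zero] at h
      simp [h]) hP0
  calc _ ≤ c1 n * R ^ (-(n:ℝ)) * ((2 * R) ^ (n + σ * P) *
        (|u x - u y| ^ P * ‖x - y‖ ^ (-(n + σ * P)))) := by gcongr
    _ = _ := by
      rw [Real.mul_rpow (by norm_num) hR.le, Real.rpow_add hR, Real.rpow_neg hR.le]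
      field_simp

/-- energy on a diagonal ball -/
def eB (n : ℕ) (p s : ℝ) (u : En n → ℝ) (c : En n) (r : ℝ) : ℝ≥0∞ :=
  ee n p s u (ball c r ×ˢ ball c r)

/-- constant -/
def C0 (n : ℕ) (p s : ℝ) : ℝ := c1 n * (c1 n * 2 ^ ((n:ℝ) + s * p))

lemma C0_one (n : ℕ) {p s : ℝ} (hp : 1 ≤ p) (hs : 0 < s) : 1 ≤ C0 n p s := by
  have h := c1_one n
  have h2 : (1:ℝ) ≤ 2 ^ ((n:ℝ) + s * p) := Real.one_le_rpow (by norm_num) (by positivity)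
  exact one_le_mul_of_one_le_of_one_le h (one_le_mul_of_one_le_of_one_le h h2)

lemma ee_mono {n : ℕ} (p s : ℝ) (u : En n → ℝ) {S T : Set (En n × En n)} (h : S ⊆ T) :
    ee n p s u S ≤ ee n p s u T := lintegral_mono_set h

lemma eB_mono {n : ℕ} (p s : ℝ) (u : En n → ℝ) {c c' : En n} {r r' : ℝ}
    (h : ball c r ⊆ ball c' r') : eB n p s u c r ≤ eB n p s u c' r' :=
  ee_mono p s u (prod_mono h h)

lemma avdiff_gen {n : ℕ} (hn : 0 < n) {p s : ℝ} (hp : 1 ≤ p) (hs : 0 < s)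
    {u : En n → ℝ} (hu : Measurable u) {Λ : ℝ} (hb : ∀ x, |u x| ≤ Λ) {c c' : En n} {ρ ρ' X : ℝ}
    (hρ : 0 < ρ) (hρ' : 0 < ρ') (hsub : ball c' ρ' ⊆ ball c ρ) (hX0 : 0 ≤ X)
    (hX : eB n p s u c ρ ≤ ENNReal.ofReal X) :
    |av n u c' ρ' - av n u c ρ| ^ p ≤ C0 n p s * (ρ' ^ (-(n:ℝ)) * ρ ^ (s * p) * X) := by
  have hcp := c1_pos n
  have h1 := av_pow hn hu hb c' hρ' (av n u c ρ) hp
  have h2 := poin hn hp hs hu hb c hρ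
  have h3 : ENNReal.ofReal (|av n u c' ρ' - av n u c ρ| ^ p) ≤
      ENNReal.ofReal (C0 n p s * (ρ' ^ (-(n:ℝ)) * ρ ^ (s * p) * X)) := by
    rw [abs_sub_comm]
    refine h1.trans ?_
    calc _ ≤ ENNReal.ofReal (c1 n * ρ' ^ (-(n:ℝ))) * (ENNReal.ofReal
          (c1 n * 2 ^ (n + s * p) * ρ ^ (s * p)) * ENNReal.ofReal X) := by
          refine mul_le_mul' le_rfl ?_
          refine (le_trans (lintegral_mono_set hsub) ?_).trans (h2.trans (mul_le_mul' le_rfl hX))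
          refine lintegral_mono fun y => ?_
          rw [abs_sub_comm]
      _ = _ := by
        rw [← ENNReal.ofReal_mul (by positivity), ← ENNReal.ofReal_mul (by positivity)]
        congr 1
        unfold C0; ring
  refine (ENNReal.ofReal_le_ofReal_iff ?_).1 h3
  have := C0_one n hp hs
  positivity

/-- the growth condition at one radius -/
def Cnd (n : ℕ) (p s ε ℓ : ℝ) (u : En n → ℝ) (c : En n) (ρ : ℝ) : Prop :=
  eB n p s u c ρ ≤ ENNReal.ofReal (ℓ ^ p * ρ ^ ((n:ℝ) + ε * p))

lemma rpow_le_of {a b p : ℝ} (ha : 0 ≤ a) (hb : 0 ≤ b) (hp : 0 < p) (h : a ^ p ≤ b ^ p) : a ≤ b :=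
  (Real.rpow_le_rpow_iff ha hb hp).1 h

lemma avdiff {n : ℕ} (hn : 0 < n) {p s ε ℓ : ℝ} (hp : 1 ≤ p) (hs : 0 < s) (hℓ : 0 ≤ ℓ)
    {u : En n → ℝ} (hu : Measurable u) {Λ : ℝ} (hb : ∀ x, |u x| ≤ Λ) {c c' : En n} {ρ ρ' : ℝ}
    (hρ : 0 < ρ) (hρ' : 0 < ρ') (hN : ρ ≤ 2 * ρ') (hsub : ball c' ρ' ⊆ ball c ρ)
    (hX : Cnd n p s ε ℓ u c ρ) :
    |av n u c' ρ' - av n u c ρ| ≤ C0 n p s * 2 ^ (n:ℝ) * (ℓ * ρ ^ (s + ε)) := by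
  have hC := C0_one n hp hs
  have hp0 : 0 < p := by linarith
  have h1 := avdiff_gen hn hp hs hu hb hρ hρ' hsub (by positivity) hX
  refine rpow_le_of (abs_nonneg _) (by positivity) hp0 (h1.trans ?_)
  rw [Real.mul_rpow (by positivity) (by positivity), Real.mul_rpow hℓ (by positivity),
    ← Real.rpow_mul hρ.le]
  have e1 : ρ' ^ (-(n:ℝ)) ≤ 2 ^ (n:ℝ) * ρ ^ (-(n:ℝ)) := by
    rw [Real.rpow_neg hρ'.le, Real.rpow_neg hρ.le, ← div_eq_mul_inv, inv_eq_one_div,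
      div_le_div_iff₀ (by positivity) (by positivity), one_mul, ← Real.mul_rpow (by norm_num) hρ'.le]
    gcongr
  have e2 : C0 n p s * 2 ^ (n:ℝ) ≤ (C0 n p s * 2 ^ (n:ℝ)) ^ p :=
    Real.self_le_rpow_of_one_le (one_le_mul_of_one_le_of_one_le hC
      (Real.one_le_rpow (by norm_num) (by positivity))) hp
  calc _ ≤ C0 n p s * (2 ^ (n:ℝ) * ρ ^ (-(n:ℝ)) * ρ ^ (s * p) * (ℓ ^ p * ρ ^ ((n:ℝ) + ε * p))) := by
        gcongr
    _ = C0 n p s * 2 ^ (n:ℝ) * (ℓ ^ p * (ρ ^ (-(n:ℝ)) * ρ ^ (s * p) * ρ ^ ((n:ℝ) + ε * p))) := by ring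
    _ = C0 n p s * 2 ^ (n:ℝ) * (ℓ ^ p * ρ ^ ((s + ε) * p)) := by
        rw [← Real.rpow_add hρ, ← Real.rpow_add hρ]; ring_nf
    _ ≤ _ := by gcongr

/-- telescoping constant -/
def C4 (n : ℕ) (p s : ℝ) : ℝ := C0 n p s * 2 ^ (n:ℝ) / (1 - 2 ^ (-s))

lemma two_s {s : ℝ} (hs : 0 < s) : (2:ℝ) ^ (-s) < 1 :=
  Real.rpow_lt_one_of_one_lt_of_neg (by norm_num) (by linarith)

lemma C4_pos (n : ℕ) {p s : ℝ} (hp : 1 ≤ p) (hs : 0 < s) : 0 < C4 n p s := by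
  have h := C0_one n hp hs
  have h2 := two_s hs
  have : 0 < 1 - (2:ℝ) ^ (-s) := by linarith
  unfold C4; positivity

lemma tele {n : ℕ} (hn : 0 < n) {p s ε ℓ : ℝ} (hp : 1 ≤ p) (hs : 0 < s) (hε : 0 < ε) (hℓ : 0 ≤ ℓ)
    {u : En n → ℝ} (hu : Measurable u) {Λ : ℝ} (hb : ∀ x, |u x| ≤ Λ) {c : En n} {ρ₁ ρ₂ : ℝ}
    (hρ : 0 < ρ₁) (h12 : ρ₁ ≤ ρ₂)
    (hX : ∀ ρ, ρ₁ ≤ ρ → ρ ≤ ρ₂ → Cnd n p s ε ℓ u c ρ) :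
    |av n u c ρ₁ - av n u c ρ₂| ≤ C4 n p s * (ℓ * ρ₂ ^ (s + ε)) := by
  have hC := C0_one n hp hs
  have h2 := two_s hs
  have h2' : 0 < 1 - (2:ℝ) ^ (-s) := by linarith
  have hstep : C0 n p s * 2 ^ (n:ℝ) = C4 n p s * (1 - 2 ^ (-s)) := by
    unfold C4; field_simp
  have hC4 := C4_pos n hp hs
  have hle : C0 n p s * 2 ^ (n:ℝ) ≤ C4 n p s := by
    rw [hstep]
    have : (0:ℝ) < 2 ^ (-s) := by positivity
    nlinarith
  have main : ∀ k : ℕ, ∀ ρ₂, ρ₁ ≤ ρ₂ → ρ₂ ≤ 2 ^ k * ρ₁ →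
      (∀ ρ, ρ₁ ≤ ρ → ρ ≤ ρ₂ → Cnd n p s ε ℓ u c ρ) →
      |av n u c ρ₁ - av n u c ρ₂| ≤ C4 n p s * (ℓ * ρ₂ ^ (s + ε)) := by
    intro k
    induction k with
    | zero =>
      intro ρ₂ h1 h2 _
      have : ρ₁ = ρ₂ := by simp at h2; linarith
      rw [this]; simp
      have : 0 < ρ₂ := by linarith
      positivity
    | succ k ih =>
      intro ρ₂ h1 h2 hX
      have hρ2 : 0 < ρ₂ := by linarith
      by_cases h : ρ₂ ≤ 2 * ρ₁
      · refine (avdiff hn hp hs hℓ hu hb hρ2 hρ h (ball_subset_ball h1) (hX _ h1 le_rfl)).trans ?_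
        gcongr
      · push Not at h
        have a1 := ih (ρ₂ / 2) (by linarith) (by rw [pow_succ] at h2; linarith)
          (fun ρ h h' => hX ρ h (by linarith))
        have a2 := avdiff (c' := c) (ρ' := ρ₂ / 2) hn hp hs hℓ hu hb hρ2 (by linarith) (by linarith)
          (ball_subset_ball (by linarith)) (hX _ h1 le_rfl)
        have a3 : (ρ₂ / 2) ^ (s + ε) ≤ 2 ^ (-s) * ρ₂ ^ (s + ε) := by
          rw [div_eq_mul_inv, mul_comm, Real.mul_rpow (by positivity) hρ2.le, Real.inv_rpow
            (by norm_num), ← Real.rpow_neg (by norm_num)]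
          gcongr
          · norm_num
          · linarith
        calc _ ≤ |av n u c ρ₁ - av n u c (ρ₂ / 2)| + |av n u c (ρ₂ / 2) - av n u c ρ₂| :=
              abs_sub_le _ _ _
          _ ≤ C4 n p s * (ℓ * (2 ^ (-s) * ρ₂ ^ (s + ε))) +
              C0 n p s * 2 ^ (n:ℝ) * (ℓ * ρ₂ ^ (s + ε)) := by
                refine add_le_add (a1.trans ?_) a2
                gcongr
          _ = _ := by rw [hstep]; ring
  obtain ⟨k, hk⟩ := pow_unbounded_of_one_lt (ρ₂ / ρ₁) (by norm_num : (1:ℝ) < 2)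
  exact main k ρ₂ h12 (by rw [div_lt_iff₀ hρ] at hk; exact hk.le) hX

/-- Lebesgue points -/
def LPt (n : ℕ) (u : En n → ℝ) (x : En n) : Prop :=
  Filter.Tendsto (fun ρ => av n u x ρ) (nhdsWithin 0 (Ioi 0)) (nhds (u x))

lemma ae_LPt {n : ℕ} {u : En n → ℝ} (hu : Measurable u) {Λ : ℝ} (hb : ∀ x, |u x| ≤ Λ) :
    ∀ᵐ x, LPt n u x := by
  have hl : LocallyIntegrable u := by
    intro x
    exact ⟨ball x 1, ball_mem_nhds x one_pos,
      integrableOn_bdd hu hb _ measure_ball_lt_top.ne⟩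
  filter_upwards [IsUnifLocDoublingMeasure.ae_tendsto_average (μ := volume) hl 1] with x hx
  have := hx (ι := ℝ) (l := nhdsWithin 0 (Ioi 0)) (fun _ => x) (fun r => r) Filter.tendsto_id (by
    filter_upwards [self_mem_nhdsWithin] with r hr
    have hr' : 0 < r := hr
    simp [hr'.le])
  refine this.congr' ?_
  filter_upwards [self_mem_nhdsWithin] with r hr
  have hr' : 0 < r := hr
  unfold av
  refine setAverage_congr ?_
  rw [← ball_union_sphere]
  have h0 : volume (sphere x r) = 0 := Measure.addHaar_sphere_of_ne_zero _ _ hr'.ne'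
  exact union_ae_eq_left_of_ae_eq_empty (ae_eq_empty.2 h0)

lemma tele_pt {n : ℕ} (hn : 0 < n) {p s ε ℓ : ℝ} (hp : 1 ≤ p) (hs : 0 < s) (hε : 0 < ε)
    (hℓ : 0 ≤ ℓ)
    {u : En n → ℝ} (hu : Measurable u) {Λ : ℝ} (hb : ∀ x, |u x| ≤ Λ) {x : En n} {ρ₂ : ℝ}
    (hρ : 0 < ρ₂) (hx : LPt n u x)
    (hX : ∀ ρ, 0 < ρ → ρ ≤ ρ₂ → Cnd n p s ε ℓ u x ρ) :
    |u x - av n u x ρ₂| ≤ C4 n p s * (ℓ * ρ₂ ^ (s + ε)) := by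
  have h1 : Filter.Tendsto (fun ρ => |av n u x ρ - av n u x ρ₂|) (nhdsWithin 0 (Ioi 0))
      (nhds |u x - av n u x ρ₂|) := (hx.sub_const _).abs
  refine le_of_tendsto h1 ?_
  filter_upwards [Ioo_mem_nhdsGT hρ] with ρ hr
  exact tele hn hp hs hε hℓ hu hb hr.1 hr.2.le (fun r h h' => hX r (lt_of_lt_of_le hr.1 h) h')

section absmoll
variable {n : ℕ} {X : Type*} [NormedAddCommGroup X] [NormedSpace ℝ X] [FiniteDimensional ℝ X]
  [MeasurableSpace X] [BorelSpace X]

lemma psi_cont (μ : Measure X) [μ.IsAddHaarMeasure] {i : En n → X} (hi : Continuous i)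
    {P P' : ℝ≥0∞} [Fact (1 ≤ P)] [Fact (1 ≤ P')] [ENNReal.HolderConjugate P' P] (hPt : P ≠ ⊤)
    {w ξ : X → ℝ} (hw : MemLp w P' μ) (hξ : MemLp ξ P μ) :
    Continuous fun t : En n => ∫ z, w z * ξ (z - i t) ∂μ := by
  let g : En n → C(X, X) := fun t => ⟨fun z => z - i t, by fun_prop⟩
  have hg : Continuous g := by
    refine ContinuousMap.continuous_of_continuous_uncurry _ ?_
    show Continuous fun q : En n × X => q.2 - i q.1
    fun_prop
  have hgm : ∀ t, MeasurePreserving (g t) μ μ := fun t => measurePreserving_sub_right μ (i t)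
  have h1 : Continuous fun t => Lp.compMeasurePreserving (g t) (hgm t) (hξ.toLp ξ) :=
    Continuous.compMeasurePreservingLp continuous_const hg hgm hPt
  have h2 : Continuous fun t => (ContinuousLinearMap.mul ℝ ℝ).lpPairing μ P' P (hw.toLp w)
      (Lp.compMeasurePreserving (g t) (hgm t) (hξ.toLp ξ)) :=
    ((ContinuousLinearMap.mul ℝ ℝ).lpPairing μ P' P (hw.toLp w)).continuous.comp h1
  refine h2.congr fun t => ?_
  rw [ContinuousLinearMap.lpPairing_eq_integral]
  refine integral_congr_ae ?_
  have e1 := hw.coeFn_toLp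
  have e2 := Lp.coeFn_compMeasurePreserving (hξ.toLp ξ) (hgm t)
  have e3 := (hgm t).quasiMeasurePreserving.ae_eq_comp hξ.coeFn_toLp
  filter_upwards [e1, e2, e3] with z h1 h2 h3
  rw [h1, h2, h3]
  simp [g]

lemma psi_fubini (μ : Measure X) [μ.IsAddHaarMeasure] {i : En n → X} (hi : Continuous i)
    {P P' : ℝ≥0∞} [Fact (1 ≤ P)] [Fact (1 ≤ P')] [ENNReal.HolderConjugate P' P]
    {w ξ : X → ℝ} (hwm : Measurable w) (hξm : Measurable ξ)
    (hw : MemLp w P' μ) (hξ : MemLp ξ P μ) {η : En n → ℝ} (hη : Continuous η)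
    (hηc : HasCompactSupport η) :
    ∫ z, w z * (∫ t, η t * ξ (z - i t)) ∂μ = ∫ t, η t * ∫ z, w z * ξ (z - i t) ∂μ := by
  have hηi : Integrable η := hη.integrable_of_hasCompactSupport hηc
  have hmp : ∀ t, MeasurePreserving (fun z => z - i t) μ μ :=
    fun t => measurePreserving_sub_right μ (i t)
  have hξt : ∀ t, MemLp (fun z => ξ (z - i t)) P μ := fun t => hξ.comp_measurePreserving (hmp t)
  have hIntg : ∀ t, Integrable (fun z => w z * ξ (z - i t)) μ := fun t => hw.integrable_mul (hξt t)
  have hmeas : Measurable fun a : X × En n => w a.1 * (η a.2 * ξ (a.1 - i a.2)) :=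
    (hwm.comp measurable_fst).mul ((hη.measurable.comp measurable_snd).mul
      (hξm.comp (measurable_fst.sub (hi.measurable.comp measurable_snd))))
  have hprod : Integrable (fun a : X × En n => w a.1 * (η a.2 * ξ (a.1 - i a.2)))
      (μ.prod volume) := by
    rw [integrable_prod_iff' hmeas.aestronglyMeasurable]
    constructor
    · refine Filter.Eventually.of_forall fun t => ?_
      refine ((hIntg t).const_mul (η t)).congr (Filter.Eventually.of_forall fun z => ?_)
      simp; ring
    · set Cst : ℝ := (eLpNorm w P' μ * eLpNorm ξ P μ).toReal with hC
      have hfin : eLpNorm w P' μ * eLpNorm ξ P μ ≠ ⊤ := ENNReal.mul_ne_top hw.2.ne hξ.2.ne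
      refine Integrable.mono' (hηi.norm.mul_const Cst)
        (hmeas.norm.stronglyMeasurable.integral_prod_left' (μ := μ)).aestronglyMeasurable ?_
      refine Filter.Eventually.of_forall fun t => ?_
      have h1 : eLpNorm (fun z => w z * ξ (z - i t)) 1 μ ≤ eLpNorm w P' μ * eLpNorm ξ P μ := by
        have := eLpNorm_smul_le_mul_eLpNorm (p := P') (q := P) (r := 1) (hξt t).1 hw.1
        rw [show eLpNorm (fun z => ξ (z - i t)) P μ = eLpNorm ξ P μ from
          eLpNorm_comp_measurePreserving hξ.1 (hmp t)] at this
        exact this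
      have h2 : ∫ z, ‖w z * (η t * ξ (z - i t))‖ ∂μ
          = ‖η t‖ * (eLpNorm (fun z => w z * ξ (z - i t)) 1 μ).toReal := by
        rw [eLpNorm_one_eq_lintegral_enorm, ← integral_norm_eq_lintegral_enorm (hIntg t).1,
          ← integral_const_mul]
        refine integral_congr_ae (Filter.Eventually.of_forall fun z => ?_)
        simp only [norm_mul]; ring
      rw [Real.norm_of_nonneg (integral_nonneg fun z => norm_nonneg _)]
      show ∫ z, ‖w z * (η t * ξ (z - i t))‖ ∂μ ≤ _
      rw [h2]
      gcongr
      exact ENNReal.toReal_mono hfin h1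
  calc ∫ z, w z * (∫ t, η t * ξ (z - i t)) ∂μ
      = ∫ z, ∫ t, w z * (η t * ξ (z - i t)) ∂volume ∂μ := by
        refine integral_congr_ae (Filter.Eventually.of_forall fun z => ?_)
        simp only
        rw [integral_const_mul]
    _ = ∫ t, ∫ z, w z * (η t * ξ (z - i t)) ∂μ := integral_integral_swap hprod
    _ = _ := by
        refine integral_congr_ae (Filter.Eventually.of_forall fun t => ?_)
        simp only
        rw [← integral_const_mul]
        refine integral_congr_ae (Filter.Eventually.of_forall fun z => ?_)
        simp only; ring

/-- mollifiers -/
def bmp (n : ℕ) (j : ℕ) : ContDiffBump (0 : En n) :=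
  ⟨1 / (j + 2), 1 / (j + 1), by positivity, by
    apply one_div_lt_one_div_of_lt <;> linarith [show (0:ℝ) ≤ j from Nat.cast_nonneg j]⟩

lemma psi_tendsto (μ : Measure X) [μ.IsAddHaarMeasure] {i : En n → X} (hi : Continuous i)
    (hi0 : i 0 = 0)
    {P P' : ℝ≥0∞} [Fact (1 ≤ P)] [Fact (1 ≤ P')] [ENNReal.HolderConjugate P' P] (hPt : P ≠ ⊤)
    {w ξ : X → ℝ} (hwm : Measurable w) (hξm : Measurable ξ)
    (hw : MemLp w P' μ) (hξ : MemLp ξ P μ) :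
    Filter.Tendsto (fun j : ℕ => ∫ z, w z * (∫ t, (bmp n j).normed volume t * ξ (z - i t)) ∂μ)
      Filter.atTop (nhds (∫ z, w z * ξ z ∂μ)) := by
  have h1 := psi_cont μ hi hPt hw hξ
  have h2 : Continuous fun t : En n => ∫ z, w z * ξ (z - i (-t)) ∂μ := h1.comp continuous_neg
  have h3 := ContDiffBump.convolution_tendsto_right_of_continuous (μ := (volume : Measure (En n)))
    (φ := bmp n) (l := Filter.atTop) (by
      show Filter.Tendsto (fun j : ℕ => (1:ℝ) / (j + 1)) _ _
      exact tendsto_one_div_add_atTop_nhds_zero_nat) h2 0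
  simp only [neg_zero, hi0, sub_zero] at h3
  refine h3.congr fun j => ?_
  rw [psi_fubini μ hi hwm hξm hw hξ (bmp n j).continuous_normed (bmp n j).hasCompactSupport_normed]
  simp [convolution_def]

end absmoll

lemma memLp_of_lint {X : Type*} [MeasurableSpace X] {μ : Measure X} {f : X → ℝ} (hf : Measurable f)
    {P : ℝ} (hP : 0 < P) (h : ∫⁻ x, ENNReal.ofReal (|f x| ^ P) ∂μ < ⊤) :
    MemLp f (ENNReal.ofReal P) μ := by
  refine ⟨hf.aestronglyMeasurable, ?_⟩
  rw [eLpNorm_lt_top_iff_lintegral_rpow_enorm_lt_top (by simpa using hP) ENNReal.ofReal_ne_top,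
    ENNReal.toReal_ofReal hP.le]
  convert h using 2 with x
  ext x
  rw [← ofReal_norm, Real.norm_eq_abs, ENNReal.ofReal_rpow_of_nonneg (abs_nonneg _) hP.le]

/-- weighted difference of test function -/
def xi (n : ℕ) (p s : ℝ) (φ : En n → ℝ) (z : En n × En n) : ℝ :=
  (φ z.1 - φ z.2) * ‖z.1 - z.2‖ ^ (-((n + s * p) / p))

/-- flux parts -/
def W1 (n : ℕ) (p s : ℝ) (u : En n → ℝ) (z : En n × En n) : ℝ :=
  |u z.1 - u z.2| ^ (p - 2) * (u z.1 - u z.2) * ‖z.1 - z.2‖ ^ (-((n + s * p) * ((p - 1) / p)))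

def W2 (n : ℕ) (p q s t : ℝ) (a : En n × En n → ℝ) (u : En n → ℝ) (z : En n × En n) : ℝ :=
  a z * (|u z.1 - u z.2| ^ (q - 2) * (u z.1 - u z.2)) * ‖z.1 - z.2‖ ^ (-(n + t * q) + (n + s * p) / p)

lemma form_eq {n : ℕ} {p q s t : ℝ} (hp : 0 < p) (a : En n × En n → ℝ) (u φ : En n → ℝ)
    (z : En n × En n) :
    formIntegrand n p q s t a u φ z = (W1 n p s u z + W2 n p q s t a u z) * xi n p s φ z := by
  unfold formIntegrand W1 W2 xi
  rcases eq_or_ne ‖z.1 - z.2‖ 0 with h | h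
  · rw [norm_eq_zero, sub_eq_zero] at h
    simp [h]
  · have hK : 0 < ‖z.1 - z.2‖ := lt_of_le_of_ne (norm_nonneg _) (Ne.symm h)
    set K := ‖z.1 - z.2‖
    have e1 : K ^ (-(((n:ℝ) + s * p) * ((p - 1) / p))) * K ^ (-(((n:ℝ) + s * p) / p)) =
        (K ^ ((n:ℝ) + s * p))⁻¹ := by
      rw [← Real.rpow_add hK, ← Real.rpow_neg hK.le]; congr 1; field_simp; ring
    have e2 : K ^ (-((n:ℝ) + t * q) + ((n:ℝ) + s * p) / p) * K ^ (-(((n:ℝ) + s * p) / p)) =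
        (K ^ ((n:ℝ) + t * q))⁻¹ := by
      rw [← Real.rpow_add hK, ← Real.rpow_neg hK.le]; congr 1; ring
    rw [div_eq_mul_inv, div_eq_mul_inv, ← e1, ← e2]
    ring

lemma diff_meas {n : ℕ} {w : En n → ℝ} (hw : Measurable w) :
    Measurable fun z : En n × En n => w z.1 - w z.2 :=
  (hw.comp measurable_fst).sub (hw.comp measurable_snd)

lemma K_meas {n : ℕ} : Measurable fun z : En n × En n => ‖z.1 - z.2‖ :=
  (measurable_fst.sub measurable_snd).norm

lemma xi_meas {n : ℕ} {p s : ℝ} {φ : En n → ℝ} (hφ : Measurable φ) : Measurable (xi n p s φ) :=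
  (diff_meas hφ).mul (K_meas.pow_const _)

lemma W1_meas {n : ℕ} {p s : ℝ} {φ : En n → ℝ} (hφ : Measurable φ) : Measurable (W1 n p s φ) :=
  (((diff_meas hφ).norm.pow_const _).mul (diff_meas hφ)).mul (K_meas.pow_const _)

lemma W2_meas {n : ℕ} {p q s t : ℝ} {a : En n × En n → ℝ} (ha : Measurable a) {φ : En n → ℝ}
    (hφ : Measurable φ) : Measurable (W2 n p q s t a φ) :=
  (ha.mul (((diff_meas hφ).norm.pow_const _).mul (diff_meas hφ))).mul (K_meas.pow_const _)

lemma xi_memLp {n : ℕ} {p s : ℝ} (hp : 0 < p) {φ : En n → ℝ} (hφ : Measurable φ)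
    (h : ee n p s φ univ < ⊤) : MemLp (xi n p s φ) (ENNReal.ofReal p) := by
  refine memLp_of_lint (xi_meas hφ) hp ?_
  rw [ee, Measure.restrict_univ] at h
  refine lt_of_eq_of_lt (lintegral_congr fun z => ?_) h
  congr 1
  rw [xi, abs_mul, Real.mul_rpow (abs_nonneg _) (abs_nonneg _),
    abs_of_nonneg (Real.rpow_nonneg (norm_nonneg _) _), ← Real.rpow_mul (norm_nonneg _)]
  congr 2
  field_simp

lemma abs_pow_sub {D P : ℝ} (hP : 1 < P) : |(|D| ^ (P - 2) * D)| = |D| ^ (P - 1) := by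
  rcases eq_or_ne D 0 with h | h
  · rw [h]; simp; rw [Real.zero_rpow (by linarith)]
  · have := abs_pos.2 h
    rw [abs_mul, abs_of_nonneg (a := |D| ^ (P - 2)) (by positivity)]
    conv_lhs => rw [← Real.rpow_one |D|, ← Real.rpow_mul (abs_nonneg _), one_mul]
    rw [← Real.rpow_add this]; congr 1; ring

lemma W1_memLp {n : ℕ} {p s : ℝ} (hp : 1 < p) {u : En n → ℝ} (hu : Measurable u)
    (h : ee n p s u univ < ⊤) : MemLp (W1 n p s u) (ENNReal.ofReal (pC p)) := by
  have hp1 : 0 < p - 1 := by linarith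
  refine memLp_of_lint (W1_meas hu) (by unfold pC; positivity) ?_
  rw [ee, Measure.restrict_univ] at h
  refine lt_of_eq_of_lt (lintegral_congr fun z => ?_) h
  congr 1
  rw [W1, abs_mul, abs_pow_sub hp, Real.mul_rpow (by positivity) (abs_nonneg _),
    abs_of_nonneg (Real.rpow_nonneg (norm_nonneg _) _), ← Real.rpow_mul (norm_nonneg _),
    ← Real.rpow_mul (abs_nonneg _)]
  unfold pC
  congr 2
  · field_simp
  · field_simp

lemma pow_sub_le {a b P : ℝ} (hP : 0 ≤ P) : |a - b| ^ P ≤ 2 ^ P * (|a| ^ P + |b| ^ P) := by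
  have h1 : |a - b| ≤ 2 * max |a| |b| := by
    calc |a - b| ≤ |a| + |b| := abs_sub _ _
      _ ≤ _ := by linarith [le_max_left |a| |b|, le_max_right |a| |b|]
  have h0 : 0 ≤ max |a| |b| := le_max_of_le_left (abs_nonneg _)
  calc |a - b| ^ P ≤ (2 * max |a| |b|) ^ P := by gcongr
    _ = 2 ^ P * (max |a| |b|) ^ P := Real.mul_rpow (by norm_num) h0
    _ ≤ _ := by
      gcongr
      rcases max_choice |a| |b| with h | h <;> rw [h]
      · have : 0 ≤ |b| ^ P := by positivity
        linarith
      · have : 0 ≤ |a| ^ P := by positivity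
        linarith

lemma far_int {n : ℕ} (hn : 0 < n) {p b : ℝ} (hp : 0 < p) (hb : 0 < b) {u : En n → ℝ}
    (hu : Measurable u) (h : ∫⁻ x, ENNReal.ofReal (|u x| ^ p) < ⊤) :
    ∫⁻ z in {z : En n × En n | 1 ≤ ‖z.1 - z.2‖},
      ENNReal.ofReal (|u z.1 - u z.2| ^ p * ‖z.1 - z.2‖ ^ (-(n + b))) < ⊤ := by
  have hS : MeasurableSet {z : En n × En n | 1 ≤ ‖z.1 - z.2‖} := measurableSet_le measurable_const K_meas
  have hum : Measurable fun x => |u x| := hu.norm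
  set S := {z : En n × En n | 1 ≤ ‖z.1 - z.2‖} with hSdef
  have hkm : Measurable fun z : En n × En n => S.indicator
      (fun z => ENNReal.ofReal (‖z.1 - z.2‖ ^ (-((n:ℝ) + b)))) z :=
    ((K_meas.pow_const _).ennreal_ofReal).indicator hS
  have hker : ∀ x, ∫⁻ y, S.indicator
      (fun z => ENNReal.ofReal (‖z.1 - z.2‖ ^ (-((n:ℝ) + b)))) (x, y) = ENNReal.ofReal (n * om n * (1 / b)) := by
    intro x
    have := ker_out hn x hb one_pos
    rw [Real.one_rpow] at this
    rw [← this, ← lintegral_indicator measurableSet_ball.compl]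
    congr 1; ext y
    have : (x, y) ∈ S ↔ y ∈ (ball x 1)ᶜ := by
      simp [hSdef, dist_comm y x, dist_eq_norm]
    by_cases hy : y ∈ (ball x 1)ᶜ
    · rw [indicator_of_mem hy, indicator_of_mem (this.2 hy)]
    · rw [indicator_of_notMem hy, indicator_of_notMem (fun h => hy (this.1 h))]
  have hker' : ∀ y, ∫⁻ x, S.indicator
      (fun z => ENNReal.ofReal (‖z.1 - z.2‖ ^ (-((n:ℝ) + b)))) (x, y) = ENNReal.ofReal (n * om n * (1 / b)) := by
    intro y
    rw [← hker y]
    congr 1; ext x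
    simp only [indicator, hSdef, mem_ofPred_eq, norm_sub_rev x y]
  have hum' : Measurable fun x => ENNReal.ofReal (|u x| ^ p) := (hum.pow_const _).ennreal_ofReal
  have hm1 : Measurable fun z : En n × En n => ENNReal.ofReal (|u z.1| ^ p) * S.indicator
      (fun z => ENNReal.ofReal (‖z.1 - z.2‖ ^ (-((n:ℝ) + b)))) z := (hum'.comp measurable_fst).mul hkm
  have hm2 : Measurable fun z : En n × En n => ENNReal.ofReal (|u z.2| ^ p) * S.indicator
      (fun z => ENNReal.ofReal (‖z.1 - z.2‖ ^ (-((n:ℝ) + b)))) z := (hum'.comp measurable_snd).mul hkm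
  have hI1 : ∫⁻ z : En n × En n, ENNReal.ofReal (|u z.1| ^ p) * S.indicator
      (fun z => ENNReal.ofReal (‖z.1 - z.2‖ ^ (-((n:ℝ) + b)))) z < ⊤ := by
    rw [Measure.volume_eq_prod, lintegral_prod _ hm1.aemeasurable]
    simp only
    calc _ = ∫⁻ x, ENNReal.ofReal (|u x| ^ p) * ENNReal.ofReal (n * om n * (1 / b)) := by
          refine lintegral_congr fun x => ?_
          rw [lintegral_const_mul' _ _ ENNReal.ofReal_ne_top, hker x]
      _ < ⊤ := by
          rw [lintegral_mul_const' _ _ ENNReal.ofReal_ne_top]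
          exact ENNReal.mul_lt_top h ENNReal.ofReal_lt_top
  have hI2 : ∫⁻ z : En n × En n, ENNReal.ofReal (|u z.2| ^ p) * S.indicator
      (fun z => ENNReal.ofReal (‖z.1 - z.2‖ ^ (-((n:ℝ) + b)))) z < ⊤ := by
    rw [Measure.volume_eq_prod, lintegral_prod_symm _ hm2.aemeasurable]
    simp only
    calc _ = ∫⁻ x, ENNReal.ofReal (|u x| ^ p) * ENNReal.ofReal (n * om n * (1 / b)) := by
          refine lintegral_congr fun x => ?_
          rw [lintegral_const_mul' _ _ ENNReal.ofReal_ne_top, hker' x]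
      _ < ⊤ := by
          rw [lintegral_mul_const' _ _ ENNReal.ofReal_ne_top]
          exact ENNReal.mul_lt_top h ENNReal.ofReal_lt_top
  rw [← lintegral_indicator hS]
  refine lt_of_le_of_lt (b := ∫⁻ z : En n × En n, ENNReal.ofReal (2 ^ p) *
      (ENNReal.ofReal (|u z.1| ^ p) * S.indicator
      (fun z => ENNReal.ofReal (‖z.1 - z.2‖ ^ (-((n:ℝ) + b)))) z +
      ENNReal.ofReal (|u z.2| ^ p) * S.indicator
      (fun z => ENNReal.ofReal (‖z.1 - z.2‖ ^ (-((n:ℝ) + b)))) z)) ?_ ?_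
  · refine lintegral_mono fun z => ?_
    by_cases hz : z ∈ S
    · simp only [indicator_of_mem hz]
      rw [← add_mul, ← mul_assoc, ← ENNReal.ofReal_add (by positivity) (by positivity),
        ← ENNReal.ofReal_mul (by positivity), ← ENNReal.ofReal_mul (by positivity)]
      refine ENNReal.ofReal_le_ofReal ?_
      gcongr
      exact pow_sub_le hp.le
    · simp [indicator_of_notMem hz]
  · rw [lintegral_const_mul' _ _ ENNReal.ofReal_ne_top,
      lintegral_add_left hm1]
    exact ENNReal.mul_lt_top ENNReal.ofReal_lt_top (ENNReal.add_lt_top.2 ⟨hI1, hI2⟩)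

lemma W2_memLp {n : ℕ} (hn : 0 < n) {p q s t M Λ : ℝ} (hp : 2 ≤ p) (hpq : p ≤ q)
    (htq : t * q ≤ s * p) (htq2 : s < t * q)
    {a : En n × En n → ℝ} (ha : Measurable a) (ha0 : ∀ z, 0 ≤ a z) (haM : ∀ z, a z ≤ M)
    {u : En n → ℝ} (hu : Measurable u) (hb : ∀ x, |u x| ≤ Λ)
    (hup : ∫⁻ x, ENNReal.ofReal (|u x| ^ p) < ⊤)
    (h : ee n p s u univ < ⊤) : MemLp (W2 n p q s t a u) (ENNReal.ofReal (pC p)) := by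
  have hp1 : 0 < p - 1 := by linarith
  have hp0 : 0 < p := by linarith
  have hpc : 0 < pC p := by unfold pC; positivity
  have hpc1 : pC p * (p - 1) = p := by unfold pC; field_simp
  have hM : 0 ≤ M := (ha0 0).trans (haM 0)
  have hΛ : 0 ≤ Λ := (abs_nonneg _).trans (hb 0)
  set b := (t * q - s) * pC p with hbdef
  have hb0 : 0 < b := mul_pos (by linarith) hpc
  have hq : 0 ≤ (q - 1) * pC p - p := by nlinarith
  have hfar := far_int hn hp0 hb0 hu hup
  have hS : MeasurableSet {z : En n × En n | 1 ≤ ‖z.1 - z.2‖} := measurableSet_le measurable_const K_meas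
  rw [← lintegral_indicator hS] at hfar
  rw [ee, Measure.restrict_univ] at h
  set S := {z : En n × En n | 1 ≤ ‖z.1 - z.2‖} with hSdef
  refine memLp_of_lint (W2_meas ha hu) hpc ?_
  set C := M ^ pC p * (2 * Λ) ^ ((q - 1) * pC p - p) with hC
  have hC0 : 0 ≤ C := by positivity
  have hmain : ∀ z : En n × En n, ENNReal.ofReal (|W2 n p q s t a u z| ^ pC p) ≤
      ENNReal.ofReal C * (ENNReal.ofReal (|u z.1 - u z.2| ^ p * ‖z.1 - z.2‖ ^ (-((n:ℝ) + s * p))) +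
        S.indicator (fun z => ENNReal.ofReal (|u z.1 - u z.2| ^ p * ‖z.1 - z.2‖ ^ (-((n:ℝ) + b)))) z) := by
    intro z
    set D := |u z.1 - u z.2| with hD
    have hD0 : 0 ≤ D := abs_nonneg _
    have hDΛ : D ≤ 2 * Λ := by
      calc D ≤ |u z.1| + |u z.2| := abs_sub _ _
        _ ≤ _ := by linarith [hb z.1, hb z.2]
    have hE : |W2 n p q s t a u z| ^ pC p ≤
        C * (D ^ p * ‖z.1 - z.2‖ ^ ((-(n + t * q) + (n + s * p) / p) * pC p)) := by
      rw [W2, abs_mul, abs_mul, abs_pow_sub (by linarith), abs_of_nonneg (ha0 z),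
        abs_of_nonneg (Real.rpow_nonneg (norm_nonneg _) _),
        Real.mul_rpow (mul_nonneg (ha0 z) (by positivity)) (by positivity),
        Real.mul_rpow (ha0 z) (by positivity), ← Real.rpow_mul (norm_nonneg _),
        ← Real.rpow_mul (abs_nonneg _), hC]
      have h1 : a z ^ pC p ≤ M ^ pC p := Real.rpow_le_rpow (ha0 z) (haM z) hpc.le
      have h2 : D ^ ((q - 1) * pC p) ≤ (2 * Λ) ^ ((q - 1) * pC p - p) * D ^ p := by
        rcases eq_or_lt_of_le hD0 with h0 | h0
        · rw [← h0, Real.zero_rpow (by nlinarith)]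
          positivity
        · calc D ^ ((q - 1) * pC p) = D ^ ((q - 1) * pC p - p) * D ^ p := by
                rw [← Real.rpow_add h0]; congr 1; ring
            _ ≤ _ := by gcongr
      calc _ ≤ M ^ pC p * ((2 * Λ) ^ ((q - 1) * pC p - p) * D ^ p) * ‖z.1 - z.2‖ ^ ((-(n + t * q) + (n + s * p) / p) * pC p) := by
            gcongr
        _ = _ := by ring
    refine (ENNReal.ofReal_le_ofReal hE).trans ?_
    rw [ENNReal.ofReal_mul hC0]
    gcongr
    by_cases hz : z ∈ S
    · rw [indicator_of_mem hz]
      refine le_trans (le_of_eq ?_) le_add_self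
      congr 3
      rw [hbdef]; unfold pC; field_simp; ring
    · refine le_trans ?_ le_self_add
      refine ENNReal.ofReal_le_ofReal ?_
      have hz1 : ‖z.1 - z.2‖ ≤ 1 := by
        have : ¬ (1 ≤ ‖z.1 - z.2‖) := hz
        linarith
      rcases eq_or_lt_of_le (norm_nonneg (z.1 - z.2)) with h0 | h0
      · have : z.1 = z.2 := by rw [← sub_eq_zero]; exact norm_eq_zero.1 h0.symm
        have hD' : D = 0 := by rw [hD, this]; simp
        rw [hD', Real.zero_rpow hp0.ne']; simp
      · gcongr 1
        refine Real.rpow_le_rpow_of_exponent_ge h0 hz1 ?_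
        have : (-(n + t * q) + (n + s * p) / p) * pC p = -((n:ℝ) + s * p) + (s * p - t * q) * pC p := by
          unfold pC; field_simp; ring
        rw [this]
        have : 0 ≤ (s * p - t * q) * pC p := mul_nonneg (by linarith) hpc.le
        linarith
  refine lt_of_le_of_lt (lintegral_mono hmain) ?_
  rw [lintegral_const_mul' _ _ ENNReal.ofReal_ne_top, lintegral_add_left (kin_meas hu _ _)]
  exact ENNReal.mul_lt_top ENNReal.ofReal_lt_top (ENNReal.add_lt_top.2 ⟨h, hfar⟩)

/-- mollified test function -/
def mol (n j : ℕ) (φ : En n → ℝ) (x : En n) : ℝ :=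
  ∫ t, (bmp n j).normed volume t * φ (x - t)

lemma mol_eq {n j : ℕ} (φ : En n → ℝ) :
    mol n j φ = convolution ((bmp n j).normed volume) φ (ContinuousLinearMap.lsmul ℝ ℝ) volume := by
  ext x
  simp [mol, convolution]

lemma bdd_locInt {n : ℕ} {φ : En n → ℝ} (hφ : Measurable φ) {Bd : ℝ} (hB : ∀ x, |φ x| ≤ Bd) :
    LocallyIntegrable φ volume := by
  have h : MemLp φ ⊤ volume := memLp_top_of_bound hφ.aestronglyMeasurable Bd (Filter.Eventually.of_forall hB)
  exact h.locallyIntegrable le_top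

lemma mol_smooth {n j : ℕ} {φ : En n → ℝ} (hφ : Measurable φ) {Bd : ℝ} (hB : ∀ x, |φ x| ≤ Bd) :
    ContDiff ℝ (⊤ : ℕ∞) (mol n j φ) := by
  rw [mol_eq]
  exact HasCompactSupport.contDiff_convolution_left _ ((bmp n j).hasCompactSupport_normed)
    ((bmp n j).contDiff_normed) (bdd_locInt hφ hB)

lemma mol_supp {n j : ℕ} {φ : En n → ℝ} (hc : HasCompactSupport φ) :
    HasCompactSupport (mol n j φ) := by
  rw [mol_eq]
  exact HasCompactSupport.convolution _ ((bmp n j).hasCompactSupport_normed) hc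

lemma mol_xi {n j : ℕ} {p s : ℝ} {φ : En n → ℝ} (hφ : Measurable φ) {Bd : ℝ} (hB : ∀ x, |φ x| ≤ Bd)
    (z : En n × En n) :
    xi n p s (mol n j φ) z = ∫ t, (bmp n j).normed volume t * xi n p s φ (z - (t, t)) := by
  have hI : ∀ x, Integrable fun t => (bmp n j).normed volume t * φ (x - t) := by
    intro x
    refine Integrable.mul_bdd (c := Bd) ?_ ?_ ?_
    · exact (bmp n j).continuous_normed.integrable_of_hasCompactSupport (bmp n j).hasCompactSupport_normed
    · exact (hφ.comp (measurable_const.sub measurable_id)).aestronglyMeasurable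
    · exact Filter.Eventually.of_forall fun t => hB _
  unfold xi mol
  rw [← integral_sub (hI _) (hI _), ← integral_mul_const]
  refine integral_congr_ae (Filter.Eventually.of_forall fun t => ?_)
  simp only [Prod.fst_sub, Prod.snd_sub, sub_sub_sub_cancel_right]
  ring

lemma weak_ext {n : ℕ} (hn : 0 < n) {p q s t M Λ δ : ℝ} (hp : 2 ≤ p) (hpq : p ≤ q)
    (htq : t * q ≤ s * p) (htq2 : s < t * q)
    {a : En n × En n → ℝ} (ha : Measurable a) (ha0 : ∀ z, 0 ≤ a z) (haM : ∀ z, a z ≤ M)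
    {u f : En n → ℝ} (hu : MemWsp n s p u) (hb : ∀ x, |u x| ≤ Λ)
    (hee : ee n p s u univ < ⊤)
    (hδ : 1 < δ) (hf : Measurable f) (hfδ : ∫⁻ x, ENNReal.ofReal (|f x| ^ δ) < ⊤)
    (hw : IsBoundedWeakSolution n p q s t a u f)
    {φ : En n → ℝ} (hφ : Measurable φ) {Bd : ℝ} (hB : ∀ x, |φ x| ≤ Bd) (hc : HasCompactSupport φ)
    (hφe : ee n p s φ univ < ⊤) :
    Integrable (formIntegrand n p q s t a u φ) ∧
      ∫ z, formIntegrand n p q s t a u φ z = ∫ x, f x * φ x := by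
  have hp1 : 0 < p - 1 := by linarith
  have hp0 : 0 < p := by linarith
  have hpc : 1 < pC p := by unfold pC; rw [one_lt_div hp1]; linarith
  have hHC : Real.HolderConjugate (pC p) p := by
    rw [Real.holderConjugate_iff]; refine ⟨hpc, ?_⟩; unfold pC; field_simp; ring
  have hHC2 : Real.HolderConjugate δ (pC δ) := by
    have : δ - 1 ≠ 0 := by linarith
    rw [Real.holderConjugate_iff]; refine ⟨hδ, ?_⟩; unfold pC; field_simp; ring
  have i1 : ENNReal.HolderConjugate (ENNReal.ofReal (pC p)) (ENNReal.ofReal p) := hHC.ennrealOfReal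
  have i2 : ENNReal.HolderConjugate (ENNReal.ofReal δ) (ENNReal.ofReal (pC δ)) := hHC2.ennrealOfReal
  have f1 : Fact (1 ≤ ENNReal.ofReal (pC p)) := ⟨by simpa using hpc.le⟩
  have f2 : Fact (1 ≤ ENNReal.ofReal p) := ⟨by simp; linarith⟩
  have f3 : Fact (1 ≤ ENNReal.ofReal δ) := ⟨by simpa using hδ.le⟩
  have f4 : Fact (1 ≤ ENNReal.ofReal (pC δ)) := ⟨by simpa using hHC2.symm.lt.le⟩
  have hW : MemLp (fun z => W1 n p s u z + W2 n p q s t a u z) (ENNReal.ofReal (pC p)) :=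
    (W1_memLp (by linarith) hu.1 hee).add
      (W2_memLp hn hp hpq htq htq2 ha ha0 haM hu.1 hb hu.2.1 hee)
  have hWm : Measurable (fun z => W1 n p s u z + W2 n p q s t a u z) :=
    (W1_meas hu.1).add (W2_meas ha hu.1)
  have hxi := xi_memLp hp0 hφ hφe
  have hformeq : ∀ φ : En n → ℝ, formIntegrand n p q s t a u φ = fun z =>
      (W1 n p s u z + W2 n p q s t a u z) * xi n p s φ z := fun φ => funext fun z => form_eq hp0 a u φ z
  refine ⟨?_, ?_⟩
  · rw [hformeq]; exact hW.integrable_mul hxi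
  have hvol : (volume : Measure (En n × En n)).IsAddHaarMeasure := by
    rw [Measure.volume_eq_prod]; infer_instance
  have T1 := psi_tendsto (volume : Measure (En n × En n)) (i := fun t : En n => (t, t))
    (by fun_prop) rfl ENNReal.ofReal_ne_top hWm (xi_meas hφ) hW hxi
  have hfL : MemLp f (ENNReal.ofReal δ) := memLp_of_lint hf (by linarith) hfδ
  have hφL : MemLp φ (ENNReal.ofReal (pC δ)) := by
    have h : MemLp φ ⊤ volume := memLp_top_of_bound hφ.aestronglyMeasurable Bd (Filter.Eventually.of_forall hB)
    refine h.mono_exponent_of_measure_support_ne_top (s := tsupport φ) ?_ ?_ le_top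
    · intro x hx; exact image_eq_zero_of_notMem_tsupport hx
    · exact (IsCompact.measure_lt_top hc).ne
  have T2 := psi_tendsto (volume : Measure (En n)) (i := fun t : En n => t)
    (by fun_prop) rfl ENNReal.ofReal_ne_top hf hφ hfL hφL
  rw [hformeq]
  refine tendsto_nhds_unique T1 ?_
  refine T2.congr fun j => ?_
  have := hw.2 (mol n j φ) (mol_smooth hφ hB) (mol_supp hc)
  rw [hformeq] at this
  refine this.symm.trans ?_
  refine integral_congr_ae (Filter.Eventually.of_forall fun z => ?_)
  simp only [mol_xi hφ hB]

/-- cutoff -/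
def cut {n : ℕ} (c : En n) (r : ℝ) (x : En n) : ℝ := max 0 (min 1 (3 - 2 * ‖x - c‖ / r))

lemma cut_nonneg {n : ℕ} (c : En n) (r : ℝ) (x : En n) : 0 ≤ cut c r x := le_max_left _ _
lemma cut_le_one {n : ℕ} (c : En n) (r : ℝ) (x : En n) : cut c r x ≤ 1 :=
  max_le (by norm_num) (min_le_left _ _)
lemma cut_one {n : ℕ} {c : En n} {r : ℝ} (hr : 0 < r) {x : En n} (hx : x ∈ ball c r) : cut c r x = 1 := by
  rw [mem_ball, dist_eq_norm] at hx
  unfold cut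
  have : 2 * ‖x - c‖ / r ≤ 2 := by rw [div_le_iff₀ hr]; linarith
  rw [min_eq_left (by linarith), max_eq_right (by norm_num)]
lemma cut_zero {n : ℕ} {c : En n} {r : ℝ} (hr : 0 < r) {x : En n} (hx : 3 / 2 * r ≤ ‖x - c‖) : cut c r x = 0 := by
  unfold cut
  have : 3 ≤ 2 * ‖x - c‖ / r := by rw [le_div_iff₀ hr]; linarith
  exact max_eq_left (min_le_of_right_le (by linarith))
lemma cut_meas {n : ℕ} (c : En n) (r : ℝ) : Measurable (cut c r) := by
  unfold cut
  exact measurable_const.max (measurable_const.min (measurable_const.sub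
    ((measurable_const.mul (measurable_id.sub_const c).norm).div_const r)))
lemma cut_lip {n : ℕ} (c : En n) {r : ℝ} (hr : 0 < r) (x y : En n) :
    |cut c r x - cut c r y| ≤ 2 / r * ‖x - y‖ := by
  unfold cut
  have h1 : ∀ A B : ℝ, |max 0 (min 1 A) - max 0 (min 1 B)| ≤ |A - B| := by
    intro A B
    refine (abs_max_sub_max_le_max 0 _ 0 _).trans ?_
    refine max_le (by simp) ?_
    refine (abs_min_sub_min_le_max 1 A 1 B).trans ?_
    exact max_le (by simp) le_rfl
  refine (h1 _ _).trans ?_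
  have h2 : 3 - 2 * ‖x - c‖ / r - (3 - 2 * ‖y - c‖ / r) = 2 / r * (‖y - c‖ - ‖x - c‖) := by ring
  rw [h2, abs_mul, abs_of_nonneg (by positivity : 0 ≤ 2 / r)]
  gcongr
  refine (abs_norm_sub_norm_le _ _).trans ?_
  rw [sub_sub_sub_cancel_right, norm_sub_rev]

lemma pow_sub_pow_le {x y p : ℝ} (hp : 1 ≤ p) (hy : 0 ≤ y) (hyx : y ≤ x) :
    x ^ p - y ^ p ≤ p * x ^ (p - 1) * (x - y) := by
  rcases eq_or_lt_of_le (hy.trans hyx) with h | h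
  · have : y = 0 := by linarith
    rw [this, ← h]; simp
  · have h0 : 0 ≤ y / x := by positivity
    have h1 := one_add_mul_self_le_rpow_one_add (s := y / x - 1) (by linarith) hp
    have h2 : x ^ p * (y / x) ^ p = y ^ p := by
      rw [← Real.mul_rpow h.le (by positivity)]; congr 1; field_simp
    have h3 : x ^ p = x ^ (p - 1) * x := by
      conv_rhs => rw [← Real.rpow_one x, ← Real.rpow_mul h.le, one_mul]
      rw [← Real.rpow_add h]; congr 1; ring
    rw [show 1 + (y / x - 1) = y / x by ring] at h1
    have h4 := mul_le_mul_of_nonneg_left h1 (by positivity : 0 ≤ x ^ p)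
    rw [h2] at h4
    have h5 : x ^ p * (1 + p * (y / x - 1)) = x ^ p - p * x ^ (p - 1) * (x - y) := by
      rw [h3]; field_simp; ring
    linarith

lemma young_half {A B c p : ℝ} (hp : 1 ≤ p) (hA : 0 ≤ A) (hB : 0 ≤ B) (hc : 0 ≤ c) :
    c * (A ^ (p - 1) * B) ≤ 1 / 2 * A ^ p + (2 * c) ^ p * B ^ p := by
  have key : ∀ x : ℝ, 0 ≤ x → x ^ (p - 1) * x = x ^ p := by
    intro x hx
    rcases eq_or_lt_of_le hx with h | h
    · rw [← h, Real.zero_rpow (by linarith : p ≠ 0)]; simp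
    · conv_lhs => rw [mul_comm, ← Real.rpow_one x, ← Real.rpow_mul hx, one_mul]
      rw [← Real.rpow_add h]; congr 1; ring
  have hAp : 0 ≤ A ^ p := by positivity
  have hAp1 : 0 ≤ A ^ (p - 1) := by positivity
  have h2 : 0 ≤ (2 * c) ^ p * B ^ p := by positivity
  rcases le_total (2 * c * B) A with h | h
  · have : c * (A ^ (p - 1) * B) ≤ 1 / 2 * (A ^ (p - 1) * A) := by nlinarith
    rw [key A hA] at this; linarith
  · have h3 : A ^ (p - 1) ≤ (2 * c * B) ^ (p - 1) := Real.rpow_le_rpow hA h (by linarith)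
    have h4 : c * (A ^ (p - 1) * B) ≤ (2 * c * B) ^ (p - 1) * (2 * c * B) := by
      have : c * (A ^ (p - 1) * B) ≤ c * ((2 * c * B) ^ (p - 1) * B) := by gcongr
      have h6 : 0 ≤ c * ((2 * c * B) ^ (p - 1) * B) := by positivity
      nlinarith
    rw [key _ (by positivity), Real.mul_rpow (by positivity) hB] at h4
    linarith

lemma rpow_pm {D p : ℝ} (hD : 0 < D) : D ^ (p - 2) * D = D ^ (p - 1) := by
  rw [← Real.rpow_add_one hD.ne']; congr 1; ring
lemma rpow_pm2 {D p : ℝ} (hD : 0 < D) : D ^ (p - 1) * D = D ^ p := by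
  rw [← Real.rpow_add_one hD.ne']; congr 1; ring

/-- core algebraic inequality -/
lemma cacc_alg {p c m v1 v2 x y : ℝ} (hp : 2 ≤ p) (hc : 1 ≤ c) (hy : 0 ≤ y) (hyx : y ≤ x)
    (hd : v1 ≠ v2)
    (hm : |v1 - v2| ^ (p - 2) ≤ m) (hm2 : m ≤ c * |v1 - v2| ^ (p - 2)) :
    1 / 2 * (|v1 - v2| ^ p * x ^ p) ≤ m * (v1 - v2) * (v1 * x ^ p - v2 * y ^ p) +
      (2 * (c * p)) ^ p * (|v2| ^ p * |x - y| ^ p) := by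
  set d := v1 - v2 with hdd
  have hD : 0 < |d| := abs_pos.2 (sub_ne_zero.2 hd)
  set D := |d|
  have hx : 0 ≤ x := hy.trans hyx
  have hm0 : 0 ≤ m := le_trans (by positivity) hm
  have e1 : m * d * (v1 * x ^ p - v2 * y ^ p) = m * (d * d) * x ^ p + m * d * v2 * (x ^ p - y ^ p) := by
    have : v1 = d + v2 := by rw [hdd]; ring
    rw [this]; ring
  have e2 : d * d = D * D := (abs_mul_abs_self d).symm
  have h1 : D ^ p * x ^ p ≤ m * (D * D) * x ^ p := by
    gcongr
    calc D ^ p = D ^ (p - 2) * (D * D) := by rw [← mul_assoc, rpow_pm hD, rpow_pm2 hD]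
      _ ≤ _ := by gcongr
  have hxy : 0 ≤ x ^ p - y ^ p := sub_nonneg.2 (Real.rpow_le_rpow hy hyx (by linarith))
  have h2 : |m * d * v2 * (x ^ p - y ^ p)| ≤ (c * p) * ((D * x) ^ (p - 1) * (|v2| * (x - y))) := by
    rw [abs_mul, abs_mul, abs_mul, abs_of_nonneg hm0, abs_of_nonneg hxy]
    calc m * |d| * |v2| * (x ^ p - y ^ p) ≤ (c * D ^ (p - 2)) * D * |v2| * (p * x ^ (p - 1) * (x - y)) := by
          have := pow_sub_pow_le (p := p) (by linarith) hy hyx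
          gcongr
      _ = (c * p) * ((D ^ (p - 2) * D) * x ^ (p - 1) * (|v2| * (x - y))) := by ring
      _ = _ := by rw [rpow_pm hD, Real.mul_rpow hD.le hx]
  have h3 := young_half (A := D * x) (B := |v2| * (x - y)) (c := c * p) (p := p) (by linarith)
    (by positivity) (mul_nonneg (abs_nonneg _) (by linarith)) (by positivity)
  rw [Real.mul_rpow (z := p) hD.le hx, Real.mul_rpow (z := p) (abs_nonneg _) (by linarith : 0 ≤ x - y)] at h3
  rw [abs_of_nonneg (by linarith : 0 ≤ x - y), e1, e2]
  have := neg_abs_le (m * d * v2 * (x ^ p - y ^ p))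
  linarith

lemma form_m {n : ℕ} {p q s t : ℝ} (a : En n × En n → ℝ) (u φ : En n → ℝ) (z : En n × En n)
    (hK : 0 < ‖z.1 - z.2‖) :
    formIntegrand n p q s t a u φ z =
      (|u z.1 - u z.2| ^ (p - 2) + a z * |u z.1 - u z.2| ^ (q - 2) * ‖z.1 - z.2‖ ^ (s * p - t * q)) *
        (u z.1 - u z.2) * (φ z.1 - φ z.2) * ‖z.1 - z.2‖ ^ (-((n:ℝ) + s * p)) := by
  unfold formIntegrand
  set K := ‖z.1 - z.2‖
  have e2 : K ^ (s * p - t * q) * K ^ (-((n:ℝ) + s * p)) = (K ^ ((n:ℝ) + t * q))⁻¹ := by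
    rw [← Real.rpow_add hK, ← Real.rpow_neg hK.le]; congr 1; ring
  rw [div_eq_mul_inv, div_eq_mul_inv, ← e2, Real.rpow_neg hK.le]
  ring

lemma form_zero {n : ℕ} {p q s t : ℝ} (a : En n × En n → ℝ) (u φ : En n → ℝ) (z : En n × En n)
    (h : u z.1 = u z.2) : formIntegrand n p q s t a u φ z = 0 := by
  unfold formIntegrand; simp [h]

lemma Dq_le {D Λ p q : ℝ} (hD : 0 < D) (hDΛ : D ≤ 2 * Λ) (hpq : p ≤ q) (e : ℝ) :
    D ^ (q - e) ≤ (2 * Λ) ^ (q - p) * D ^ (p - e) := by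
  calc D ^ (q - e) = D ^ (q - p) * D ^ (p - e) := by rw [← Real.rpow_add hD]; congr 1; ring
    _ ≤ _ := by gcongr

/-- comparability constant -/
def cF (p q s M Λ : ℝ) : ℝ := 1 + M * (2 * Λ) ^ (q - p) * 4 ^ (s * p)

lemma cF_one {p q s M Λ : ℝ} (hM : 0 ≤ M) (hΛ : 0 ≤ Λ) : 1 ≤ cF p q s M Λ := by
  unfold cF
  have : 0 ≤ M * (2 * Λ) ^ (q - p) * 4 ^ (s * p) := by positivity
  linarith

lemma lint_le_of_form {X : Type*} [MeasurableSpace X] {μ : Measure X} {f g h : X → ℝ}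
    (hI : Integrable g μ) (hf : Measurable f) (hh : Measurable h) (hf0 : ∀ x, 0 ≤ f x) (hh0 : ∀ x, 0 ≤ h x)
    (hle : ∀ x, f x ≤ g x + h x) :
    ∫⁻ x, ENNReal.ofReal (f x) ∂μ ≤ ENNReal.ofReal (∫ x, g x ∂μ) + ∫⁻ x, ENNReal.ofReal (h x) ∂μ := by
  by_cases ht : ∫⁻ x, ENNReal.ofReal (h x) ∂μ = ⊤
  · rw [ht]; simp
  have hhi : Integrable h μ := by
    refine ⟨hh.aestronglyMeasurable, ?_⟩
    rw [hasFiniteIntegral_iff_ofReal (Filter.Eventually.of_forall hh0)]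
    exact lt_top_iff_ne_top.2 ht
  have hfi : Integrable f μ := by
    refine (hI.add hhi).mono' hf.aestronglyMeasurable (Filter.Eventually.of_forall fun x => ?_)
    rw [Real.norm_eq_abs, abs_of_nonneg (hf0 x)]
    exact hle x
  rw [← ofReal_integral_eq_lintegral_ofReal hfi (Filter.Eventually.of_forall hf0),
    ← ofReal_integral_eq_lintegral_ofReal hhi (Filter.Eventually.of_forall hh0)]
  refine le_trans (ENNReal.ofReal_le_ofReal ?_) ENNReal.ofReal_add_le
  rw [← integral_add hI hhi]
  exact integral_mono hfi (hI.add hhi) hle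

def Xc (n : ℕ) (p s : ℝ) (u : En n → ℝ) (c : En n) (r : ℝ) (z : En n × En n) : ℝ :=
  (ball c (2 * r) ×ˢ ball c (2 * r)).indicator (fun z => |u z.1 - u z.2| ^ p *
    (max (cut c r z.1) (cut c r z.2)) ^ p * ‖z.1 - z.2‖ ^ (-((n:ℝ) + s * p))) z

def Y0 (n : ℕ) (p s : ℝ) (u : En n → ℝ) (k : ℝ) (c : En n) (r : ℝ) (z : En n × En n) : ℝ :=
  (ball c (2 * r) ×ˢ ball c (2 * r)).indicator (fun z => (|u z.1 - k| ^ p + |u z.2 - k| ^ p) *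
    |cut c r z.1 - cut c r z.2| ^ p * ‖z.1 - z.2‖ ^ (-((n:ℝ) + s * p))) z

def kap (n : ℕ) (p q s t : ℝ) (c y : En n) : ℝ :=
  ‖y - c‖ ^ (-((n:ℝ) + s * p)) + ‖y - c‖ ^ (-((n:ℝ) + t * q))

def Y1 (n : ℕ) (p q s t : ℝ) (u : En n → ℝ) (k : ℝ) (c : En n) (r : ℝ) (z : En n × En n) : ℝ :=
  (ball c (2 * r) ×ˢ (ball c (2 * r))ᶜ).indicator (fun z => (|u z.1 - k| ^ p +
    |u z.1 - k| * |u z.2 - k| ^ (p - 1)) * kap n p q s t c z.2) z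

lemma kap_nonneg {n : ℕ} {p q s t : ℝ} (c y : En n) : 0 ≤ kap n p q s t c y := by
  unfold kap; positivity
lemma Xc_nonneg {n : ℕ} {p s : ℝ} (u : En n → ℝ) (c : En n) (r : ℝ) (z) : 0 ≤ Xc n p s u c r z := by
  refine indicator_nonneg (fun z _ => ?_) z
  have : 0 ≤ max (cut c r z.1) (cut c r z.2) := le_max_of_le_left (cut_nonneg _ _ _)
  positivity
lemma Y0_nonneg {n : ℕ} {p s : ℝ} (u : En n → ℝ) (k : ℝ) (c : En n) (r : ℝ) (z) : 0 ≤ Y0 n p s u k c r z := by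
  refine indicator_nonneg (fun z _ => ?_) z
  positivity
lemma Y1_nonneg {n : ℕ} {p q s t : ℝ} (u : En n → ℝ) (k : ℝ) (c : En n) (r : ℝ) (z) :
    0 ≤ Y1 n p q s t u k c r z := by
  refine indicator_nonneg (fun z _ => ?_) z
  have := kap_nonneg (n := n) (p := p) (q := q) (s := s) (t := t) c z.2
  positivity
lemma kap_meas {n : ℕ} {p q s t : ℝ} (c : En n) : Measurable (kap n p q s t c) :=
  ((measurable_id.sub_const c).norm.pow_const _).add ((measurable_id.sub_const c).norm.pow_const _)
lemma Xc_meas {n : ℕ} {p s : ℝ} {u : En n → ℝ} (hu : Measurable u) (c : En n) (r : ℝ) :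
    Measurable (Xc n p s u c r) := by
  refine Measurable.indicator ?_ (measurableSet_ball.prod measurableSet_ball)
  exact (((diff_meas hu).norm.pow_const _).mul (((cut_meas c r).comp measurable_fst).max
    ((cut_meas c r).comp measurable_snd) |>.pow_const _)).mul (K_meas.pow_const _)
lemma Y0_meas {n : ℕ} {p s : ℝ} {u : En n → ℝ} (hu : Measurable u) (k : ℝ) (c : En n) (r : ℝ) :
    Measurable (Y0 n p s u k c r) := by
  refine Measurable.indicator ?_ (measurableSet_ball.prod measurableSet_ball)
  exact (((((hu.comp measurable_fst).sub_const k).norm.pow_const _).add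
    (((hu.comp measurable_snd).sub_const k).norm.pow_const _)).mul
      ((diff_meas (cut_meas c r)).norm.pow_const _)).mul (K_meas.pow_const _)
lemma Y1_meas {n : ℕ} {p q s t : ℝ} {u : En n → ℝ} (hu : Measurable u) (k : ℝ) (c : En n) (r : ℝ) :
    Measurable (Y1 n p q s t u k c r) := by
  refine Measurable.indicator ?_ (measurableSet_ball.prod measurableSet_ball.compl)
  exact ((((hu.comp measurable_fst).sub_const k).norm.pow_const _).add
    (((hu.comp measurable_fst).sub_const k).norm.mul
      (((hu.comp measurable_snd).sub_const k).norm.pow_const _))).mul ((kap_meas c).comp measurable_snd)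

section
variable {n : ℕ} {p q s t M Λ r : ℝ} {a : En n × En n → ℝ} {u : En n → ℝ} {c : En n} {k : ℝ}

lemma not_ball {x : En n} (h : x ∉ ball c (2 * r)) : 2 * r ≤ ‖x - c‖ := by
  rw [mem_ball, dist_eq_norm] at h; linarith

lemma ker_mixed (hsp : 0 ≤ s * p) (htq0 : 0 ≤ t * q) (htq : t * q ≤ s * p) (hr : 0 < r) {x y : En n}
    (hx : ‖x - c‖ < 3 / 2 * r) (hy : y ∉ ball c (2 * r)) :
    ‖x - y‖ ^ (-((n:ℝ) + s * p)) + ‖x - y‖ ^ (-((n:ℝ) + t * q)) ≤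
      4 ^ ((n:ℝ) + s * p) * kap n p q s t c y := by
  have hy' := not_ball hy
  have h1 : ‖y - c‖ / 4 ≤ ‖x - y‖ := by
    have : ‖y - c‖ ≤ ‖x - y‖ + ‖x - c‖ := by
      have := norm_sub_le (x - c) (x - y)
      rw [show x - c - (x - y) = y - c by abel] at this; linarith
    linarith
  have h0 : 0 < ‖y - c‖ / 4 := by linarith
  have key : ∀ b : ℝ, 0 ≤ b → b ≤ (n:ℝ) + s * p → ‖x - y‖ ^ (-b) ≤ 4 ^ ((n:ℝ) + s * p) * ‖y - c‖ ^ (-b) := by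
    intro b hb hb2
    calc ‖x - y‖ ^ (-b) ≤ (‖y - c‖ / 4) ^ (-b) := Real.rpow_le_rpow_of_nonpos h0 h1 (by linarith)
      _ = 4 ^ b * ‖y - c‖ ^ (-b) := by
          rw [Real.div_rpow (norm_nonneg _) (by norm_num), Real.rpow_neg (by norm_num : (0:ℝ) ≤ 4)]
          field_simp
      _ ≤ _ := by
          gcongr
          norm_num
  unfold kap
  have k1 := key ((n:ℝ) + s * p) (by positivity) le_rfl
  have k2 := key ((n:ℝ) + t * q) (by positivity) (by linarith)
  linarith

lemma form_abs (hpq : p ≤ q) (hsp : 0 ≤ s * p) (ha0 : ∀ z, 0 ≤ a z) (haM : ∀ z, a z ≤ M)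
    (hb : ∀ x, |u x| ≤ Λ) (φ : En n → ℝ) (z : En n × En n) :
    |formIntegrand n p q s t a u φ z| ≤ cF p q s M Λ * |u z.1 - u z.2| ^ (p - 1) * |φ z.1 - φ z.2| *
      (‖z.1 - z.2‖ ^ (-((n:ℝ) + s * p)) + ‖z.1 - z.2‖ ^ (-((n:ℝ) + t * q))) := by
  have hM : 0 ≤ M := (ha0 0).trans (haM 0)
  have hΛ : 0 ≤ Λ := (abs_nonneg _).trans (hb 0)
  have hcF := cF_one (p := p) (q := q) (s := s) hM hΛ
  by_cases hd : u z.1 = u z.2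
  · rw [form_zero _ _ _ _ hd]; simp; positivity
  have hD : 0 < |u z.1 - u z.2| := abs_pos.2 (sub_ne_zero.2 hd)
  have hK : 0 < ‖z.1 - z.2‖ := by
    rw [norm_pos_iff, sub_ne_zero]; rintro h; exact hd (by rw [h])
  have hDΛ : |u z.1 - u z.2| ≤ 2 * Λ := (abs_sub _ _).trans (by linarith [hb z.1, hb z.2])
  rw [form_m _ _ _ _ hK]
  set D := |u z.1 - u z.2| with hDdef
  set K := ‖z.1 - z.2‖
  have hm0 : 0 ≤ D ^ (p - 2) + a z * D ^ (q - 2) * K ^ (s * p - t * q) := by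
    have := ha0 z; positivity
  rw [abs_mul, abs_mul, abs_mul, abs_of_nonneg hm0, abs_of_nonneg (Real.rpow_nonneg hK.le _), ← hDdef]
  have e2 : K ^ (s * p - t * q) * K ^ (-((n:ℝ) + s * p)) = K ^ (-((n:ℝ) + t * q)) := by
    rw [← Real.rpow_add hK]; congr 1; ring
  calc (D ^ (p - 2) + a z * D ^ (q - 2) * K ^ (s * p - t * q)) * D * |φ z.1 - φ z.2| * K ^ (-((n:ℝ) + s * p))
      = (D ^ (p - 2) * D) * |φ z.1 - φ z.2| * K ^ (-((n:ℝ) + s * p)) +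
        a z * (D ^ (q - 2) * D) * |φ z.1 - φ z.2| * K ^ (-((n:ℝ) + t * q)) := by rw [← e2]; ring
    _ ≤ cF p q s M Λ * D ^ (p - 1) * |φ z.1 - φ z.2| * K ^ (-((n:ℝ) + s * p)) +
        cF p q s M Λ * D ^ (p - 1) * |φ z.1 - φ z.2| * K ^ (-((n:ℝ) + t * q)) := by
        rw [rpow_pm hD, rpow_pm hD]
        have h1 : a z * D ^ (q - 1) ≤ cF p q s M Λ * D ^ (p - 1) := by
          calc a z * D ^ (q - 1) ≤ M * ((2 * Λ) ^ (q - p) * D ^ (p - 1)) := by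
                gcongr
                · exact haM z
                · exact Dq_le hD hDΛ hpq 1
            _ = M * (2 * Λ) ^ (q - p) * 1 * D ^ (p - 1) := by ring
            _ ≤ cF p q s M Λ * D ^ (p - 1) := by
                gcongr
                unfold cF
                have : (1:ℝ) ≤ 4 ^ (s * p) := Real.one_le_rpow (by norm_num) hsp
                have h2 : M * (2 * Λ) ^ (q - p) * 1 ≤ M * (2 * Λ) ^ (q - p) * 4 ^ (s * p) := by gcongr
                linarith
        have h2 : D ^ (p - 1) ≤ cF p q s M Λ * D ^ (p - 1) := le_mul_of_one_le_left (by positivity) hcF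
        gcongr
    _ = _ := by ring

def C43 (n : ℕ) (p q s M Λ : ℝ) : ℝ := (2 * (cF p q s M Λ * p)) ^ p + cF p q s M Λ * 2 ^ (p - 1) * 4 ^ ((n:ℝ) + s * p)

/-- test function -/
def tf {n : ℕ} (p : ℝ) (u : En n → ℝ) (k : ℝ) (c : En n) (r : ℝ) (x : En n) : ℝ := (u x - k) * cut c r x ^ p

lemma tf_zero (hp : 0 < p) (hr : 0 < r) {x : En n} (hx : x ∉ ball c (2 * r)) : tf p u k c r x = 0 := by
  rw [tf, cut_zero hr (by linarith [not_ball hx]), Real.zero_rpow hp.ne']; simp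

lemma tf_abs (hp : 0 ≤ p) (x : En n) : |tf p u k c r x| ≤ |u x - k| := by
  rw [tf, abs_mul, abs_of_nonneg (Real.rpow_nonneg (cut_nonneg _ _ _) _)]
  exact mul_le_of_le_one_right (abs_nonneg _) (Real.rpow_le_one (cut_nonneg _ _ _) (cut_le_one _ _ _) hp)

/-- mixed region bound -/
lemma mixed_bd (hp : 2 ≤ p) (hM : 0 ≤ M) (hΛ : 0 ≤ Λ) (hsp : 0 ≤ s * p) (htq0 : 0 ≤ t * q) (htq : t * q ≤ s * p) (hr : 0 < r)
    {x y : En n} (hy : y ∉ ball c (2 * r)) :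
    cF p q s M Λ * |u x - u y| ^ (p - 1) * |tf p u k c r x| *
      (‖x - y‖ ^ (-((n:ℝ) + s * p)) + ‖x - y‖ ^ (-((n:ℝ) + t * q))) ≤
    C43 n p q s M Λ * ((|u x - k| ^ p + |u x - k| * |u y - k| ^ (p - 1)) * kap n p q s t c y) := by
  have hcF := cF_one (p := p) (q := q) (s := s) hM hΛ
  have hk := kap_nonneg (n := n) (p := p) (q := q) (s := s) (t := t) c y
  have hC : 0 ≤ C43 n p q s M Λ := by unfold C43; positivity
  by_cases hx : ‖x - c‖ < 3 / 2 * r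
  · have h1 := ker_mixed (n := n) hsp htq0 htq hr hx hy
    have h2 : |u x - u y| ^ (p - 1) ≤ 2 ^ (p - 1) * (|u x - k| ^ (p - 1) + |u y - k| ^ (p - 1)) := by
      have := pow_sub_le (a := u x - k) (b := u y - k) (P := p - 1) (by linarith)
      rwa [sub_sub_sub_cancel_right] at this
    have h3 : |u x - k| ^ (p - 1) * |u x - k| = |u x - k| ^ p := by
      rcases eq_or_lt_of_le (abs_nonneg (u x - k)) with h | h
      · rw [← h, Real.zero_rpow (by linarith : p ≠ 0)]; simp
      · exact rpow_pm2 h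
    have htf := tf_abs (p := p) (u := u) (k := k) (c := c) (r := r) (by linarith) x
    calc _ ≤ cF p q s M Λ * (2 ^ (p - 1) * (|u x - k| ^ (p - 1) + |u y - k| ^ (p - 1))) * |u x - k| *
          (4 ^ ((n:ℝ) + s * p) * kap n p q s t c y) := by
          gcongr
      _ = (cF p q s M Λ * 2 ^ (p - 1) * 4 ^ ((n:ℝ) + s * p)) * ((|u x - k| ^ (p - 1) * |u x - k| + |u x - k| * |u y - k| ^ (p - 1)) * kap n p q s t c y) := by ring
      _ ≤ _ := by
          rw [h3]
          gcongr
          unfold C43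
          have : 0 ≤ (2 * (cF p q s M Λ * p)) ^ p := by positivity
          linarith
  · have : tf p u k c r x = 0 := by
      rw [tf, cut_zero hr (by linarith), Real.zero_rpow (by linarith)]; simp
    rw [this]; simp; positivity

lemma cacc_pt (hp : 2 ≤ p) (hpq : p ≤ q) (hsp : 0 ≤ s * p) (htq0 : 0 ≤ t * q) (htq : t * q ≤ s * p)
    (ha0 : ∀ z, 0 ≤ a z) (haM : ∀ z, a z ≤ M) (hb : ∀ x, |u x| ≤ Λ) (hr : 0 < r) (hr1 : r ≤ 1)
    (z : En n × En n) :
    1 / 2 * Xc n p s u c r z ≤ formIntegrand n p q s t a u (tf p u k c r) z +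
      C43 n p q s M Λ * (Y0 n p s u k c r z + Y1 n p q s t u k c r z + Y1 n p q s t u k c r z.swap) := by
  have hM : 0 ≤ M := (ha0 0).trans (haM 0)
  have hΛ : 0 ≤ Λ := (abs_nonneg _).trans (hb 0)
  have hcF := cF_one (p := p) (q := q) (s := s) hM hΛ
  have hp0 : 0 < p := by linarith
  have hC : 0 ≤ C43 n p q s M Λ := by unfold C43; positivity
  have n0 := Y0_nonneg (p := p) (s := s) u k c r z
  have n1 := Y1_nonneg (p := p) (q := q) (s := s) (t := t) u k c r z
  have n2 := Y1_nonneg (p := p) (q := q) (s := s) (t := t) u k c r z.swap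
  have hfa := form_abs (t := t) hpq hsp ha0 haM hb (tf p u k c r) z
  have hna := neg_abs_le (formIntegrand n p q s t a u (tf p u k c r) z)
  by_cases h1 : z.1 ∈ ball c (2 * r) <;> by_cases h2 : z.2 ∈ ball c (2 * r)
  · have hS : z ∈ ball c (2 * r) ×ˢ ball c (2 * r) := ⟨h1, h2⟩
    by_cases hd : u z.1 = u z.2
    · rw [form_zero _ _ _ _ hd, Xc, indicator_of_mem hS, hd, sub_self, abs_zero, Real.zero_rpow hp0.ne']
      simp; positivity
    have hD : 0 < |u z.1 - u z.2| := abs_pos.2 (sub_ne_zero.2 hd)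
    have hK : 0 < ‖z.1 - z.2‖ := by
      rw [norm_pos_iff, sub_ne_zero]; rintro h; exact hd (by rw [h])
    have hK4 : ‖z.1 - z.2‖ ≤ 4 := by
      rw [mem_ball, dist_eq_norm] at h1 h2
      have := norm_sub_le (z.1 - c) (z.2 - c)
      rw [sub_sub_sub_cancel_right] at this; linarith
    have hDΛ : |u z.1 - u z.2| ≤ 2 * Λ := (abs_sub _ _).trans (by linarith [hb z.1, hb z.2])
    rw [form_m _ _ _ _ hK]
    set m := |u z.1 - u z.2| ^ (p - 2) + a z * |u z.1 - u z.2| ^ (q - 2) * ‖z.1 - z.2‖ ^ (s * p - t * q) with hm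
    have hm1 : |u z.1 - u z.2| ^ (p - 2) ≤ m := by
      have : 0 ≤ a z * |u z.1 - u z.2| ^ (q - 2) * ‖z.1 - z.2‖ ^ (s * p - t * q) := by
        have := ha0 z; positivity
      linarith
    have hm2 : m ≤ cF p q s M Λ * |u z.1 - u z.2| ^ (p - 2) := by
      have : a z * |u z.1 - u z.2| ^ (q - 2) * ‖z.1 - z.2‖ ^ (s * p - t * q) ≤
          M * ((2 * Λ) ^ (q - p) * |u z.1 - u z.2| ^ (p - 2)) * 4 ^ (s * p) := by
        gcongr
        · exact haM z
        · exact Dq_le hD hDΛ hpq 2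
        · calc ‖z.1 - z.2‖ ^ (s * p - t * q) ≤ 4 ^ (s * p - t * q) :=
                Real.rpow_le_rpow hK.le hK4 (by linarith)
            _ ≤ 4 ^ (s * p) := Real.rpow_le_rpow_of_exponent_le (by norm_num) (by linarith)
      rw [hm]; unfold cF
      linarith
    have hd' : u z.1 - k ≠ u z.2 - k := fun h => hd (by linarith)
    have key : 1 / 2 * (|u z.1 - u z.2| ^ p * (max (cut c r z.1) (cut c r z.2)) ^ p) ≤
        m * (u z.1 - u z.2) * (tf p u k c r z.1 - tf p u k c r z.2) +
          (2 * (cF p q s M Λ * p)) ^ p * ((|u z.1 - k| ^ p + |u z.2 - k| ^ p) * |cut c r z.1 - cut c r z.2| ^ p) := by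
      have hA : 0 ≤ (2 * (cF p q s M Λ * p)) ^ p * (|u z.1 - k| ^ p * |cut c r z.1 - cut c r z.2| ^ p) := by positivity
      have hB : 0 ≤ (2 * (cF p q s M Λ * p)) ^ p * (|u z.2 - k| ^ p * |cut c r z.1 - cut c r z.2| ^ p) := by positivity
      rcases le_total (cut c r z.2) (cut c r z.1) with ho | ho
      · rw [max_eq_left ho]
        have := cacc_alg (m := m) (v1 := u z.1 - k) (v2 := u z.2 - k) hp hcF (cut_nonneg c r z.2) ho hd'
          (by rwa [sub_sub_sub_cancel_right]) (by rwa [sub_sub_sub_cancel_right])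
        rw [sub_sub_sub_cancel_right] at this
        unfold tf
        linarith
      · rw [max_eq_right ho]
        have := cacc_alg (m := m) (v1 := u z.2 - k) (v2 := u z.1 - k) hp hcF (cut_nonneg c r z.1) ho hd'.symm
          (by rwa [sub_sub_sub_cancel_right, abs_sub_comm]) (by rwa [sub_sub_sub_cancel_right, abs_sub_comm (u z.2)])
        rw [sub_sub_sub_cancel_right, abs_sub_comm (u z.2), abs_sub_comm (cut c r z.2)] at this
        unfold tf
        linarith
    have hKn : 0 ≤ ‖z.1 - z.2‖ ^ (-((n:ℝ) + s * p)) := by positivity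
    have key2 := mul_le_mul_of_nonneg_right key hKn
    rw [Xc, indicator_of_mem hS]
    have hY : (2 * (cF p q s M Λ * p)) ^ p * ((|u z.1 - k| ^ p + |u z.2 - k| ^ p) * |cut c r z.1 - cut c r z.2| ^ p) * ‖z.1 - z.2‖ ^ (-((n:ℝ) + s * p)) ≤
        C43 n p q s M Λ * Y0 n p s u k c r z := by
      rw [Y0, indicator_of_mem hS]
      have : (2 * (cF p q s M Λ * p)) ^ p ≤ C43 n p q s M Λ := by
        unfold C43
        have : 0 ≤ cF p q s M Λ * 2 ^ (p - 1) * 4 ^ ((n:ℝ) + s * p) := by positivity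
        linarith
      calc _ = (2 * (cF p q s M Λ * p)) ^ p * ((|u z.1 - k| ^ p + |u z.2 - k| ^ p) * |cut c r z.1 - cut c r z.2| ^ p * ‖z.1 - z.2‖ ^ (-((n:ℝ) + s * p))) := by ring
        _ ≤ _ := by gcongr
    have h3 : 0 ≤ C43 n p q s M Λ * (Y1 n p q s t u k c r z + Y1 n p q s t u k c r z.swap) := by positivity
    linarith
  · have hX : Xc n p s u c r z = 0 := by rw [Xc, indicator_of_notMem (fun h => h2 h.2)]
    rw [tf_zero hp0 hr h2, sub_zero] at hfa
    have := mixed_bd (q := q) (M := M) (Λ := Λ) (u := u) (k := k) (x := z.1) hp hM hΛ hsp htq0 htq hr h2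
    have hY : Y1 n p q s t u k c r z = (|u z.1 - k| ^ p + |u z.1 - k| * |u z.2 - k| ^ (p - 1)) * kap n p q s t c z.2 := by
      rw [Y1, indicator_of_mem (show z ∈ ball c (2 * r) ×ˢ (ball c (2 * r))ᶜ from ⟨h1, h2⟩)]
    rw [← hY] at this
    have h3 : 0 ≤ C43 n p q s M Λ * (Y0 n p s u k c r z + Y1 n p q s t u k c r z.swap) := by positivity
    rw [hX]; linarith
  · have hX : Xc n p s u c r z = 0 := by rw [Xc, indicator_of_notMem (fun h => h1 h.1)]
    rw [tf_zero hp0 hr h1, zero_sub, abs_neg] at hfa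
    have := mixed_bd (q := q) (M := M) (Λ := Λ) (u := u) (k := k) (x := z.2) hp hM hΛ hsp htq0 htq hr h1
    have hY : Y1 n p q s t u k c r z.swap = (|u z.2 - k| ^ p + |u z.2 - k| * |u z.1 - k| ^ (p - 1)) * kap n p q s t c z.1 := by
      rw [Y1, indicator_of_mem (show z.swap ∈ ball c (2 * r) ×ˢ (ball c (2 * r))ᶜ from ⟨h2, h1⟩)]; rfl
    rw [← hY, norm_sub_rev z.2, abs_sub_comm (u z.2)] at this
    have h3 : 0 ≤ C43 n p q s M Λ * (Y0 n p s u k c r z + Y1 n p q s t u k c r z) := by positivity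
    rw [hX]; linarith
  · have hX : Xc n p s u c r z = 0 := by rw [Xc, indicator_of_notMem (fun h => h1 h.1)]
    rw [tf_zero hp0 hr h1, tf_zero hp0 hr h2, sub_zero, abs_zero] at hfa
    have h3 : 0 ≤ C43 n p q s M Λ * (Y0 n p s u k c r z + Y1 n p q s t u k c r z + Y1 n p q s t u k c r z.swap) := by positivity
    rw [hX]; simp only [mul_zero, zero_mul] at hfa ⊢; linarith

def C45 (n : ℕ) (p s : ℝ) : ℝ := 2 ^ p * (1 + p ^ p * 2 ^ p) + 4 ^ ((n:ℝ) + s * p)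

lemma tf_diff {P : ℝ} (hP : 1 ≤ P) (hPp : P ≤ p) (x y : En n) :
    |tf P u k c r x - tf P u k c r y| ≤ |u x - u y| * max (cut c r x) (cut c r y) +
      p * ((|u x - k| + |u y - k|) * |cut c r x - cut c r y|) := by
  have main : ∀ x y : En n, cut c r y ≤ cut c r x → |tf P u k c r x - tf P u k c r y| ≤ |u x - u y| * cut c r x +
      p * (|u y - k| * |cut c r x - cut c r y|) := by
    intro x y h
    have e : tf P u k c r x - tf P u k c r y = (u x - u y) * cut c r x ^ P + (u y - k) * (cut c r x ^ P - cut c r y ^ P) := by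
      unfold tf; ring
    have h0 := cut_nonneg c r x
    have h1 := cut_le_one c r x
    have hx1 : cut c r x ^ P ≤ cut c r x := by
      calc cut c r x ^ P ≤ cut c r x ^ (1:ℝ) := Real.rpow_le_rpow_of_exponent_ge' h0 h1 (by norm_num) hP
        _ = _ := Real.rpow_one _
    have hd0 : 0 ≤ cut c r x ^ P - cut c r y ^ P := sub_nonneg.2 (Real.rpow_le_rpow (cut_nonneg _ _ _) h (by linarith))
    have hd : cut c r x ^ P - cut c r y ^ P ≤ p * (cut c r x - cut c r y) := by
      refine (pow_sub_pow_le hP (cut_nonneg _ _ _) h).trans ?_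
      have : cut c r x ^ (P - 1) ≤ 1 := Real.rpow_le_one h0 h1 (by linarith)
      have h3 : 0 ≤ cut c r x - cut c r y := by linarith
      have : P * cut c r x ^ (P - 1) ≤ p * 1 := mul_le_mul hPp this (by positivity) (by linarith)
      nlinarith
    rw [e]
    refine (abs_add_le _ _).trans ?_
    rw [abs_mul, abs_mul, abs_of_nonneg (Real.rpow_nonneg h0 _), abs_of_nonneg hd0, abs_of_nonneg (by linarith : 0 ≤ cut c r x - cut c r y)]
    have := mul_le_mul_of_nonneg_left hd (abs_nonneg (u y - k))
    have := mul_le_mul_of_nonneg_left hx1 (abs_nonneg (u x - u y))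
    linarith
  have hp0 : 0 ≤ p := by linarith
  have hA : 0 ≤ p * (|u x - k| * |cut c r x - cut c r y|) := by positivity
  have hB : 0 ≤ p * (|u y - k| * |cut c r x - cut c r y|) := by positivity
  rcases le_total (cut c r y) (cut c r x) with h | h
  · rw [max_eq_left h]
    have := main x y h
    linarith
  · rw [max_eq_right h]
    have := main y x h
    rw [abs_sub_comm, abs_sub_comm (u y), abs_sub_comm (cut c r y)] at this
    linarith

lemma pow_add_le' {a b P : ℝ} (hP : 0 ≤ P) (ha : 0 ≤ a) (hb : 0 ≤ b) : (a + b) ^ P ≤ 2 ^ P * (a ^ P + b ^ P) := by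
  have := pow_sub_le (a := a) (b := -b) hP
  rwa [abs_neg, abs_of_nonneg ha, abs_of_nonneg hb, sub_neg_eq_add, abs_of_nonneg (by linarith)] at this

lemma tf_energy {P : ℝ} (hP : 1 ≤ P) (hPp : P ≤ p) (hsp : 0 ≤ s * p) (htq0 : 0 ≤ t * q)
    (htq : t * q ≤ s * p) (hr : 0 < r) (z : En n × En n) :
    |tf P u k c r z.1 - tf P u k c r z.2| ^ p * ‖z.1 - z.2‖ ^ (-((n:ℝ) + s * p)) ≤
      C45 n p s * (Xc n p s u c r z + (Y0 n p s u k c r z + Y1 n p q s t u k c r z + Y1 n p q s t u k c r z.swap)) := by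
  have hp0 : 0 < p := by linarith
  have hC : 0 ≤ C45 n p s := by unfold C45; positivity
  have nx := Xc_nonneg (p := p) (s := s) u c r z
  have n0 := Y0_nonneg (p := p) (s := s) u k c r z
  have n1 := Y1_nonneg (p := p) (q := q) (s := s) (t := t) u k c r z
  have n2 := Y1_nonneg (p := p) (q := q) (s := s) (t := t) u k c r z.swap
  have hKn : 0 ≤ ‖z.1 - z.2‖ ^ (-((n:ℝ) + s * p)) := by positivity
  have mix : ∀ x y : En n, x ∈ ball c (2 * r) → y ∉ ball c (2 * r) → |tf P u k c r x| ^ p * ‖x - y‖ ^ (-((n:ℝ) + s * p)) ≤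
      C45 n p s * Y1 n p q s t u k c r (x, y) := by
    intro x y hx hy
    rw [Y1, indicator_of_mem (show (x, y) ∈ ball c (2 * r) ×ˢ (ball c (2 * r))ᶜ from ⟨hx, hy⟩)]
    have hk := kap_nonneg (n := n) (p := p) (q := q) (s := s) (t := t) c y
    by_cases hxx : ‖x - c‖ < 3 / 2 * r
    · have h1 := ker_mixed (n := n) hsp htq0 htq hr hxx hy
      have h2 : 0 ≤ ‖x - y‖ ^ (-((n:ℝ) + t * q)) := by positivity
      have h5 : 0 ≤ 2 ^ p * (1 + p ^ p * 2 ^ p) := by positivity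
      have htf := tf_abs (p := P) (u := u) (k := k) (c := c) (r := r) (by linarith) x
      calc |tf P u k c r x| ^ p * ‖x - y‖ ^ (-((n:ℝ) + s * p)) ≤ |u x - k| ^ p * (4 ^ ((n:ℝ) + s * p) * kap n p q s t c y) := by
            gcongr
            linarith
        _ = 4 ^ ((n:ℝ) + s * p) * (|u x - k| ^ p * kap n p q s t c y) := by ring
        _ ≤ C45 n p s * ((|u x - k| ^ p + |u x - k| * |u y - k| ^ (p - 1)) * kap n p q s t c y) := by
            gcongr
            · unfold C45; linarith
            · have : 0 ≤ |u x - k| * |u y - k| ^ (p - 1) := by positivity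
              linarith
    · have : tf P u k c r x = 0 := by
        rw [tf, cut_zero hr (by linarith), Real.zero_rpow (by linarith)]; simp
      rw [this, abs_zero, Real.zero_rpow hp0.ne', zero_mul]
      positivity
  by_cases h1 : z.1 ∈ ball c (2 * r) <;> by_cases h2 : z.2 ∈ ball c (2 * r)
  · have hS : z ∈ ball c (2 * r) ×ˢ ball c (2 * r) := ⟨h1, h2⟩
    have hmx : 0 ≤ max (cut c r z.1) (cut c r z.2) := le_max_of_le_left (cut_nonneg _ _ _)
    have : |tf P u k c r z.1 - tf P u k c r z.2| ^ p ≤ 2 ^ p * (1 + p ^ p * 2 ^ p) *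
        (|u z.1 - u z.2| ^ p * (max (cut c r z.1) (cut c r z.2)) ^ p +
          (|u z.1 - k| ^ p + |u z.2 - k| ^ p) * |cut c r z.1 - cut c r z.2| ^ p) := by
      set A := |u z.1 - u z.2| ^ p * (max (cut c r z.1) (cut c r z.2)) ^ p with hA
      set B := (|u z.1 - k| ^ p + |u z.2 - k| ^ p) * |cut c r z.1 - cut c r z.2| ^ p with hB
      have hA0 : 0 ≤ A := by positivity
      have hB0 : 0 ≤ B := by positivity
      calc _ ≤ (|u z.1 - u z.2| * max (cut c r z.1) (cut c r z.2) +
            p * ((|u z.1 - k| + |u z.2 - k|) * |cut c r z.1 - cut c r z.2|)) ^ p := by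
            gcongr; exact tf_diff hP hPp _ _
        _ ≤ 2 ^ p * ((|u z.1 - u z.2| * max (cut c r z.1) (cut c r z.2)) ^ p +
            (p * ((|u z.1 - k| + |u z.2 - k|) * |cut c r z.1 - cut c r z.2|)) ^ p) :=
            pow_add_le' hp0.le (by positivity) (by positivity)
        _ = 2 ^ p * (A + p ^ p * ((|u z.1 - k| + |u z.2 - k|) ^ p * |cut c r z.1 - cut c r z.2| ^ p)) := by
            rw [Real.mul_rpow (abs_nonneg _) hmx, Real.mul_rpow hp0.le (by positivity), Real.mul_rpow (by positivity) (abs_nonneg _)]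
        _ ≤ 2 ^ p * (A + p ^ p * ((2 ^ p * (|u z.1 - k| ^ p + |u z.2 - k| ^ p)) * |cut c r z.1 - cut c r z.2| ^ p)) := by
            have := pow_add_le' (a := |u z.1 - k|) (b := |u z.2 - k|) hp0.le (abs_nonneg _) (abs_nonneg _)
            gcongr
        _ = 2 ^ p * (A + p ^ p * 2 ^ p * B) := by rw [hB]; ring
        _ ≤ 2 ^ p * ((1 + p ^ p * 2 ^ p) * (A + B)) := by
            gcongr
            have : 0 ≤ p ^ p * 2 ^ p * A := by positivity
            linarith
        _ = _ := by ring
    have hXY : Xc n p s u c r z + Y0 n p s u k c r z = (|u z.1 - u z.2| ^ p * (max (cut c r z.1) (cut c r z.2)) ^ p +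
          (|u z.1 - k| ^ p + |u z.2 - k| ^ p) * |cut c r z.1 - cut c r z.2| ^ p) * ‖z.1 - z.2‖ ^ (-((n:ℝ) + s * p)) := by
      rw [Xc, Y0, indicator_of_mem hS, indicator_of_mem hS]; ring
    calc _ ≤ (2 ^ p * (1 + p ^ p * 2 ^ p) *
        (|u z.1 - u z.2| ^ p * (max (cut c r z.1) (cut c r z.2)) ^ p +
          (|u z.1 - k| ^ p + |u z.2 - k| ^ p) * |cut c r z.1 - cut c r z.2| ^ p)) * ‖z.1 - z.2‖ ^ (-((n:ℝ) + s * p)) := by gcongr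
      _ = (2 ^ p * (1 + p ^ p * 2 ^ p)) * (Xc n p s u c r z + Y0 n p s u k c r z) := by rw [hXY]; ring
      _ ≤ C45 n p s * (Xc n p s u c r z + Y0 n p s u k c r z) := by
          gcongr
          unfold C45
          have : (0:ℝ) ≤ 4 ^ ((n:ℝ) + s * p) := by positivity
          linarith
      _ ≤ _ := by gcongr; linarith
  · rw [tf_zero (by linarith) hr h2, sub_zero]
    refine (mix _ _ h1 h2).trans ?_
    rw [Prod.mk.eta]
    gcongr; linarith
  · rw [tf_zero (by linarith) hr h1, zero_sub, abs_neg, norm_sub_rev]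
    refine (mix _ _ h2 h1).trans ?_
    rw [show (z.2, z.1) = z.swap from rfl]
    gcongr; linarith
  · rw [tf_zero (by linarith) hr h1, tf_zero (by linarith) hr h2, sub_zero, abs_zero, Real.zero_rpow hp0.ne', zero_mul]
    positivity

end

section
variable {n : ℕ} {p q s t M Λ r : ℝ} {a : En n × En n → ℝ} {u : En n → ℝ} {c : En n} {k : ℝ}

lemma lint_swap (g : En n × En n → ℝ≥0∞) (hg : Measurable g) :
    ∫⁻ z : En n × En n, g z.swap = ∫⁻ z, g z :=
  (Measure.measurePreserving_swap (μ := (volume : Measure (En n))) (ν := (volume : Measure (En n)))).lintegral_comp hg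

/-- integral of `W(x) 1_{|x-y|<R}|x-y|^{b-n}`. -/
def gk (n : ℕ) (W : En n → ℝ≥0∞) (b R : ℝ) (z : En n × En n) : ℝ≥0∞ :=
  W z.1 * (ball (0 : En n) R).indicator (fun h => ENNReal.ofReal (‖h‖ ^ (b - n))) (z.1 - z.2)

lemma gk_meas {W : En n → ℝ≥0∞} (hW : Measurable W) (b R : ℝ) : Measurable (gk n W b R) := by
  refine (hW.comp measurable_fst).mul ?_
  have : Measurable ((ball (0 : En n) R).indicator (fun h => ENNReal.ofReal (‖h‖ ^ (b - n)))) :=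
    Measurable.indicator (measurable_norm.pow_const _).ennreal_ofReal measurableSet_ball
  exact this.comp (measurable_fst.sub measurable_snd)

lemma gk_int (hn : 0 < n) {W : En n → ℝ≥0∞} (hW : Measurable W) {b R : ℝ} (hb : 0 < b) (hR : 0 < R) :
    ∫⁻ z, gk n W b R z = (∫⁻ x, W x) * ENNReal.ofReal (n * om n * (R ^ b / b)) := by
  have hm := gk_meas hW b R
  rw [Measure.volume_eq_prod, lintegral_prod _ hm.aemeasurable, ← lintegral_mul_const _ hW]
  refine lintegral_congr fun x => ?_
  rw [← ker_in hn x hb hR, ← lintegral_indicator measurableSet_ball]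
  unfold gk
  have hm2 : Measurable fun y => (ball (0 : En n) R).indicator (fun h => ENNReal.ofReal (‖h‖ ^ (b - n))) (x - y) := by
    have : Measurable ((ball (0 : En n) R).indicator (fun h => ENNReal.ofReal (‖h‖ ^ (b - n)))) :=
      Measurable.indicator (measurable_norm.pow_const _).ennreal_ofReal measurableSet_ball
    exact this.comp (measurable_const.sub measurable_id)
  dsimp only
  rw [lintegral_const_mul _ hm2]
  congr 1
  refine lintegral_congr fun y => ?_
  by_cases h : y ∈ ball x R
  · rw [indicator_of_mem h, indicator_of_mem]
    rw [mem_ball, dist_eq_norm, norm_sub_rev] at h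
    simpa using h
  · rw [indicator_of_notMem h, indicator_of_notMem]
    rw [mem_ball, dist_eq_norm, norm_sub_rev] at h
    simpa using h

def VV (n : ℕ) (u : En n → ℝ) (k : ℝ) (c : En n) (r P : ℝ) : ℝ≥0∞ :=
  ∫⁻ x in ball c (2 * r), ENNReal.ofReal (|u x - k| ^ P)

def C46 (n : ℕ) (p s : ℝ) : ℝ := 2 * (2 ^ p * (n * om n * (4 ^ (p - s * p) / (p - s * p))))

lemma Y0_int (hn : 0 < n) (hp : 1 ≤ p) (hs1 : s < 1) (hu : Measurable u) (hr : 0 < r) :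
    ∫⁻ z, ENNReal.ofReal (Y0 n p s u k c r z) ≤ ENNReal.ofReal (C46 n p s * r ^ (-(s * p))) * VV n u k c r p := by
  set W : En n → ℝ≥0∞ := (ball c (2 * r)).indicator (fun x => ENNReal.ofReal (|u x - k| ^ p)) with hW
  have hWm : Measurable W :=
    (((hu.sub_const k).norm.pow_const _).ennreal_ofReal).indicator measurableSet_ball
  have hb : 0 < p - s * p := by nlinarith
  have hm := gk_meas hWm (p - s * p) (4 * r)
  have hV : ∫⁻ x, W x = VV n u k c r p := by rw [hW, lintegral_indicator measurableSet_ball]; rfl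
  have hpt : ∀ z, ENNReal.ofReal (Y0 n p s u k c r z) ≤
      ENNReal.ofReal ((2 / r) ^ p) * (gk n W (p - s * p) (4 * r) z + gk n W (p - s * p) (4 * r) z.swap) := by
    intro z
    by_cases hz : z ∈ ball c (2 * r) ×ˢ ball c (2 * r)
    · have h1 : z.1 - z.2 ∈ ball (0 : En n) (4 * r) := by
        have h1 := hz.1; have h2 := hz.2
        rw [mem_ball, dist_eq_norm] at h1 h2
        rw [mem_ball_zero_iff]
        have := norm_sub_le (z.1 - c) (z.2 - c)
        rw [sub_sub_sub_cancel_right] at this; linarith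
      have h2 : z.2 - z.1 ∈ ball (0 : En n) (4 * r) := by
        rw [mem_ball_zero_iff] at h1 ⊢; rwa [norm_sub_rev]
      unfold gk
      simp only [Prod.fst_swap, Prod.snd_swap]
      rw [indicator_of_mem h1, indicator_of_mem h2, hW, indicator_of_mem hz.1, indicator_of_mem hz.2,
        norm_sub_rev z.2 z.1, ← ENNReal.ofReal_mul (by positivity), ← ENNReal.ofReal_mul (by positivity),
        ← ENNReal.ofReal_add (by positivity) (by positivity), ← ENNReal.ofReal_mul (by positivity)]
      refine ENNReal.ofReal_le_ofReal ?_
      unfold Y0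
      rw [indicator_of_mem hz]
      rcases eq_or_lt_of_le (norm_nonneg (z.1 - z.2)) with h0 | h0
      · have : z.1 = z.2 := by rwa [eq_comm, norm_eq_zero, sub_eq_zero] at h0
        rw [this]; simp [Real.zero_rpow (by linarith : p ≠ 0)]; positivity
      · have h3 : |cut c r z.1 - cut c r z.2| ^ p ≤ (2 / r) ^ p * ‖z.1 - z.2‖ ^ p := by
          rw [← Real.mul_rpow (by positivity) (by positivity)]
          exact Real.rpow_le_rpow (abs_nonneg _) (cut_lip c hr _ _) (by linarith)
        have h4 : ‖z.1 - z.2‖ ^ p * ‖z.1 - z.2‖ ^ (-((n:ℝ) + s * p)) = ‖z.1 - z.2‖ ^ (p - s * p - n) := by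
          rw [← Real.rpow_add h0]; congr 1; ring
        calc _ ≤ (|u z.1 - k| ^ p + |u z.2 - k| ^ p) * ((2 / r) ^ p * ‖z.1 - z.2‖ ^ p) * ‖z.1 - z.2‖ ^ (-((n:ℝ) + s * p)) := by
              gcongr
          _ = (|u z.1 - k| ^ p + |u z.2 - k| ^ p) * (2 / r) ^ p * (‖z.1 - z.2‖ ^ p * ‖z.1 - z.2‖ ^ (-((n:ℝ) + s * p))) := by ring
          _ = _ := by rw [h4]; ring
          _ ≤ _ := le_refl _
    · unfold Y0; rw [indicator_of_notMem hz]; simp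
  calc ∫⁻ z, ENNReal.ofReal (Y0 n p s u k c r z) ≤ ∫⁻ z, ENNReal.ofReal ((2 / r) ^ p) * (gk n W (p - s * p) (4 * r) z + gk n W (p - s * p) (4 * r) z.swap) := lintegral_mono hpt
    _ = ENNReal.ofReal ((2 / r) ^ p) * (2 * (VV n u k c r p * ENNReal.ofReal (n * om n * ((4 * r) ^ (p - s * p) / (p - s * p))))) := by
      have hmm : Measurable fun z => gk n W (p - s * p) (4 * r) z + gk n W (p - s * p) (4 * r) z.swap :=
        hm.add (hm.comp measurable_swap)
      rw [lintegral_const_mul _ hmm, lintegral_add_left hm, lint_swap _ hm,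
        gk_int hn hWm hb (by positivity), hV, two_mul]
    _ = _ := by
      have h2 : (2 : ℝ≥0∞) = ENNReal.ofReal 2 := by simp
      have hom := om_pos n
      rw [h2]
      rw [show ∀ A B C D : ℝ≥0∞, A * (B * (C * D)) = (A * (B * D)) * C by intros; ring,
        ← ENNReal.ofReal_mul (by positivity), ← ENNReal.ofReal_mul (by positivity)]
      congr 2
      unfold C46
      rw [Real.div_rpow (by norm_num) hr.le, Real.mul_rpow (by norm_num) hr.le]
      rw [show -(s * p) = (p - s * p) - p by ring, Real.rpow_sub hr (p - s * p) p]
      ring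

def TT (n : ℕ) (p q s t : ℝ) (u : En n → ℝ) (k : ℝ) (c : En n) (r : ℝ) : ℝ≥0∞ :=
  ∫⁻ y in (ball c (2 * r))ᶜ, ENNReal.ofReal (|u y - k| ^ (p - 1) * kap n p q s t c y)

def C47 (n : ℕ) (p q s t : ℝ) : ℝ := n * om n * (1 / (s * p) + 1 / (t * q))

lemma kap_int (hn : 0 < n) (hsp : 0 < s * p) (htq0 : 0 < t * q) (htq : t * q ≤ s * p) (hr : 0 < r) (hr1 : r ≤ 1) :
    ∫⁻ y in (ball c (2 * r))ᶜ, ENNReal.ofReal (kap n p q s t c y) ≤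
      ENNReal.ofReal (C47 n p q s t * r ^ (-(s * p))) := by
  have hom := om_pos n
  have e : ∀ b : ℝ, 0 < b → b ≤ s * p → ∫⁻ y in (ball c (2 * r))ᶜ, ENNReal.ofReal (‖y - c‖ ^ (-((n:ℝ) + b))) ≤
      ENNReal.ofReal (n * om n * (1 / b) * r ^ (-(s * p))) := by
    intro b hb hb2
    have := ker_out hn c hb (R := 2 * r) (by positivity)
    simp_rw [norm_sub_rev c] at this
    rw [this]
    refine ENNReal.ofReal_le_ofReal ?_
    have h1 : (2 * r) ^ (-b) ≤ r ^ (-(s * p)) :=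
      calc (2 * r) ^ (-b) ≤ r ^ (-b) := Real.rpow_le_rpow_of_nonpos hr (by linarith) (by linarith)
        _ ≤ r ^ (-(s * p)) := Real.rpow_le_rpow_of_exponent_ge hr hr1 (by linarith)
    calc _ ≤ n * om n * (r ^ (-(s * p)) / b) := by gcongr
      _ = _ := by ring
  have hm : Measurable fun y : En n => ENNReal.ofReal (‖y - c‖ ^ (-((n:ℝ) + s * p))) :=
    ((measurable_id.sub_const c).norm.pow_const _).ennreal_ofReal
  calc _ = ∫⁻ y in (ball c (2 * r))ᶜ, (ENNReal.ofReal (‖y - c‖ ^ (-((n:ℝ) + s * p))) + ENNReal.ofReal (‖y - c‖ ^ (-((n:ℝ) + t * q)))) := by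
        refine lintegral_congr fun y => ?_
        unfold kap
        rw [ENNReal.ofReal_add (by positivity) (by positivity)]
    _ ≤ _ := by
        rw [lintegral_add_left hm]
        refine (add_le_add (e _ hsp le_rfl) (e _ htq0 htq)).trans ?_
        rw [← ENNReal.ofReal_add (by positivity) (by positivity)]
        refine ENNReal.ofReal_le_ofReal (le_of_eq ?_)
        unfold C47; ring

lemma Y1_int (hn : 0 < n) (hp : 1 ≤ p) (hsp : 0 < s * p) (htq0 : 0 < t * q) (htq : t * q ≤ s * p)
    (hu : Measurable u) (hr : 0 < r) (hr1 : r ≤ 1) :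
    ∫⁻ z, ENNReal.ofReal (Y1 n p q s t u k c r z) ≤
      ENNReal.ofReal (C47 n p q s t * r ^ (-(s * p))) * VV n u k c r p + VV n u k c r 1 * TT n p q s t u k c r := by
  have hm := (Y1_meas (p := p) (q := q) (s := s) (t := t) hu k c r).ennreal_ofReal
  have hkm := kap_meas (n := n) (p := p) (q := q) (s := s) (t := t) c
  have m1 : Measurable fun x => ENNReal.ofReal (|u x - k| ^ p) := ((hu.sub_const k).norm.pow_const _).ennreal_ofReal
  have m2 : Measurable fun x => ENNReal.ofReal (|u x - k| ^ (1:ℝ)) := ((hu.sub_const k).norm.pow_const _).ennreal_ofReal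
  rw [Measure.volume_eq_prod, lintegral_prod _ hm.aemeasurable]
  have hx : ∀ x, ∫⁻ y, ENNReal.ofReal (Y1 n p q s t u k c r (x, y)) ≤
      (ball c (2 * r)).indicator (fun x => ENNReal.ofReal (|u x - k| ^ p) * ENNReal.ofReal (C47 n p q s t * r ^ (-(s * p)))
        + ENNReal.ofReal (|u x - k| ^ (1:ℝ)) * TT n p q s t u k c r) x := by
    intro x
    by_cases hxb : x ∈ ball c (2 * r)
    · rw [indicator_of_mem hxb]
      have : ∀ y, ENNReal.ofReal (Y1 n p q s t u k c r (x, y)) = ((ball c (2 * r))ᶜ).indicator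
          (fun y => ENNReal.ofReal (|u x - k| ^ p) * ENNReal.ofReal (kap n p q s t c y) +
            ENNReal.ofReal (|u x - k| ^ (1:ℝ)) * ENNReal.ofReal (|u y - k| ^ (p - 1) * kap n p q s t c y)) y := by
        intro y
        have hk := kap_nonneg (n := n) (p := p) (q := q) (s := s) (t := t) c y
        unfold Y1
        by_cases hy : y ∈ (ball c (2 * r))ᶜ
        · rw [indicator_of_mem (show (x, y) ∈ ball c (2 * r) ×ˢ (ball c (2 * r))ᶜ from ⟨hxb, hy⟩), indicator_of_mem hy,
            ← ENNReal.ofReal_mul (by positivity), ← ENNReal.ofReal_mul (by positivity),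
            ← ENNReal.ofReal_add (by positivity) (by positivity)]
          congr 1; rw [Real.rpow_one]; ring
        · rw [indicator_of_notMem (show (x, y) ∉ ball c (2 * r) ×ˢ (ball c (2 * r))ᶜ from fun h => hy h.2), indicator_of_notMem hy]
          simp
      simp_rw [this]
      have mm1 : Measurable fun y => ENNReal.ofReal (|u x - k| ^ p) * ENNReal.ofReal (kap n p q s t c y) :=
        hkm.ennreal_ofReal.const_mul _
      have mm2 : Measurable fun y => ENNReal.ofReal (|u y - k| ^ (p - 1) * kap n p q s t c y) :=
        (((hu.sub_const k).norm.pow_const _).mul hkm).ennreal_ofReal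
      rw [lintegral_indicator measurableSet_ball.compl, lintegral_add_left mm1,
        lintegral_const_mul _ hkm.ennreal_ofReal, lintegral_const_mul _ mm2]
      gcongr
      · exact kap_int hn hsp htq0 htq hr hr1
      · exact le_refl _
    · rw [indicator_of_notMem hxb]
      have : ∀ y, ENNReal.ofReal (Y1 n p q s t u k c r (x, y)) = 0 := by
        intro y
        unfold Y1
        rw [indicator_of_notMem (show (x, y) ∉ ball c (2 * r) ×ˢ (ball c (2 * r))ᶜ from fun h => hxb h.1)]; simp
      simp_rw [this]; simp
  refine (lintegral_mono hx).trans ?_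
  rw [lintegral_indicator measurableSet_ball, lintegral_add_left (m1.mul_const _),
    lintegral_mul_const _ m1, lintegral_mul_const _ m2, mul_comm (ENNReal.ofReal (C47 n p q s t * r ^ (-(s * p))))]
  exact le_refl _

end

lemma mul_ofR {a b : ℝ} {A B : ℝ≥0∞} (ha : 0 ≤ a) (hA : A ≤ ENNReal.ofReal a) (hB : B ≤ ENNReal.ofReal b) :
    A * B ≤ ENNReal.ofReal (a * b) := by
  rw [ENNReal.ofReal_mul ha]; exact mul_le_mul' hA hB

lemma add_ofR {a b : ℝ} {A B : ℝ≥0∞} (ha : 0 ≤ a) (hb : 0 ≤ b) (hA : A ≤ ENNReal.ofReal a) (hB : B ≤ ENNReal.ofReal b) :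
    A + B ≤ ENNReal.ofReal (a + b) := by
  rw [ENNReal.ofReal_add ha hb]; exact add_le_add hA hB

lemma le_ofR {a b : ℝ} {A : ℝ≥0∞} (hA : A ≤ ENNReal.ofReal a) (hab : a ≤ b) : A ≤ ENNReal.ofReal b :=
  hA.trans (ENNReal.ofReal_le_ofReal hab)

lemma rpow_ofR {a P : ℝ} {A : ℝ≥0∞} (ha : 0 ≤ a) (hP : 0 ≤ P) (hA : A ≤ ENNReal.ofReal a) :
    A ^ P ≤ ENNReal.ofReal (a ^ P) := by
  rw [← ENNReal.ofReal_rpow_of_nonneg ha hP]; exact ENNReal.rpow_le_rpow hA hP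

/-- Standing hypotheses. -/
structure Dat (n : ℕ) (p q s t M Λ : ℝ) (a : En n × En n → ℝ) (u f : En n → ℝ) (δ : ℝ) : Prop where
  hn : 2 ≤ n
  hp : 2 ≤ p
  hpq : p ≤ q
  hs0 : 0 < s
  hs1 : s < 1
  ht0 : 0 < t
  htq : t * q ≤ s * p
  htq2 : s * (p - 1) < t * q
  hspn : s * p < n
  hM : 1 ≤ M
  hΛ : 1 ≤ Λ
  ha : Measurable a
  ha0 : ∀ z, 0 ≤ a z
  haM : ∀ z, a z ≤ M
  hW : MemWsp n s p u
  hb : ∀ x, |u x| ≤ Λ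
  hee : ee n p s u univ < ⊤
  hf : Measurable f
  hδ : pStar n p s < δ
  hfδ : ∫⁻ x, ENNReal.ofReal (|f x| ^ δ) < ⊤
  hw : IsBoundedWeakSolution n p q s t a u f

lemma pStar_eq {n : ℕ} {p s : ℝ} (hp : 2 ≤ p) (hn : 2 ≤ n) (hs : 0 < s) :
    pStar n p s = n * p / (n * (p - 1) + s * p) := by
  have h1 : 0 < p - 1 := by linarith
  have h2 : (0:ℝ) < n := by exact_mod_cast (by omega : 0 < n)
  have : 0 < n * (p - 1) + s * p := by positivity
  unfold pStar pC
  field_simp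

lemma pStar_one {n : ℕ} {p s : ℝ} (hp : 2 ≤ p) (hn : 2 ≤ n) (hs : 0 < s) (hspn : s * p < n) :
    1 < pStar n p s := by
  have h1 : 0 < p - 1 := by linarith
  have h2 : (0:ℝ) < n := by exact_mod_cast (by omega : 0 < n)
  rw [pStar_eq hp hn hs, one_lt_div (by positivity)]
  linarith

lemma absorb {Z A B Y p : ℝ} (hp : 2 ≤ p) (hZ : 0 ≤ Z) (hA : 0 ≤ A) (hB : 0 ≤ B) (hY : 0 ≤ Y)
    (h : Z ≤ A * Z ^ (1 / p) + B * Y) : Z ≤ 2 * B * Y + (2 * A) ^ pC p := by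
  have h1 : 0 < p - 1 := by linarith
  have : 0 ≤ (2 * A) ^ pC p := by positivity
  rcases le_total (A * Z ^ (1 / p)) (Z / 2) with h2 | h2
  · nlinarith
  · have h3 : Z ≤ (2 * A) ^ pC p := by
      rcases eq_or_lt_of_le hZ with h0 | h0
      · rw [← h0]; exact this
      have h4 : Z ^ ((p - 1) / p) ≤ 2 * A := by
        have e : Z = Z ^ ((p - 1) / p) * Z ^ (1 / p) := by
          rw [← Real.rpow_add h0, ← add_div]; simp [div_self (by linarith : p ≠ 0)]
        have h5 : Z ^ ((p - 1) / p) * Z ^ (1 / p) ≤ 2 * A * Z ^ (1 / p) := by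
          rw [← e]; linarith
        exact le_of_mul_le_mul_right h5 (by positivity)
      calc Z = (Z ^ ((p - 1) / p)) ^ pC p := by
            rw [← Real.rpow_mul hZ]; unfold pC
            rw [div_mul_div_cancel₀ (by linarith), div_self (by linarith), Real.rpow_one]
        _ ≤ _ := Real.rpow_le_rpow (by positivity) h4 (by unfold pC; positivity)
    nlinarith [mul_nonneg hB hY]

section
variable {n : ℕ} {p q s t M Λ r δ : ℝ} {a : En n × En n → ℝ} {u f : En n → ℝ} {c : En n} {k : ℝ}

lemma tf_meas (P : ℝ) (hu : Measurable u) (c : En n) (r k : ℝ) : Measurable (tf P u k c r) :=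
  (hu.sub_const k).mul ((cut_meas c r).pow_const P)

lemma Xc_le_ee (hp : 0 ≤ p) : ∫⁻ z, ENNReal.ofReal (Xc n p s u c r z) ≤ ee n p s u univ := by
  unfold ee
  rw [Measure.restrict_univ]
  refine lintegral_mono fun z => ENNReal.ofReal_le_ofReal ?_
  unfold Xc
  refine (indicator_le_self' (fun z _ => ?_) z).trans ?_
  · have : 0 ≤ max (cut c r z.1) (cut c r z.2) := le_max_of_le_left (cut_nonneg _ _ _)
    positivity
  · have h0 : 0 ≤ max (cut c r z.1) (cut c r z.2) := le_max_of_le_left (cut_nonneg _ _ _)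
    have h1 : (max (cut c r z.1) (cut c r z.2)) ^ p ≤ 1 :=
      Real.rpow_le_one h0 (max_le (cut_le_one _ _ _) (cut_le_one _ _ _)) hp
    calc _ ≤ |u z.1 - u z.2| ^ p * 1 * ‖z.1 - z.2‖ ^ (-((n:ℝ) + s * p)) := by gcongr
      _ = _ := by rw [mul_one]

lemma eB_le_Xc (hr : 0 < r) : eB n p s u c r ≤ ∫⁻ z, ENNReal.ofReal (Xc n p s u c r z) := by
  unfold eB ee
  rw [← lintegral_indicator (measurableSet_ball.prod measurableSet_ball)]
  refine lintegral_mono fun z => ?_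
  by_cases hz : z ∈ ball c r ×ˢ ball c r
  · rw [indicator_of_mem hz]
    have hs : ball c r ⊆ ball c (2 * r) := ball_subset_ball (by linarith)
    unfold Xc
    rw [indicator_of_mem (show z ∈ ball c (2 * r) ×ˢ ball c (2 * r) from ⟨hs hz.1, hs hz.2⟩),
      cut_one hr hz.1, cut_one hr hz.2, max_self, Real.one_rpow, mul_one]
  · rw [indicator_of_notMem hz]; exact zero_le

def YY (n : ℕ) (p q s t : ℝ) (u : En n → ℝ) (k : ℝ) (c : En n) (r : ℝ) (z : En n × En n) : ℝ :=
  Y0 n p s u k c r z + Y1 n p q s t u k c r z + Y1 n p q s t u k c r z.swap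

lemma YY_meas (hu : Measurable u) : Measurable (YY n p q s t u k c r) :=
  ((Y0_meas hu k c r).add (Y1_meas hu k c r)).add ((Y1_meas hu k c r).comp measurable_swap)

lemma YY_nonneg (z) : 0 ≤ YY n p q s t u k c r z :=
  add_nonneg (add_nonneg (Y0_nonneg _ _ _ _ _) (Y1_nonneg _ _ _ _ _)) (Y1_nonneg _ _ _ _ _)

def C49 (n : ℕ) (p q s t : ℝ) : ℝ := C46 n p s + 2 * C47 n p q s t + 2

lemma YY_int (hn : 0 < n) (hp : 1 ≤ p) (hs0 : 0 < s) (hs1 : s < 1) (htq0 : 0 < t * q) (htq : t * q ≤ s * p)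
    (hu : Measurable u) (hr : 0 < r) (hr1 : r ≤ 1) {Vr Nr Tr : ℝ} (hV0 : 0 ≤ Vr) (hN0 : 0 ≤ Nr) (hT0 : 0 ≤ Tr)
    (hV : VV n u k c r p ≤ ENNReal.ofReal Vr) (hN : VV n u k c r 1 ≤ ENNReal.ofReal Nr)
    (hT : TT n p q s t u k c r ≤ ENNReal.ofReal Tr) :
    ∫⁻ z, ENNReal.ofReal (YY n p q s t u k c r z) ≤
      ENNReal.ofReal (C49 n p q s t * (r ^ (-(s * p)) * Vr + Nr * Tr)) := by
  have hsp : 0 < s * p := by positivity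
  have hom := om_pos n
  have h46 : 0 ≤ C46 n p s := by
    have : 0 < p - s * p := by nlinarith
    unfold C46; positivity
  have h47 : 0 ≤ C47 n p q s t := by unfold C47; positivity
  have m0 := (Y0_meas (p := p) (s := s) hu k c r).ennreal_ofReal
  have m1 := (Y1_meas (p := p) (q := q) (s := s) (t := t) hu k c r).ennreal_ofReal
  have e1 : ∫⁻ z, ENNReal.ofReal (Y1 n p q s t u k c r z) ≤
      ENNReal.ofReal (C47 n p q s t * r ^ (-(s * p)) * Vr + Nr * Tr) := by
    refine (Y1_int hn hp hsp htq0 htq hu hr hr1).trans ?_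
    exact add_ofR (by positivity) (by positivity) (mul_ofR (by positivity) le_rfl hV) (mul_ofR hN0 hN hT)
  have e0 : ∫⁻ z, ENNReal.ofReal (Y0 n p s u k c r z) ≤
      ENNReal.ofReal (C46 n p s * r ^ (-(s * p)) * Vr) := by
    refine (Y0_int hn hp hs1 hu hr).trans ?_
    exact mul_ofR (by positivity) le_rfl hV
  calc ∫⁻ z, ENNReal.ofReal (YY n p q s t u k c r z) = ∫⁻ z, (ENNReal.ofReal (Y0 n p s u k c r z) +
        ENNReal.ofReal (Y1 n p q s t u k c r z) + ENNReal.ofReal (Y1 n p q s t u k c r z.swap)) := by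
        refine lintegral_congr fun z => ?_
        unfold YY
        rw [ENNReal.ofReal_add (add_nonneg (Y0_nonneg _ _ _ _ _) (Y1_nonneg _ _ _ _ _)) (Y1_nonneg _ _ _ _ _),
          ENNReal.ofReal_add (Y0_nonneg _ _ _ _ _) (Y1_nonneg _ _ _ _ _)]
    _ = (∫⁻ z, ENNReal.ofReal (Y0 n p s u k c r z)) + (∫⁻ z, ENNReal.ofReal (Y1 n p q s t u k c r z))
        + (∫⁻ z, ENNReal.ofReal (Y1 n p q s t u k c r z)) := by
        have mm : Measurable fun z => ENNReal.ofReal (Y0 n p s u k c r z) + ENNReal.ofReal (Y1 n p q s t u k c r z) := m0.add m1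
        rw [lintegral_add_left mm, lintegral_add_left m0, lint_swap (fun z => ENNReal.ofReal (Y1 n p q s t u k c r z)) m1]
    _ ≤ ENNReal.ofReal (C46 n p s * r ^ (-(s * p)) * Vr + (C47 n p q s t * r ^ (-(s * p)) * Vr + Nr * Tr)
        + (C47 n p q s t * r ^ (-(s * p)) * Vr + Nr * Tr)) :=
        add_ofR (by positivity) (by positivity) (add_ofR (by positivity) (by positivity) e0 e1) e1
    _ ≤ _ := by
        refine ENNReal.ofReal_le_ofReal ?_
        unfold C49
        have : 0 ≤ r ^ (-(s * p)) * Vr := by positivity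
        have : 0 ≤ Nr * Tr := by positivity
        nlinarith [mul_nonneg h46 this, mul_nonneg h47 this]

lemma tf_ee {P : ℝ} (hP : 1 ≤ P) (hPp : P ≤ p) (hsp : 0 ≤ s * p) (htq0 : 0 ≤ t * q)
    (htq : t * q ≤ s * p) (hr : 0 < r) (hu : Measurable u) :
    ee n p s (tf P u k c r) univ ≤ ENNReal.ofReal (C45 n p s) *
      ((∫⁻ z, ENNReal.ofReal (Xc n p s u c r z)) + ∫⁻ z, ENNReal.ofReal (YY n p q s t u k c r z)) := by
  unfold ee
  have hp0 : 0 < p := by linarith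
  have hC : 0 ≤ C45 n p s := by unfold C45; positivity
  have hx := (Xc_meas (p := p) (s := s) hu c r).ennreal_ofReal
  have hy := (YY_meas (p := p) (q := q) (s := s) (t := t) (k := k) (c := c) (r := r) hu).ennreal_ofReal
  have hm : Measurable fun z => ENNReal.ofReal (Xc n p s u c r z) + ENNReal.ofReal (YY n p q s t u k c r z) := hx.add hy
  rw [Measure.restrict_univ, ← lintegral_add_left hx, ← lintegral_const_mul _ hm]
  refine lintegral_mono fun z => ?_
  rw [← ENNReal.ofReal_add (Xc_nonneg _ _ _ _) (YY_nonneg _), ← ENNReal.ofReal_mul hC]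
  exact ENNReal.ofReal_le_ofReal (tf_energy hP hPp hsp htq0 htq hr z)

lemma holder_fw (hf : Measurable f) {w φ : En n → ℝ} (hw : Measurable w)
    (hφw : ∀ x, |φ x| ≤ |w x|) (hw0 : ∀ x, x ∉ ball c (2 * r) → φ x = 0) {P Q : ℝ} (hPQ : P.HolderConjugate Q) :
    ENNReal.ofReal (∫ x, f x * φ x) ≤
      (∫⁻ x in ball c (2 * r), ENNReal.ofReal (|f x| ^ P)) ^ (1 / P) * (∫⁻ x, ENNReal.ofReal |w x| ^ Q) ^ (1 / Q) := by
  have h1 : ENNReal.ofReal (∫ x, f x * φ x) ≤ ∫⁻ x, ENNReal.ofReal |f x * φ x| := by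
    calc ENNReal.ofReal (∫ x, f x * φ x) ≤ ENNReal.ofReal ‖∫ x, f x * φ x‖ := ENNReal.ofReal_le_ofReal (le_abs_self _)
      _ ≤ ∫⁻ x, ENNReal.ofReal ‖f x * φ x‖ := by
        rw [ofReal_norm]
        refine (enorm_integral_le_lintegral_enorm _).trans (le_of_eq ?_)
        refine lintegral_congr fun x => (ofReal_norm _).symm
      _ = _ := rfl
  refine h1.trans ?_
  have hm1 : Measurable fun x => ENNReal.ofReal |f x| := hf.norm.ennreal_ofReal
  have hm2 : Measurable fun x => ENNReal.ofReal |w x| := hw.norm.ennreal_ofReal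
  calc ∫⁻ x, ENNReal.ofReal |f x * φ x| ≤ ∫⁻ x, ((ball c (2 * r)).indicator (fun x => ENNReal.ofReal |f x|) * fun x => ENNReal.ofReal |w x|) x := by
        refine lintegral_mono fun x => ?_
        simp only [Pi.mul_apply]
        by_cases hx : x ∈ ball c (2 * r)
        · rw [indicator_of_mem hx, abs_mul, ENNReal.ofReal_mul (abs_nonneg _)]
          exact mul_le_mul' le_rfl (ENNReal.ofReal_le_ofReal (hφw x))
        · rw [hw0 x hx]; simp
    _ ≤ (∫⁻ x, ((ball c (2 * r)).indicator (fun x => ENNReal.ofReal |f x|) x) ^ P) ^ (1 / P) * (∫⁻ x, ENNReal.ofReal |w x| ^ Q) ^ (1 / Q) :=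
        ENNReal.lintegral_mul_le_Lp_mul_Lq _ hPQ (hm1.indicator measurableSet_ball).aemeasurable hm2.aemeasurable
    _ = _ := by
        congr 2
        rw [← lintegral_indicator measurableSet_ball]
        refine lintegral_congr fun x => ?_
        by_cases hx : x ∈ ball c (2 * r)
        · rw [indicator_of_mem hx, indicator_of_mem hx, ENNReal.ofReal_rpow_of_nonneg (abs_nonneg _) hPQ.nonneg]
        · rw [indicator_of_notMem hx, indicator_of_notMem hx, ENNReal.zero_rpow_of_pos hPQ.pos]
end

theorem cacc (n : ℕ) (p q s t M Λ : ℝ) : ∃ C : ℝ, 0 < C ∧ ∀ {a : En n × En n → ℝ} {u f : En n → ℝ} {δ : ℝ},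
    Dat n p q s t M Λ a u f δ → ∀ (c : En n) (r k Vr Nr Tr Fr : ℝ), 0 < r → r ≤ 1 →
      0 ≤ Vr → 0 ≤ Nr → 0 ≤ Tr → 0 ≤ Fr →
      VV n u k c r p ≤ ENNReal.ofReal Vr → VV n u k c r 1 ≤ ENNReal.ofReal Nr →
      TT n p q s t u k c r ≤ ENNReal.ofReal Tr →
      ∫⁻ x in ball c (2 * r), ENNReal.ofReal (|f x| ^ pStar n p s) ≤ ENNReal.ofReal Fr →
      eB n p s u c r ≤ ENNReal.ofReal (C * (r ^ (-(s * p)) * Vr + Nr * Tr + Fr ^ (pC p / pStar n p s))) := by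
  set Q : ℝ := n * p / (n - s * p) with hQdef
  set S : ℝ := (2 * (2 * c1 n)) ^ Q with hS
  set A : ℝ := 2 * (S * C45 n p s) ^ (1 / p) with hA
  set B : ℝ := 2 * |C43 n p q s M Λ| + 1 with hB
  have hc1 := c1_pos n
  refine ⟨2 * B * |C49 n p q s t| + |2 * A| ^ pC p + 1, by positivity, ?_⟩
  intro a u f δ h c r k Vr Nr Tr Fr hr hr1 hV0 hN0 hT0 hF0 hV hN hT hF
  have hn : 0 < n := by have := h.hn; omega
  have hnR : (0:ℝ) < n := by exact_mod_cast hn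
  have hp := h.hp
  have hp0 : 0 < p := by linarith
  have hsp : 0 < s * p := mul_pos h.hs0 hp0
  have htq0 : 0 < t * q := mul_pos h.ht0 (by linarith [h.hpq])
  have hspn := h.hspn
  have hd : 0 < (n:ℝ) - s * p := by linarith
  have hQ1 : 1 < Q := by rw [hQdef, one_lt_div hd]; nlinarith
  have hps := pStar_one hp h.hn h.hs0 hspn
  have hPQ : (pStar n p s).HolderConjugate Q := by
    rw [Real.holderConjugate_iff]
    refine ⟨hps, ?_⟩
    rw [pStar_eq hp h.hn h.hs0, hQdef, inv_div, inv_div, ← add_div, div_eq_one_iff_eq (by positivity)]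
    ring
  have hum := h.hW.1
  have hC45 : 0 ≤ C45 n p s := by unfold C45; positivity
  have hC49 : 0 ≤ C49 n p q s t := by
    have hom := om_pos n
    have : 0 < p - s * p := by nlinarith [h.hs1]
    unfold C49 C46 C47; positivity
  have hC43 : 0 ≤ C43 n p q s M Λ := by
    have := cF_one (p := p) (q := q) (s := s) (zero_le_one.trans h.hM) (zero_le_one.trans h.hΛ)
    unfold C43; positivity
  set X := ∫⁻ z, ENNReal.ofReal (Xc n p s u c r z) with hX
  set Y := ∫⁻ z, ENNReal.ofReal (YY n p q s t u k c r z) with hY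
  set Yr : ℝ := C49 n p q s t * (r ^ (-(s * p)) * Vr + Nr * Tr) with hYr
  have hYr0 : 0 ≤ Yr := by positivity
  have hYb : Y ≤ ENNReal.ofReal Yr := YY_int hn (by linarith) h.hs0 h.hs1 htq0 h.htq hum hr hr1 hV0 hN0 hT0 hV hN hT
  have hYtop : Y ≠ ⊤ := (hYb.trans_lt ENNReal.ofReal_lt_top).ne
  have hXtop : X ≠ ⊤ := ((Xc_le_ee hp0.le).trans_lt h.hee).ne
  have hwm := tf_meas 1 hum c r k
  have hφm := tf_meas p hum c r k
  have eew : ee n p s (tf 1 u k c r) univ ≤ ENNReal.ofReal (C45 n p s) * (X + Y) :=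
    tf_ee le_rfl (by linarith) hsp.le htq0.le h.htq hr hum
  have eeφ : ee n p s (tf p u k c r) univ ≤ ENNReal.ofReal (C45 n p s) * (X + Y) :=
    tf_ee (by linarith) le_rfl hsp.le htq0.le h.htq hr hum
  have hZtop : X + Y ≠ ⊤ := ENNReal.add_ne_top.2 ⟨hXtop, hYtop⟩
  have hbd : ∀ x, |u x - k| ≤ Λ + |k| := fun x => (abs_sub _ _).trans (by linarith [h.hb x])
  have htq2 : s < t * q := by
    have h1 := h.htq2; have h2 := h.hs0
    nlinarith
  obtain ⟨hI, hEq⟩ := weak_ext hn hp h.hpq h.htq htq2 h.ha h.ha0 h.haM h.hW h.hb h.hee (hps.trans h.hδ) h.hf h.hfδ h.hw hφm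
    (Bd := Λ + |k|) (fun x => (tf_abs hp0.le x).trans (hbd x))
    (HasCompactSupport.intro (isCompact_closedBall c (2 * r)) (fun x hx => tf_zero hp0 hr (fun h' => hx (ball_subset_closedBall h'))))
    (eeφ.trans_lt (ENNReal.mul_lt_top ENNReal.ofReal_lt_top (lt_top_iff_ne_top.2 hZtop)))
  -- Sobolev for `w`
  have hNQ : ∫⁻ y, ENNReal.ofReal |tf 1 u k c r y| ^ Q ≠ ⊤ := by
    have : ∫⁻ y, ENNReal.ofReal |tf 1 u k c r y| ^ Q ≤ ∫⁻ y, (ball c (2 * r)).indicator (fun _ => ENNReal.ofReal (Λ + |k|) ^ Q) y := by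
      refine lintegral_mono fun y => ?_
      by_cases hy : y ∈ ball c (2 * r)
      · rw [indicator_of_mem hy]
        have := (tf_abs (r := r) (c := c) (u := u) (k := k) zero_le_one y).trans (hbd y)
        gcongr
      · rw [indicator_of_notMem hy, tf_zero one_pos hr hy]
        simp [ENNReal.zero_rpow_of_pos (show 0 < Q by linarith)]
    refine (this.trans_lt ?_).ne
    rw [lintegral_indicator measurableSet_ball, setLIntegral_const]
    exact ENNReal.mul_lt_top (ENNReal.rpow_lt_top_of_nonneg (by linarith) ENNReal.ofReal_ne_top) measure_ball_lt_top
  have hsob := sob_whole hn (P := p) (Q := Q) (σ := s) (by linarith) hQ1.le h.hs0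
    (by rw [hQdef]; field_simp; ring) hwm hNQ
  have hF1 := holder_fw (c := c) (r := r) h.hf hwm (φ := tf p u k c r) (by
      intro x
      unfold tf
      rw [abs_mul, abs_mul, abs_of_nonneg (Real.rpow_nonneg (cut_nonneg c r x) p), abs_of_nonneg (Real.rpow_nonneg (cut_nonneg c r x) 1)]
      refine mul_le_mul_of_nonneg_left ?_ (abs_nonneg _)
      rcases eq_or_lt_of_le (cut_nonneg c r x) with h0 | h0
      · rw [← h0, Real.zero_rpow (by linarith), Real.zero_rpow (by norm_num)]
      · exact Real.rpow_le_rpow_of_exponent_ge h0 (cut_le_one c r x) (by linarith)) (fun x hx => tf_zero hp0 hr hx) hPQ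
  have hform := lint_le_of_form (f := fun z => 1 / 2 * Xc n p s u c r z)
    (h := fun z => C43 n p q s M Λ * YY n p q s t u k c r z) hI ((Xc_meas hum c r).const_mul _)
    ((YY_meas hum).const_mul _) (fun z => by have := Xc_nonneg (p := p) (s := s) u c r z; positivity)
    (fun z => mul_nonneg hC43 (YY_nonneg z))
    (fun z => cacc_pt hp h.hpq hsp.le htq0.le h.htq h.ha0 h.haM h.hb hr hr1 z)
  rw [hEq] at hform
  simp_rw [ENNReal.ofReal_mul hC43, ENNReal.ofReal_mul (show (0:ℝ) ≤ 1 / 2 by norm_num)] at hform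
  rw [lintegral_const_mul _ (Xc_meas hum c r).ennreal_ofReal, lintegral_const_mul _ (YY_meas hum).ennreal_ofReal] at hform
  -- to reals
  set Z : ℝ := (X + Y).toReal with hZ
  have hZe : X + Y = ENNReal.ofReal Z := (ENNReal.ofReal_toReal hZtop).symm
  have hZ0 : 0 ≤ Z := ENNReal.toReal_nonneg
  have hS0 : 0 ≤ S := by positivity
  have hwQ : (∫⁻ y, ENNReal.ofReal |tf 1 u k c r y| ^ Q) ^ (1 / Q) ≤ ENNReal.ofReal ((S * C45 n p s * Z) ^ (1 / p)) := by
    calc _ = ((∫⁻ y, ENNReal.ofReal |tf 1 u k c r y| ^ Q) ^ (p / Q)) ^ (1 / p) := by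
          rw [← ENNReal.rpow_mul]; congr 1; field_simp
      _ ≤ (ENNReal.ofReal S * (ENNReal.ofReal (C45 n p s) * ENNReal.ofReal Z)) ^ (1 / p) := by
          rw [← hZe]
          refine ENNReal.rpow_le_rpow (hsob.trans ?_) (by positivity)
          gcongr
      _ = _ := by
          rw [← ENNReal.ofReal_mul hC45, ← ENNReal.ofReal_mul hS0, ENNReal.ofReal_rpow_of_nonneg (by positivity) (by positivity), mul_assoc]
  have hFb : (∫⁻ x in ball c (2 * r), ENNReal.ofReal (|f x| ^ pStar n p s)) ^ (1 / pStar n p s) ≤ ENNReal.ofReal (Fr ^ (1 / pStar n p s)) := by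
    rw [← ENNReal.ofReal_rpow_of_nonneg hF0 (by positivity)]
    exact ENNReal.rpow_le_rpow hF (by positivity)
  have hmain : Z ≤ (A * Fr ^ (1 / pStar n p s)) * Z ^ (1 / p) + B * Yr := by
    have h1 : ENNReal.ofReal (1 / 2) * X ≤ ENNReal.ofReal (Fr ^ (1 / pStar n p s) * (S * C45 n p s * Z) ^ (1 / p) + C43 n p q s M Λ * Yr) := by
      refine hform.trans ?_
      rw [ENNReal.ofReal_add (by positivity) (by positivity), ENNReal.ofReal_mul (by positivity), ENNReal.ofReal_mul hC43]
      exact add_le_add (hF1.trans (mul_le_mul' hFb hwQ)) (mul_le_mul' le_rfl hYb)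
    have h2 : 1 / 2 * X.toReal ≤ Fr ^ (1 / pStar n p s) * (S * C45 n p s * Z) ^ (1 / p) + C43 n p q s M Λ * Yr := by
      have := ENNReal.toReal_mono ENNReal.ofReal_ne_top h1
      rwa [ENNReal.toReal_mul, ENNReal.toReal_ofReal (by norm_num), ENNReal.toReal_ofReal (by positivity)] at this
    have h3 : Y.toReal ≤ Yr := by
      have := ENNReal.toReal_mono ENNReal.ofReal_ne_top hYb
      rwa [ENNReal.toReal_ofReal hYr0] at this
    have h4 : Z = X.toReal + Y.toReal := ENNReal.toReal_add hXtop hYtop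
    rw [Real.mul_rpow (by positivity) hZ0] at h2
    have h5 : |C43 n p q s M Λ| = C43 n p q s M Λ := abs_of_nonneg hC43
    rw [h4] at h2 ⊢
    rw [hA, hB, h5]
    nlinarith
  have hfin := absorb hp hZ0 (by positivity) (by positivity) hYr0 hmain
  calc eB n p s u c r ≤ X := eB_le_Xc hr
    _ ≤ X + Y := le_self_add
    _ = ENNReal.ofReal Z := hZe
    _ ≤ _ := by
      refine ENNReal.ofReal_le_ofReal (hfin.trans ?_)
      have hA0 : 0 ≤ A := by positivity
      have hpc : 0 ≤ pC p := by unfold pC; exact div_nonneg hp0.le (by linarith)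
      have e : (2 * (A * Fr ^ (1 / pStar n p s))) ^ pC p = (2 * A) ^ pC p * Fr ^ (pC p / pStar n p s) := by
        rw [← mul_assoc, Real.mul_rpow (by positivity) (by positivity), ← Real.rpow_mul hF0]; congr 2; ring
      rw [e, hYr, abs_of_nonneg hC49, abs_of_nonneg (by positivity : 0 ≤ 2 * A)]
      set P1 := r ^ (-(s * p)) * Vr + Nr * Tr
      set P2 := Fr ^ (pC p / pStar n p s)
      have : 0 ≤ P1 := by positivity
      have : 0 ≤ P2 := by positivity
      have : 0 ≤ (2 * A) ^ pC p := by positivity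
      have : 0 ≤ 2 * B * C49 n p q s t := by positivity
      nlinarith [mul_nonneg ‹0 ≤ (2 * A) ^ pC p› ‹0 ≤ P1›, mul_nonneg ‹0 ≤ 2 * B * C49 n p q s t› ‹0 ≤ P2›]

lemma rpow_le_add_one {x y : ℝ} (hx : 0 ≤ x) (hy : 0 ≤ y) (hy1 : y ≤ 1) : x ^ y ≤ x + 1 :=
  calc x ^ y ≤ (x + 1) ^ y := Real.rpow_le_rpow hx (by linarith) hy
    _ ≤ (x + 1) ^ (1:ℝ) := Real.rpow_le_rpow_of_exponent_le (by linarith) hy1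
    _ = _ := Real.rpow_one _

lemma pow_jen {n : ℕ} (hn : 0 < n) {v : En n → ℝ} (hv : Measurable v) {P p R X : ℝ} (hP : 0 < P) (hPp : P ≤ p)
    (hR : 0 < R) (hX : 0 ≤ X) {c : En n} (h : ∫⁻ y in ball c R, ENNReal.ofReal (|v y| ^ p) ≤ ENNReal.ofReal X) :
    ∫⁻ y in ball c R, ENNReal.ofReal (|v y| ^ P) ≤
      ENNReal.ofReal ((om n * R ^ (n:ℝ)) ^ (1 - P / p) * X ^ (P / p)) := by
  have hp : 0 < p := by linarith
  have hom := om_pos n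
  have h1 := jen (volume.restrict (ball c R)) (fun y => ENNReal.ofReal (|v y| ^ P))
    ((hv.norm.pow_const P).ennreal_ofReal).aemeasurable (P := p / P) (by rwa [one_le_div hP])
  rw [Measure.restrict_apply_univ, vol_ball c hR.le hn] at h1
  have e : ∀ y, ENNReal.ofReal (|v y| ^ P) ^ (p / P) = ENNReal.ofReal (|v y| ^ p) := by
    intro y
    rw [ENNReal.ofReal_rpow_of_nonneg (by positivity) (by positivity), ← Real.rpow_mul (abs_nonneg _), mul_div_cancel₀ _ hP.ne']
  simp_rw [e] at h1
  have h0 : 0 ≤ p / P - 1 := by rw [sub_nonneg, one_le_div hP]; exact hPp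
  have h2 := h1.trans (mul_ofR (a := (om n * R ^ (n:ℝ)) ^ (p / P - 1)) (by positivity)
    (rpow_ofR (by positivity) h0 le_rfl) h)
  have h3 := rpow_ofR (P := P / p) (by positivity) (by positivity) h2
  rw [← ENNReal.rpow_mul, div_mul_div_cancel₀ hP.ne', div_self hp.ne', ENNReal.rpow_one] at h3
  refine le_ofR h3 (le_of_eq ?_)
  rw [Real.mul_rpow (by positivity) hX, ← Real.rpow_mul (by positivity)]
  congr 2; field_simp

def C50 (n : ℕ) (p s : ℝ) : ℝ := 2 ^ p * (c1 n * 2 ^ ((n:ℝ) + s * p) + om n * C4 n p s ^ p)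
def C51 (n : ℕ) (p s : ℝ) : ℝ := (om n + 1) * (C50 n p s + 1)

section
variable {n : ℕ} {p s ε ℓ Λ : ℝ} {u : En n → ℝ} {c : En n}

lemma C50_pos (n : ℕ) {p s : ℝ} (hp : 1 ≤ p) (hs : 0 < s) : 0 < C50 n p s := by
  have := C4_pos n hp hs
  have := c1_pos n
  have := om_pos n
  unfold C50; positivity

lemma C51_pos (n : ℕ) {p s : ℝ} (hp : 1 ≤ p) (hs : 0 < s) : 0 < C51 n p s := by
  have := C50_pos n hp hs
  have := om_pos n
  unfold C51; positivity

lemma near_p (hn : 0 < n) (hp : 1 ≤ p) (hs : 0 < s) (hε : 0 < ε) (hℓ : 0 ≤ ℓ)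
    (hu : Measurable u) (hb : ∀ x, |u x| ≤ Λ) {ρ₁ ρ₂ : ℝ}
    (hρ : 0 < ρ₁) (h12 : ρ₁ ≤ ρ₂)
    (hX : ∀ ρ, ρ₁ ≤ ρ → ρ ≤ ρ₂ → Cnd n p s ε ℓ u c ρ) :
    ∫⁻ y in ball c ρ₂, ENNReal.ofReal (|u y - av n u c ρ₁| ^ p) ≤
      ENNReal.ofReal (C50 n p s * (ℓ ^ p * ρ₂ ^ ((n:ℝ) + (s + ε) * p))) := by
  have hρ2 : 0 < ρ₂ := by linarith
  have hp0 : 0 < p := by linarith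
  have hc1 := c1_pos n
  have hom := om_pos n
  have hC4 := C4_pos n hp hs
  have h1 := poin hn hp hs hu hb c hρ2
  have h2 := tele hn hp hs hε hℓ hu hb hρ h12 hX
  have h3 := mul_ofR (by positivity) (le_refl (ENNReal.ofReal (c1 n * 2 ^ (n + s * p) * ρ₂ ^ (s * p)))) (hX ρ₂ h12 le_rfl)
  have h4 := h1.trans h3
  have hd : |av n u c ρ₂ - av n u c ρ₁| ^ p ≤ (C4 n p s * (ℓ * ρ₂ ^ (s + ε))) ^ p := by
    rw [abs_sub_comm]; exact Real.rpow_le_rpow (abs_nonneg _) h2 hp0.le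
  have hm : Measurable fun y => ENNReal.ofReal (|u y - av n u c ρ₂| ^ p) :=
    ((hu.sub_const _).norm.pow_const _).ennreal_ofReal
  calc ∫⁻ y in ball c ρ₂, ENNReal.ofReal (|u y - av n u c ρ₁| ^ p)
      ≤ ∫⁻ y in ball c ρ₂, ENNReal.ofReal (2 ^ p) * (ENNReal.ofReal (|u y - av n u c ρ₂| ^ p) +
        ENNReal.ofReal ((C4 n p s * (ℓ * ρ₂ ^ (s + ε))) ^ p)) := by
        refine lintegral_mono fun y => ?_
        rw [← ENNReal.ofReal_add (by positivity) (by positivity), ← ENNReal.ofReal_mul (by positivity)]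
        refine ENNReal.ofReal_le_ofReal ?_
        have e : |u y - av n u c ρ₁| ≤ |u y - av n u c ρ₂| + |av n u c ρ₂ - av n u c ρ₁| := abs_sub_le _ _ _
        calc |u y - av n u c ρ₁| ^ p ≤ (|u y - av n u c ρ₂| + |av n u c ρ₂ - av n u c ρ₁|) ^ p :=
              Real.rpow_le_rpow (abs_nonneg _) e hp0.le
          _ ≤ 2 ^ p * (|u y - av n u c ρ₂| ^ p + |av n u c ρ₂ - av n u c ρ₁| ^ p) := pow_add_le' hp0.le (abs_nonneg _) (abs_nonneg _)
          _ ≤ _ := by gcongr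
    _ = ENNReal.ofReal (2 ^ p) * ((∫⁻ y in ball c ρ₂, ENNReal.ofReal (|u y - av n u c ρ₂| ^ p)) +
        ENNReal.ofReal ((C4 n p s * (ℓ * ρ₂ ^ (s + ε))) ^ p) * ENNReal.ofReal (om n * ρ₂ ^ (n:ℝ))) := by
        rw [lintegral_const_mul _ (hm.add_const _), lintegral_add_left hm, setLIntegral_const, vol_ball c hρ2.le hn]
    _ ≤ ENNReal.ofReal (2 ^ p * (c1 n * 2 ^ (n + s * p) * ρ₂ ^ (s * p) * (ℓ ^ p * ρ₂ ^ ((n:ℝ) + ε * p)) +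
        (C4 n p s * (ℓ * ρ₂ ^ (s + ε))) ^ p * (om n * ρ₂ ^ (n:ℝ)))) :=
        mul_ofR (by positivity) le_rfl (add_ofR (by positivity) (by positivity) h4 (mul_ofR (by positivity) le_rfl le_rfl))
    _ = _ := by
        congr 1
        unfold C50
        rw [Real.mul_rpow hC4.le (by positivity), Real.mul_rpow hℓ (by positivity), ← Real.rpow_mul hρ2.le,
          show (n:ℝ) + (s + ε) * p = s * p + ((n:ℝ) + ε * p) by ring, Real.rpow_add hρ2 (s * p), show (s + ε) * p = s * p + ε * p by ring,
          Real.rpow_add hρ2, Real.rpow_add hρ2]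
        ring

lemma near_P (hn : 0 < n) (hp : 1 ≤ p) (hs : 0 < s) (hε : 0 < ε) (hℓ : 0 ≤ ℓ)
    (hu : Measurable u) (hb : ∀ x, |u x| ≤ Λ) {ρ₁ ρ₂ P : ℝ} (hP : 0 < P) (hPp : P ≤ p)
    (hρ : 0 < ρ₁) (h12 : ρ₁ ≤ ρ₂)
    (hX : ∀ ρ, ρ₁ ≤ ρ → ρ ≤ ρ₂ → Cnd n p s ε ℓ u c ρ) :
    ∫⁻ y in ball c ρ₂, ENNReal.ofReal (|u y - av n u c ρ₁| ^ P) ≤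
      ENNReal.ofReal (C51 n p s * (ℓ ^ P * ρ₂ ^ ((n:ℝ) + (s + ε) * P))) := by
  have hρ2 : 0 < ρ₂ := by linarith
  have hp0 : 0 < p := by linarith
  have hom := om_pos n
  have hC := C50_pos n hp hs
  have h1 := pow_jen hn (hu.sub_const (av n u c ρ₁)) hP hPp hρ2 (by positivity) (near_p hn hp hs hε hℓ hu hb hρ h12 hX)
  refine le_ofR h1 ?_
  have hq : P / p ≤ 1 := by rwa [div_le_one hp0]
  have e1 : (om n * ρ₂ ^ (n:ℝ)) ^ (1 - P / p) * (C50 n p s * (ℓ ^ p * ρ₂ ^ ((n:ℝ) + (s + ε) * p))) ^ (P / p) =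
      om n ^ (1 - P / p) * C50 n p s ^ (P / p) * (ℓ ^ P * ρ₂ ^ ((n:ℝ) + (s + ε) * P)) := by
    rw [Real.mul_rpow hom.le (by positivity), Real.mul_rpow hC.le (by positivity), Real.mul_rpow (by positivity) (by positivity),
      ← Real.rpow_mul hρ2.le, ← Real.rpow_mul hρ2.le, ← Real.rpow_mul hℓ]
    have e2 : ρ₂ ^ ((n:ℝ) + (s + ε) * P) = ρ₂ ^ ((n:ℝ) * (1 - P / p)) * ρ₂ ^ (((n:ℝ) + (s + ε) * p) * (P / p)) := by
      rw [← Real.rpow_add hρ2]; congr 1; field_simp; ring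
    have e3 : p * (P / p) = P := by field_simp
    rw [e2, e3]; ring
  rw [e1]
  unfold C51
  have := rpow_le_add_one hom.le (sub_nonneg.2 hq) (by have : 0 ≤ P / p := by positivity
                                                       linarith)
  have := rpow_le_add_one hC.le (by positivity : 0 ≤ P / p) hq
  gcongr

end

lemma dyad_pt {x ρ : ℝ} (hρ : 0 < ρ) (hx : ρ ≤ x) : ∃ j : ℕ, 2 ^ j * ρ ≤ x ∧ x < 2 ^ (j + 1) * ρ := by
  obtain ⟨j, h1, h2⟩ := exists_nat_pow_near (one_le_div hρ |>.2 hx) (one_lt_two)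
  refine ⟨j, ?_, ?_⟩
  · rwa [le_div_iff₀ hρ] at h1
  · rwa [div_lt_iff₀ hρ] at h2

lemma dyad {n : ℕ} {g : En n → ℝ≥0∞} (hg : Measurable g) (c : En n) {ρ b : ℝ} (hρ : 0 < ρ) (hb : 0 ≤ b) :
    ∫⁻ y in (ball c ρ)ᶜ, g y * ENNReal.ofReal (‖y - c‖ ^ (-b)) ≤
      ∑' j : ℕ, ENNReal.ofReal ((2 ^ j * ρ) ^ (-b)) * ∫⁻ y in ball c (2 ^ (j + 1) * ρ), g y := by
  have hm : ∀ j : ℕ, Measurable fun y => ENNReal.ofReal ((2 ^ j * ρ) ^ (-b)) * (ball c (2 ^ (j + 1) * ρ)).indicator g y :=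
    fun j => (hg.indicator measurableSet_ball).const_mul _
  calc _ = ∫⁻ y, ((ball c ρ)ᶜ).indicator (fun y => g y * ENNReal.ofReal (‖y - c‖ ^ (-b))) y :=
        (lintegral_indicator measurableSet_ball.compl _).symm
    _ ≤ ∫⁻ y, ∑' j : ℕ, ENNReal.ofReal ((2 ^ j * ρ) ^ (-b)) * (ball c (2 ^ (j + 1) * ρ)).indicator g y := by
        refine lintegral_mono fun y => ?_
        by_cases hy : y ∈ (ball c ρ)ᶜ
        · rw [indicator_of_mem hy]
          have hy' : ρ ≤ ‖y - c‖ := by rw [mem_compl_iff, mem_ball, dist_eq_norm] at hy; linarith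
          obtain ⟨j, h1, h2⟩ := dyad_pt hρ hy'
          refine le_trans ?_ (ENNReal.le_tsum j)
          rw [indicator_of_mem (by rwa [mem_ball, dist_eq_norm]), mul_comm]
          exact mul_le_mul' (ENNReal.ofReal_le_ofReal (Real.rpow_le_rpow_of_nonpos (by positivity) h1 (by linarith))) le_rfl
        · rw [indicator_of_notMem hy]; exact zero_le
    _ = _ := by
        rw [lintegral_tsum fun j => (hm j).aemeasurable]
        congr 1; ext j
        rw [lintegral_const_mul _ (hg.indicator measurableSet_ball), lintegral_indicator measurableSet_ball]

lemma geo_sum {A x : ℝ} (hA : 0 ≤ A) (hx : 0 ≤ x) (hx1 : x < 1) :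
    ∑' j : ℕ, ENNReal.ofReal (A * x ^ j) ≤ ENNReal.ofReal (A / (1 - x)) := by
  have hs := (hasSum_geometric_of_lt_one hx hx1).mul_left A
  rw [← ENNReal.ofReal_tsum_of_nonneg (fun j => by positivity) hs.summable, hs.tsum_eq, div_eq_mul_inv]

lemma geo_sum' {A w : ℝ} (hA : 0 ≤ A) (hw : 0 < w) :
    ∑' j : ℕ, ENNReal.ofReal (A * ((2:ℝ) ^ j) ^ (-w)) ≤ ENNReal.ofReal (A / (1 - 2 ^ (-w))) := by
  have := geo_sum hA (x := (2:ℝ) ^ (-w)) (by positivity) (two_s hw)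
  refine le_trans (le_of_eq ?_) this
  congr 1; ext j
  rw [← Real.rpow_natCast, ← Real.rpow_natCast, ← Real.rpow_mul (by norm_num), ← Real.rpow_mul (by norm_num), mul_comm (j:ℝ)]

structure Eps (n : ℕ) (p q s t ε : ℝ) : Prop where
  h0 : 0 < ε
  h1 : ε < s / p
  h2 : ε * p < t * q - s * (p - 1)
  h3 : ε < 1 - s

structure Lev (n : ℕ) (p q s t ε ℓ : ℝ) (u : En n → ℝ) (x₀ : En n) (ϱ₀ r₀ : ℝ) : Prop where
  hℓ : 0 < ℓ
  hr0 : 0 < r₀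
  hr0ϱ : r₀ ≤ ϱ₀ / 2
  hϱ1 : ϱ₀ ≤ 1
  h1a : eB n p s u x₀ (2 * ϱ₀) < ENNReal.ofReal (ℓ ^ p * (r₀ / 80) ^ ((n:ℝ) + ε * p))
  h1b : eB n p s u x₀ (2 * ϱ₀) ≤ ENNReal.ofReal (ℓ ^ p * r₀ ^ ((n:ℝ) + (s + ε) * p) * ϱ₀ ^ (-(s * p)))
  h1c : ∫⁻ y in ball x₀ (2 * ϱ₀), ENNReal.ofReal (|u y - av n u x₀ (2 * ϱ₀)| ^ (p - 1)) ≤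
    ENNReal.ofReal (ℓ ^ (p - 1) * r₀ ^ ((n:ℝ) + (s + ε) * (p - 1)))
  h2 : TT n p q s t u (av n u x₀ (2 * ϱ₀)) x₀ ϱ₀ ≤
    ENNReal.ofReal (ℓ ^ (p - 1) * r₀ ^ ((s + ε) * (p - 1) - s * p))

section
variable {n : ℕ} {p q s t M Λ r δ ε ℓ ϱ₀ r₀ : ℝ} {a : En n × En n → ℝ} {u f : En n → ℝ} {c x₀ : En n} {k : ℝ}

lemma Dat.n0 (h : Dat n p q s t M Λ a u f δ) : 0 < n := by have := h.hn; omega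
lemma Dat.p1 (h : Dat n p q s t M Λ a u f δ) : 1 ≤ p := by have := h.hp; linarith
lemma Dat.p0 (h : Dat n p q s t M Λ a u f δ) : 0 < p := by have := h.hp; linarith
lemma Dat.sp (h : Dat n p q s t M Λ a u f δ) : 0 < s * p := mul_pos h.hs0 h.p0
lemma Dat.tq (h : Dat n p q s t M Λ a u f δ) : 0 < t * q := mul_pos h.ht0 (by have := h.hpq; have := h.p0; linarith)

lemma kap_le_of_le (htq : t * q ≤ s * p) (htq0 : 0 < t * q) {ρ : ℝ} (hρ : 0 < ρ) (hρ1 : ρ ≤ 1) {y : En n} (hy : ρ ≤ ‖y - c‖) :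
    kap n p q s t c y ≤ 2 * ρ ^ (-((n:ℝ) + s * p)) := by
  unfold kap
  have h1 : ‖y - c‖ ^ (-((n:ℝ) + s * p)) ≤ ρ ^ (-((n:ℝ) + s * p)) :=
    Real.rpow_le_rpow_of_nonpos hρ hy (by have : (0:ℝ) ≤ n := by positivity
                                          linarith)
  have h2 : ‖y - c‖ ^ (-((n:ℝ) + t * q)) ≤ ρ ^ (-((n:ℝ) + s * p)) :=
    (Real.rpow_le_rpow_of_nonpos hρ hy (by have : (0:ℝ) ≤ n := by positivity
                                           linarith)).trans
      (Real.rpow_le_rpow_of_exponent_ge hρ hρ1 (by linarith))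
  linarith

lemma two_ofR (x : ℝ) : ENNReal.ofReal (2 * x) = 2 * ENNReal.ofReal x := by
  rw [ENNReal.ofReal_mul (by norm_num)]; simp

def C52 (n : ℕ) (p s : ℝ) : ℝ := C0 n p s * 2 ^ (s * p)

lemma ball_sub2 (hr0ϱ : r₀ ≤ ϱ₀ / 2) (hc : c ∈ ball x₀ (3 / 2 * ϱ₀)) : ball c r₀ ⊆ ball x₀ (2 * ϱ₀) := by
  intro y hy
  rw [mem_ball] at *
  have := dist_triangle y c x₀
  linarith

lemma k0diff (h : Dat n p q s t M Λ a u f δ) (hL : Lev n p q s t ε ℓ u x₀ ϱ₀ r₀) (hc : c ∈ ball x₀ (3 / 2 * ϱ₀)) :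
    |av n u c r₀ - av n u x₀ (2 * ϱ₀)| ≤ C52 n p s * (ℓ * r₀ ^ (s + ε)) := by
  have hr0 := hL.hr0
  have hϱ : 0 < ϱ₀ := by have := hL.hr0ϱ; linarith
  have hℓ := hL.hℓ
  have hC := C0_one n h.p1 h.hs0
  have h1 := avdiff_gen h.n0 h.p1 h.hs0 h.hW.1 h.hb (by linarith) hr0 (ball_sub2 hL.hr0ϱ hc) (by positivity) hL.h1b
  have hsp := h.sp
  have h2 : 1 ≤ (2:ℝ) ^ (s * p) := Real.one_le_rpow (by norm_num) hsp.le
  have h52 : 1 ≤ C52 n p s := one_le_mul_of_one_le_of_one_le hC h2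
  refine rpow_le_of (abs_nonneg _) (by positivity) h.p0 (h1.trans ?_)
  have e : C0 n p s * (r₀ ^ (-(n:ℝ)) * (2 * ϱ₀) ^ (s * p) * (ℓ ^ p * r₀ ^ ((n:ℝ) + (s + ε) * p) * ϱ₀ ^ (-(s * p)))) =
      C52 n p s * (ℓ * r₀ ^ (s + ε)) ^ p := by
    unfold C52
    rw [Real.mul_rpow (by norm_num) hϱ.le, Real.mul_rpow hℓ.le (by positivity), Real.rpow_add hr0, Real.rpow_neg hr0.le, Real.rpow_neg hϱ.le,
      ← Real.rpow_mul hr0.le]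
    field_simp
  rw [e, Real.mul_rpow (x := C52 n p s) (by linarith) (by positivity)]
  have : C52 n p s ≤ C52 n p s ^ p := Real.self_le_rpow_of_one_le h52 h.p1
  exact mul_le_mul_of_nonneg_right this (by positivity)

def C53 (n : ℕ) (p s : ℝ) : ℝ := 2 * (C51 n p s * 2 ^ ((n:ℝ) + 2 * p) / (1 - 2 ^ (-(s / p))))

lemma eps_sub (h : Dat n p q s t M Λ a u f δ) (hE : Eps n p q s t ε) : s / p < s * p - (s + ε) * (p - 1) := by
  have h1 := hE.h1
  have hp := h.hp
  have : s = s / p * p := by rw [div_mul_cancel₀ _ h.p0.ne']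
  nlinarith

lemma tail_near (h : Dat n p q s t M Λ a u f δ) (hE : Eps n p q s t ε) (hℓ : 0 < ℓ) (hr0 : r₀ ≤ 1)
    (hr : 0 < r) (hrr : 2 * r ≤ r₀) (hC : ∀ ρ, 2 * r ≤ ρ → ρ ≤ r₀ → Cnd n p s ε ℓ u c ρ) :
    ∫⁻ y in (ball c (2 * r))ᶜ ∩ ball c r₀, ENNReal.ofReal (|u y - av n u c (2 * r)| ^ (p - 1) * kap n p q s t c y) ≤
      ENNReal.ofReal (C53 n p s * (ℓ ^ (p - 1) * r ^ ((s + ε) * (p - 1) - s * p))) := by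
  have hp := h.hp
  have hp0 := h.p0
  have hum := h.hW.1
  have hsp := h.sp
  have hεs := eps_sub h hE
  have hsp' : 0 < s / p := div_pos h.hs0 hp0
  have hC51 := C51_pos n h.p1 h.hs0
  have hnn : (0:ℝ) ≤ n := by positivity
  set k := av n u c (2 * r) with hk
  set g : En n → ℝ≥0∞ := (ball c r₀).indicator fun y => ENNReal.ofReal (|u y - k| ^ (p - 1)) with hg
  have hgm : Measurable g := (((hum.sub_const k).norm.pow_const _).ennreal_ofReal).indicator measurableSet_ball
  have hd := dyad hgm c (ρ := 2 * r) (b := (n:ℝ) + s * p) (by positivity) (by positivity)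
  have step : ∫⁻ y in (ball c (2 * r))ᶜ ∩ ball c r₀, ENNReal.ofReal (|u y - k| ^ (p - 1) * kap n p q s t c y) ≤
      2 * ∫⁻ y in (ball c (2 * r))ᶜ, g y * ENNReal.ofReal (‖y - c‖ ^ (-((n:ℝ) + s * p))) := by
    have hm : Measurable fun y => g y * ENNReal.ofReal (‖y - c‖ ^ (-((n:ℝ) + s * p))) :=
      hgm.mul ((measurable_id.sub_const c).norm.pow_const _).ennreal_ofReal
    rw [← lintegral_const_mul _ hm]
    refine le_trans ?_ (lintegral_mono_set (inter_subset_left (s := (ball c (2 * r))ᶜ) (t := ball c r₀)))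
    refine setLIntegral_mono (hm.const_mul 2) fun y hy => ?_
    rw [hg, indicator_of_mem hy.2, ← ENNReal.ofReal_mul (by positivity)]
    refine le_trans (ENNReal.ofReal_le_ofReal ?_) (le_of_eq (two_ofR _))
    have h1 := not_ball hy.1
    have h2 := hy.2
    rw [mem_ball, dist_eq_norm] at h2
    have := kap_le_of_le (n := n) (c := c) h.htq h.tq (ρ := ‖y - c‖) (by linarith) (by linarith) le_rfl
    calc |u y - k| ^ (p - 1) * kap n p q s t c y ≤ |u y - k| ^ (p - 1) * (2 * ‖y - c‖ ^ (-((n:ℝ) + s * p))) := by gcongr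
      _ = _ := by ring
  have hgb : ∀ j : ℕ, ∫⁻ y in ball c (2 ^ (j + 1) * (2 * r)), g y ≤
      ENNReal.ofReal (C51 n p s * (ℓ ^ (p - 1) * (2 ^ (j + 1) * (2 * r)) ^ ((n:ℝ) + (s + ε) * (p - 1)))) := by
    intro j
    set ρ := min (2 ^ (j + 1) * (2 * r)) r₀ with hρ
    have hρ1 : 2 * r ≤ ρ := le_min (by
      have : (1:ℝ) ≤ 2 ^ (j + 1) := one_le_pow₀ (by norm_num)
      nlinarith) hrr
    have h1 : ∫⁻ y in ball c (2 ^ (j + 1) * (2 * r)), g y = ∫⁻ y in ball c ρ, ENNReal.ofReal (|u y - k| ^ (p - 1)) := by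
      rw [hg, setLIntegral_indicator measurableSet_ball]
      congr 2
      rw [hρ]; ext y; simp [mem_ball, and_comm]
    rw [h1]
    have h2 := near_P h.n0 h.p1 h.hs0 hE.h0 hℓ.le hum h.hb (P := p - 1) (by linarith) (by linarith) (by positivity) hρ1
      (fun ρ' a1 a2 => hC ρ' a1 (a2.trans (min_le_right _ _)))
    refine le_ofR h2 ?_
    have : ρ ^ ((n:ℝ) + (s + ε) * (p - 1)) ≤ (2 ^ (j + 1) * (2 * r)) ^ ((n:ℝ) + (s + ε) * (p - 1)) := by
      refine Real.rpow_le_rpow (by linarith) (min_le_left _ _) ?_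
      have := mul_pos (add_pos h.hs0 hE.h0) (by linarith : 0 < p - 1)
      linarith
    gcongr
  set w := s * p - (s + ε) * (p - 1) with hw
  have hsum : ∑' j : ℕ, ENNReal.ofReal ((2 ^ j * (2 * r)) ^ (-((n:ℝ) + s * p))) * ∫⁻ y in ball c (2 ^ (j + 1) * (2 * r)), g y ≤
      ENNReal.ofReal (C51 n p s * 2 ^ ((n:ℝ) + 2 * p) * (ℓ ^ (p - 1) * r ^ (-w)) / (1 - 2 ^ (-(s / p)))) := by
    refine le_trans (ENNReal.tsum_le_tsum fun j => ?_) (geo_sum' (by positivity) hsp')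
    refine (mul_ofR (by positivity) le_rfl (hgb j)).trans (ENNReal.ofReal_le_ofReal ?_)
    set X : ℝ := 2 ^ j with hX
    have hX1 : 1 ≤ X := one_le_pow₀ (by norm_num)
    have hX0 : 0 < X := by linarith
    have e1 : (2:ℝ) ^ (j + 1) * (2 * r) = 2 * (X * (2 * r)) := by rw [hX, pow_succ]; ring
    rw [e1, Real.mul_rpow (x := 2) (y := X * (2 * r)) (by norm_num) (by positivity)]
    have e2 : (X * (2 * r)) ^ (-((n:ℝ) + s * p)) * (X * (2 * r)) ^ ((n:ℝ) + (s + ε) * (p - 1)) = (X * (2 * r)) ^ (-w) := by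
      rw [← Real.rpow_add (by positivity)]; congr 1; simp only [hw]; ring
    have e3 : (X * (2 * r)) ^ (-w) ≤ X ^ (-(s / p)) * r ^ (-w) := by
      rw [Real.mul_rpow (by positivity) (by positivity)]
      have a1 : X ^ (-w) ≤ X ^ (-(s / p)) := Real.rpow_le_rpow_of_exponent_le hX1 (by linarith)
      have a2 : (2 * r) ^ (-w) ≤ r ^ (-w) := Real.rpow_le_rpow_of_nonpos hr (by linarith) (by linarith)
      gcongr
    have e4 : (2:ℝ) ^ ((n:ℝ) + (s + ε) * (p - 1)) ≤ 2 ^ ((n:ℝ) + 2 * p) := by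
      refine Real.rpow_le_rpow_of_exponent_le (by norm_num) ?_
      have := h.hs0; have := hE.h0; have := hE.h3
      nlinarith
    calc _ = C51 n p s * ℓ ^ (p - 1) * 2 ^ ((n:ℝ) + (s + ε) * (p - 1)) * ((X * (2 * r)) ^ (-((n:ℝ) + s * p)) * (X * (2 * r)) ^ ((n:ℝ) + (s + ε) * (p - 1))) := by ring
      _ ≤ C51 n p s * ℓ ^ (p - 1) * 2 ^ ((n:ℝ) + 2 * p) * (X ^ (-(s / p)) * r ^ (-w)) := by rw [e2]; gcongr
      _ = _ := by ring
  refine (step.trans (mul_le_mul' le_rfl (hd.trans hsum))).trans (le_of_eq ?_)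
  rw [← two_ofR]
  congr 1
  unfold C53
  rw [show -w = (s + ε) * (p - 1) - s * p by rw [hw]; ring]
  ring

def C54 (n : ℕ) (p q s t : ℝ) : ℝ :=
  C53 n p s + 2 ^ p * ((C4 n p s + C52 n p s) ^ (p - 1) * (C47 n p q s t * 2 ^ (s * p)) + 2 + 4 ^ ((n:ℝ) + s * p))

lemma tail_bd (h : Dat n p q s t M Λ a u f δ) (hE : Eps n p q s t ε) (hL : Lev n p q s t ε ℓ u x₀ ϱ₀ r₀)
    (hc : c ∈ ball x₀ (3 / 2 * ϱ₀))
    (hr : 0 < r) (hrr : 2 * r ≤ r₀) (hC : ∀ ρ, 2 * r ≤ ρ → ρ ≤ r₀ → Cnd n p s ε ℓ u c ρ) :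
    TT n p q s t u (av n u c (2 * r)) c r ≤
      ENNReal.ofReal (C54 n p q s t * (ℓ ^ (p - 1) * r ^ ((s + ε) * (p - 1) - s * p))) := by
  have hp := h.hp
  have hp0 := h.p0
  have hum := h.hW.1
  have hsp := h.sp
  have htq := h.tq
  have hεs := eps_sub h hE
  have hsp' : 0 < s / p := div_pos h.hs0 hp0
  have hC4 := C4_pos n h.p1 h.hs0
  have hC52 : 0 < C52 n p s := by have := C0_one n h.p1 h.hs0; unfold C52; positivity
  have hC53 : 0 < C53 n p s := by
    have := C51_pos n h.p1 h.hs0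
    have h2 := two_s hsp'
    have : 0 < 1 - (2:ℝ) ^ (-(s / p)) := by linarith
    unfold C53; positivity
  have hC47 : 0 ≤ C47 n p q s t := by have := om_pos n; unfold C47; positivity
  have hr0 := hL.hr0
  have hϱ : 0 < ϱ₀ := by have := hL.hr0ϱ; linarith
  have hr01 : r₀ ≤ 1 := by have := hL.hr0ϱ; have := hL.hϱ1; linarith
  have hℓ := hL.hℓ
  have hnn : (0:ℝ) ≤ n := by positivity
  have hp1 : 0 < p - 1 := by linarith
  set k := av n u c (2 * r) with hk
  set k₀ := av n u x₀ (2 * ϱ₀) with hk₀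
  set σ := (s + ε) * (p - 1) - s * p with hσ
  set E := ℓ ^ (p - 1) * r ^ σ with hEdef
  have hrσ : r₀ ^ σ ≤ r ^ σ := Real.rpow_le_rpow_of_nonpos hr (by linarith) (by rw [hσ]; linarith)
  have hkk : |k - k₀| ≤ (C4 n p s + C52 n p s) * (ℓ * r₀ ^ (s + ε)) := by
    have h1 := tele h.n0 h.p1 h.hs0 hE.h0 hℓ.le hum h.hb (c := c) (by positivity) hrr hC
    have h2 := k0diff h hL hc
    have := abs_sub_le k (av n u c r₀) k₀
    rw [add_mul]; linarith
  -- far parts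
  have f1 : ∫⁻ y in (ball c r₀)ᶜ, ENNReal.ofReal (|k - k₀| ^ (p - 1) * kap n p q s t c y) ≤
      ENNReal.ofReal ((C4 n p s + C52 n p s) ^ (p - 1) * (C47 n p q s t * 2 ^ (s * p)) * E) := by
    have hkm := kap_meas (n := n) (p := p) (q := q) (s := s) (t := t) c
    simp_rw [ENNReal.ofReal_mul (show 0 ≤ |k - k₀| ^ (p - 1) by positivity)]
    rw [lintegral_const_mul _ hkm.ennreal_ofReal]
    have hki := kap_int (c := c) h.n0 hsp htq h.htq (r := r₀ / 2) (by positivity) (by linarith)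
    rw [show 2 * (r₀ / 2) = r₀ by ring] at hki
    refine le_ofR (mul_ofR (by positivity) le_rfl hki) ?_
    have a1 : |k - k₀| ^ (p - 1) ≤ ((C4 n p s + C52 n p s) * (ℓ * r₀ ^ (s + ε))) ^ (p - 1) :=
      Real.rpow_le_rpow (abs_nonneg _) hkk hp1.le
    rw [Real.mul_rpow (by positivity) (by positivity), Real.mul_rpow hℓ.le (by positivity), ← Real.rpow_mul hr0.le] at a1
    have a2 : (r₀ / 2) ^ (-(s * p)) = r₀ ^ (-(s * p)) * 2 ^ (s * p) := by
      rw [Real.div_rpow hr0.le (by norm_num), Real.rpow_neg (by norm_num : (0:ℝ) ≤ 2)]; field_simp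
    have a3 : r₀ ^ ((s + ε) * (p - 1)) * r₀ ^ (-(s * p)) = r₀ ^ σ := by
      rw [← Real.rpow_add hr0]; congr 1
    calc |k - k₀| ^ (p - 1) * (C47 n p q s t * (r₀ / 2) ^ (-(s * p)))
        ≤ (C4 n p s + C52 n p s) ^ (p - 1) * (ℓ ^ (p - 1) * r₀ ^ ((s + ε) * (p - 1))) * (C47 n p q s t * (r₀ / 2) ^ (-(s * p))) := by gcongr
      _ = (C4 n p s + C52 n p s) ^ (p - 1) * (C47 n p q s t * 2 ^ (s * p)) * (ℓ ^ (p - 1) * (r₀ ^ ((s + ε) * (p - 1)) * r₀ ^ (-(s * p)))) := by rw [a2]; ring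
      _ ≤ _ := by rw [a3, hEdef]; gcongr
  have f2 : ∫⁻ y in (ball c r₀)ᶜ ∩ ball x₀ (2 * ϱ₀), ENNReal.ofReal (|u y - k₀| ^ (p - 1) * kap n p q s t c y) ≤
      ENNReal.ofReal (2 * E) := by
    have hm : Measurable fun y => ENNReal.ofReal (|u y - k₀| ^ (p - 1)) := ((hum.sub_const k₀).norm.pow_const _).ennreal_ofReal
    calc _ ≤ ∫⁻ y in (ball c r₀)ᶜ ∩ ball x₀ (2 * ϱ₀), ENNReal.ofReal (2 * r₀ ^ (-((n:ℝ) + s * p))) * ENNReal.ofReal (|u y - k₀| ^ (p - 1)) := by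
          refine setLIntegral_mono (hm.const_mul _) fun y hy => ?_
          rw [← ENNReal.ofReal_mul (by positivity)]
          refine ENNReal.ofReal_le_ofReal ?_
          have h1 : r₀ ≤ ‖y - c‖ := by have := hy.1; rw [mem_compl_iff, mem_ball, dist_eq_norm] at this; linarith
          have := kap_le_of_le (n := n) (c := c) h.htq htq hr0 hr01 h1
          rw [mul_comm]; gcongr
      _ ≤ ∫⁻ y in ball x₀ (2 * ϱ₀), ENNReal.ofReal (2 * r₀ ^ (-((n:ℝ) + s * p))) * ENNReal.ofReal (|u y - k₀| ^ (p - 1)) :=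
          lintegral_mono_set inter_subset_right
      _ ≤ _ := by
          rw [lintegral_const_mul _ hm]
          refine le_ofR (mul_ofR (by positivity) le_rfl hL.h1c) ?_
          have a3 : r₀ ^ (-((n:ℝ) + s * p)) * r₀ ^ ((n:ℝ) + (s + ε) * (p - 1)) = r₀ ^ σ := by
            rw [← Real.rpow_add hr0]; congr 1; rw [hσ]; ring
          calc _ = 2 * (ℓ ^ (p - 1) * (r₀ ^ (-((n:ℝ) + s * p)) * r₀ ^ ((n:ℝ) + (s + ε) * (p - 1)))) := by ring
            _ ≤ _ := by rw [a3, hEdef]; gcongr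
  have f3 : ∫⁻ y in (ball x₀ (2 * ϱ₀))ᶜ, ENNReal.ofReal (|u y - k₀| ^ (p - 1) * kap n p q s t c y) ≤
      ENNReal.ofReal (4 ^ ((n:ℝ) + s * p) * E) := by
    have hm : Measurable fun y => ENNReal.ofReal (|u y - k₀| ^ (p - 1) * kap n p q s t x₀ y) :=
      (((hum.sub_const k₀).norm.pow_const _).mul (kap_meas x₀)).ennreal_ofReal
    calc _ ≤ ∫⁻ y in (ball x₀ (2 * ϱ₀))ᶜ, ENNReal.ofReal (4 ^ ((n:ℝ) + s * p)) * ENNReal.ofReal (|u y - k₀| ^ (p - 1) * kap n p q s t x₀ y) := by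
          refine setLIntegral_mono (hm.const_mul _) fun y hy => ?_
          rw [← ENNReal.ofReal_mul (by positivity)]
          refine ENNReal.ofReal_le_ofReal ?_
          have h1 := ker_mixed (n := n) (x := c) (y := y) hsp.le htq.le h.htq hϱ (by rw [mem_ball, dist_eq_norm] at hc; exact hc) hy
          have h2 : kap n p q s t c y ≤ 4 ^ ((n:ℝ) + s * p) * kap n p q s t x₀ y := by
            rw [norm_sub_rev c y] at h1; exact h1
          calc _ ≤ |u y - k₀| ^ (p - 1) * (4 ^ ((n:ℝ) + s * p) * kap n p q s t x₀ y) := by gcongr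
            _ = _ := by ring
      _ ≤ _ := by
          rw [lintegral_const_mul _ hm]
          refine le_ofR (mul_ofR (by positivity) le_rfl hL.h2) ?_
          rw [hEdef]; gcongr
  have f23 : ∫⁻ y in (ball c r₀)ᶜ, ENNReal.ofReal (|u y - k₀| ^ (p - 1) * kap n p q s t c y) ≤
      ENNReal.ofReal (2 * E + 4 ^ ((n:ℝ) + s * p) * E) := by
    have hsub : (ball c r₀)ᶜ ⊆ ((ball c r₀)ᶜ ∩ ball x₀ (2 * ϱ₀)) ∪ (ball x₀ (2 * ϱ₀))ᶜ := by
      intro y hy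
      by_cases hy2 : y ∈ ball x₀ (2 * ϱ₀)
      · exact Or.inl ⟨hy, hy2⟩
      · exact Or.inr hy2
    exact (lintegral_mono_set hsub).trans ((lintegral_union_le _ _ _).trans (add_ofR (by positivity) (by positivity) f2 f3))
  have f : ∫⁻ y in (ball c r₀)ᶜ, ENNReal.ofReal (|u y - k| ^ (p - 1) * kap n p q s t c y) ≤
      ENNReal.ofReal (2 ^ p * ((C4 n p s + C52 n p s) ^ (p - 1) * (C47 n p q s t * 2 ^ (s * p)) * E + (2 * E + 4 ^ ((n:ℝ) + s * p) * E))) := by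
    have hkm := kap_meas (n := n) (p := p) (q := q) (s := s) (t := t) c
    have m1 : Measurable fun y => ENNReal.ofReal (|k - k₀| ^ (p - 1) * kap n p q s t c y) := (hkm.const_mul _).ennreal_ofReal
    have m2 : Measurable fun y => ENNReal.ofReal (|u y - k₀| ^ (p - 1) * kap n p q s t c y) :=
      (((hum.sub_const k₀).norm.pow_const _).mul hkm).ennreal_ofReal
    have mm : Measurable fun y => ENNReal.ofReal (|k - k₀| ^ (p - 1) * kap n p q s t c y) + ENNReal.ofReal (|u y - k₀| ^ (p - 1) * kap n p q s t c y) := m1.add m2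
    refine le_trans ?_ (mul_ofR (by positivity) le_rfl (add_ofR (by positivity) (by positivity) f1 f23))
    rw [← lintegral_add_left m1, ← lintegral_const_mul _ mm]
    refine lintegral_mono fun y => ?_
    have hkn := kap_nonneg (n := n) (p := p) (q := q) (s := s) (t := t) c y
    rw [← ENNReal.ofReal_add (by positivity) (by positivity), ← ENNReal.ofReal_mul (by positivity)]
    refine ENNReal.ofReal_le_ofReal ?_
    have e : |u y - k| ≤ |k - k₀| + |u y - k₀| := by
      have := abs_sub_le (u y) k₀ k; rw [abs_sub_comm k₀ k] at this; linarith
    have e2 : |u y - k| ^ (p - 1) ≤ 2 ^ p * (|k - k₀| ^ (p - 1) + |u y - k₀| ^ (p - 1)) :=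
      calc _ ≤ (|k - k₀| + |u y - k₀|) ^ (p - 1) := Real.rpow_le_rpow (abs_nonneg _) e hp1.le
        _ ≤ 2 ^ (p - 1) * (|k - k₀| ^ (p - 1) + |u y - k₀| ^ (p - 1)) := pow_add_le' hp1.le (abs_nonneg _) (abs_nonneg _)
        _ ≤ _ := by
          have : (2:ℝ) ^ (p - 1) ≤ 2 ^ p := Real.rpow_le_rpow_of_exponent_le (by norm_num) (by linarith)
          gcongr
    calc _ ≤ 2 ^ p * (|k - k₀| ^ (p - 1) + |u y - k₀| ^ (p - 1)) * kap n p q s t c y := by gcongr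
      _ = _ := by ring
  have hsub : (ball c (2 * r))ᶜ ⊆ ((ball c (2 * r))ᶜ ∩ ball c r₀) ∪ (ball c r₀)ᶜ := by
    intro y hy
    by_cases hy2 : y ∈ ball c r₀
    · exact Or.inl ⟨hy, hy2⟩
    · exact Or.inr hy2
  refine ((lintegral_mono_set hsub).trans ((lintegral_union_le _ _ _).trans
    (add_ofR (by positivity) (by positivity) (tail_near h hE hℓ hr01 hr hrr hC) f))).trans (le_of_eq ?_)
  congr 1
  unfold C54
  rw [← hσ, ← hEdef]
  ring
end

def tauEx (n : ℕ) (p s ε : ℝ) : ℝ := (s + ε) - ε * p / etaEx n p s ε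

section
variable {n : ℕ} {p q s t M Λ r δ ε ℓ ϱ₀ r₀ : ℝ} {a : En n × En n → ℝ} {u f : En n → ℝ} {c x₀ : En n} {k : ℝ}

lemma eta_den (h : Dat n p q s t M Λ a u f δ) (hE : Eps n p q s t ε) :
    0 < (n:ℝ) + ε * p ∧ 0 < (n:ℝ) + s * p + ε * p := by
  have := h.sp
  have h2 := mul_pos hE.h0 h.p0
  have hn : (0:ℝ) ≤ n := by positivity
  constructor <;> linarith

lemma eta_eq (n : ℕ) (p s ε : ℝ) : etaEx n p s ε = p * ((n:ℝ) + ε * p) / ((n:ℝ) + s * p + ε * p) := by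
  unfold etaEx; congr 1; ring

lemma eta_mul (h : Dat n p q s t M Λ a u f δ) (hE : Eps n p q s t ε) :
    ((n:ℝ) + s * p + ε * p) * (etaEx n p s ε / p) = (n:ℝ) + ε * p := by
  obtain ⟨h1, h2⟩ := eta_den h hE
  have hp := h.p0
  have h2' := h2.ne'
  rw [eta_eq]
  generalize (n:ℝ) + s * p + ε * p = X at *
  generalize (n:ℝ) + ε * p = Y at *
  field_simp

lemma eta_one (h : Dat n p q s t M Λ a u f δ) (hE : Eps n p q s t ε) : 1 < etaEx n p s ε := by
  obtain ⟨h1, h2⟩ := eta_den h hE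
  rw [eta_eq, lt_div_iff₀ h2]
  have hp := h.hp
  have h3 := h.hspn
  have h4 := mul_pos hE.h0 h.p0
  nlinarith

lemma eta_lt (h : Dat n p q s t M Λ a u f δ) (hE : Eps n p q s t ε) : etaEx n p s ε < p := by
  obtain ⟨h1, h2⟩ := eta_den h hE
  rw [eta_eq, div_lt_iff₀ h2]
  have hp := h.p0
  have h4 := h.sp
  nlinarith

lemma tau_pos (h : Dat n p q s t M Λ a u f δ) (hE : Eps n p q s t ε) : 0 < tauEx n p s ε := by
  obtain ⟨h1, h2⟩ := eta_den h hE
  have h3 := eta_one h hE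
  unfold tauEx
  rw [sub_pos, div_lt_iff₀ (by linarith), eta_eq, ← mul_div_assoc, lt_div_iff₀ h2]
  have h4 := mul_pos hE.h0 h.p0
  have h5 : 0 < s * p * n := mul_pos h.sp (by have := h.n0; positivity)
  nlinarith

lemma tau_eta (h : Dat n p q s t M Λ a u f δ) (hE : Eps n p q s t ε) :
    tauEx n p s ε * etaEx n p s ε = (s + ε) * etaEx n p s ε - ε * p := by
  have h3 := eta_one h hE
  unfold tauEx
  rw [sub_mul, div_mul_cancel₀ _ (by linarith)]

lemma tau_bal (h : Dat n p q s t M Λ a u f δ) (hE : Eps n p q s t ε) :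
    (n:ℝ) / p + tauEx n p s ε = n / etaEx n p s ε := by
  obtain ⟨h1, h2⟩ := eta_den h hE
  have hp := h.p0
  unfold tauEx
  rw [eta_eq]
  have h2' := h2.ne'
  have h1' := h1.ne'
  rw [div_div_eq_mul_div, div_div_eq_mul_div, div_add' _ _ _ hp.ne', div_eq_div_iff hp.ne' (mul_ne_zero hp.ne' h1'), sub_mul]
  have e : ε * p * ((n:ℝ) + s * p + ε * p) / (p * ((n:ℝ) + ε * p)) * (p * ((n:ℝ) + ε * p)) = ε * p * ((n:ℝ) + s * p + ε * p) := 
    div_mul_cancel₀ _ (mul_ne_zero hp.ne' h1')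
  linear_combination (-p) * e

lemma fint (h : Dat n p q s t M Λ a u f δ) {P : ℝ} (hP : 0 ≤ P) (hPδ : P ≤ δ) (c : En n) (R : ℝ) :
    ∫⁻ x in ball c R, ENNReal.ofReal (|f x| ^ P) < ⊤ := by
  have hm : Measurable fun x => ENNReal.ofReal (|f x| ^ δ) := (h.hf.norm.pow_const _).ennreal_ofReal
  calc ∫⁻ x in ball c R, ENNReal.ofReal (|f x| ^ P) ≤ ∫⁻ x in ball c R, (ENNReal.ofReal (|f x| ^ δ) + 1) := by
        refine lintegral_mono fun x => ?_
        rw [show (1:ℝ≥0∞) = ENNReal.ofReal 1 by simp, ← ENNReal.ofReal_add (by positivity) (by norm_num)]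
        refine ENNReal.ofReal_le_ofReal ?_
        rcases le_total 1 |f x| with h1 | h1
        · have := Real.rpow_le_rpow_of_exponent_le h1 hPδ
          linarith
        · have := Real.rpow_le_one (abs_nonneg _) h1 hP
          have : 0 ≤ |f x| ^ δ := by positivity
          linarith
    _ = (∫⁻ x in ball c R, ENNReal.ofReal (|f x| ^ δ)) + volume (ball c R) := by
        rw [lintegral_add_left hm]; simp
    _ < ⊤ := ENNReal.add_lt_top.2 ⟨(setLIntegral_le_lintegral _ _).trans_lt h.hfδ, measure_ball_lt_top⟩

lemma alt_real {E W C C' F p : ℝ} (hp : 1 ≤ p) (hE : 0 < E) (hW : 0 ≤ W) (hC : 0 < C) (hC' : 0 ≤ C')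
    (hle : E ≤ C * (W + C' * (E ^ ((p - 1) / p) * W ^ (1 / p)) + F)) :
    E ≤ (1 + 4 * C + (4 * C * C') ^ p) * W ∨ E ≤ 2 * C * F := by
  by_contra hcon
  push Not at hcon
  obtain ⟨h1, h2⟩ := hcon
  have hp0 : 0 < p := by linarith
  set D := 1 + 4 * C + (4 * C * C') ^ p with hD
  have hX0 : 0 ≤ (4 * C * C') ^ p := by positivity
  have hD1 : 0 < D := by linarith
  have hWE : W ≤ E / D := by rw [le_div_iff₀ hD1]; linarith
  have a1 : C * W ≤ E / 4 := by
    have : 4 * C * W ≤ D * W := mul_le_mul_of_nonneg_right (by linarith) hW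
    linarith
  have a2 : C * (C' * (E ^ ((p - 1) / p) * W ^ (1 / p))) ≤ E / 4 := by
    have b1 : (4 * C * C') ≤ D ^ (1 / p) := by
      have : ((4 * C * C') ^ p) ^ (1 / p) ≤ D ^ (1 / p) := Real.rpow_le_rpow hX0 (by linarith) (by positivity)
      rwa [← Real.rpow_mul (by positivity), mul_one_div_cancel hp0.ne', Real.rpow_one] at this
    have b2 : (D * W) ^ (1 / p) ≤ E ^ (1 / p) := Real.rpow_le_rpow (by positivity) h1.le (by positivity)
    rw [Real.mul_rpow hD1.le hW] at b2
    have b3 : E ^ ((p - 1) / p) * E ^ (1 / p) = E := by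
      rw [← Real.rpow_add hE, ← add_div]; simp [hp0.ne']
    have b4 : 4 * C * C' * W ^ (1 / p) ≤ E ^ (1 / p) := le_trans (mul_le_mul_of_nonneg_right b1 (by positivity)) b2
    have b5 : E ^ ((p - 1) / p) * (4 * C * C' * W ^ (1 / p)) ≤ E := by
      calc _ ≤ E ^ ((p - 1) / p) * E ^ (1 / p) := mul_le_mul_of_nonneg_left b4 (by positivity)
        _ = E := b3
    linarith
  nlinarith

end

lemma exit_alt (n : ℕ) (p q s t M Λ : ℝ) : ∃ C1 : ℝ, 1 ≤ C1 ∧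
    ∀ {a : En n × En n → ℝ} {u f : En n → ℝ} {δ : ℝ}, Dat n p q s t M Λ a u f δ →
    ∀ {ε ℓ ϱ₀ r₀ r : ℝ} {x₀ c : En n}, Eps n p q s t ε → Lev n p q s t ε ℓ u x₀ ϱ₀ r₀ →
      c ∈ ball x₀ (3 / 2 * ϱ₀) → 0 < r → 80 * r ≤ r₀ →
      (∀ ρ, r ≤ ρ → ρ ≤ r₀ → Cnd n p s ε ℓ u c ρ) →
      ENNReal.ofReal (ℓ ^ p * r ^ ((n:ℝ) + ε * p)) ≤ eB n p s u c r →
      ENNReal.ofReal (ℓ ^ etaEx n p s ε * r ^ ((n:ℝ) + ε * p)) ≤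
        ENNReal.ofReal C1 * ee n (etaEx n p s ε) (tauEx n p s ε) u (ball c (2 * r) ×ˢ ball c (2 * r)) ∨
      ℓ ^ p * r ^ ((n:ℝ) + ε * p) ≤
        C1 * (∫⁻ x in ball c (2 * r), ENNReal.ofReal (|f x| ^ pStar n p s)).toReal ^ (pC p / pStar n p s) := by
  obtain ⟨C, hC, hcacc⟩ := cacc n p q s t M Λ
  set C' := (om n * 2 ^ (n:ℝ)) ^ (1 - 1 / p) * |C54 n p q s t| with hC'
  have hom := om_pos n
  have hC'0 : 0 ≤ C' := by positivity
  set D := 1 + 4 * C + (4 * C * C') ^ p with hD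
  have hD1 : 1 ≤ D := by
    have : 0 ≤ (4 * C * C') ^ p := by positivity
    linarith
  refine ⟨max (D * (2 * (2 * c1 n)) ^ p) (max (2 * C) 1), le_max_of_le_right (le_max_right _ _), ?_⟩
  intro a u f δ h ε ℓ ϱ₀ r₀ r x₀ c hE hL hc hr hrr hCnd hex
  have hp := h.hp
  have hp0 := h.p0
  have hum := h.hW.1
  have hsp := h.sp
  have hℓ := hL.hℓ
  have hr01 : r₀ ≤ 1 := by have := hL.hr0ϱ; have := hL.hϱ1; linarith
  have hr1 : r ≤ 1 := by linarith
  have hη1 := eta_one h hE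
  have hηp := eta_lt h hE
  set η := etaEx n p s ε with hη
  set k := av n u c (2 * r) with hk
  set Ei := ℓ ^ p * r ^ ((n:ℝ) + ε * p) with hEi
  have hEi0 : 0 < Ei := by positivity
  have hVfin : VV n u k c r p ≤ ENNReal.ofReal (C50 n p s * (ℓ ^ p * (2 * r) ^ ((n:ℝ) + (s + ε) * p))) :=
    near_p h.n0 h.p1 h.hs0 hE.h0 hℓ.le hum h.hb (by positivity) le_rfl
      (fun ρ h1 h2 => hCnd ρ (by linarith) (by linarith))
  have hVt : VV n u k c r p ≠ ⊤ := (hVfin.trans_lt ENNReal.ofReal_lt_top).ne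
  set V := (VV n u k c r p).toReal with hV
  have hV0 : 0 ≤ V := ENNReal.toReal_nonneg
  have hVeq : ENNReal.ofReal V = VV n u k c r p := ENNReal.ofReal_toReal hVt
  have hN : VV n u k c r 1 ≤ ENNReal.ofReal ((om n * (2 * r) ^ (n:ℝ)) ^ (1 - 1 / p) * V ^ (1 / p)) :=
    pow_jen h.n0 (hum.sub_const k) one_pos (by linarith) (by positivity) hV0 hVeq.ge
  have hT : TT n p q s t u k c r ≤ ENNReal.ofReal (|C54 n p q s t| * (ℓ ^ (p - 1) * r ^ ((s + ε) * (p - 1) - s * p))) := by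
    refine le_ofR (tail_bd h hE hL hc hr (by linarith) (fun ρ h1 h2 => hCnd ρ (by linarith) h2)) ?_
    have := le_abs_self (C54 n p q s t)
    gcongr
  have hps := pStar_one h.hp h.hn h.hs0 h.hspn
  have hFt := fint h (P := pStar n p s) (by linarith) h.hδ.le c (2 * r)
  set Fr := (∫⁻ x in ball c (2 * r), ENNReal.ofReal (|f x| ^ pStar n p s)).toReal with hFr
  have hF0 : 0 ≤ Fr := ENNReal.toReal_nonneg
  have hFe := ENNReal.ofReal_toReal hFt.ne
  have hcc := hcacc h c r k V _ _ Fr hr hr1 hV0 (by positivity) (by positivity) hF0 hVeq.ge hN hT hFe.ge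
  have hcr := (ENNReal.ofReal_le_ofReal_iff (by positivity)).1 (hex.trans hcc)
  have key : (om n * (2 * r) ^ (n:ℝ)) ^ (1 - 1 / p) * V ^ (1 / p) * (|C54 n p q s t| * (ℓ ^ (p - 1) * r ^ ((s + ε) * (p - 1) - s * p)))
      = C' * (Ei ^ ((p - 1) / p) * (r ^ (-(s * p)) * V) ^ (1 / p)) := by
    rw [hC', hEi, Real.mul_rpow (x := 2) (by norm_num) hr.le, ← mul_assoc (om n), Real.mul_rpow (x := om n * 2 ^ (n:ℝ)) (by positivity) (by positivity),
      Real.mul_rpow (x := ℓ ^ p) (by positivity) (by positivity), Real.mul_rpow (x := r ^ (-(s * p))) (by positivity) hV0,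
      ← Real.rpow_mul hℓ.le, ← Real.rpow_mul hr.le, ← Real.rpow_mul hr.le, ← Real.rpow_mul hr.le,
      show p * ((p - 1) / p) = p - 1 by field_simp]
    have : r ^ ((n:ℝ) * (1 - 1 / p)) * r ^ ((s + ε) * (p - 1) - s * p) = r ^ (((n:ℝ) + ε * p) * ((p - 1) / p)) * r ^ (-(s * p) * (1 / p)) := by
      rw [← Real.rpow_add hr, ← Real.rpow_add hr]; congr 1; field_simp; ring
    linear_combination (om n * 2 ^ (n:ℝ)) ^ (1 - 1 / p) * V ^ (1 / p) * |C54 n p q s t| * ℓ ^ (p - 1) * this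
  rw [key] at hcr
  rcases alt_real h.p1 hEi0 (by positivity) hC hC'0 hcr with hA | hB
  · left
    have hsob := sob_ball h.n0 hη1.le h.p1 (tau_pos h hE) (tau_bal h hE) hum h.hb c (R := 2 * r) (by positivity)
    have e1 : ENNReal.ofReal (ℓ ^ η * r ^ ((n:ℝ) + ε * p)) ≤ ENNReal.ofReal D * (VV n u k c r p) ^ (η / p) := by
      rw [← hVeq, ENNReal.ofReal_rpow_of_nonneg hV0 (by positivity), ← ENNReal.ofReal_mul (by linarith)]
      refine ENNReal.ofReal_le_ofReal ?_
      have e2 : (Ei * r ^ (s * p)) ≤ D * V := by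
        calc Ei * r ^ (s * p) ≤ D * (r ^ (-(s * p)) * V) * r ^ (s * p) := by gcongr
          _ = D * V * (r ^ (-(s * p)) * r ^ (s * p)) := by ring
          _ = D * V := by rw [← Real.rpow_add hr]; simp
      have e3 : (Ei * r ^ (s * p)) ^ (η / p) ≤ (D * V) ^ (η / p) := Real.rpow_le_rpow (by positivity) e2 (by positivity)
      have e4 : (Ei * r ^ (s * p)) ^ (η / p) = ℓ ^ η * r ^ ((n:ℝ) + ε * p) := by
        rw [hEi, mul_assoc, ← Real.rpow_add hr, Real.mul_rpow (by positivity) (by positivity), ← Real.rpow_mul hℓ.le, ← Real.rpow_mul hr.le,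
          show ((n:ℝ) + ε * p + s * p) * (η / p) = (n:ℝ) + ε * p by have := eta_mul h hE; rw [← hη] at this; linarith, mul_div_cancel₀ _ hp0.ne']
      rw [e4, Real.mul_rpow (by linarith) hV0] at e3
      refine e3.trans ?_
      have : D ^ (η / p) ≤ D := by
        conv_rhs => rw [← Real.rpow_one D]
        exact Real.rpow_le_rpow_of_exponent_le hD1 (by rw [div_le_one hp0]; exact hηp.le)
      gcongr
    refine e1.trans ((mul_le_mul' le_rfl hsob).trans ?_)
    rw [← mul_assoc, ← ENNReal.ofReal_mul (by linarith)]
    exact mul_le_mul' (ENNReal.ofReal_le_ofReal (le_max_left _ _)) le_rfl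
  · right
    refine hB.trans ?_
    have : 2 * C ≤ max (D * (2 * (2 * c1 n)) ^ p) (max (2 * C) 1) := le_max_of_le_right (le_max_left _ _)
    gcongr

section
open Filter Topology

section
variable {n : ℕ} {p q s t M Λ r δ ε ℓ ϱ₀ r₀ β d : ℝ} {a : En n × En n → ℝ} {u f : En n → ℝ} {c c' x x₀ : En n} {k : ℝ}

lemma cnd_big (h : Dat n p q s t M Λ a u f δ) (hE : Eps n p q s t ε) (hL : Lev n p q s t ε ℓ u x₀ ϱ₀ r₀)
    (hc : c ∈ ball x₀ (3 / 2 * ϱ₀)) {ρ : ℝ} (h1 : r₀ / 80 ≤ ρ) (h2 : ρ ≤ r₀) : Cnd n p s ε ℓ u c ρ := by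
  have hr0 := hL.hr0
  have hℓ := hL.hℓ
  have hsub := ball_sub2 (r₀ := ρ) (h2.trans hL.hr0ϱ) hc
  refine (eB_mono p s u hsub).trans (hL.h1a.le.trans (ENNReal.ofReal_le_ofReal ?_))
  have := (eta_den h hE).1.le
  gcongr

lemma exit_exists (h : Dat n p q s t M Λ a u f δ) (hE : Eps n p q s t ε) (hL : Lev n p q s t ε ℓ u x₀ ϱ₀ r₀)
    (hc : c ∈ ball x₀ (3 / 2 * ϱ₀)) (hbad : ∃ ρ, 0 < ρ ∧ ρ ≤ r₀ ∧ ¬ Cnd n p s ε ℓ u c ρ) :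
    ∃ R, 0 < R ∧ 80 * R ≤ r₀ ∧ (∀ ρ, R ≤ ρ → ρ ≤ r₀ → Cnd n p s ε ℓ u c ρ) ∧
      ENNReal.ofReal (ℓ ^ p * R ^ ((n:ℝ) + ε * p)) ≤ eB n p s u c R := by
  have hr0 := hL.hr0
  have hN := (eta_den h hE).1
  set S := {ρ | 0 < ρ ∧ ρ ≤ r₀ ∧ ¬ Cnd n p s ε ℓ u c ρ} with hS
  have hne : S.Nonempty := hbad
  have hub : ∀ ρ ∈ S, ρ ≤ r₀ / 80 := by
    intro ρ hρ
    by_contra hcon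
    exact hρ.2.2 (cnd_big h hE hL hc (not_le.1 hcon).le hρ.2.1)
  have hbdd : BddAbove S := ⟨_, hub⟩
  set R := sSup S with hR
  have hRpos : 0 < R := by
    obtain ⟨ρ, hρ⟩ := hne
    exact hρ.1.trans_le (le_csSup hbdd hρ)
  have hRle : R ≤ r₀ / 80 := csSup_le hne hub
  have hcont : Continuous fun ρ : ℝ => ENNReal.ofReal (ℓ ^ p * ρ ^ ((n:ℝ) + ε * p)) :=
    ENNReal.continuous_ofReal.comp ((Real.continuous_rpow_const hN.le).const_mul _)
  have hgt : ∀ ρ, R < ρ → ρ ≤ r₀ → Cnd n p s ε ℓ u c ρ := by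
    intro ρ h1 h2
    by_contra hcon
    exact absurd (le_csSup hbdd (show ρ ∈ S from ⟨hRpos.trans h1, h2, hcon⟩)) (not_le.2 h1)
  refine ⟨R, hRpos, by linarith, ?_, ?_⟩
  · intro ρ h1 h2
    rcases h1.lt_or_eq with h1 | h1
    · exact hgt ρ h1 h2
    · subst h1
      have ht : Tendsto (fun ρ : ℝ => ENNReal.ofReal (ℓ ^ p * ρ ^ ((n:ℝ) + ε * p))) (𝓝[>] R) (𝓝 (ENNReal.ofReal (ℓ ^ p * R ^ ((n:ℝ) + ε * p)))) :=
        hcont.continuousAt.tendsto.mono_left nhdsWithin_le_nhds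
      refine ge_of_tendsto ht ?_
      filter_upwards [Ioo_mem_nhdsGT (show R < r₀ by linarith)] with ρ hρ
      exact (eB_mono p s u (ball_subset_ball hρ.1.le)).trans (hgt ρ hρ.1 hρ.2.le)
  · obtain ⟨v, -, hv, hvS⟩ := exists_seq_tendsto_sSup hne hbdd
    refine le_of_tendsto ((hcont.tendsto R).comp hv) (Eventually.of_forall fun m => ?_)
    have h1 := (hvS m).2.2
    unfold Cnd at h1
    exact (not_le.1 h1).le.trans (eB_mono p s u (ball_subset_ball (le_csSup hbdd (hvS m))))

/-- an anchor: a ball center `c` near `x` and a value `b` compatible with all averages at scales `≳ d` -/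
structure Anch (n : ℕ) (p s ε ℓ : ℝ) (u : En n → ℝ) (x₀ : En n) (ϱ₀ r₀ d : ℝ) (x c : En n) (b : ℝ) : Prop where
  hc : c ∈ ball x₀ (3 / 2 * ϱ₀)
  hd : ‖c - x‖ ≤ d / 3
  hR : ∀ R, (4 / 3 * d ≤ R ∨ R = r₀) → R ≤ r₀ → Cnd n p s ε ℓ u c R ∧ |b - av n u c R| ≤ C4 n p s * (ℓ * R ^ (s + ε))

def C60 (n : ℕ) (p s : ℝ) : ℝ := 8 * (C4 n p s + C0 n p s * 2 ^ (n:ℝ) + C52 n p s)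

lemma C52_pos (n : ℕ) (hp : 1 ≤ p) (hs : 0 < s) : 0 < C52 n p s := by
  have := C0_one n hp hs; unfold C52; positivity

lemma C60_pos (n : ℕ) (hp : 1 ≤ p) (hs : 0 < s) : 0 < C60 n p s := by
  have := C0_one n hp hs
  have := C52_pos n hp hs
  have := C4_pos n hp hs
  unfold C60; positivity

lemma anch_diff (h : Dat n p q s t M Λ a u f δ) (hE : Eps n p q s t ε) (hL : Lev n p q s t ε ℓ u x₀ ϱ₀ r₀)
    {x y c c' : En n} {b b' : ℝ} (hd : 0 < d) (hxy : ‖x - y‖ = d)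
    (hx : Anch n p s ε ℓ u x₀ ϱ₀ r₀ d x c b) (hy : Anch n p s ε ℓ u x₀ ϱ₀ r₀ d y c' b') :
    |b - b'| ≤ C60 n p s * (ℓ * d ^ (s + ε)) := by
  have hℓ := hL.hℓ
  have hr0 := hL.hr0
  have hs0 := h.hs0
  have h0 := C0_one n h.p1 h.hs0
  have h52 := C52_pos n h.p1 h.hs0
  have h4 := C4_pos n h.p1 h.hs0
  have hse : s + ε ≤ 1 := by have := hE.h3; linarith
  have hse0 : 0 ≤ s + ε := by have := hE.h0; linarith
  have hpow : ∀ m : ℝ, 1 ≤ m → (m * d) ^ (s + ε) ≤ m * d ^ (s + ε) := by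
    intro m hm
    rw [Real.mul_rpow (by linarith) hd.le]
    have : m ^ (s + ε) ≤ m := by
      conv_rhs => rw [← Real.rpow_one m]
      exact Real.rpow_le_rpow_of_exponent_le hm hse
    gcongr
  have hP0 : 0 < d ^ (s + ε) := by positivity
  set Q := ℓ * d ^ (s + ε) with hQ
  have hQ0 : 0 < Q := by positivity
  by_cases h4d : 4 * d ≤ r₀
  · obtain ⟨-, a1⟩ := hx.hR (2 * d) (Or.inl (by linarith)) (by linarith)
    obtain ⟨-, a2⟩ := hy.hR (2 * d) (Or.inl (by linarith)) (by linarith)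
    obtain ⟨a3, -⟩ := hx.hR (4 * d) (Or.inl (by linarith)) h4d
    have hcc : dist c' c ≤ 5 / 3 * d := by
      rw [dist_eq_norm]
      have e : c' - c = (c' - y) - (x - y) - (c - x) := by abel
      rw [e]
      have n1 := norm_sub_le ((c' - y) - (x - y)) (c - x)
      have n2 := norm_sub_le (c' - y) (x - y)
      have := hx.hd; have := hy.hd
      linarith
    have b1 := avdiff h.n0 h.p1 h.hs0 hℓ.le h.hW.1 h.hb (c' := c) (ρ' := 2 * d) (by positivity) (by positivity) (by linarith)
      (ball_subset_ball (by linarith)) a3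
    have b2 := avdiff h.n0 h.p1 h.hs0 hℓ.le h.hW.1 h.hb (c' := c') (ρ' := 2 * d) (by positivity) (by positivity) (by linarith)
      (ball_subset_ball' (by linarith)) a3
    have p2 := hpow 2 (by norm_num)
    have p4 := hpow 4 (by norm_num)
    have q2 : C4 n p s * (ℓ * (2 * d) ^ (s + ε)) ≤ C4 n p s * (2 * Q) := by
      have : ℓ * (2 * d) ^ (s + ε) ≤ 2 * Q := by rw [hQ]; nlinarith
      exact mul_le_mul_of_nonneg_left this h4.le
    have q4 : C0 n p s * 2 ^ (n:ℝ) * (ℓ * (4 * d) ^ (s + ε)) ≤ C0 n p s * 2 ^ (n:ℝ) * (4 * Q) := by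
      have : ℓ * (4 * d) ^ (s + ε) ≤ 4 * Q := by rw [hQ]; nlinarith
      exact mul_le_mul_of_nonneg_left this (by positivity)
    have tri : |b - b'| ≤ |b - av n u c (2 * d)| + |av n u c (2 * d) - av n u c (4 * d)| + |av n u c' (2 * d) - av n u c (4 * d)| + |b' - av n u c' (2 * d)| := by
      have e : b - b' = (b - av n u c (2 * d)) + (av n u c (2 * d) - av n u c (4 * d)) - (av n u c' (2 * d) - av n u c (4 * d)) - (b' - av n u c' (2 * d)) := by ring
      rw [e]
      refine (abs_sub _ _).trans (add_le_add_left ((abs_sub _ _).trans (add_le_add_left (abs_add_le _ _) _)) _)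
    have hp1 : 0 ≤ C0 n p s * 2 ^ (n:ℝ) * Q := by positivity
    have hp2 : 0 ≤ C52 n p s * Q := by positivity
    have hp3 : 0 ≤ C4 n p s * Q := by positivity
    unfold C60
    linarith
  · push Not at h4d
    obtain ⟨-, a1⟩ := hx.hR r₀ (Or.inr rfl) le_rfl
    obtain ⟨-, a2⟩ := hy.hR r₀ (Or.inr rfl) le_rfl
    have b1 := k0diff h hL hx.hc
    have b2 := k0diff h hL hy.hc
    have p4 : ℓ * r₀ ^ (s + ε) ≤ 4 * Q := by
      have : r₀ ^ (s + ε) ≤ (4 * d) ^ (s + ε) := Real.rpow_le_rpow hr0.le h4d.le hse0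
      have := hpow 4 (by norm_num)
      rw [hQ]; nlinarith
    have q4 : C4 n p s * (ℓ * r₀ ^ (s + ε)) ≤ C4 n p s * (4 * Q) := mul_le_mul_of_nonneg_left p4 h4.le
    have q5 : C52 n p s * (ℓ * r₀ ^ (s + ε)) ≤ C52 n p s * (4 * Q) := mul_le_mul_of_nonneg_left p4 h52.le
    set k₀ := av n u x₀ (2 * ϱ₀)
    have tri : |b - b'| ≤ |b - av n u c r₀| + |av n u c r₀ - k₀| + |av n u c' r₀ - k₀| + |b' - av n u c' r₀| := by
      have e : b - b' = (b - av n u c r₀) + (av n u c r₀ - k₀) - (av n u c' r₀ - k₀) - (b' - av n u c' r₀) := by ring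
      rw [e]
      refine (abs_sub _ _).trans (add_le_add_left ((abs_sub _ _).trans (add_le_add_left (abs_add_le _ _) _)) _)
    have hp1 : 0 ≤ C0 n p s * 2 ^ (n:ℝ) * Q := by positivity
    unfold C60
    linarith

lemma anch_good (h : Dat n p q s t M Λ a u f δ) (hE : Eps n p q s t ε) (hL : Lev n p q s t ε ℓ u x₀ ϱ₀ r₀)
    (hd : 0 < d) (hx : x ∈ ball x₀ (3 / 2 * ϱ₀)) (hl : LPt n u x) (hg : ∀ ρ, 0 < ρ → ρ ≤ r₀ → Cnd n p s ε ℓ u x ρ) :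
    Anch n p s ε ℓ u x₀ ϱ₀ r₀ d x x (u x) := by
  refine ⟨hx, by simp; positivity, fun R hR hR0 => ?_⟩
  have hRp : 0 < R := by
    rcases hR with h1 | h1
    · linarith
    · rw [h1]; exact hL.hr0
  exact ⟨hg R hRp hR0, tele_pt h.n0 h.p1 h.hs0 hE.h0 hL.hℓ.le h.hW.1 h.hb hRp hl fun ρ h1 h2 => hg ρ h1 (h2.trans hR0)⟩

lemma anch_bad (h : Dat n p q s t M Λ a u f δ) (hE : Eps n p q s t ε) (hL : Lev n p q s t ε ℓ u x₀ ϱ₀ r₀)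
    (hc : c ∈ ball x₀ (3 / 2 * ϱ₀)) (hr : 0 < r) (hrr : 80 * r ≤ r₀) (hC : ∀ ρ, r ≤ ρ → ρ ≤ r₀ → Cnd n p s ε ℓ u c ρ)
    (hxc : x ∈ closedBall c (10 * r)) (hd : 30 * r ≤ d) :
    Anch n p s ε ℓ u x₀ ϱ₀ r₀ d x c (av n u c (40 * r)) := by
  refine ⟨hc, ?_, fun R hR hR0 => ?_⟩
  · rw [mem_closedBall, dist_eq_norm, norm_sub_rev] at hxc
    linarith
  have hRp : 40 * r ≤ R := by
    rcases hR with h1 | h1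
    · linarith
    · rw [h1]; linarith
  exact ⟨hC R (by linarith) hR0, tele h.n0 h.p1 h.hs0 hE.h0 hL.hℓ.le h.hW.1 h.hb (by positivity) hRp
    fun ρ h1 h2 => hC ρ (by linarith) (h2.trans hR0)⟩
end

end

section
open Filter Topology

section
variable {n : ℕ} {p q s t M Λ r δ ε ℓ ϱ₀ r₀ β d : ℝ} {a : En n × En n → ℝ} {u f : En n → ℝ} {c c' x x₀ : En n} {k : ℝ}

/-- the near-ball weight -/
def hh (n : ℕ) (p s : ℝ) (u : En n → ℝ) (c : En n) (r b : ℝ) (z : En n × En n) : ℝ≥0∞ :=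
  (closedBall c (10 * r)).indicator (fun x => ENNReal.ofReal (|u x - b| ^ p)) z.1 *
    ({z : En n × En n | 30 * r ≤ ‖z.1 - z.2‖}.indicator (fun z => ENNReal.ofReal (‖z.1 - z.2‖ ^ (-((n:ℝ) + s * p)))) z)

lemma hh_meas (hu : Measurable u) (c : En n) (r b : ℝ) : Measurable (hh n p s u c r b) := by
  have h1 : Measurable fun z : En n × En n => ‖z.1 - z.2‖ := (measurable_fst.sub measurable_snd).norm
  have h2 : Measurable ((closedBall c (10 * r)).indicator (fun x => ENNReal.ofReal (|u x - b| ^ p))) :=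
    (((hu.sub_const b).norm.pow_const _).ennreal_ofReal).indicator measurableSet_closedBall
  refine (h2.comp measurable_fst).mul (((h1.pow_const _).ennreal_ofReal).indicator (measurableSet_le measurable_const h1))

lemma hh_int (hn : 0 < n) (hsp : 0 < s * p) (hu : Measurable u) (hr : 0 < r) (b : ℝ) {X : ℝ} (hX0 : 0 ≤ X)
    (hX : ∫⁻ y in ball c (40 * r), ENNReal.ofReal (|u y - b| ^ p) ≤ ENNReal.ofReal X) :
    ∫⁻ z, hh n p s u c r b z ≤ ENNReal.ofReal (X * (n * om n * (r ^ (-(s * p)) / (s * p)))) := by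
  have hom := om_pos n
  rw [Measure.volume_eq_prod, lintegral_prod _ (hh_meas hu c r b).aemeasurable]
  have h1 : ∀ x : En n, ∫⁻ y, hh n p s u c r b (x, y) ≤
      (closedBall c (10 * r)).indicator (fun x => ENNReal.ofReal (|u x - b| ^ p)) x * ENNReal.ofReal (n * om n * (r ^ (-(s * p)) / (s * p))) := by
    intro x
    have h1 : Measurable fun y : En n => ‖x - y‖ := (measurable_const.sub measurable_id).norm
    have hs' : MeasurableSet {y : En n | 30 * r ≤ ‖x - y‖} := measurableSet_le measurable_const h1
    have hm : Measurable ({y : En n | 30 * r ≤ ‖x - y‖}.indicator (fun y => ENNReal.ofReal (‖x - y‖ ^ (-((n:ℝ) + s * p))))) :=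
      ((h1.pow_const _).ennreal_ofReal).indicator hs'
    have e : ∫⁻ y, hh n p s u c r b (x, y) = (closedBall c (10 * r)).indicator (fun x => ENNReal.ofReal (|u x - b| ^ p)) x *
        ∫⁻ y, {y : En n | 30 * r ≤ ‖x - y‖}.indicator (fun y => ENNReal.ofReal (‖x - y‖ ^ (-((n:ℝ) + s * p)))) y := by
      rw [← lintegral_const_mul _ hm]
      rfl
    rw [e, lintegral_indicator hs']
    have e2 : {y : En n | 30 * r ≤ ‖x - y‖} = (ball x (30 * r))ᶜ := by
      ext y; simp [dist_eq_norm, norm_sub_rev]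
    rw [e2, ker_out hn x hsp (by positivity)]
    refine mul_le_mul' le_rfl (ENNReal.ofReal_le_ofReal ?_)
    have : (30 * r) ^ (-(s * p)) ≤ r ^ (-(s * p)) := Real.rpow_le_rpow_of_nonpos hr (by linarith) (by linarith)
    gcongr
  refine (lintegral_mono h1).trans ?_
  have hm2 : Measurable ((closedBall c (10 * r)).indicator (fun x => ENNReal.ofReal (|u x - b| ^ p))) :=
    (((hu.sub_const b).norm.pow_const _).ennreal_ofReal).indicator measurableSet_closedBall
  rw [lintegral_mul_const _ hm2, lintegral_indicator measurableSet_closedBall]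
  refine mul_ofR hX0 ((lintegral_mono_set ?_).trans hX) le_rfl
  exact closedBall_subset_ball (by linarith)

def C61 (n : ℕ) (p s : ℝ) : ℝ :=
  40 ^ ((n:ℝ) + p) + 4 ^ p * (2 * (C50 n p s * 40 ^ ((n:ℝ) + p) * (n * om n / (s * p))))

/-- the per-ball majorant -/
def gg (n : ℕ) (p s : ℝ) (u : En n → ℝ) (c : En n) (r : ℝ) (z : En n × En n) : ℝ≥0∞ :=
  (ball c (40 * r) ×ˢ ball c (40 * r)).indicator (fun z => ENNReal.ofReal (|u z.1 - u z.2| ^ p * ‖z.1 - z.2‖ ^ (-((n:ℝ) + s * p)))) z +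
    ENNReal.ofReal (4 ^ p) * (hh n p s u c r (av n u c (40 * r)) z + hh n p s u c r (av n u c (40 * r)) z.swap)

lemma gg_meas (hu : Measurable u) (c : En n) (r : ℝ) : Measurable (gg n p s u c r) :=
  ((kin_meas hu p _).indicator (measurableSet_ball.prod measurableSet_ball)).add
    (((hh_meas hu c r _).add ((hh_meas hu c r _).comp measurable_swap)).const_mul _)

lemma gg_int (h : Dat n p q s t M Λ a u f δ) (hE : Eps n p q s t ε) (hL : Lev n p q s t ε ℓ u x₀ ϱ₀ r₀)
    (hr : 0 < r) (hrr : 80 * r ≤ r₀) (hC : ∀ ρ, r ≤ ρ → ρ ≤ r₀ → Cnd n p s ε ℓ u c ρ) :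
    ∫⁻ z, gg n p s u c r z ≤ ENNReal.ofReal (C61 n p s * (ℓ ^ p * r ^ ((n:ℝ) + ε * p))) := by
  have hum := h.hW.1
  have hℓ := hL.hℓ
  have hp0 := h.p0
  have hsp := h.sp
  have hom := om_pos n
  have hC50 := C50_pos n h.p1 h.hs0
  have m1 := hh_meas (p := p) (s := s) hum c r (av n u c (40 * r))
  have m2 : Measurable fun z : En n × En n => hh n p s u c r (av n u c (40 * r)) z.swap := m1.comp measurable_swap
  have m12 : Measurable fun z : En n × En n => hh n p s u c r (av n u c (40 * r)) z + hh n p s u c r (av n u c (40 * r)) z.swap := m1.add m2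
  have m0 : Measurable fun z => (ball c (40 * r) ×ˢ ball c (40 * r)).indicator (fun z => ENNReal.ofReal (|u z.1 - u z.2| ^ p * ‖z.1 - z.2‖ ^ (-((n:ℝ) + s * p)))) z :=
    (kin_meas hum p _).indicator (measurableSet_ball.prod measurableSet_ball)
  have hn1 := near_p h.n0 h.p1 h.hs0 hE.h0 hℓ.le hum h.hb (c := c) (ρ₁ := 40 * r) (ρ₂ := 40 * r) (by positivity) le_rfl
    (fun ρ h1 h2 => hC ρ (by linarith) (by linarith))
  have hh1 := hh_int h.n0 hsp hum hr (av n u c (40 * r)) (by positivity) hn1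
  unfold gg
  rw [lintegral_add_left m0, lintegral_const_mul _ m12, lintegral_add_left m1, lint_swap _ m1, lintegral_indicator (measurableSet_ball.prod measurableSet_ball)]
  refine le_ofR (add_ofR (by positivity) (by positivity) (hC (40 * r) (by linarith) (by linarith))
    (mul_ofR (by positivity) le_rfl (add_ofR (by positivity) (by positivity) hh1 hh1))) ?_
  have hεp : ε * p ≤ p := by have := hE.h3; have := h.hs0; nlinarith
  have hsεp : (s + ε) * p ≤ p := by have := hE.h3; nlinarith
  have e1 : (40 * r) ^ ((n:ℝ) + ε * p) ≤ 40 ^ ((n:ℝ) + p) * r ^ ((n:ℝ) + ε * p) := by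
    rw [Real.mul_rpow (by norm_num) hr.le]
    have : (40:ℝ) ^ ((n:ℝ) + ε * p) ≤ 40 ^ ((n:ℝ) + p) := Real.rpow_le_rpow_of_exponent_le (by norm_num) (by linarith)
    gcongr
  have e2 : (40 * r) ^ ((n:ℝ) + (s + ε) * p) * r ^ (-(s * p)) ≤ 40 ^ ((n:ℝ) + p) * r ^ ((n:ℝ) + ε * p) := by
    rw [Real.mul_rpow (by norm_num) hr.le, mul_assoc, ← Real.rpow_add hr, show (n:ℝ) + (s + ε) * p + -(s * p) = (n:ℝ) + ε * p by ring]
    have : (40:ℝ) ^ ((n:ℝ) + (s + ε) * p) ≤ 40 ^ ((n:ℝ) + p) := Real.rpow_le_rpow_of_exponent_le (by norm_num) (by linarith)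
    gcongr
  have e3 : C50 n p s * (ℓ ^ p * (40 * r) ^ ((n:ℝ) + (s + ε) * p)) * (n * om n * (r ^ (-(s * p)) / (s * p))) ≤
      (C50 n p s * 40 ^ ((n:ℝ) + p) * (n * om n / (s * p))) * (ℓ ^ p * r ^ ((n:ℝ) + ε * p)) := by
    calc _ = C50 n p s * ℓ ^ p * (n * om n / (s * p)) * ((40 * r) ^ ((n:ℝ) + (s + ε) * p) * r ^ (-(s * p))) := by ring
      _ ≤ C50 n p s * ℓ ^ p * (n * om n / (s * p)) * (40 ^ ((n:ℝ) + p) * r ^ ((n:ℝ) + ε * p)) :=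
          mul_le_mul_of_nonneg_left e2 (by positivity)
      _ = _ := by ring
  have e4 : ℓ ^ p * (40 * r) ^ ((n:ℝ) + ε * p) ≤ ℓ ^ p * (40 ^ ((n:ℝ) + p) * r ^ ((n:ℝ) + ε * p)) :=
    mul_le_mul_of_nonneg_left e1 (by positivity)
  have e5 := mul_le_mul_of_nonneg_left (add_le_add e3 e3) (show (0:ℝ) ≤ 4 ^ p by positivity)
  refine (add_le_add e4 e5).trans (le_of_eq ?_)
  unfold C61
  ring

/-- pointwise domination -/
lemma gg_dom (h : Dat n p q s t M Λ a u f δ) (hE : Eps n p q s t ε) (hL : Lev n p q s t ε ℓ u x₀ ϱ₀ r₀)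
    (hβ : β ≤ 3 / 2 * ϱ₀) {T : Set (En n)} {R : En n → ℝ}
    (hT : ∀ c ∈ T, c ∈ ball x₀ (3 / 2 * ϱ₀) ∧ 0 < R c ∧ 80 * R c ≤ r₀ ∧ ∀ ρ, R c ≤ ρ → ρ ≤ r₀ → Cnd n p s ε ℓ u c ρ)
    (hbad : ∀ x ∈ ball x₀ β, (∃ c ∈ T, x ∈ closedBall c (10 * R c)) ∨ ∀ ρ, 0 < ρ → ρ ≤ r₀ → Cnd n p s ε ℓ u x ρ)
    {z : En n × En n} (hz1 : z.1 ∈ ball x₀ β) (hz2 : z.2 ∈ ball x₀ β) (hl1 : LPt n u z.1) (hl2 : LPt n u z.2)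
    (hU : 2 * C60 n p s * (ℓ * ‖z.1 - z.2‖ ^ (s + ε)) < |u z.1 - u z.2|) :
    ∃ c ∈ T, ENNReal.ofReal (|u z.1 - u z.2| ^ p * ‖z.1 - z.2‖ ^ (-((n:ℝ) + s * p))) ≤ gg n p s u c (R c) z := by
  obtain ⟨x, y⟩ := z
  simp only at hz1 hz2 hl1 hl2 hU ⊢
  have hℓ := hL.hℓ
  have hp0 := h.p0
  have hC60 := C60_pos n h.p1 h.hs0
  have hne : x ≠ y := by
    rintro rfl
    have : 0 ≤ 2 * C60 n p s * (ℓ * ‖x - x‖ ^ (s + ε)) := by positivity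
    simp only [sub_self, abs_zero] at hU this
    linarith
  set d := ‖x - y‖ with hd
  have hd0 : 0 < d := norm_pos_iff.2 (sub_ne_zero.2 hne)
  have hD0 : 0 < |u x - u y| := lt_of_le_of_lt (by positivity) hU
  -- contained case
  have cont : ∀ c, 0 < R c → x ∈ ball c (40 * R c) → y ∈ ball c (40 * R c) →
      ENNReal.ofReal (|u x - u y| ^ p * d ^ (-((n:ℝ) + s * p))) ≤ gg n p s u c (R c) (x, y) := by
    intro c _ h1 h2
    unfold gg
    rw [indicator_of_mem (show (x, y) ∈ ball c (40 * R c) ×ˢ ball c (40 * R c) from ⟨h1, h2⟩)]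
    exact le_self_add
  have hhb : ∀ (x' y' : En n) c, ‖x' - y'‖ = d → x' ∈ closedBall c (10 * R c) → 30 * R c ≤ d →
      |u x - u y| ≤ 4 * |u x' - av n u c (40 * R c)| →
      ENNReal.ofReal (|u x - u y| ^ p * d ^ (-((n:ℝ) + s * p))) ≤ ENNReal.ofReal (4 ^ p) * hh n p s u c (R c) (av n u c (40 * R c)) (x', y') := by
    intro x' y' c hxy h1 h2 h3
    unfold hh
    rw [indicator_of_mem (show (x', y').1 ∈ closedBall c (10 * R c) from h1),
      indicator_of_mem (show (x', y') ∈ {z : En n × En n | 30 * R c ≤ ‖z.1 - z.2‖} from by simp only [mem_ofPred_eq]; rw [hxy]; exact h2)]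
    simp only [hxy]
    rw [← ENNReal.ofReal_mul (by positivity), ← ENNReal.ofReal_mul (by positivity)]
    refine ENNReal.ofReal_le_ofReal ?_
    rw [← mul_assoc, ← Real.mul_rpow (by norm_num) (abs_nonneg _)]
    have := Real.rpow_le_rpow (abs_nonneg _) h3 hp0.le
    gcongr
  -- anchors
  have anc : ∀ x' y' : En n, ‖x' - y'‖ = d → x' ∈ ball x₀ β → LPt n u x' →
      (∃ c ∈ T, x' ∈ ball c (40 * R c) ∧ y' ∈ ball c (40 * R c)) ∨
      ∃ c b, Anch n p s ε ℓ u x₀ ϱ₀ r₀ d x' c b ∧ (u x' - b = 0 ∨ (c ∈ T ∧ x' ∈ closedBall c (10 * R c) ∧ 30 * R c ≤ d ∧ b = av n u c (40 * R c))) := by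
    intro x' y' hxy hx' hl
    rcases hbad x' hx' with ⟨c, hc, hxc⟩ | hg
    · obtain ⟨t1, t2, t3, t4⟩ := hT c hc
      by_cases hcase : d < 30 * R c
      · left
        refine ⟨c, hc, closedBall_subset_ball (by linarith) hxc, ?_⟩
        rw [mem_closedBall] at hxc
        rw [mem_ball]
        have := dist_triangle y' x' c
        rw [dist_comm y' x', dist_eq_norm x' y', hxy] at this
        linarith
      · right
        push Not at hcase
        exact ⟨c, _, anch_bad h hE hL t1 t2 t3 t4 hxc hcase, Or.inr ⟨hc, hxc, hcase, rfl⟩⟩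
    · right
      exact ⟨x', u x', anch_good h hE hL hd0 (ball_subset_ball hβ hx') hl hg, Or.inl (sub_self _)⟩
  have hyx : ‖y - x‖ = d := by rw [hd, norm_sub_rev]
  rcases anc x y hd.symm hz1 hl1 with ⟨c, hc, h1, h2⟩ | ⟨c, b, hA, hb⟩
  · exact ⟨c, hc, cont c (hT c hc).2.1 h1 h2⟩
  rcases anc y x hyx hz2 hl2 with ⟨c, hc, h1, h2⟩ | ⟨c', b', hA', hb'⟩
  · exact ⟨c, hc, cont c (hT c hc).2.1 h2 h1⟩
  have hbb := anch_diff h hE hL hd0 hd.symm hA hA'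
  have tri : |u x - u y| ≤ |u x - b| + |b - b'| + |u y - b'| := by
    have e : u x - u y = (u x - b) + (b - b') - (u y - b') := by ring
    rw [e]
    exact (abs_sub _ _).trans (add_le_add_left (abs_add_le _ _) _)
  have half : |u x - u y| ≤ 2 * (|u x - b| + |u y - b'|) := by linarith
  rcases le_total |u y - b'| |u x - b| with hle | hle
  · rcases hb with h0 | ⟨hc, hxc, hdc, rfl⟩
    · rw [h0, abs_zero] at hle half; linarith
    · refine ⟨c, hc, (hhb x y c hd.symm hxc hdc (by linarith)).trans ?_⟩
      unfold gg
      refine le_trans (mul_le_mul' le_rfl le_self_add) le_add_self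
  · rcases hb' with h0 | ⟨hc, hxc, hdc, rfl⟩
    · rw [h0, abs_zero] at hle half; linarith
    · refine ⟨c', hc, (hhb y x c' hyx hxc hdc (by linarith)).trans ?_⟩
      unfold gg
      refine le_trans (mul_le_mul' le_rfl le_add_self) le_add_self

lemma cover (h : Dat n p q s t M Λ a u f δ) (hE : Eps n p q s t ε) (hL : Lev n p q s t ε ℓ u x₀ ϱ₀ r₀)
    (hβ : β ≤ 3 / 2 * ϱ₀) :
    ∃ (T : Set (En n)) (R : En n → ℝ), T.Countable ∧
      (∀ c ∈ T, c ∈ ball x₀ β ∧ 0 < R c ∧ 80 * R c ≤ r₀ ∧ (∀ ρ, R c ≤ ρ → ρ ≤ r₀ → Cnd n p s ε ℓ u c ρ) ∧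
        ENNReal.ofReal (ℓ ^ p * R c ^ ((n:ℝ) + ε * p)) ≤ eB n p s u c (R c)) ∧
      (T.PairwiseDisjoint fun c => ball c (2 * R c)) ∧
      ∫⁻ z in (ball x₀ β ×ˢ ball x₀ β) ∩ {z | 2 * C60 n p s * (ℓ * ‖z.1 - z.2‖ ^ (s + ε)) < |u z.1 - u z.2|},
        ENNReal.ofReal (|u z.1 - u z.2| ^ p * ‖z.1 - z.2‖ ^ (-((n:ℝ) + s * p))) ≤
        ∑' c : T, ENNReal.ofReal (C61 n p s * (ℓ ^ p * R c ^ ((n:ℝ) + ε * p))) := by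
  classical
  have hum := h.hW.1
  have hr0 := hL.hr0
  set D := {x | x ∈ ball x₀ β ∧ ∃ ρ, 0 < ρ ∧ ρ ≤ r₀ ∧ ¬ Cnd n p s ε ℓ u x ρ} with hD
  have hex : ∀ x, ∃ R, x ∈ D → 0 < R ∧ 80 * R ≤ r₀ ∧ (∀ ρ, R ≤ ρ → ρ ≤ r₀ → Cnd n p s ε ℓ u x ρ) ∧
      ENNReal.ofReal (ℓ ^ p * R ^ ((n:ℝ) + ε * p)) ≤ eB n p s u x R := by
    intro x
    by_cases hx : x ∈ D
    · obtain ⟨R, hR⟩ := exit_exists h hE hL (ball_subset_ball hβ hx.1) hx.2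
      exact ⟨R, fun _ => hR⟩
    · exact ⟨0, fun hx' => absurd hx' hx⟩
  choose R hR using hex
  obtain ⟨T, hTD, hdis, hcov⟩ := Vitali.exists_disjoint_subfamily_covering_enlargement_closedBall D id (fun x => 2 * R x) r₀
    (fun x hx => by have := (hR x hx).2.1; have := (hR x hx).1; linarith) 5 (by norm_num)
  have hdis2 : T.PairwiseDisjoint fun c => ball c (2 * R c) :=
    hdis.mono fun c => ball_subset_closedBall
  have hcount : T.Countable := hdis2.countable_of_nonempty_interior fun c hc => by
    rw [isOpen_ball.interior_eq]
    exact nonempty_ball.2 (by have := (hR c (hTD hc)).1; linarith)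
  have hbad : ∀ x ∈ ball x₀ β, (∃ c ∈ T, x ∈ closedBall c (10 * R c)) ∨ ∀ ρ, 0 < ρ → ρ ≤ r₀ → Cnd n p s ε ℓ u x ρ := by
    intro x hx
    by_cases hxD : x ∈ D
    · left
      obtain ⟨c, hc, hsub⟩ := hcov x hxD
      refine ⟨c, hc, ?_⟩
      have := hsub (mem_closedBall_self (by have := (hR x hxD).1; linarith))
      rwa [show 5 * (2 * R c) = 10 * R c by ring] at this
    · right
      intro ρ h1 h2
      by_contra hcon
      exact hxD ⟨hx, ρ, h1, h2, hcon⟩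
  refine ⟨T, R, hcount, fun c hc => ⟨(hTD hc).1, hR c (hTD hc)⟩, hdis2, ?_⟩
  have := hcount.to_subtype
  have hm : Measurable fun z => ∑' c : T, gg n p s u c (R c) z := Measurable.tsum fun c => gg_meas hum _ _
  have hae1 : ∀ᵐ z : En n × En n, LPt n u z.1 := Measure.quasiMeasurePreserving_fst.ae (ae_LPt hum h.hb)
  have hae2 : ∀ᵐ z : En n × En n, LPt n u z.2 := Measure.quasiMeasurePreserving_snd.ae (ae_LPt hum h.hb)
  calc _ ≤ ∫⁻ z in (ball x₀ β ×ˢ ball x₀ β) ∩ {z | 2 * C60 n p s * (ℓ * ‖z.1 - z.2‖ ^ (s + ε)) < |u z.1 - u z.2|},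
        ∑' c : T, gg n p s u c (R c) z := by
        refine setLIntegral_mono_ae hm.aemeasurable ?_
        filter_upwards [hae1, hae2] with z hl1 hl2 hz
        obtain ⟨c, hc, hle⟩ := gg_dom h hE hL hβ (fun c hc => ⟨ball_subset_ball hβ (hTD hc).1, (hR c (hTD hc)).1, (hR c (hTD hc)).2.1, (hR c (hTD hc)).2.2.1⟩)
          hbad hz.1.1 hz.1.2 hl1 hl2 hz.2
        exact hle.trans (ENNReal.le_tsum (f := fun c : T => gg n p s u c (R c) z) ⟨c, hc⟩)
    _ ≤ ∫⁻ z, ∑' c : T, gg n p s u c (R c) z := setLIntegral_le_lintegral _ _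
    _ = ∑' c : T, ∫⁻ z, gg n p s u c (R c) z := lintegral_tsum fun c => (gg_meas hum _ _).aemeasurable
    _ ≤ _ := ENNReal.tsum_le_tsum fun c => by
        obtain ⟨h1, h2, h3, -⟩ := hR c (hTD c.2)
        exact gg_int h hE hL h1 h2 h3
end

end

section
variable {n : ℕ} {p q s t M Λ r δ ε ℓ ϱ₀ r₀ : ℝ} {a : En n × En n → ℝ} {u f : En n → ℝ} {c x₀ : En n} {k : ℝ}

lemma Ufun_nonneg (z : En n × En n) : 0 ≤ Ufun n s ε u z := by unfold Ufun; positivity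

lemma Ufun_meas (hu : Measurable u) : Measurable (Ufun n s ε u) := by
  unfold Ufun
  have h1 : Measurable fun z : En n × En n => |u z.1 - u z.2| := by fun_prop
  have h2 : Measurable fun z : En n × En n => ‖z.1 - z.2‖ ^ (s + ε) :=
    (measurable_fst.sub measurable_snd).norm.pow_const _
  exact h1.div h2

lemma Afun_nonneg (ha0 : ∀ z, 0 ≤ a z) (z : En n × En n) : 0 ≤ Afun n p q s t ε a z := by
  unfold Afun; have := ha0 z; positivity

lemma Gfun_ge (ha0 : ∀ z, 0 ≤ a z) (z : En n × En n) :
    Ufun n s ε u z ^ p ≤ Gfun n p q s t ε a u z := by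
  have h1 := Afun_nonneg (p := p) (q := q) (s := s) (t := t) (ε := ε) ha0 z
  have h2 := Ufun_nonneg (s := s) (ε := ε) (u := u) z
  unfold Gfun
  have : 0 ≤ Afun n p q s t ε a z * Ufun n s ε u z ^ q := by positivity
  linarith

lemma Gfun_nonneg (ha0 : ∀ z, 0 ≤ a z) (z : En n × En n) : 0 ≤ Gfun n p q s t ε a u z :=
  (Real.rpow_nonneg (Ufun_nonneg z) p).trans (Gfun_ge ha0 z)

lemma Hfun_nonneg (ha0 : ∀ z, 0 ≤ a z) (z : En n × En n) : 0 ≤ Hfun n p q s t ε a u z :=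
  Real.rpow_nonneg (Gfun_nonneg ha0 z) _

lemma Gfun_meas (ha : Measurable a) (hu : Measurable u) : Measurable (Gfun n p q s t ε a u) := by
  have h1 : Measurable (Ufun n s ε u) := Ufun_meas hu
  have h2 : Measurable fun z : En n × En n => ‖z.1 - z.2‖ ^ ((s - t) * q + ε * (q - p)) :=
    (measurable_fst.sub measurable_snd).norm.pow_const _
  have h3 : Measurable (Afun n p q s t ε a) := by unfold Afun; exact ha.mul h2
  unfold Gfun
  exact (h1.pow_const _).add (h3.mul (h1.pow_const _))

lemma Hfun_meas (ha : Measurable a) (hu : Measurable u) : Measurable (Hfun n p q s t ε a u) :=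
  (Gfun_meas ha hu).pow_const _

lemma Hfun_ge (hp : 2 ≤ p) (ha0 : ∀ z, 0 ≤ a z) (z : En n × En n) :
    Ufun n s ε u z ^ (p - 1) ≤ Hfun n p q s t ε a u z := by
  have h1 := Gfun_ge (p := p) (q := q) (s := s) (t := t) (ε := ε) (u := u) ha0 z
  have h2 := Ufun_nonneg (s := s) (ε := ε) (u := u) z
  unfold Hfun
  calc Ufun n s ε u z ^ (p - 1) = (Ufun n s ε u z ^ p) ^ ((p - 1) / p) := by
        rw [← Real.rpow_mul h2]; congr 1; field_simp
    _ ≤ _ := Real.rpow_le_rpow (by positivity) h1 (by apply div_nonneg <;> linarith)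

lemma Hfun_pC (hp : 2 ≤ p) (ha0 : ∀ z, 0 ≤ a z) (z : En n × En n) :
    Hfun n p q s t ε a u z ^ pC p = Gfun n p q s t ε a u z := by
  unfold Hfun pC
  rw [← Real.rpow_mul (Gfun_nonneg ha0 z), show (p - 1) / p * (p / (p - 1)) = 1 by
    have : p - 1 ≠ 0 := by linarith
    field_simp, Real.rpow_one]

def c00 (p q s t M Λ : ℝ) : ℝ := 1 + M * ((2 * Λ) ^ (q - p) * 3 ^ (s * p - t * q))

lemma Dat.c00_one (h : Dat n p q s t M Λ a u f δ) : 1 ≤ c00 p q s t M Λ := by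
  have := h.hM; have := h.hΛ
  unfold c00
  have : 0 ≤ M * ((2 * Λ) ^ (q - p) * 3 ^ (s * p - t * q)) := by positivity
  linarith

lemma Gfun_le (h : Dat n p q s t M Λ a u f δ) (hE : Eps n p q s t ε) {z : En n × En n}
    (hz : ‖z.1 - z.2‖ ≤ 3) :
    Gfun n p q s t ε a u z ≤ c00 p q s t M Λ * Ufun n s ε u z ^ p := by
  have hp0 := h.p0
  have hpq := h.hpq
  have hq0 : 0 < q := by linarith
  have hε := hE.h0
  have hM := h.hM
  have hΛ := h.hΛ
  have htq := h.htq
  unfold Gfun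
  rcases eq_or_lt_of_le (norm_nonneg (z.1 - z.2)) with h0 | h0
  · have hU : Ufun n s ε u z = 0 := by
      unfold Ufun
      rw [eq_of_sub_eq_zero (norm_eq_zero.1 h0.symm)]; simp
    rw [hU, Real.zero_rpow hp0.ne', Real.zero_rpow hq0.ne']; simp
  · set K := ‖z.1 - z.2‖ with hK
    have hD : |u z.1 - u z.2| ≤ 2 * Λ := by
      have h1 := h.hb z.1; have h2 := h.hb z.2
      have := abs_sub (u z.1) (u z.2)
      linarith
    set D := |u z.1 - u z.2| with hDd
    have hD0 : 0 ≤ D := abs_nonneg _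
    have hU0 := Ufun_nonneg (s := s) (ε := ε) (u := u) z
    have hsplit : Ufun n s ε u z ^ q = Ufun n s ε u z ^ (q - p) * Ufun n s ε u z ^ p := by
      rcases eq_or_lt_of_le hU0 with h1 | h1
      · rw [← h1, Real.zero_rpow hq0.ne', Real.zero_rpow hp0.ne']; simp
      · rw [← Real.rpow_add h1]; congr 1; ring
    have hA : Afun n p q s t ε a z * Ufun n s ε u z ^ (q - p) ≤ M * ((2 * Λ) ^ (q - p) * 3 ^ (s * p - t * q)) := by
      unfold Afun Ufun
      rw [← hK, ← hDd, Real.div_rpow hD0 (by positivity), ← Real.rpow_mul h0.le]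
      have e : a z * K ^ ((s - t) * q + ε * (q - p)) * (D ^ (q - p) / K ^ ((s + ε) * (q - p)))
          = a z * (D ^ (q - p) * K ^ (s * p - t * q)) := by
        have : K ^ ((s - t) * q + ε * (q - p)) = K ^ (s * p - t * q) * K ^ ((s + ε) * (q - p)) := by
          rw [← Real.rpow_add h0]; congr 1; ring
        rw [this]
        have : K ^ ((s + ε) * (q - p)) ≠ 0 := by positivity
        field_simp
      rw [e]
      have h1 : D ^ (q - p) ≤ (2 * Λ) ^ (q - p) := Real.rpow_le_rpow hD0 hD (by linarith)
      have h2 : K ^ (s * p - t * q) ≤ 3 ^ (s * p - t * q) := Real.rpow_le_rpow h0.le hz (by linarith)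
      exact mul_le_mul (h.haM z) (mul_le_mul h1 h2 (by positivity) (by positivity)) (by positivity) (by linarith)
    rw [hsplit, ← mul_assoc]
    unfold c00
    rw [add_mul, one_mul]
    have := mul_le_mul_of_nonneg_right hA (Real.rpow_nonneg hU0 p)
    linarith

/-! ### the measure nu -/

lemma nuK_meas : Measurable fun z : En n × En n => ENNReal.ofReal (‖z.1 - z.2‖ ^ (ε * p - n)) :=
  ((measurable_fst.sub measurable_snd).norm.pow_const _).ennreal_ofReal

lemma lint_nu {g : En n × En n → ℝ≥0∞} (hg : Measurable g) {S : Set (En n × En n)} (hS : MeasurableSet S) :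
    ∫⁻ z in S, g z ∂nu n p ε = ∫⁻ z in S, ENNReal.ofReal (‖z.1 - z.2‖ ^ (ε * p - n)) * g z := by
  unfold nu
  rw [setLIntegral_withDensity_eq_setLIntegral_mul _ nuK_meas hg hS]
  rfl

lemma nu_apply {S : Set (En n × En n)} (hS : MeasurableSet S) :
    nu n p ε S = ∫⁻ z in S, ENNReal.ofReal (‖z.1 - z.2‖ ^ (ε * p - n)) := by
  unfold nu; rw [withDensity_apply _ hS]

lemma Ufun_ker {P σ : ℝ} (hP : 0 < P) (hσ : σ * P = (s + ε) * P - ε * p) (z : En n × En n) :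
    ‖z.1 - z.2‖ ^ (ε * p - n) * Ufun n s ε u z ^ P =
      |u z.1 - u z.2| ^ P * ‖z.1 - z.2‖ ^ (-((n:ℝ) + σ * P)) := by
  rcases eq_or_lt_of_le (norm_nonneg (z.1 - z.2)) with h0 | h0
  · have h1 := eq_of_sub_eq_zero (norm_eq_zero.1 h0.symm)
    have hU : Ufun n s ε u z = 0 := by unfold Ufun; rw [h1]; simp
    rw [hU, h1, Real.zero_rpow hP.ne']; simp [Real.zero_rpow hP.ne']
  · unfold Ufun
    rw [Real.div_rpow (abs_nonneg _) (by positivity), ← Real.rpow_mul h0.le, div_eq_mul_inv, ← Real.rpow_neg h0.le,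
      mul_left_comm, ← Real.rpow_add h0]
    congr 2; linarith

lemma ee_eq {P σ : ℝ} (hP : 0 < P) (hσ : σ * P = (s + ε) * P - ε * p) (hu : Measurable u)
    {S : Set (En n × En n)} (hS : MeasurableSet S) :
    ee n P σ u S = ∫⁻ z in S, ENNReal.ofReal (Ufun n s ε u z ^ P) ∂nu n p ε := by
  rw [lint_nu ((Ufun_meas hu).pow_const _).ennreal_ofReal hS]
  unfold ee
  refine lintegral_congr fun z => ?_
  rw [← ENNReal.ofReal_mul (by positivity), Ufun_ker hP hσ]

lemma bB_meas (c : En n) (R : ℝ) : MeasurableSet (bB n c R) := measurableSet_ball.prod measurableSet_ball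

lemma eB_eq (hp : 2 ≤ p) (hu : Measurable u) (c : En n) (R : ℝ) :
    eB n p s u c R = ∫⁻ z in bB n c R, ENNReal.ofReal (Ufun n s ε u z ^ p) ∂nu n p ε :=
  ee_eq (by linarith) (by ring) hu (bB_meas c R)

lemma Dat.epsp (_h : Dat n p q s t M Λ a u f δ) (hE : Eps n p q s t ε) : ε * p < s := by
  have := _h.p0
  have := hE.h1
  rwa [lt_div_iff₀ (by positivity)] at this

lemma Dat.eps1 (h : Dat n p q s t M Λ a u f δ) (hE : Eps n p q s t ε) : ε < 1 := by
  have := hE.h3; have := h.hs0; linarith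

def C71 (n : ℕ) : ℝ := 1 + 2 * n * om n ^ 2

lemma C71_one (n : ℕ) : 1 ≤ C71 n := by unfold C71; have := om_pos n; have : 0 ≤ 2 * n * om n ^ 2 := by positivity
                                        linarith

lemma nu_le (h : Dat n p q s t M Λ a u f δ) (hE : Eps n p q s t ε) (c : En n) {R : ℝ} (hR : 0 < R) :
    nu n p ε (bB n c R) ≤ ENNReal.ofReal (C71 n * R ^ ((n:ℝ) + ε * p) / ε) := by
  have hp := h.hp
  have hp0 := h.p0
  have hε := hE.h0
  have hom := om_pos n
  have hs1 := h.hs1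
  have hεp : ε * p < s := h.epsp hE
  have hn : (0:ℝ) < n := by exact_mod_cast h.n0
  rw [nu_apply (bB_meas c R)]
  unfold bB
  rw [Measure.volume_eq_prod, ← Measure.prod_restrict,
    lintegral_prod _ nuK_meas.aemeasurable]
  calc ∫⁻ x in ball c R, ∫⁻ y in ball c R, ENNReal.ofReal (‖x - y‖ ^ (ε * p - n))
      ≤ ∫⁻ x in ball c R, ENNReal.ofReal (n * om n * ((2 * R) ^ (ε * p) / (ε * p))) := by
        refine setLIntegral_mono measurable_const fun x hx => ?_
        rw [← ker_in h.n0 x (by positivity) (by positivity : 0 < 2 * R)]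
        refine lintegral_mono_set fun y hy => ?_
        rw [mem_ball] at *
        have := dist_triangle_right y x c
        linarith
    _ = ENNReal.ofReal (n * om n * ((2 * R) ^ (ε * p) / (ε * p))) * ENNReal.ofReal (om n * R ^ (n:ℝ)) := by
        rw [setLIntegral_const, vol_ball c hR.le h.n0]
    _ ≤ _ := by
        rw [← ENNReal.ofReal_mul (by positivity)]
        apply ENNReal.ofReal_le_ofReal
        rw [Real.mul_rpow (by norm_num) hR.le, Real.rpow_add hR]
        have h2 : (2:ℝ) ^ (ε * p) ≤ 2 := by
          calc (2:ℝ) ^ (ε * p) ≤ 2 ^ (1:ℝ) := Real.rpow_le_rpow_of_exponent_le (by norm_num) (by linarith)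
            _ = 2 := Real.rpow_one _
        have h3 : 1 / (ε * p) ≤ 1 / ε := by
          apply one_div_le_one_div_of_le hε; nlinarith
        calc n * om n * (2 ^ (ε * p) * R ^ (ε * p) / (ε * p)) * (om n * R ^ (n:ℝ))
            = (n * om n ^ 2 * (R ^ (n:ℝ) * R ^ (ε * p))) * (2 ^ (ε * p) * (1 / (ε * p))) := by ring
          _ ≤ (n * om n ^ 2 * (R ^ (n:ℝ) * R ^ (ε * p))) * (2 * (1 / ε)) := by gcongr
          _ ≤ _ := by
              unfold C71
              rw [div_eq_mul_one_div (_ * _) ε]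
              have : 0 ≤ (R ^ (n:ℝ) * R ^ (ε * p)) * (1 / ε) := by positivity
              nlinarith

lemma nu_lt_top (h : Dat n p q s t M Λ a u f δ) (hE : Eps n p q s t ε) (c : En n) {R : ℝ} (hR : 0 < R) :
    nu n p ε (bB n c R) < ⊤ := (nu_le h hE c hR).trans_lt ENNReal.ofReal_lt_top

/-- slice lower bound -/
lemma slice_ge (h : Dat n p q s t M Λ a u f δ) (hE : Eps n p q s t ε) (c : En n) {R : ℝ} (hR : 0 < R)
    {x : En n} (hx : x ∈ ball c R) :
    ENNReal.ofReal (om n * 2 ^ (-(n:ℝ)) * R ^ (ε * p)) ≤ ∫⁻ y in ball c R, ENNReal.ofReal (‖x - y‖ ^ (ε * p - n)) := by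
  have hp := h.hp
  have hp0 := h.p0
  have hε := hE.h0
  have hom := om_pos n
  have hs1 := h.hs1
  have hεp : ε * p < s := h.epsp hE
  have hn : (2:ℝ) ≤ n := by exact_mod_cast h.hn
  have hN : ∀ᵐ y ∂(volume.restrict (ball c R)), y ≠ x := by
    have : NeZero n := ⟨h.n0.ne'⟩
    have : Nontrivial (En n) := by
      have : Nonempty (Fin n) := ⟨⟨0, h.n0⟩⟩
      infer_instance
    exact ae_restrict_of_ae (by
      rw [ae_iff]; simp only [not_not]
      exact measure_singleton x)
  calc ENNReal.ofReal (om n * 2 ^ (-(n:ℝ)) * R ^ (ε * p))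
      ≤ ENNReal.ofReal ((2 * R) ^ (ε * p - n)) * ENNReal.ofReal (om n * R ^ (n:ℝ)) := by
        rw [← ENNReal.ofReal_mul (by positivity)]
        apply ENNReal.ofReal_le_ofReal
        rw [Real.mul_rpow (by norm_num) hR.le]
        have e1 : R ^ (ε * p - n) * R ^ (n:ℝ) = R ^ (ε * p) := by
          rw [← Real.rpow_add hR]; congr 1; ring
        have e2 : (2:ℝ) ^ (-(n:ℝ)) ≤ 2 ^ (ε * p - n) :=
          Real.rpow_le_rpow_of_exponent_le (by norm_num) (by have : 0 ≤ ε * p := by positivity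
                                                             linarith)
        calc om n * 2 ^ (-(n:ℝ)) * R ^ (ε * p) ≤ om n * 2 ^ (ε * p - n) * R ^ (ε * p) := by gcongr
          _ = _ := by rw [← e1]; ring
    _ = ∫⁻ y in ball c R, ENNReal.ofReal ((2 * R) ^ (ε * p - n)) := by
        rw [setLIntegral_const, vol_ball c hR.le h.n0]
    _ ≤ _ := by
        refine lintegral_mono_ae ?_
        filter_upwards [hN, ae_restrict_mem measurableSet_ball] with y hy hyb
        apply ENNReal.ofReal_le_ofReal
        refine Real.rpow_le_rpow_of_nonpos (norm_pos_iff.2 (sub_ne_zero.2 hy.symm)) ?_ (by linarith)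
        rw [mem_ball] at *
        have := dist_triangle_right x y c
        rw [← dist_eq_norm]
        linarith

lemma nu_pos (h : Dat n p q s t M Λ a u f δ) (hE : Eps n p q s t ε) (c : En n) {R : ℝ} (hR : 0 < R) :
    0 < nu n p ε (bB n c R) := by
  have hom := om_pos n
  rw [nu_apply (bB_meas c R)]
  unfold bB
  rw [Measure.volume_eq_prod, ← Measure.prod_restrict,
    lintegral_prod _ nuK_meas.aemeasurable]
  calc 0 < ENNReal.ofReal (om n * 2 ^ (-(n:ℝ)) * R ^ (ε * p)) * ENNReal.ofReal (om n * R ^ (n:ℝ)) := by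
        refine ENNReal.mul_pos ?_ ?_ <;>
        · rw [Ne, ENNReal.ofReal_eq_zero, not_le]; positivity
    _ = ∫⁻ x in ball c R, ENNReal.ofReal (om n * 2 ^ (-(n:ℝ)) * R ^ (ε * p)) := by
        rw [setLIntegral_const, vol_ball c hR.le h.n0]
    _ ≤ _ := by
        refine lintegral_mono_ae ?_
        filter_upwards [ae_restrict_mem measurableSet_ball] with x hx
        exact slice_ge h hE c hR hx

/-- global finiteness of the energy against nu -/
lemma Gnu_fin (h : Dat n p q s t M Λ a u f δ) (hE : Eps n p q s t ε) :
    ∫⁻ z, ENNReal.ofReal (Gfun n p q s t ε a u z) ∂nu n p ε < ⊤ := by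
  have hp0 := h.p0
  have hq0 : 0 < q := by have := h.hpq; linarith
  have hm := Gfun_meas (p := p) (q := q) (s := s) (t := t) (ε := ε) h.ha h.hW.1
  have e := lint_nu (n := n) (p := p) (ε := ε) hm.ennreal_ofReal MeasurableSet.univ
  rw [setLIntegral_univ, setLIntegral_univ] at e
  rw [e]
  refine lt_of_le_of_lt (lintegral_mono fun z => ?_) h.hw.1
  rw [← ENNReal.ofReal_mul (by positivity)]
  apply ENNReal.ofReal_le_ofReal
  apply le_of_eq
  unfold Gfun energyIntegrand
  rcases eq_or_lt_of_le (norm_nonneg (z.1 - z.2)) with h0 | h0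
  · have h1 := eq_of_sub_eq_zero (norm_eq_zero.1 h0.symm)
    have hU : Ufun n s ε u z = 0 := by unfold Ufun; rw [h1]; simp
    rw [hU, h1, Real.zero_rpow hp0.ne', Real.zero_rpow hq0.ne']
    simp [Real.zero_rpow hp0.ne', Real.zero_rpow hq0.ne']
  · unfold Afun Ufun
    set K := ‖z.1 - z.2‖
    rw [Real.div_rpow (abs_nonneg _) (by positivity), ← Real.rpow_mul h0.le,
      Real.div_rpow (abs_nonneg _) (by positivity), ← Real.rpow_mul h0.le, mul_add]
    congr 1
    · rw [div_eq_mul_inv, div_eq_mul_inv, ← Real.rpow_neg h0.le, ← Real.rpow_neg h0.le, mul_left_comm,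
        ← Real.rpow_add h0]
      congr 2; ring
    · rw [div_eq_mul_inv, div_eq_mul_inv, ← Real.rpow_neg h0.le, ← Real.rpow_neg h0.le]
      rw [show K ^ (-((n:ℝ) + t * q)) = K ^ (ε * p - n) * (K ^ ((s - t) * q + ε * (q - p)) * K ^ (-((s + ε) * q))) by
        rw [← Real.rpow_add h0, ← Real.rpow_add h0]; congr 1; ring]
      ring
end

section
variable {n : ℕ} {p q s t M Λ r δ ε ℓ ϱ₀ r₀ C1 μ : ℝ} {a : En n × En n → ℝ} {u f : En n → ℝ} {c x₀ : En n} {k : ℝ}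

lemma gam_eq (n : ℕ) (p s ε : ℝ) : gammaEx n p s ε = etaEx n p s ε / (p - 1) := by
  rw [eta_eq]; unfold gammaEx pC; ring

lemma U_le_H (h : Dat n p q s t M Λ a u f δ) (hE : Eps n p q s t ε) (z : En n × En n) :
    Ufun n s ε u z ^ etaEx n p s ε ≤ Hfun n p q s t ε a u z ^ gammaEx n p s ε := by
  have hp := h.hp
  have hη := eta_one h hE
  have h1 := Hfun_ge (q := q) (s := s) (t := t) (ε := ε) (u := u) hp h.ha0 z
  have h2 := Ufun_nonneg (s := s) (ε := ε) (u := u) z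
  rw [gam_eq]
  have hp1 : 0 < p - 1 := by linarith
  calc Ufun n s ε u z ^ etaEx n p s ε = (Ufun n s ε u z ^ (p - 1)) ^ (etaEx n p s ε / (p - 1)) := by
        rw [← Real.rpow_mul h2]; congr 1; field_simp
    _ ≤ _ := Real.rpow_le_rpow (by positivity) h1 (by positivity)

def C2f (n : ℕ) (C1 : ℝ) : ℝ := 2 * C1 * C71 n * 2 ^ ((n:ℝ) + 1)

lemma C2f_one (n : ℕ) (hC1 : 1 ≤ C1) : 1 ≤ C2f n C1 := by
  have h1 := C71_one n
  have h2 : (1:ℝ) ≤ 2 ^ ((n:ℝ) + 1) := Real.one_le_rpow (by norm_num) (by positivity)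
  unfold C2f
  have h3 : 1 ≤ 2 * C1 := by linarith
  have h4 := one_le_mul_of_one_le_of_one_le h3 h1
  exact one_le_mul_of_one_le_of_one_le h4 h2

lemma half_absorb {x : ℝ} {Y : ℝ≥0∞} (hx : 0 ≤ x) (h : ENNReal.ofReal x ≤ ENNReal.ofReal (x / 2) + Y) :
    ENNReal.ofReal x ≤ 2 * Y := by
  have e : ENNReal.ofReal x = ENNReal.ofReal (x / 2) + ENNReal.ofReal (x / 2) := by
    rw [← ENNReal.ofReal_add (by positivity) (by positivity)]; congr 1; ring
  rw [e] at h
  have h2 := (ENNReal.add_le_add_iff_left ENNReal.ofReal_ne_top).1 h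
  rw [e, two_mul]
  exact add_le_add h2 h2

lemma caseA (h : Dat n p q s t M Λ a u f δ) (hE : Eps n p q s t ε) (hC1 : 1 ≤ C1) (hμ : 0 < μ) (hr : 0 < r)
    (hℓ : ℓ = C2f n C1 * ε ^ (-(1 / etaEx n p s ε)) * μ)
    (hA : ENNReal.ofReal (ℓ ^ etaEx n p s ε * r ^ ((n:ℝ) + ε * p)) ≤
        ENNReal.ofReal C1 * ee n (etaEx n p s ε) (tauEx n p s ε) u (ball c (2 * r) ×ˢ ball c (2 * r))) :
    ENNReal.ofReal (ℓ ^ p * r ^ ((n:ℝ) + ε * p)) ≤ ENNReal.ofReal (2 * C1 * ℓ ^ (p - etaEx n p s ε)) *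
      ∫⁻ z in bB n c (2 * r) ∩ {z | Hfun n p q s t ε a u z > μ ^ (p - 1)},
        ENNReal.ofReal (Hfun n p q s t ε a u z ^ gammaEx n p s ε) ∂nu n p ε := by
  have hp := h.hp
  have hε := hE.h0
  have hεp := h.epsp hE
  have hs1 := h.hs1
  have hη1 := eta_one h hE
  have hηp := eta_lt h hE
  have hte := tau_eta h hE
  have hu := h.hW.1
  have hC2 := C2f_one n hC1
  have hC71 := C71_one n
  set η := etaEx n p s ε with hη
  set γ := gammaEx n p s ε with hγ
  have hℓ0 : 0 < ℓ := by rw [hℓ]; positivity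
  set J := ∫⁻ z in bB n c (2 * r) ∩ {z | Hfun n p q s t ε a u z > μ ^ (p - 1)},
        ENNReal.ofReal (Hfun n p q s t ε a u z ^ γ) ∂nu n p ε with hJ
  have hHm : Measurable (Hfun n p q s t ε a u) := Hfun_meas h.ha hu
  have hSm : MeasurableSet {z | Hfun n p q s t ε a u z > μ ^ (p - 1)} := measurableSet_lt measurable_const hHm
  have h1 : ee n η (tauEx n p s ε) u (ball c (2 * r) ×ˢ ball c (2 * r)) ≤
      ENNReal.ofReal (μ ^ η) * nu n p ε (bB n c (2 * r)) + J := by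
    rw [ee_eq (p := p) (s := s) (ε := ε) (by linarith) hte hu (measurableSet_ball.prod measurableSet_ball)]
    change ∫⁻ z in bB n c (2 * r), _ ∂_ ≤ _
    rw [← setLIntegral_const, hJ]
    have e : ∫⁻ z in bB n c (2 * r) ∩ {z | Hfun n p q s t ε a u z > μ ^ (p - 1)},
        ENNReal.ofReal (Hfun n p q s t ε a u z ^ γ) ∂nu n p ε =
        ∫⁻ z in bB n c (2 * r), {z | Hfun n p q s t ε a u z > μ ^ (p - 1)}.indicator
          (fun z => ENNReal.ofReal (Hfun n p q s t ε a u z ^ γ)) z ∂nu n p ε := by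
      rw [lintegral_indicator hSm, Measure.restrict_restrict hSm, inter_comm]
    rw [e, ← lintegral_add_left measurable_const]
    refine lintegral_mono fun z => ?_
    have hU0 := Ufun_nonneg (s := s) (ε := ε) (u := u) z
    rcases le_or_gt (Ufun n s ε u z) μ with h2 | h2
    · refine le_add_right (ENNReal.ofReal_le_ofReal (Real.rpow_le_rpow hU0 h2 (by linarith)))
    · refine le_add_left ?_
      rw [indicator_of_mem]
      · exact ENNReal.ofReal_le_ofReal (U_le_H h hE z)
      · exact lt_of_lt_of_le (Real.rpow_lt_rpow hμ.le h2 (by linarith)) (Hfun_ge hp h.ha0 z)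
  have h2 : ENNReal.ofReal C1 * (ENNReal.ofReal (μ ^ η) * nu n p ε (bB n c (2 * r))) ≤
      ENNReal.ofReal (ℓ ^ η * r ^ ((n:ℝ) + ε * p) / 2) := by
    calc _ ≤ ENNReal.ofReal C1 * (ENNReal.ofReal (μ ^ η) * ENNReal.ofReal (C71 n * (2 * r) ^ ((n:ℝ) + ε * p) / ε)) := by
          have := nu_le h hE c (R := 2 * r) (by positivity)
          gcongr
      _ = ENNReal.ofReal (C1 * (μ ^ η * (C71 n * (2 * r) ^ ((n:ℝ) + ε * p) / ε))) := by
          rw [← ENNReal.ofReal_mul (by positivity), ← ENNReal.ofReal_mul (by positivity)]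
      _ ≤ _ := by
          apply ENNReal.ofReal_le_ofReal
          have e1 : ℓ ^ η = C2f n C1 ^ η * (1 / ε) * μ ^ η := by
            rw [hℓ, Real.mul_rpow (by positivity) hμ.le, Real.mul_rpow (by positivity) (by positivity),
              ← Real.rpow_mul hε.le, show -(1 / η) * η = -1 by field_simp, Real.rpow_neg_one, one_div]
          have e2 : C2f n C1 ≤ C2f n C1 ^ η := by
            calc C2f n C1 = C2f n C1 ^ (1:ℝ) := (Real.rpow_one _).symm
              _ ≤ _ := Real.rpow_le_rpow_of_exponent_le hC2 hη1.le
          have e3 : (2:ℝ) ^ ((n:ℝ) + ε * p) ≤ 2 ^ ((n:ℝ) + 1) :=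
            Real.rpow_le_rpow_of_exponent_le (by norm_num) (by linarith)
          rw [e1, Real.mul_rpow (by norm_num) hr.le]
          calc C1 * (μ ^ η * (C71 n * (2 ^ ((n:ℝ) + ε * p) * r ^ ((n:ℝ) + ε * p)) / ε))
              = (C1 * C71 n * 2 ^ ((n:ℝ) + ε * p)) * (μ ^ η * r ^ ((n:ℝ) + ε * p) * (1 / ε)) := by ring
            _ ≤ (C1 * C71 n * 2 ^ ((n:ℝ) + 1)) * (μ ^ η * r ^ ((n:ℝ) + ε * p) * (1 / ε)) := by gcongr
            _ = (C2f n C1 / 2) * (μ ^ η * r ^ ((n:ℝ) + ε * p) * (1 / ε)) := by unfold C2f; ring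
            _ ≤ (C2f n C1 ^ η / 2) * (μ ^ η * r ^ ((n:ℝ) + ε * p) * (1 / ε)) := by gcongr
            _ = _ := by ring
  have h3 : ENNReal.ofReal (ℓ ^ η * r ^ ((n:ℝ) + ε * p)) ≤ 2 * (ENNReal.ofReal C1 * J) := by
    refine half_absorb (by positivity) (hA.trans ?_)
    calc _ ≤ ENNReal.ofReal C1 * (ENNReal.ofReal (μ ^ η) * nu n p ε (bB n c (2 * r)) + J) := mul_le_mul' le_rfl h1
      _ ≤ _ := by rw [mul_add]; exact add_le_add h2 le_rfl
  calc ENNReal.ofReal (ℓ ^ p * r ^ ((n:ℝ) + ε * p))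
      = ENNReal.ofReal (ℓ ^ (p - η)) * ENNReal.ofReal (ℓ ^ η * r ^ ((n:ℝ) + ε * p)) := by
        rw [← ENNReal.ofReal_mul (by positivity), ← mul_assoc, ← Real.rpow_add hℓ0]; congr 3; ring
    _ ≤ ENNReal.ofReal (ℓ ^ (p - η)) * (2 * (ENNReal.ofReal C1 * J)) := mul_le_mul' le_rfl h3
    _ = _ := by
        rw [mul_assoc 2 C1, two_ofR, ENNReal.ofReal_mul (by positivity)]; ring

/-! ### exponents for case B -/

lemma pC_pos (hp : 2 ≤ p) : 0 < pC p := by unfold pC; apply div_pos <;> linarith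

lemma pS_ratio (h : Dat n p q s t M Λ a u f δ) : pStar n p s / pC p = n / (n + s * pC p) := by
  have h1 := pC_pos h.hp
  have h2 := h.hs0
  have hn : (0:ℝ) < n := by exact_mod_cast h.n0
  unfold pStar
  have : 0 < (n:ℝ) + s * pC p := by positivity
  field_simp

lemma theta_id (h : Dat n p q s t M Λ a u f δ) (hE : Eps n p q s t ε) :
    pStar n p s / pC p + ε * p / (n + ε * p) = 1 - pStar n p s * thetaEx n p s ε := by
  have hp := h.hp
  have h1 := pC_pos h.hp
  have h2 := h.hs0
  have hε := hE.h0
  have hn : (0:ℝ) < n := by exact_mod_cast h.n0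
  rw [pS_ratio h]
  have e1 : 0 < (n:ℝ) + s * pC p := by positivity
  have e2 : 0 < (n:ℝ) + ε * p := by positivity
  have e3 : pC p * (s - ε * (p - 1)) = s * pC p - ε * p := by
    unfold pC; have : p - 1 ≠ 0 := by linarith
    field_simp
  have e4 : pStar n p s * thetaEx n p s ε = n * (s * pC p - ε * p) / ((n + s * pC p) * (n + ε * p)) := by
    rw [← e3]; unfold pStar thetaEx
    rw [div_mul_div_comm]; congr 1; ring
  rw [e4]
  have e1' := e1.ne'
  have e2' := e2.ne'
  rw [div_add_div _ _ e1' e2', eq_sub_iff_add_eq, ← add_div, div_eq_one_iff_eq (by positivity)]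
  ring

lemma theta_rng (h : Dat n p q s t M Λ a u f δ) (hE : Eps n p q s t ε) :
    0 < pStar n p s * thetaEx n p s ε ∧ 0 < 1 - pStar n p s * thetaEx n p s ε := by
  have hp := h.hp
  have h1 := pC_pos h.hp
  have h2 := h.hs0
  have hε := hE.h0
  have hn : (0:ℝ) < n := by exact_mod_cast h.n0
  have h3 := h.epsp hE
  constructor
  · unfold pStar thetaEx
    have : 0 < s - ε * (p - 1) := by nlinarith
    positivity
  · rw [← theta_id h hE, pS_ratio h]; positivity
end

section
variable {n : ℕ} {p q s t M Λ r δ ε ℓ ϱ₀ r₀ C1 μ κ lam : ℝ} {a : En n × En n → ℝ} {u f : En n → ℝ} {c x₀ : En n} {k : ℝ}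

lemma Fm (hf : Measurable f) (P : ℝ) : Measurable fun x => ENNReal.ofReal (|f x| ^ P) :=
  (hf.norm.pow_const _).ennreal_ofReal

lemma Fm1 (hf : Measurable f) (P : ℝ) : Measurable fun z : En n × En n => ENNReal.ofReal (|f z.1| ^ P) :=
  (Fm hf P).comp measurable_fst

lemma Fnu_fin (h : Dat n p q s t M Λ a u f δ) (hE : Eps n p q s t ε) {P : ℝ} (hP : 0 ≤ P) (hPδ : P ≤ δ) (c : En n)
    {R : ℝ} (hR : 0 < R) :
    ∫⁻ z in bB n c R, ENNReal.ofReal (|f z.1| ^ P) ∂nu n p ε < ⊤ := by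
  have hp0 := h.p0
  have hε := hE.h0
  rw [lint_nu (Fm1 h.hf P) (bB_meas c R)]
  unfold bB
  have hm : Measurable fun z : En n × En n => ENNReal.ofReal (‖z.1 - z.2‖ ^ (ε * p - n)) * ENNReal.ofReal (|f z.1| ^ P) :=
    nuK_meas.mul (Fm1 h.hf P)
  rw [Measure.volume_eq_prod, ← Measure.prod_restrict, lintegral_prod _ hm.aemeasurable]
  calc _ ≤ ∫⁻ x in ball c R, ENNReal.ofReal (n * om n * ((2 * R) ^ (ε * p) / (ε * p))) * ENNReal.ofReal (|f x| ^ P) := by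
        refine setLIntegral_mono (measurable_const.mul (Fm h.hf P)) fun x hx => ?_
        have hm2 : Measurable fun y : En n => ENNReal.ofReal (‖x - y‖ ^ (ε * p - n)) :=
          ((measurable_const.sub measurable_id).norm.pow_const _).ennreal_ofReal
        dsimp only
        rw [lintegral_mul_const _ hm2]
        refine mul_le_mul' ?_ le_rfl
        rw [← ker_in h.n0 x (by positivity) (by positivity : 0 < 2 * R)]
        refine lintegral_mono_set fun y hy => ?_
        rw [mem_ball] at *
        have := dist_triangle_right y x c
        linarith
    _ < ⊤ := by
        rw [lintegral_const_mul _ (Fm h.hf P)]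
        exact ENNReal.mul_lt_top ENNReal.ofReal_lt_top (fint h hP hPδ c R)

lemma J_ge (h : Dat n p q s t M Λ a u f δ) (hE : Eps n p q s t ε) {P : ℝ} {L : ℝ} (c : En n)
    {R : ℝ} (hR : 0 < R) :
    ENNReal.ofReal (om n * 2 ^ (-(n:ℝ)) * R ^ (ε * p)) * ∫⁻ x in ball c R ∩ {x | |f x| > L}, ENNReal.ofReal (|f x| ^ P) ≤
    ∫⁻ z in bB n c R ∩ {z | |f z.1| > L}, ENNReal.ofReal (|f z.1| ^ P) ∂nu n p ε := by
  have hS : MeasurableSet {x | |f x| > L} := measurableSet_lt measurable_const h.hf.norm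
  have hS2 : MeasurableSet {z : En n × En n | |f z.1| > L} := measurable_fst hS
  rw [lint_nu (Fm1 h.hf P) ((bB_meas c R).inter hS2)]
  have e : bB n c R ∩ {z | |f z.1| > L} = (ball c R ∩ {x | |f x| > L}) ×ˢ ball c R := by
    ext z; simp only [bB, mem_inter_iff, mem_prod, mem_ofPred_eq]; tauto
  have hm : Measurable fun z : En n × En n => ENNReal.ofReal (‖z.1 - z.2‖ ^ (ε * p - n)) * ENNReal.ofReal (|f z.1| ^ P) :=
    nuK_meas.mul (Fm1 h.hf P)
  rw [e, Measure.volume_eq_prod, ← Measure.prod_restrict, lintegral_prod _ hm.aemeasurable, ← lintegral_const_mul _ (Fm h.hf P)]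
  refine lintegral_mono_ae ?_
  filter_upwards [ae_restrict_mem (measurableSet_ball.inter hS)] with x hx
  have hm2 : Measurable fun y : En n => ENNReal.ofReal (‖x - y‖ ^ (ε * p - n)) :=
    ((measurable_const.sub measurable_id).norm.pow_const _).ennreal_ofReal
  rw [lintegral_mul_const _ hm2]
  exact mul_le_mul' (slice_ge h hE c hR hx.1) le_rfl

def Cb (n : ℕ) (C1 : ℝ) : ℝ := C1 * 2 * 2 ^ (n:ℝ) / om n

lemma caseB (h : Dat n p q s t M Λ a u f δ) (hE : Eps n p q s t ε) (hC1 : 1 ≤ C1) (hlam : 0 < lam) (hr : 0 < r) (hr1 : r ≤ 1)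
    (hκ : 0 < κ) (hκ1 : C1 * (2 * om n * 2 ^ (n:ℝ)) ^ (pC p / pStar n p s) * κ ^ pC p < 1) (hℓ : lam ^ pC p ≤ ℓ ^ p)
    (hB : ℓ ^ p * r ^ ((n:ℝ) + ε * p) ≤
        C1 * (∫⁻ x in ball c (2 * r), ENNReal.ofReal (|f x| ^ pStar n p s)).toReal ^ (pC p / pStar n p s)) :
    lam ^ pStar n p s * (r ^ ((n:ℝ) + ε * p)) ^ (1 - pStar n p s * thetaEx n p s ε) ≤
      Cb n C1 * (∫⁻ z in bB n c (2 * r) ∩ {z | |f z.1| > κ * lam}, ENNReal.ofReal (|f z.1| ^ pStar n p s) ∂nu n p ε).toReal := by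
  have hp := h.hp
  have hp0 := h.p0
  have hε := hE.h0
  have hom := om_pos n
  have hn : (0:ℝ) < n := by exact_mod_cast h.n0
  have hps1 : 1 < pStar n p s := pStar_one h.hp h.hn h.hs0 h.hspn
  have hps0 : 0 < pStar n p s := by linarith
  have hpC := pC_pos hp
  have hεp := h.epsp hE
  have hs0 := h.hs0
  have hid := theta_id h hE
  have hrat := pS_ratio h
  set ps := pStar n p s with hps
  set pc := pC p with hpc
  have hpc1 : 1 ≤ pc := by rw [hpc]; unfold pC; rw [le_div_iff₀ (by linarith)]; linarith
  set L := κ * lam with hL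
  have hL0 : 0 < L := by positivity
  have hS : MeasurableSet {x | |f x| > L} := measurableSet_lt measurable_const h.hf.norm
  set Fr := ∫⁻ x in ball c (2 * r), ENNReal.ofReal (|f x| ^ ps) with hFr
  set Fg := ∫⁻ x in ball c (2 * r) ∩ {x | |f x| > L}, ENNReal.ofReal (|f x| ^ ps) with hFg
  set J := ∫⁻ z in bB n c (2 * r) ∩ {z | |f z.1| > L}, ENNReal.ofReal (|f z.1| ^ ps) ∂nu n p ε with hJ
  have hFrt : Fr ≠ ⊤ := (fint h hps0.le h.hδ.le c _).ne
  have hFgt : Fg ≠ ⊤ := ((lintegral_mono_set inter_subset_left).trans_lt (fint h hps0.le h.hδ.le c _)).ne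
  have hJt : J ≠ ⊤ := ((lintegral_mono_set inter_subset_left).trans_lt
    (Fnu_fin h hE hps0.le h.hδ.le c (by positivity))).ne
  set low := L ^ ps * (om n * (2 * r) ^ (n:ℝ)) with hlow
  have hlow0 : 0 < low := by positivity
  have h1 : Fr.toReal ≤ low + Fg.toReal := by
    rw [← ENNReal.toReal_ofReal hlow0.le, ← ENNReal.toReal_add ENNReal.ofReal_ne_top hFgt]
    refine ENNReal.toReal_mono (ENNReal.add_ne_top.2 ⟨ENNReal.ofReal_ne_top, hFgt⟩) ?_
    rw [hlow, ENNReal.ofReal_mul (by positivity), ← vol_ball c (by positivity : 0 ≤ 2 * r) h.n0, ← setLIntegral_const]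
    have e : Fg = ∫⁻ x in ball c (2 * r), {x | |f x| > L}.indicator (fun x => ENNReal.ofReal (|f x| ^ ps)) x := by
      rw [lintegral_indicator hS, Measure.restrict_restrict hS, inter_comm]
    rw [e, ← lintegral_add_left measurable_const]
    refine lintegral_mono fun x => ?_
    rcases le_or_gt |f x| L with h2 | h2
    · exact le_add_right (ENNReal.ofReal_le_ofReal (Real.rpow_le_rpow (abs_nonneg _) h2 hps0.le))
    · refine le_add_left ?_
      rw [indicator_of_mem]
      exact h2
  have hpcps : 0 < pc / ps := by positivity
  have hexp : (n:ℝ) * (pc / ps) = n + s * pc := by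
    have : pc / ps = (n + s * pc) / n := by rw [← inv_div, hrat, inv_div]
    rw [this]; field_simp
  have hspc : ε * p ≤ s * pc := by nlinarith
  have h2 : low ≤ Fg.toReal := by
    by_contra hcon
    push Not at hcon
    have h3 : Fr.toReal ≤ 2 * low := by linarith
    have h4 : (2 * low) ^ (pc / ps) = (2 * om n * 2 ^ (n:ℝ)) ^ (pc / ps) * κ ^ pc * lam ^ pc * r ^ ((n:ℝ) + s * pc) := by
      have e1 : 2 * low = (2 * om n * 2 ^ (n:ℝ)) * (κ ^ ps * (lam ^ ps * r ^ (n:ℝ))) := by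
        rw [hlow, hL, Real.mul_rpow hκ.le hlam.le, Real.mul_rpow (by norm_num) hr.le]; ring
      rw [e1, Real.mul_rpow (x := 2 * om n * 2 ^ (n:ℝ)) (by positivity) (by positivity),
        Real.mul_rpow (x := κ ^ ps) (by positivity) (by positivity),
        Real.mul_rpow (x := lam ^ ps) (by positivity) (by positivity), ← Real.rpow_mul hκ.le, ← Real.rpow_mul hlam.le, ← Real.rpow_mul hr.le,
        hexp, show ps * (pc / ps) = pc by field_simp]
      ring
    have h5 : lam ^ pc * r ^ ((n:ℝ) + ε * p) ≤ C1 * (2 * low) ^ (pc / ps) :=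
      calc lam ^ pc * r ^ ((n:ℝ) + ε * p) ≤ ℓ ^ p * r ^ ((n:ℝ) + ε * p) := by gcongr
        _ ≤ _ := hB
        _ ≤ _ := by gcongr
    have h6 : r ^ ((n:ℝ) + s * pc) ≤ r ^ ((n:ℝ) + ε * p) := Real.rpow_le_rpow_of_exponent_ge hr hr1 (by linarith)
    rw [h4] at h5
    have h7 : C1 * ((2 * om n * 2 ^ (n:ℝ)) ^ (pc / ps) * κ ^ pc * lam ^ pc * r ^ ((n:ℝ) + s * pc)) ≤
        (C1 * (2 * om n * 2 ^ (n:ℝ)) ^ (pc / ps) * κ ^ pc) * (lam ^ pc * r ^ ((n:ℝ) + ε * p)) := by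
      calc _ = (C1 * (2 * om n * 2 ^ (n:ℝ)) ^ (pc / ps) * κ ^ pc) * (lam ^ pc * r ^ ((n:ℝ) + s * pc)) := by ring
        _ ≤ _ := by gcongr
    have h8 : 0 < lam ^ pc * r ^ ((n:ℝ) + ε * p) := by positivity
    have h9 := mul_lt_mul_of_pos_right hκ1 h8
    linarith
  have h3 : Fr.toReal ≤ 2 * Fg.toReal := by linarith
  have h4 : lam ^ pc * r ^ ((n:ℝ) + ε * p) ≤ C1 * (2 * Fg.toReal) ^ (pc / ps) :=
    calc lam ^ pc * r ^ ((n:ℝ) + ε * p) ≤ ℓ ^ p * r ^ ((n:ℝ) + ε * p) := by gcongr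
      _ ≤ _ := hB
      _ ≤ _ := by gcongr
  set m := r ^ ((n:ℝ) + ε * p) with hm
  have hm0 : 0 < m := by positivity
  have hFg0 : 0 ≤ Fg.toReal := ENNReal.toReal_nonneg
  have hrat1 : ps / pc ≤ 1 := by
    rw [hrat, div_le_one (by positivity)]; have : 0 < s * pc := by positivity
    linarith
  have h5 : lam ^ ps * m ^ (ps / pc) ≤ C1 * (2 * Fg.toReal) := by
    have e := Real.rpow_le_rpow (by positivity) h4 (by positivity : 0 ≤ ps / pc)
    rw [Real.mul_rpow (by positivity) (by positivity), Real.mul_rpow (by positivity) (by positivity), ← Real.rpow_mul hlam.le,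
      ← Real.rpow_mul (x := 2 * Fg.toReal) (by positivity), show pc * (ps / pc) = ps by field_simp, show pc / ps * (ps / pc) = 1 by field_simp,
      Real.rpow_one] at e
    refine e.trans ?_
    have : C1 ^ (ps / pc) ≤ C1 := by
      calc C1 ^ (ps / pc) ≤ C1 ^ (1:ℝ) := Real.rpow_le_rpow_of_exponent_le hC1 hrat1
        _ = C1 := Real.rpow_one _
    gcongr
  have h6 : om n * 2 ^ (-(n:ℝ)) * r ^ (ε * p) * Fg.toReal ≤ J.toReal := by
    have h7 := J_ge h hE (P := ps) (L := L) c (R := 2 * r) (by positivity)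
    have h8 := ENNReal.toReal_mono hJt h7
    rw [ENNReal.toReal_mul, ENNReal.toReal_ofReal (by positivity)] at h8
    refine le_trans ?_ h8
    have : r ^ (ε * p) ≤ (2 * r) ^ (ε * p) := Real.rpow_le_rpow hr.le (by linarith) (by positivity)
    gcongr
  have h7 : m ^ (ε * p / (n + ε * p)) = r ^ (ε * p) := by
    rw [hm, ← Real.rpow_mul hr.le]; congr 1
    have : (0:ℝ) < n + ε * p := by positivity
    field_simp
  rw [← hid, Real.rpow_add hm0, h7]
  have h2n : (0:ℝ) < 2 ^ (n:ℝ) := by positivity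
  calc lam ^ ps * (m ^ (ps / pc) * r ^ (ε * p)) = (lam ^ ps * m ^ (ps / pc)) * r ^ (ε * p) := by ring
    _ ≤ (C1 * (2 * Fg.toReal)) * r ^ (ε * p) := by gcongr
    _ = Cb n C1 * (om n * 2 ^ (-(n:ℝ)) * r ^ (ε * p) * Fg.toReal) := by
        unfold Cb; rw [Real.rpow_neg (by norm_num)]; field_simp
    _ ≤ _ := by
        have : 0 < Cb n C1 := by unfold Cb; positivity
        gcongr

lemma caseB' (h : Dat n p q s t M Λ a u f δ) (hE : Eps n p q s t ε) (hC1 : 1 ≤ C1) (hlam : 0 < lam) (hr : 0 < r) (hr1 : r ≤ 1)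
    (hκ : 0 < κ) (hκ1 : C1 * (2 * om n * 2 ^ (n:ℝ)) ^ (pC p / pStar n p s) * κ ^ pC p < 1) (hℓ : lam ^ pC p ≤ ℓ ^ p)
    (hB : ℓ ^ p * r ^ ((n:ℝ) + ε * p) ≤
        C1 * (∫⁻ x in ball c (2 * r), ENNReal.ofReal (|f x| ^ pStar n p s)).toReal ^ (pC p / pStar n p s))
    {Jt : ℝ} (hJt : ∫⁻ z in bB n c (2 * r) ∩ {z | |f z.1| > κ * lam}, ENNReal.ofReal (|f z.1| ^ pStar n p s) ∂nu n p ε ≤ ENNReal.ofReal Jt) (hJt0 : 0 ≤ Jt) :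
    ENNReal.ofReal (r ^ ((n:ℝ) + ε * p)) ≤
      ENNReal.ofReal ((Cb n C1 / lam ^ pStar n p s) ^ (1 / (1 - pStar n p s * thetaEx n p s ε)) *
        Jt ^ (pStar n p s * thetaEx n p s ε / (1 - pStar n p s * thetaEx n p s ε))) *
      ∫⁻ z in bB n c (2 * r) ∩ {z | |f z.1| > κ * lam}, ENNReal.ofReal (|f z.1| ^ pStar n p s) ∂nu n p ε := by
  have h1 := caseB h hE hC1 hlam hr hr1 hκ hκ1 hℓ hB
  obtain ⟨h2, h3⟩ := theta_rng h hE
  have hom := om_pos n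
  set J := ∫⁻ z in bB n c (2 * r) ∩ {z | |f z.1| > κ * lam}, ENNReal.ofReal (|f z.1| ^ pStar n p s) ∂nu n p ε with hJ
  have hJtop : J ≠ ⊤ := (hJt.trans_lt ENNReal.ofReal_lt_top).ne
  set b := pStar n p s * thetaEx n p s ε with hb
  set ps := pStar n p s
  have hCb : 0 < Cb n C1 := by unfold Cb; positivity
  have hJ0 : 0 ≤ J.toReal := ENNReal.toReal_nonneg
  have hJle : J.toReal ≤ Jt := ENNReal.toReal_le_of_le_ofReal hJt0 hJt
  set m := r ^ ((n:ℝ) + ε * p) with hm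
  have hm0 : 0 < m := by positivity
  have hl : 0 < lam ^ ps := by positivity
  have h4 : m ^ (1 - b) ≤ Cb n C1 / lam ^ ps * J.toReal := by
    rw [div_mul_eq_mul_div, le_div_iff₀ hl]; linarith
  have h5 : m ≤ (Cb n C1 / lam ^ ps) ^ (1 / (1 - b)) * Jt ^ (b / (1 - b)) * J.toReal := by
    calc m = (m ^ (1 - b)) ^ (1 / (1 - b)) := by
          rw [← Real.rpow_mul hm0.le, mul_one_div_cancel h3.ne', Real.rpow_one]
      _ ≤ (Cb n C1 / lam ^ ps * J.toReal) ^ (1 / (1 - b)) := by gcongr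
      _ = (Cb n C1 / lam ^ ps) ^ (1 / (1 - b)) * (J.toReal ^ (b / (1 - b)) * J.toReal) := by
          rw [Real.mul_rpow (by positivity) hJ0]
          congr 1
          have e : 1 / (1 - b) = b / (1 - b) + 1 := by field_simp; ring
          rw [e, Real.rpow_add_one' hJ0 (by positivity)]
      _ ≤ (Cb n C1 / lam ^ ps) ^ (1 / (1 - b)) * (Jt ^ (b / (1 - b)) * J.toReal) := by gcongr
      _ = _ := by ring
  calc ENNReal.ofReal m ≤ ENNReal.ofReal ((Cb n C1 / lam ^ ps) ^ (1 / (1 - b)) * Jt ^ (b / (1 - b)) * J.toReal) :=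
        ENNReal.ofReal_le_ofReal h5
    _ = _ := by rw [ENNReal.ofReal_mul (by positivity), ENNReal.ofReal_toReal hJtop]
end

section
variable {n : ℕ} {p q s t M Λ r δ ε ℓ ϱ₀ r₀ C1 μ κ lam α β : ℝ} {a : En n × En n → ℝ} {u f : En n → ℝ} {c x₀ : En n} {k : ℝ}

lemma sum_disj {T : Set (En n)} {R : En n → ℝ} (hT : T.Countable) (hd : T.PairwiseDisjoint fun c => ball c (2 * R c))
    (hsub : ∀ c ∈ T, ball c (2 * R c) ⊆ ball x₀ α) {S : Set (En n × En n)} (hS : MeasurableSet S)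
    (g : En n × En n → ℝ≥0∞) (m : Measure (En n × En n)) :
    ∑' c : T, ∫⁻ z in bB n c (2 * R c) ∩ S, g z ∂m ≤ ∫⁻ z in bB n x₀ α ∩ S, g z ∂m := by
  have hc : Countable T := hT.to_subtype
  rw [← lintegral_iUnion (fun c : T => (bB_meas _ _).inter hS)]
  · refine lintegral_mono_set ?_
    refine iUnion_subset fun c => inter_subset_inter_left _ (prod_mono (hsub c c.2) (hsub c c.2))
  · intro c d hcd
    have h1 : Disjoint (ball (c : En n) (2 * R c)) (ball (d : En n) (2 * R d)) :=
      hd c.2 d.2 fun e => hcd (Subtype.ext e)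
    refine Disjoint.mono inter_subset_left inter_subset_left ?_
    exact Set.disjoint_prod.2 (Or.inl h1)

lemma C61_nonneg (hp : 1 ≤ p) (hs : 0 < s) : 0 ≤ C61 n p s := by
  have := C50_pos n hp hs; have := om_pos n
  unfold C61; positivity

def K1c (n : ℕ) (p q s t M Λ C1 : ℝ) : ℝ :=
  c00 p q s t M Λ * ((2 * C60 n p s + 1) ^ p + C61 n p s * (2 * C1))

lemma core (n : ℕ) (p q s t M Λ : ℝ) : ∃ C1 : ℝ, 1 ≤ C1 ∧
    ∀ {a : En n × En n → ℝ} {u f : En n → ℝ} {δ : ℝ}, Dat n p q s t M Λ a u f δ →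
    ∀ {ε ℓ ϱ₀ r₀ κ μ lam α β Jt : ℝ} {x₀ : En n}, Eps n p q s t ε → Lev n p q s t ε ℓ u x₀ ϱ₀ r₀ →
    0 < μ → lam = μ ^ (p - 1) → ℓ = C2f n C1 * ε ^ (-(1 / etaEx n p s ε)) * μ →
    0 < κ → C1 * (2 * om n * 2 ^ (n:ℝ)) ^ (pC p / pStar n p s) * κ ^ pC p < 1 →
    β < α → α ≤ 3 / 2 * ϱ₀ → r₀ ≤ α - β → 0 ≤ Jt →
    ∫⁻ z in bB n x₀ α ∩ {z | |f z.1| > κ * lam}, ENNReal.ofReal (|f z.1| ^ pStar n p s) ∂nu n p ε ≤ ENNReal.ofReal Jt →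
    ∫⁻ z in bB n x₀ β ∩ {z | Hfun n p q s t ε a u z > lam}, ENNReal.ofReal (Hfun n p q s t ε a u z ^ pC p) ∂nu n p ε ≤
      ENNReal.ofReal (K1c n p q s t M Λ C1 * ℓ ^ (p - etaEx n p s ε)) *
        ∫⁻ z in bB n x₀ α ∩ {z | Hfun n p q s t ε a u z > lam}, ENNReal.ofReal (Hfun n p q s t ε a u z ^ gammaEx n p s ε) ∂nu n p ε
      + ENNReal.ofReal (c00 p q s t M Λ * C61 n p s * ℓ ^ p *
          ((Cb n C1 / lam ^ pStar n p s) ^ (1 / (1 - pStar n p s * thetaEx n p s ε)) *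
        Jt ^ (pStar n p s * thetaEx n p s ε / (1 - pStar n p s * thetaEx n p s ε)))) *
        ∫⁻ z in bB n x₀ α ∩ {z | |f z.1| > κ * lam}, ENNReal.ofReal (|f z.1| ^ pStar n p s) ∂nu n p ε := by
  obtain ⟨C1, hC1, hexit⟩ := exit_alt n p q s t M Λ
  refine ⟨C1, hC1, ?_⟩
  intro a u f δ h ε ℓ ϱ₀ r₀ κ μ lam α β Jt x₀ hE hL hμ hlam hℓ hκ hκ1 hβα hα hr0 hJt0 hJt
  have hp := h.hp
  have hp0 := h.p0
  have hp1 : 0 < p - 1 := by linarith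
  have hε := hE.h0
  have hε1 := h.eps1 hE
  have hu := h.hW.1
  have hη1 := eta_one h hE
  have hηp := eta_lt h hE
  have hlam0 : 0 < lam := by rw [hlam]; positivity
  have hC2 := C2f_one n hC1
  have hℓ0 := hL.hℓ
  have hϱ1 := hL.hϱ1
  have hr00 := hL.hr0
  have hc00 := h.c00_one
  have hC60 := C60_pos n h.p1 h.hs0
  have hC61 := C61_nonneg (n := n) h.p1 h.hs0
  have hom := om_pos n
  have hμℓ : μ ≤ ℓ := by
    rw [hℓ]
    have : 1 ≤ ε ^ (-(1 / etaEx n p s ε)) := Real.one_le_rpow_of_pos_of_le_one_of_nonpos hε hε1.le (by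
      have : 0 < 1 / etaEx n p s ε := by positivity
      linarith)
    have := one_le_mul_of_one_le_of_one_le hC2 this
    nlinarith
  have hlamℓ : lam ^ pC p ≤ ℓ ^ p := by
    have : lam ^ pC p = μ ^ p := by
      rw [hlam, ← Real.rpow_mul hμ.le]; congr 1; unfold pC; field_simp
    rw [this]; exact Real.rpow_le_rpow hμ.le hμℓ hp0.le
  obtain ⟨T, R, hTc, hTR, hTd, hcov⟩ := cover h hE hL (by linarith : β ≤ 3 / 2 * ϱ₀)
  set η := etaEx n p s ε with hη
  set γ := gammaEx n p s ε with hγ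
  have hHm : Measurable (Hfun n p q s t ε a u) := Hfun_meas h.ha hu
  set SH := {z | Hfun n p q s t ε a u z > lam} with hSH
  have hSHm : MeasurableSet SH := measurableSet_lt measurable_const hHm
  set SF := {z : En n × En n | |f z.1| > κ * lam} with hSF
  have hSFm : MeasurableSet SF :=
    (measurable_fst (measurableSet_lt measurable_const h.hf.norm : MeasurableSet {x | κ * lam < |f x|}))
  set gH := fun z => ENNReal.ofReal (Hfun n p q s t ε a u z ^ γ) with hgH
  set gF := fun z : En n × En n => ENNReal.ofReal (|f z.1| ^ pStar n p s) with hgF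
  set KB := (Cb n C1 / lam ^ pStar n p s) ^ (1 / (1 - pStar n p s * thetaEx n p s ε)) *
        Jt ^ (pStar n p s * thetaEx n p s ε / (1 - pStar n p s * thetaEx n p s ε)) with hKB
  have hKB0 : 0 ≤ KB := by
    have : 0 < Cb n C1 := by unfold Cb; positivity
    positivity
  have hsub : ∀ c ∈ T, ball c (2 * R c) ⊆ ball x₀ α := fun c hc => by
    obtain ⟨h1, h2, h3, -⟩ := hTR c hc
    refine ball_subset_ball' ?_
    rw [mem_ball] at h1
    linarith
  -- per ball
  have hball : ∀ c ∈ T, ENNReal.ofReal (ℓ ^ p * R c ^ ((n:ℝ) + ε * p)) ≤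
      ENNReal.ofReal (2 * C1 * ℓ ^ (p - η)) * (∫⁻ z in bB n c (2 * R c) ∩ SH, gH z ∂nu n p ε) +
      ENNReal.ofReal (ℓ ^ p * KB) * ∫⁻ z in bB n c (2 * R c) ∩ SF, gF z ∂nu n p ε := by
    intro c hc
    obtain ⟨h1, h2, h3, h4, h5⟩ := hTR c hc
    have hr1 : R c ≤ 1 := by have := hL.hr0ϱ; linarith
    have hcb : c ∈ ball x₀ (3 / 2 * ϱ₀) := ball_subset_ball (by linarith) h1
    rcases hexit h hE hL hcb h2 h3 h4 h5 with hA | hB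
    · refine le_add_right ?_
      have := caseA h hE hC1 hμ h2 hℓ hA
      rw [← hlam] at this
      exact this
    · refine le_add_left ?_
      have hJc : ∫⁻ z in bB n c (2 * R c) ∩ SF, gF z ∂nu n p ε ≤ ENNReal.ofReal Jt :=
        (lintegral_mono_set (inter_subset_inter_left _ (prod_mono (hsub c hc) (hsub c hc)))).trans hJt
      have := caseB' h hE hC1 hlam0 h2 hr1 hκ hκ1 hlamℓ hB hJc hJt0
      rw [ENNReal.ofReal_mul (by positivity), ENNReal.ofReal_mul (by positivity), mul_assoc]
      exact mul_le_mul' le_rfl this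
  set IA := ∫⁻ z in bB n x₀ α ∩ SH, gH z ∂nu n p ε with hIA
  set IB := ∫⁻ z in bB n x₀ α ∩ SF, gF z ∂nu n p ε with hIB
  have hsum : ∑' c : T, ENNReal.ofReal (C61 n p s * (ℓ ^ p * R c ^ ((n:ℝ) + ε * p))) ≤
      ENNReal.ofReal (C61 n p s) * (ENNReal.ofReal (2 * C1 * ℓ ^ (p - η)) * IA + ENNReal.ofReal (ℓ ^ p * KB) * IB) := by
    calc _ = ENNReal.ofReal (C61 n p s) * ∑' c : T, ENNReal.ofReal (ℓ ^ p * R c ^ ((n:ℝ) + ε * p)) := by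
          rw [← ENNReal.tsum_mul_left]
          exact tsum_congr fun c => ENNReal.ofReal_mul hC61
      _ ≤ ENNReal.ofReal (C61 n p s) * ∑' c : T, (ENNReal.ofReal (2 * C1 * ℓ ^ (p - η)) * (∫⁻ z in bB n c (2 * R c) ∩ SH, gH z ∂nu n p ε) +
      ENNReal.ofReal (ℓ ^ p * KB) * ∫⁻ z in bB n c (2 * R c) ∩ SF, gF z ∂nu n p ε) :=
          mul_le_mul' le_rfl (ENNReal.tsum_le_tsum fun c => hball c c.2)
      _ ≤ _ := by
          rw [ENNReal.tsum_add, ENNReal.tsum_mul_left, ENNReal.tsum_mul_left]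
          exact mul_le_mul' le_rfl (add_le_add (mul_le_mul' le_rfl (sum_disj hTc hTd hsub hSHm gH _))
            (mul_le_mul' le_rfl (sum_disj hTc hTd hsub hSFm gF _)))
  -- split
  have hz3 : ∀ z ∈ bB n x₀ β, ‖z.1 - z.2‖ ≤ 3 := fun z hz => by
    have h1 := hz.1; have h2 := hz.2
    rw [mem_ball] at h1 h2
    have := dist_triangle_right z.1 z.2 x₀
    rw [← dist_eq_norm]; linarith
  set W := {z : En n × En n | 2 * C60 n p s * (ℓ * ‖z.1 - z.2‖ ^ (s + ε)) < |u z.1 - u z.2|} with hW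
  have hWm : MeasurableSet W := by
    have h1 : Measurable fun z : En n × En n => ‖z.1 - z.2‖ ^ (s + ε) :=
      (measurable_fst.sub measurable_snd).norm.pow_const _
    have h2 : Measurable fun z : En n × En n => |u z.1 - u z.2| := by fun_prop
    exact measurableSet_lt ((h1.const_mul ℓ).const_mul _) h2
  have hpt1 : ∀ z ∈ bB n x₀ β, z ∉ W → ENNReal.ofReal (Hfun n p q s t ε a u z ^ pC p) ≤
      ENNReal.ofReal (c00 p q s t M Λ * (2 * C60 n p s + 1) ^ p * ℓ ^ (p - η)) * gH z := by
    intro z hz hzW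
    have hG0 := Gfun_nonneg (p := p) (q := q) (s := s) (t := t) (ε := ε) (u := u) h.ha0 z
    have hGle := Gfun_le h hE (hz3 z hz)
    have hU0 := Ufun_nonneg (s := s) (ε := ε) (u := u) z
    have hU : Ufun n s ε u z ≤ 2 * C60 n p s * ℓ := by
      rw [hW, mem_ofPred_eq, not_lt] at hzW
      unfold Ufun
      refine div_le_of_le_mul₀ (by positivity) (by positivity) ?_
      linarith
    rw [hgH, Hfun_pC hp h.ha0 z, ← ENNReal.ofReal_mul (by positivity)]
    apply ENNReal.ofReal_le_ofReal
    set G := Gfun n p q s t ε a u z with hGd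
    have e1 : Hfun n p q s t ε a u z ^ γ = G ^ (η / p) := by
      unfold Hfun
      rw [← Real.rpow_mul hG0, hγ, gam_eq]; congr 1; field_simp; rfl
    have e2 : G = G ^ ((p - η) / p) * G ^ (η / p) := by
      rw [← Real.rpow_add' hG0 (by rw [← add_div]; simp [hp0.ne'])]
      rw [← add_div, sub_add_cancel, div_self hp0.ne', Real.rpow_one]
    rw [e1]
    conv_lhs => rw [e2]
    refine mul_le_mul_of_nonneg_right ?_ (by positivity)
    have he : 0 ≤ (p - η) / p := div_nonneg (by linarith) hp0.le
    have he1 : (p - η) / p ≤ 1 := by rw [div_le_one hp0]; linarith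
    calc G ^ ((p - η) / p) ≤ (c00 p q s t M Λ * (2 * C60 n p s * ℓ) ^ p) ^ ((p - η) / p) := by
          refine Real.rpow_le_rpow hG0 (hGle.trans ?_) he
          gcongr
      _ = c00 p q s t M Λ ^ ((p - η) / p) * ((2 * C60 n p s) ^ (p - η) * ℓ ^ (p - η)) := by
          rw [Real.mul_rpow (by positivity) (by positivity), ← Real.rpow_mul (by positivity),
            mul_div_cancel₀ _ hp0.ne', Real.mul_rpow (by positivity) hℓ0.le]
      _ ≤ c00 p q s t M Λ * ((2 * C60 n p s + 1) ^ p * ℓ ^ (p - η)) := by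
          have f1 : c00 p q s t M Λ ^ ((p - η) / p) ≤ c00 p q s t M Λ := by
            calc _ ≤ c00 p q s t M Λ ^ (1:ℝ) := Real.rpow_le_rpow_of_exponent_le hc00 he1
              _ = _ := Real.rpow_one _
          have f2 : (2 * C60 n p s) ^ (p - η) ≤ (2 * C60 n p s + 1) ^ p := by
            calc _ ≤ (2 * C60 n p s + 1) ^ (p - η) := Real.rpow_le_rpow (by positivity) (by linarith) (by linarith)
              _ ≤ _ := Real.rpow_le_rpow_of_exponent_le (by linarith) (by linarith)
          gcongr
      _ = _ := by ring
  have hpt2 : ∀ z ∈ bB n x₀ β, ENNReal.ofReal (Hfun n p q s t ε a u z ^ pC p) ≤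
      ENNReal.ofReal (c00 p q s t M Λ) * ENNReal.ofReal (Ufun n s ε u z ^ p) := by
    intro z hz
    rw [Hfun_pC hp h.ha0 z, ← ENNReal.ofReal_mul (by positivity)]
    exact ENNReal.ofReal_le_ofReal (Gfun_le h hE (hz3 z hz))
  have hgHm : Measurable gH := (hHm.pow_const _).ennreal_ofReal
  have hUm : Measurable fun z => ENNReal.ofReal (Ufun n s ε u z ^ p) := ((Ufun_meas hu).pow_const _).ennreal_ofReal
  have hpart1 : ∫⁻ z in (bB n x₀ β ∩ SH) \ W, ENNReal.ofReal (Hfun n p q s t ε a u z ^ pC p) ∂nu n p ε ≤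
      ENNReal.ofReal (c00 p q s t M Λ * (2 * C60 n p s + 1) ^ p * ℓ ^ (p - η)) * IA := by
    calc _ ≤ ∫⁻ z in (bB n x₀ β ∩ SH) \ W, ENNReal.ofReal (c00 p q s t M Λ * (2 * C60 n p s + 1) ^ p * ℓ ^ (p - η)) * gH z ∂nu n p ε :=
          setLIntegral_mono (hgHm.const_mul _) fun z hz => hpt1 z hz.1.1 hz.2
      _ = ENNReal.ofReal (c00 p q s t M Λ * (2 * C60 n p s + 1) ^ p * ℓ ^ (p - η)) * ∫⁻ z in (bB n x₀ β ∩ SH) \ W, gH z ∂nu n p ε :=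
          lintegral_const_mul _ hgHm
      _ ≤ _ := by
          refine mul_le_mul' le_rfl (lintegral_mono_set fun z hz => ⟨?_, hz.1.2⟩)
          exact ⟨ball_subset_ball hβα.le hz.1.1.1, ball_subset_ball hβα.le hz.1.1.2⟩
  have hpart2 : ∫⁻ z in (bB n x₀ β ∩ SH) ∩ W, ENNReal.ofReal (Hfun n p q s t ε a u z ^ pC p) ∂nu n p ε ≤
      ENNReal.ofReal (c00 p q s t M Λ) * (ENNReal.ofReal (C61 n p s) * (ENNReal.ofReal (2 * C1 * ℓ ^ (p - η)) * IA + ENNReal.ofReal (ℓ ^ p * KB) * IB)) := by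
    calc _ ≤ ∫⁻ z in (bB n x₀ β ∩ SH) ∩ W, ENNReal.ofReal (c00 p q s t M Λ) * ENNReal.ofReal (Ufun n s ε u z ^ p) ∂nu n p ε :=
          setLIntegral_mono (hUm.const_mul _) fun z hz => hpt2 z hz.1.1
      _ = ENNReal.ofReal (c00 p q s t M Λ) * ∫⁻ z in (bB n x₀ β ∩ SH) ∩ W, ENNReal.ofReal (Ufun n s ε u z ^ p) ∂nu n p ε :=
          lintegral_const_mul _ hUm
      _ ≤ ENNReal.ofReal (c00 p q s t M Λ) * ∫⁻ z in bB n x₀ β ∩ W, ENNReal.ofReal (Ufun n s ε u z ^ p) ∂nu n p ε :=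
          mul_le_mul' le_rfl (lintegral_mono_set fun z hz => ⟨hz.1.1, hz.2⟩)
      _ = ENNReal.ofReal (c00 p q s t M Λ) * ee n p s u (bB n x₀ β ∩ W) := by
          rw [ee_eq (P := p) (σ := s) (p := p) (s := s) (ε := ε) hp0 (by ring) hu ((bB_meas x₀ β).inter hWm)]
      _ ≤ _ := mul_le_mul' le_rfl (hcov.trans hsum)
  rw [← lintegral_inter_add_sdiff _ (bB n x₀ β ∩ SH) hWm]
  refine (add_le_add hpart2 hpart1).trans (le_of_eq ?_)
  have e1 : ENNReal.ofReal (K1c n p q s t M Λ C1 * ℓ ^ (p - η)) =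
      ENNReal.ofReal (c00 p q s t M Λ) * (ENNReal.ofReal (C61 n p s) * ENNReal.ofReal (2 * C1 * ℓ ^ (p - η))) +
      ENNReal.ofReal (c00 p q s t M Λ * (2 * C60 n p s + 1) ^ p * ℓ ^ (p - η)) := by
    rw [← ENNReal.ofReal_mul (by positivity), ← ENNReal.ofReal_mul (by positivity), ← ENNReal.ofReal_add (by positivity) (by positivity)]
    congr 1; unfold K1c; ring
  have e2 : ENNReal.ofReal (c00 p q s t M Λ * C61 n p s * ℓ ^ p * KB) =
      ENNReal.ofReal (c00 p q s t M Λ) * (ENNReal.ofReal (C61 n p s) * ENNReal.ofReal (ℓ ^ p * KB)) := by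
    rw [← ENNReal.ofReal_mul (by positivity), ← ENNReal.ofReal_mul (by positivity)]
    congr 1; ring
  rw [e1, e2]; ring
end

section
variable {n : ℕ} {p q s t M Λ r δ ε ℓ ϱ₀ r₀ C1 μ κ lam α β : ℝ} {a : En n × En n → ℝ} {u f : En n → ℝ} {c x₀ : En n} {k : ℝ}

lemma pow_split {P θ x y : ℝ} (hP : 1 ≤ P) (h0 : 0 < θ) (h1 : θ < 1) (hx : 0 ≤ x) (hy : 0 ≤ y) :
    (x + y) ^ P ≤ θ ^ (1 - P) * x ^ P + (1 - θ) ^ (1 - P) * y ^ P := by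
  have h2 : 0 < 1 - θ := by linarith
  have hc := (convexOn_rpow hP).2 (x := x / θ) (y := y / (1 - θ)) (by simp; positivity) (by simp; positivity)
    h0.le h2.le (by ring)
  simp only [smul_eq_mul] at hc
  rw [mul_div_cancel₀ _ h0.ne', mul_div_cancel₀ _ h2.ne'] at hc
  refine hc.trans (le_of_eq ?_)
  rw [Real.div_rpow hx h0.le, Real.div_rpow hy h2.le, Real.rpow_sub h0, Real.rpow_sub h2, Real.rpow_one, Real.rpow_one]
  ring

lemma avg_lint {X : Type*} [MeasurableSpace X] {m : Measure X} {S : Set X} (hS0 : m S ≠ 0) (hSt : m S ≠ ⊤) {g : X → ℝ}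
    (hgm : Measurable g) (hg0 : ∀ z, 0 ≤ g z) (hfin : ∫⁻ z in S, ENNReal.ofReal (g z) ∂m < ⊤) :
    ∫⁻ z in S, ENNReal.ofReal (g z) ∂m = m S * ENNReal.ofReal (⨍ z in S, g z ∂m) := by
  have hIntg : Integrable g (m.restrict S) := by
    refine ⟨hgm.aestronglyMeasurable, ?_⟩
    rw [hasFiniteIntegral_iff_ofReal (ae_of_all _ hg0)]; exact hfin
  rw [← ofReal_integral_eq_lintegral_ofReal hIntg (ae_of_all _ hg0), setAverage_eq, smul_eq_mul, measureReal_def,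
    ENNReal.ofReal_mul (by positivity), ENNReal.ofReal_inv_of_pos (ENNReal.toReal_pos hS0 hSt), ENNReal.ofReal_toReal hSt,
    ← mul_assoc, ENNReal.mul_inv_cancel hS0 hSt, one_mul]

def hk (n : ℕ) (p q s t ε : ℝ) (a : En n × En n → ℝ) (u : En n → ℝ) (x₀ : En n) (R : ℝ) : ℝ :=
  (⨍ z in bB n x₀ R, Hfun n p q s t ε a u z ^ gammaEx n p s ε ∂nu n p ε) ^ (1 / gammaEx n p s ε)

lemma gam_pos (h : Dat n p q s t M Λ a u f δ) (hE : Eps n p q s t ε) : 0 < gammaEx n p s ε := by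
  rw [gam_eq]; have := eta_one h hE; have := h.hp
  apply div_pos <;> linarith

lemma gam_lt (h : Dat n p q s t M Λ a u f δ) (hE : Eps n p q s t ε) : gammaEx n p s ε < pC p := by
  rw [gam_eq]; have h1 := eta_lt h hE; have h2 := h.hp
  unfold pC
  exact div_lt_div_of_pos_right h1 (by linarith)

lemma Hg_le (h : Dat n p q s t M Λ a u f δ) (hE : Eps n p q s t ε) (S : Set (En n × En n)) :
    ∫⁻ z in S, ENNReal.ofReal (Hfun n p q s t ε a u z ^ gammaEx n p s ε) ∂nu n p ε ≤
      nu n p ε S + ∫⁻ z, ENNReal.ofReal (Gfun n p q s t ε a u z) ∂nu n p ε := by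
  have h0 := gam_pos h hE
  have h1 := gam_lt h hE
  calc _ ≤ ∫⁻ z in S, (1 + ENNReal.ofReal (Gfun n p q s t ε a u z)) ∂nu n p ε := by
        refine lintegral_mono fun z => ?_
        have hH := Hfun_nonneg (p := p) (q := q) (s := s) (t := t) (ε := ε) (u := u) h.ha0 z
        rw [← ENNReal.ofReal_one, ← ENNReal.ofReal_add (by norm_num) (Gfun_nonneg h.ha0 z), ← Hfun_pC h.hp h.ha0 z]
        apply ENNReal.ofReal_le_ofReal
        rcases le_or_gt (Hfun n p q s t ε a u z) 1 with h2 | h2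
        · have := Real.rpow_le_one hH h2 h0.le
          have : 0 ≤ Hfun n p q s t ε a u z ^ pC p := by positivity
          linarith
        · have := Real.rpow_le_rpow_of_exponent_le h2.le h1.le
          linarith
    _ = nu n p ε S + ∫⁻ z in S, ENNReal.ofReal (Gfun n p q s t ε a u z) ∂nu n p ε := by
        rw [lintegral_add_left measurable_const, lintegral_one, Measure.restrict_apply_univ]
    _ ≤ _ := by gcongr; exact Measure.restrict_le_self

lemma hk_nonneg (h : Dat n p q s t M Λ a u f δ) (x₀ : En n) (R : ℝ) : 0 ≤ hk n p q s t ε a u x₀ R := by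
  unfold hk
  refine Real.rpow_nonneg ?_ _
  rw [setAverage_eq, smul_eq_mul]
  exact mul_nonneg (by positivity) (integral_nonneg fun z => Real.rpow_nonneg (Hfun_nonneg h.ha0 z) _)

lemma hk_X (h : Dat n p q s t M Λ a u f δ) (hE : Eps n p q s t ε) (x₀ : En n) {R : ℝ} (hR : 0 < R) :
    ∫⁻ z in bB n x₀ R, ENNReal.ofReal (Hfun n p q s t ε a u z ^ gammaEx n p s ε) ∂nu n p ε =
      nu n p ε (bB n x₀ R) * ENNReal.ofReal (hk n p q s t ε a u x₀ R ^ gammaEx n p s ε) := by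
  have h0 := gam_pos h hE
  have hH := fun z => Hfun_nonneg (p := p) (q := q) (s := s) (t := t) (ε := ε) (u := u) h.ha0 z
  rw [avg_lint (nu_pos h hE x₀ hR).ne' (nu_lt_top h hE x₀ hR).ne ((Hfun_meas h.ha h.hW.1).pow_const _)
    (fun z => Real.rpow_nonneg (hH z) _)
    ((Hg_le h hE _).trans_lt (ENNReal.add_lt_top.2 ⟨nu_lt_top h hE x₀ hR, Gnu_fin h hE⟩))]
  unfold hk
  rw [← Real.rpow_mul, one_div_mul_cancel h0.ne', Real.rpow_one]
  rw [setAverage_eq, smul_eq_mul]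
  exact mul_nonneg (by positivity) (integral_nonneg fun z => Real.rpow_nonneg (hH z) _)

/-- `h_k` is bounded along `R ≥ R₀`. -/
lemma hk_bdd (h : Dat n p q s t M Λ a u f δ) (hE : Eps n p q s t ε) (x₀ : En n) {R0 : ℝ} (hR0 : 0 < R0) :
    ∃ B : ℝ, ∀ R, R0 ≤ R → hk n p q s t ε a u x₀ R ≤ B := by
  have h0 := gam_pos h hE
  set γ := gammaEx n p s ε
  set I := ∫⁻ z, ENNReal.ofReal (Gfun n p q s t ε a u z) ∂nu n p ε with hI
  have hIt : I ≠ ⊤ := (Gnu_fin h hE).ne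
  have hν0 := nu_pos h hE x₀ hR0
  have hν1 := nu_lt_top h hE x₀ hR0
  set V0 := nu n p ε (bB n x₀ R0) with hV0
  have hB : 1 + I / V0 ≠ ⊤ := ENNReal.add_ne_top.2 ⟨ENNReal.one_ne_top, ENNReal.div_ne_top hIt hν0.ne'⟩
  refine ⟨((1 + I / V0).toReal) ^ (1 / γ), fun R hR => ?_⟩
  have hRp : 0 < R := by linarith
  have h1 := hk_X h hE x₀ hRp
  have h2 := Hg_le h hE (bB n x₀ R)
  rw [h1] at h2
  have hk0 := hk_nonneg (ε := ε) h x₀ R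
  have hV : V0 ≤ nu n p ε (bB n x₀ R) := measure_mono (prod_mono (ball_subset_ball hR) (ball_subset_ball hR))
  have hp := nu_pos h hE x₀ hRp
  have ht := nu_lt_top h hE x₀ hRp
  set V := nu n p ε (bB n x₀ R)
  have h3 : ENNReal.ofReal (hk n p q s t ε a u x₀ R ^ γ) ≤ 1 + I / V0 := by
    calc _ ≤ (V + I) / V := by
          rw [ENNReal.le_div_iff_mul_le (Or.inl hp.ne') (Or.inl ht.ne), mul_comm]; exact h2
      _ = 1 + I / V := by rw [ENNReal.add_div, ENNReal.div_self hp.ne' ht.ne]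
      _ ≤ _ := by gcongr
  have h4 : hk n p q s t ε a u x₀ R ^ γ ≤ (1 + I / V0).toReal := (ENNReal.ofReal_le_iff_le_toReal hB).1 h3
  calc hk n p q s t ε a u x₀ R = (hk n p q s t ε a u x₀ R ^ γ) ^ (1 / γ) := by
        rw [← Real.rpow_mul hk0, mul_one_div_cancel h0.ne', Real.rpow_one]
    _ ≤ _ := by gcongr

def D81 (n : ℕ) (p : ℝ) : ℝ := (1 + om n) * ((2 * (2 * c1 n)) ^ p * C71 n + 1) ^ p

lemma D81_pos (n : ℕ) (p : ℝ) : 0 < D81 n p := by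
  have := om_pos n; have := c1_pos n; have := C71_one n
  unfold D81; positivity

lemma E_bd (h : Dat n p q s t M Λ a u f δ) (hE : Eps n p q s t ε) (x₀ : En n) {R : ℝ} (hR : 0 < R) :
    ∫⁻ y in ball x₀ R, ENNReal.ofReal (|u y - av n u x₀ R| ^ (p - 1)) ≤
      ENNReal.ofReal (D81 n p * (ε ^ (-(1 / gammaEx n p s ε)) * (R ^ ((n:ℝ) + (s + ε) * (p - 1)) * hk n p q s t ε a u x₀ R))) := by
  have hp := h.hp
  have hp0 := h.p0
  have hp1 : 0 < p - 1 := by linarith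
  have hη1 := eta_one h hE
  have hη0 : 0 < etaEx n p s ε := by linarith
  have hε := hE.h0
  have hu := h.hW.1
  have hom := om_pos n
  have hc1 := c1_pos n
  have hC71 := C71_one n
  have hn : (0:ℝ) < n := by exact_mod_cast h.n0
  have hem := eta_mul h hE
  have hγe := gam_eq n p s ε
  have hγ0 := gam_pos h hE
  set η := etaEx n p s ε with hη
  set γ := gammaEx n p s ε with hγ
  set H := hk n p q s t ε a u x₀ R with hH
  have hH0 : 0 ≤ H := hk_nonneg h x₀ R
  have h1 := sob_ball h.n0 hη1.le h.p1 (tau_pos h hE) (tau_bal h hE) hu h.hb x₀ hR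
  have h2 : ee n η (tauEx n p s ε) u (ball x₀ R ×ˢ ball x₀ R) ≤ ENNReal.ofReal (C71 n * R ^ ((n:ℝ) + ε * p) / ε * H ^ γ) := by
    rw [ee_eq (p := p) (s := s) (ε := ε) (by linarith) (tau_eta h hE) hu (measurableSet_ball.prod measurableSet_ball)]
    calc _ ≤ ∫⁻ z in bB n x₀ R, ENNReal.ofReal (Hfun n p q s t ε a u z ^ γ) ∂nu n p ε :=
          lintegral_mono fun z => ENNReal.ofReal_le_ofReal (U_le_H h hE z)
      _ = nu n p ε (bB n x₀ R) * ENNReal.ofReal (H ^ γ) := hk_X h hE x₀ hR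
      _ ≤ ENNReal.ofReal (C71 n * R ^ ((n:ℝ) + ε * p) / ε) * ENNReal.ofReal (H ^ γ) := mul_le_mul' (nu_le h hE x₀ hR) le_rfl
      _ = _ := by rw [ENNReal.ofReal_mul (by positivity)]
  set c4 := (2 * (2 * c1 n)) ^ p with hc4
  have hc40 : 0 < c4 := by positivity
  have h3 : (∫⁻ y in ball x₀ R, ENNReal.ofReal (|u y - av n u x₀ R| ^ p)) ≤
      ENNReal.ofReal ((c4 * (C71 n * R ^ ((n:ℝ) + ε * p) / ε * H ^ γ)) ^ (p / η)) := by
    have h4 : (∫⁻ y in ball x₀ R, ENNReal.ofReal (|u y - av n u x₀ R| ^ p)) ^ (η / p) ≤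
        ENNReal.ofReal (c4 * (C71 n * R ^ ((n:ℝ) + ε * p) / ε * H ^ γ)) := by
      rw [ENNReal.ofReal_mul hc40.le]
      exact h1.trans (mul_le_mul' le_rfl h2)
    have h5 := ENNReal.rpow_le_rpow h4 (by positivity : 0 ≤ p / η)
    rwa [← ENNReal.rpow_mul, show η / p * (p / η) = 1 by field_simp, ENNReal.rpow_one,
      ENNReal.ofReal_rpow_of_nonneg (by positivity) (by positivity)] at h5
  have h4 := pow_jen h.n0 (hu.sub_const (av n u x₀ R)) (P := p - 1) (p := p) (by linarith) (by linarith) hR (by positivity) h3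
  refine h4.trans (ENNReal.ofReal_le_ofReal ?_)
  have e0 : 1 - (p - 1) / p = 1 / p := by field_simp; ring
  rw [e0, ← Real.rpow_mul (by positivity), show p / η * ((p - 1) / p) = (p - 1) / η by field_simp]
  have e1 : c4 * (C71 n * R ^ ((n:ℝ) + ε * p) / ε * H ^ γ) = (c4 * C71 n) * (ε ^ (-1:ℝ) * (R ^ ((n:ℝ) + ε * p) * H ^ γ)) := by
    rw [Real.rpow_neg_one]; ring
  have e2 : (ε ^ (-1:ℝ)) ^ ((p - 1) / η) = ε ^ (-(1 / γ)) := by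
    rw [← Real.rpow_mul hε.le, hγe]; congr 1; field_simp
  have e3 : (H ^ γ) ^ ((p - 1) / η) = H := by
    rw [← Real.rpow_mul hH0, hγe, show η / (p - 1) * ((p - 1) / η) = 1 by field_simp, Real.rpow_one]
  have e4 : (R ^ ((n:ℝ) + ε * p)) ^ ((p - 1) / η) * R ^ ((n:ℝ) * (1 / p)) = R ^ ((n:ℝ) + (s + ε) * (p - 1)) := by
    rw [← Real.rpow_mul hR.le, ← Real.rpow_add hR]; congr 1
    rw [← hem]; field_simp; ring
  rw [e1, Real.mul_rpow (x := c4 * C71 n) (by positivity) (by positivity), Real.mul_rpow (x := ε ^ (-1:ℝ)) (by positivity) (by positivity),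
    Real.mul_rpow (x := R ^ ((n:ℝ) + ε * p)) (by positivity) (by positivity), e2, e3, Real.mul_rpow (x := om n) hom.le (by positivity),
    ← Real.rpow_mul hR.le, ← e4]
  have f1 : om n ^ (1 / p) ≤ 1 + om n := by
    calc om n ^ (1 / p) ≤ (1 + om n) ^ (1 / p) := Real.rpow_le_rpow hom.le (by linarith) (by positivity)
      _ ≤ (1 + om n) ^ (1:ℝ) := Real.rpow_le_rpow_of_exponent_le (by linarith) (by rw [div_le_one hp0]; linarith)
      _ = _ := Real.rpow_one _
  have f2 : (c4 * C71 n) ^ ((p - 1) / η) ≤ (c4 * C71 n + 1) ^ p := by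
    have hbase : 0 ≤ c4 * C71 n := by positivity
    calc _ ≤ (c4 * C71 n + 1) ^ ((p - 1) / η) := Real.rpow_le_rpow hbase (by linarith) (by positivity)
      _ ≤ _ := Real.rpow_le_rpow_of_exponent_le (by linarith) (by rw [div_le_iff₀ hη0]; nlinarith)
  calc om n ^ (1 / p) * R ^ ((n:ℝ) * (1 / p)) * ((c4 * C71 n) ^ ((p - 1) / η) * (ε ^ (-(1 / γ)) * ((R ^ ((n:ℝ) + ε * p)) ^ ((p - 1) / η) * H)))
      ≤ (1 + om n) * R ^ ((n:ℝ) * (1 / p)) * ((c4 * C71 n + 1) ^ p * (ε ^ (-(1 / γ)) * ((R ^ ((n:ℝ) + ε * p)) ^ ((p - 1) / η) * H))) := by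
        gcongr
    _ = _ := by unfold D81; rw [← hc4]; ring
end

/-- Constant in the discrete telescoping estimate. -/
def D82 (P b : ℝ) : ℝ := (1 - (2:ℝ) ^ (-(b / (2 * P)))) ^ (1 - P) / (1 - 2 ^ (-(b / 2)))

lemma D82_pos {P b : ℝ} (hP : 1 ≤ P) (hb : 0 < b) : 0 < D82 P b := by
  unfold D82
  have h1 := two_s (s := b / (2 * P)) (by positivity)
  have h2 := two_s (s := b / 2) (by positivity)
  have h3 : 0 < 1 - (2:ℝ) ^ (-(b / (2 * P))) := by linarith
  have h4 : 0 < 1 - (2:ℝ) ^ (-(b / 2)) := by linarith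
  positivity

lemma tail_seq {P b ρ L K : ℝ} (hP : 1 ≤ P) (hb : 0 < b) (hρ : 0 < ρ) (hK : 0 ≤ K) {A y : ℕ → ℝ}
    (hL : ∀ k, |A k - A 0| ≤ L) (hy : ∀ k, 0 ≤ y k) (hAy : ∀ k, |A (k + 1) - A k| ^ P ≤ K * y (k + 1)) :
    ∑' k, ENNReal.ofReal ((2 ^ k * ρ) ^ (-b) * |A k - A 0| ^ P) ≤
      ENNReal.ofReal (D82 P b * K) * ∑' k, ENNReal.ofReal ((2 ^ k * ρ) ^ (-b) * y k) := by
  have hP0 : 0 < P := by linarith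
  set θ : ℝ := 2 ^ (-(b / (2 * P))) with hθ
  have hθ0 : 0 < θ := by positivity
  have hθ1 : θ < 1 := two_s (by positivity)
  have hτ1 : (2:ℝ) ^ (-(b / 2)) < 1 := two_s (by positivity)
  set Cθ := (1 - θ) ^ (1 - P) with hCθ
  have hCθ0 : 0 < Cθ := by
    have : 0 < 1 - θ := by linarith
    positivity
  have hθP : θ ^ (1 - P) ≤ 2 ^ (b / 2) := by
    rw [hθ, ← Real.rpow_mul (by norm_num)]
    apply Real.rpow_le_rpow_of_exponent_le (by norm_num)
    rw [show -(b / (2 * P)) * (1 - P) = b / 2 * ((P - 1) / P) by field_simp; ring]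
    have : (P - 1) / P ≤ 1 := by rw [div_le_one hP0]; linarith
    nlinarith
  set e : ℕ → ℝ := fun k => |A k - A 0| ^ P with he
  have he0 : ∀ k, 0 ≤ e k := fun k => by positivity
  have hL0 : 0 ≤ L := (abs_nonneg _).trans (hL 0)
  have step : ∀ k, e (k + 1) ≤ 2 ^ (b / 2) * e k + Cθ * (K * y (k + 1)) := by
    intro k
    have h1 : |A (k + 1) - A 0| ≤ |A k - A 0| + |A (k + 1) - A k| := by
      have := abs_add_le (A k - A 0) (A (k + 1) - A k)
      rwa [show A k - A 0 + (A (k + 1) - A k) = A (k + 1) - A 0 by ring] at this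
    calc e (k + 1) ≤ (|A k - A 0| + |A (k + 1) - A k|) ^ P := Real.rpow_le_rpow (abs_nonneg _) h1 hP0.le
      _ ≤ θ ^ (1 - P) * |A k - A 0| ^ P + Cθ * |A (k + 1) - A k| ^ P :=
          pow_split hP hθ0 hθ1 (abs_nonneg _) (abs_nonneg _)
      _ ≤ _ := add_le_add (mul_le_mul_of_nonneg_right hθP (he0 k)) (mul_le_mul_of_nonneg_left (hAy k) hCθ0.le)
  have hR : ∀ k : ℕ, (0:ℝ) < (2 ^ k * ρ) ^ (-b) := fun k => by positivity
  have hRs : ∀ k : ℕ, ((2:ℝ) ^ (k + 1) * ρ) ^ (-b) * 2 ^ (b / 2) = 2 ^ (-(b / 2)) * (2 ^ k * ρ) ^ (-b) := by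
    intro k
    rw [pow_succ, show (2:ℝ) ^ k * 2 * ρ = 2 * (2 ^ k * ρ) by ring, Real.mul_rpow (x := 2) (by norm_num) (by positivity)]
    rw [show -(b / 2) = -b + b / 2 by ring, Real.rpow_add (by norm_num)]; ring
  set Z := ∑' k, ENNReal.ofReal ((2 ^ k * ρ) ^ (-b) * e k) with hZ
  set Q := ∑' k, ENNReal.ofReal ((2 ^ k * ρ) ^ (-b) * y k) with hQ
  have hZt : Z ≠ ⊤ := by
    have : Z ≤ ENNReal.ofReal (ρ ^ (-b) * L ^ P / (1 - 2 ^ (-b))) := by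
      refine le_trans (ENNReal.tsum_le_tsum fun k => ?_) (geo_sum' (A := ρ ^ (-b) * L ^ P) (by positivity) hb)
      apply ENNReal.ofReal_le_ofReal
      rw [Real.mul_rpow (x := (2:ℝ) ^ k) (by positivity) hρ.le]
      have h1 : e k ≤ L ^ P := Real.rpow_le_rpow (abs_nonneg _) (hL k) hP0.le
      calc ((2:ℝ) ^ k) ^ (-b) * ρ ^ (-b) * e k ≤ ((2:ℝ) ^ k) ^ (-b) * ρ ^ (-b) * L ^ P := by gcongr
        _ = _ := by ring
    exact (this.trans_lt ENNReal.ofReal_lt_top).ne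
  have hmain : Z ≤ ENNReal.ofReal (2 ^ (-(b / 2))) * Z + ENNReal.ofReal (Cθ * K) * Q := by
    calc Z = ENNReal.ofReal ((2 ^ 0 * ρ) ^ (-b) * e 0) + ∑' k : ℕ, ENNReal.ofReal ((2 ^ (k + 1) * ρ) ^ (-b) * e (k + 1)) := by
          rw [hZ]; exact tsum_eq_zero_add' ENNReal.summable
      _ = ∑' k : ℕ, ENNReal.ofReal ((2 ^ (k + 1) * ρ) ^ (-b) * e (k + 1)) := by
          have : e 0 = 0 := by simp [he, Real.zero_rpow hP0.ne']
          rw [this]; simp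
      _ ≤ ∑' k : ℕ, (ENNReal.ofReal (2 ^ (-(b / 2))) * ENNReal.ofReal ((2 ^ k * ρ) ^ (-b) * e k) +
            ENNReal.ofReal (Cθ * K) * ENNReal.ofReal ((2 ^ (k + 1) * ρ) ^ (-b) * y (k + 1))) := by
          refine ENNReal.tsum_le_tsum fun k => ?_
          have hy1 := hy (k + 1)
          have he1 := he0 k
          have hR1 := hR k
          have hR2 := hR (k + 1)
          rw [← ENNReal.ofReal_mul (by positivity), ← ENNReal.ofReal_mul (by positivity), ← ENNReal.ofReal_add (by positivity) (by positivity)]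
          apply ENNReal.ofReal_le_ofReal
          calc _ ≤ ((2:ℝ) ^ (k + 1) * ρ) ^ (-b) * (2 ^ (b / 2) * e k + Cθ * (K * y (k + 1))) :=
                mul_le_mul_of_nonneg_left (step k) hR2.le
            _ = (((2:ℝ) ^ (k + 1) * ρ) ^ (-b) * 2 ^ (b / 2)) * e k + Cθ * K * (((2:ℝ) ^ (k + 1) * ρ) ^ (-b) * y (k + 1)) := by ring
            _ = _ := by rw [hRs]; ring
      _ = ENNReal.ofReal (2 ^ (-(b / 2))) * Z + ENNReal.ofReal (Cθ * K) * ∑' k : ℕ, ENNReal.ofReal ((2 ^ (k + 1) * ρ) ^ (-b) * y (k + 1)) := by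
          rw [ENNReal.tsum_add, ENNReal.tsum_mul_left, ENNReal.tsum_mul_left]
      _ ≤ _ := by
          gcongr
          rw [hQ, tsum_eq_zero_add' (f := fun k => ENNReal.ofReal ((2 ^ k * ρ) ^ (-b) * y k)) ENNReal.summable]
          exact le_add_self
  rcases eq_or_ne Q ⊤ with hQt | hQt
  · rcases hK.eq_or_lt with hK0 | hK0
    · rw [← hK0] at hmain ⊢
      simp only [mul_zero, ENNReal.ofReal_zero, zero_mul, add_zero, nonpos_iff_eq_zero] at hmain ⊢
      by_contra hZ0
      have h1 : ENNReal.ofReal (2 ^ (-(b / 2))) * Z < 1 * Z := by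
        apply (ENNReal.mul_lt_mul_iff_left hZ0 hZt).2
        rw [← ENNReal.ofReal_one]; exact (ENNReal.ofReal_lt_ofReal_iff (by norm_num)).2 hτ1
      rw [one_mul] at h1
      exact absurd hmain (not_le.2 h1)
    · rw [hQt, ENNReal.mul_top]; · exact le_top
      have := D82_pos hP hb
      simp; positivity
  · set z := Z.toReal with hz
    set w := Q.toReal with hw
    have hw0 : 0 ≤ w := ENNReal.toReal_nonneg
    rw [← ENNReal.ofReal_toReal hZt, ← ENNReal.ofReal_toReal hQt, ← hz, ← hw, ← ENNReal.ofReal_mul (by positivity),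
      ← ENNReal.ofReal_mul (by positivity), ← ENNReal.ofReal_add (by positivity) (by positivity),
      ENNReal.ofReal_le_ofReal_iff (by positivity)] at hmain
    rw [← ENNReal.ofReal_toReal hZt, ← ENNReal.ofReal_toReal hQt, ← hz, ← hw,
      ← ENNReal.ofReal_mul (mul_nonneg (D82_pos hP hb).le hK)]
    apply ENNReal.ofReal_le_ofReal
    unfold D82
    rw [← hθ, ← hCθ]
    have hd : 0 < 1 - (2:ℝ) ^ (-(b / 2)) := by linarith
    rw [div_mul_eq_mul_div, div_mul_eq_mul_div, le_div_iff₀ hd]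
    nlinarith

section
variable {n : ℕ} {p q s t M Λ r δ ε ℓ ϱ₀ r₀ C1 μ κ lam α β : ℝ} {a : En n × En n → ℝ} {u f : En n → ℝ} {c x₀ : En n} {k : ℝ}

lemma av_abs (hb : ∀ x, |u x| ≤ Λ) (c : En n) {r : ℝ} (hr : 0 < r) : |av n u c r| ≤ Λ := by
  have hv := vol_pos c hr
  have hvt : volume (ball c r) < ⊤ := measure_ball_lt_top
  have h1 := norm_setIntegral_le_of_norm_le_const (f := u) (μ := volume) hvt (C := Λ) (fun x _ => hb x)
  unfold av
  rw [setAverage_eq, smul_eq_mul, abs_mul, abs_inv, abs_of_nonneg measureReal_nonneg]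
  have hp : 0 < volume.real (ball c r) := ENNReal.toReal_pos hv.ne' hvt.ne
  rw [inv_mul_le_iff₀ hp, mul_comm]; exact h1

/-- The exponent of the dyadic weight is positive. -/
lemma w_pos (h : Dat n p q s t M Λ a u f δ) (hE : Eps n p q s t ε) : 0 < t * q / (p - 1) - s - ε := by
  have hp := h.hp
  have h2 := hE.h2
  have h0 := hE.h0
  have hp1 : 0 < p - 1 := by linarith
  have : s + ε < t * q / (p - 1) := by rw [lt_div_iff₀ hp1]; nlinarith
  linarith

lemma TailF_eq (n : ℕ) (p q s t ε : ℝ) (a : En n × En n → ℝ) (u : En n → ℝ) (x₀ : En n) (R : ℝ) :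
    TailF n p q s t ε a u x₀ R = ∑' k : ℕ, (2 : ℝ) ^ (-(k : ℝ) * (t * q / (p - 1) - s - ε)) * hk n p q s t ε a u x₀ (2 ^ k * R) := rfl

lemma Tail_term (h : Dat n p q s t M Λ a u f δ) (x₀ : En n) (R : ℝ) (k : ℕ) :
    0 ≤ (2 : ℝ) ^ (-(k : ℝ) * (t * q / (p - 1) - s - ε)) * hk n p q s t ε a u x₀ (2 ^ k * R) :=
  mul_nonneg (by positivity) (hk_nonneg h _ _)

lemma two_kw (k : ℕ) (w : ℝ) : (2:ℝ) ^ (-(k:ℝ) * w) = ((2:ℝ) ^ (-w)) ^ k := by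
  rw [← Real.rpow_natCast, ← Real.rpow_mul (by norm_num)]; congr 1; ring

lemma Tail_summable (h : Dat n p q s t M Λ a u f δ) (hE : Eps n p q s t ε) (x₀ : En n) {R : ℝ} (hR : 0 < R) :
    Summable fun k : ℕ => (2 : ℝ) ^ (-(k : ℝ) * (t * q / (p - 1) - s - ε)) * hk n p q s t ε a u x₀ (2 ^ k * R) := by
  obtain ⟨B, hB⟩ := hk_bdd h hE x₀ hR
  have hw := w_pos h hE
  have hg := (summable_geometric_of_lt_one (r := (2:ℝ) ^ (-(t * q / (p - 1) - s - ε))) (by positivity) (two_s hw)).mul_right B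
  refine Summable.of_nonneg_of_le (Tail_term h x₀ R) (fun k => ?_) hg
  rw [two_kw]
  refine mul_le_mul_of_nonneg_left (hB _ ?_) (by positivity)
  have : (1:ℝ) ≤ 2 ^ k := one_le_pow₀ (by norm_num)
  nlinarith

lemma Tail_nonneg (h : Dat n p q s t M Λ a u f δ) (x₀ : En n) (R : ℝ) : 0 ≤ TailF n p q s t ε a u x₀ R := by
  rw [TailF_eq]; exact tsum_nonneg (Tail_term h x₀ R)

lemma hk_le_Tail (h : Dat n p q s t M Λ a u f δ) (hE : Eps n p q s t ε) (x₀ : En n) {R : ℝ} (hR : 0 < R) :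
    hk n p q s t ε a u x₀ R ≤ TailF n p q s t ε a u x₀ R := by
  have := (Tail_summable h hE x₀ hR).le_tsum 0 (fun k _ => Tail_term h x₀ R k)
  rw [TailF_eq]
  simpa using this

def C80 (n : ℕ) (p q t : ℝ) : ℝ :=
  2 * 2 ^ (p - 1 + ((n:ℝ) + t * q)) * (1 + om n * (D82 (p - 1) (t * q) * (c1 n * 2 ^ (n:ℝ)))) * D81 n p

lemma C80_pos (h : Dat n p q s t M Λ a u f δ) : 0 < C80 n p q t := by
  have := om_pos n; have := c1_pos n; have := D81_pos n p; have := D82_pos (P := p - 1) (by have := h.hp; linarith) h.tq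
  unfold C80; positivity

lemma TT_bd (h : Dat n p q s t M Λ a u f δ) (hE : Eps n p q s t ε) (x₀ : En n) (hϱ : 0 < ϱ₀) (hϱ1 : ϱ₀ ≤ 1) :
    TT n p q s t u (av n u x₀ (2 * ϱ₀)) x₀ ϱ₀ ≤
      ENNReal.ofReal (C80 n p q t * (ϱ₀ ^ ((s + ε) * (p - 1) - s * p) * (ε ^ (-(1 / gammaEx n p s ε)) * TailF n p q s t ε a u x₀ (2 * ϱ₀)))) := by
  have hp := h.hp
  have hε := hE.h0
  have hP : 1 ≤ p - 1 := by linarith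
  have hP0 : 0 < p - 1 := by linarith
  have hb := h.tq
  have hu := h.hW.1
  have hom := om_pos n
  have hc1 := c1_pos n
  have hD81 := D81_pos n p
  have hD82 := D82_pos hP hb
  have hn : (0:ℝ) < n := by exact_mod_cast h.n0
  have hw := w_pos h hE
  have htq := h.htq
  set g := ε ^ (-(1 / gammaEx n p s ε)) with hg
  have hg0 : 0 < g := by positivity
  set ρ := 2 * ϱ₀ with hρ
  have hρ0 : 0 < ρ := by positivity
  have hR : ∀ k : ℕ, (0:ℝ) < 2 ^ k * ρ := fun k => by positivity
  set A : ℕ → ℝ := fun k => av n u x₀ (2 ^ k * ρ) with hA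
  have hA0 : av n u x₀ ρ = A 0 := by simp [hA]
  set H : ℕ → ℝ := fun k => hk n p q s t ε a u x₀ (2 ^ k * ρ) with hH
  have hH0 : ∀ k, 0 ≤ H k := fun k => hk_nonneg h x₀ _
  set y : ℕ → ℝ := fun k => D81 n p * (g * ((2 ^ k * ρ) ^ ((s + ε) * (p - 1)) * H k)) with hy
  have hy0 : ∀ k, 0 ≤ y k := fun k => by have := hH0 k; have := hR k; simp only [hy]; positivity
  have hEk : ∀ k, ∫⁻ x in ball x₀ (2 ^ k * ρ), ENNReal.ofReal (|u x - A k| ^ (p - 1)) ≤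
      ENNReal.ofReal ((2 ^ k * ρ) ^ (n:ℝ) * y k) := by
    intro k
    refine le_ofR (E_bd h hE x₀ (hR k)) (le_of_eq ?_)
    rw [Real.rpow_add (hR k)]; simp only [hy, hH]; ring
  set K := c1 n * 2 ^ (n:ℝ) with hK
  have hK0 : 0 < K := by positivity
  have hAy : ∀ k, |A (k + 1) - A k| ^ (p - 1) ≤ K * y (k + 1) := by
    intro k
    have h1 := av_pow h.n0 hu h.hb x₀ (hR k) (A (k + 1)) hP
    have h2 : ∫⁻ x in ball x₀ (2 ^ k * ρ), ENNReal.ofReal (|A (k + 1) - u x| ^ (p - 1)) ≤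
        ENNReal.ofReal ((2 ^ (k + 1) * ρ) ^ (n:ℝ) * y (k + 1)) := by
      simp only [abs_sub_comm (A (k + 1))]
      refine le_trans (lintegral_mono_set (ball_subset_ball ?_)) (hEk (k + 1))
      rw [pow_succ]; have := hR k; linarith
    have h3 := h1.trans (mul_ofR (by have := hR k; positivity) le_rfl h2)
    have hRk := hR k
    rw [ENNReal.ofReal_le_ofReal_iff (by have := hR k; have := hR (k+1); have := hy0 (k + 1); positivity)] at h3
    refine h3.trans (le_of_eq ?_)
    rw [pow_succ, show (2:ℝ) ^ k * 2 * ρ = 2 * (2 ^ k * ρ) by ring, Real.mul_rpow (x := 2) (by norm_num) hRk.le, Real.rpow_neg hRk.le]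
    have : (2 ^ k * ρ) ^ (n:ℝ) ≠ 0 := by positivity
    field_simp
    rw [hK]; ring
  have hL : ∀ k, |A k - A 0| ≤ 2 * Λ := by
    intro k
    have h1 := av_abs h.hb x₀ (hR k)
    have h2 := av_abs h.hb x₀ (hR 0)
    have h3 := abs_sub (A k) (A 0)
    linarith
  have hZ := tail_seq hP hb hρ0 hK0.le hL hy0 hAy
  set Z := ∑' k, ENNReal.ofReal ((2 ^ k * ρ) ^ (-(t * q)) * |A k - A 0| ^ (p - 1)) with hZd
  set Q := ∑' k, ENNReal.ofReal ((2 ^ k * ρ) ^ (-(t * q)) * y k) with hQd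
  set T := TailF n p q s t ε a u x₀ ρ with hT
  have hT0 : 0 ≤ T := Tail_nonneg h x₀ ρ
  set e1 := (s + ε) * (p - 1) - t * q with he1
  have hwe : e1 = -((p - 1) * (t * q / (p - 1) - s - ε)) := by rw [he1]; field_simp; ring
  have he10 : e1 ≤ 0 := by rw [hwe]; nlinarith
  have hQ : Q ≤ ENNReal.ofReal (D81 n p * (g * (ϱ₀ ^ e1 * T))) := by
    have : Q ≤ ∑' k : ℕ, ENNReal.ofReal (D81 n p * (g * ϱ₀ ^ e1)) * ENNReal.ofReal ((2 : ℝ) ^ (-(k : ℝ) * (t * q / (p - 1) - s - ε)) * H k) := by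
      refine ENNReal.tsum_le_tsum fun k => ?_
      rw [← ENNReal.ofReal_mul (by positivity)]
      apply ENNReal.ofReal_le_ofReal
      have hHk := hH0 k
      have hRk := hR k
      have e2 : (2 ^ k * ρ) ^ (-(t * q)) * y k = D81 n p * (g * ((2 ^ k * ρ) ^ e1 * H k)) := by
        rw [he1, sub_eq_add_neg, Real.rpow_add hRk]; simp only [hy]; ring
      have e3 : (2 ^ k * ρ) ^ e1 ≤ 2 ^ (-(k : ℝ) * (t * q / (p - 1) - s - ε)) * ϱ₀ ^ e1 := by
        rw [Real.mul_rpow (x := (2:ℝ) ^ k) (by positivity) hρ0.le]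
        refine mul_le_mul ?_ ?_ (by positivity) (by positivity)
        · rw [hwe, ← Real.rpow_natCast, ← Real.rpow_mul (by norm_num)]
          apply Real.rpow_le_rpow_of_exponent_le (by norm_num)
          have hk0 : (0:ℝ) ≤ k := by positivity
          nlinarith [mul_nonneg hk0 hw.le]
        · exact Real.rpow_le_rpow_of_nonpos hϱ (by rw [hρ]; linarith) he10
      rw [e2]
      calc D81 n p * (g * ((2 ^ k * ρ) ^ e1 * H k)) ≤ D81 n p * (g * ((2 ^ (-(k : ℝ) * (t * q / (p - 1) - s - ε)) * ϱ₀ ^ e1) * H k)) := by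
            gcongr
        _ = _ := by ring
    refine this.trans (le_of_eq ?_)
    rw [ENNReal.tsum_mul_left, ← ENNReal.ofReal_tsum_of_nonneg (Tail_term h x₀ ρ) (Tail_summable h hE x₀ hρ0), ← TailF_eq,
      ← ENNReal.ofReal_mul (by positivity), ← hT]
    congr 1; ring
  have hgm : Measurable fun x => ENNReal.ofReal (|u x - A 0| ^ (p - 1)) :=
    ((hu.sub_const (A 0)).norm.pow_const (p - 1)).ennreal_ofReal
  have hker : Measurable fun x : En n => ENNReal.ofReal (‖x - x₀‖ ^ (-((n:ℝ) + t * q))) :=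
    ((measurable_id.sub_const x₀).norm.pow_const _).ennreal_ofReal
  have h1 : TT n p q s t u (A 0) x₀ ϱ₀ ≤ ENNReal.ofReal (2 * ϱ₀ ^ (t * q - s * p)) *
      ∫⁻ x in (ball x₀ ρ)ᶜ, ENNReal.ofReal (|u x - A 0| ^ (p - 1)) * ENNReal.ofReal (‖x - x₀‖ ^ (-((n:ℝ) + t * q))) := by
    unfold TT
    have hgk : Measurable fun x => ENNReal.ofReal (|u x - A 0| ^ (p - 1)) * ENNReal.ofReal (‖x - x₀‖ ^ (-((n:ℝ) + t * q))) := hgm.mul hker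
    rw [← lintegral_const_mul _ hgk]
    refine setLIntegral_mono (measurable_const.mul hgk) fun x hx => ?_
    rw [← ENNReal.ofReal_mul (by positivity), ← ENNReal.ofReal_mul (by positivity)]
    apply ENNReal.ofReal_le_ofReal
    have hx1 : ρ ≤ ‖x - x₀‖ := by
      rw [mem_compl_iff, mem_ball, not_lt, dist_eq_norm] at hx; exact hx
    have hx0 : 0 < ‖x - x₀‖ := by linarith
    have hk1 : kap n p q s t x₀ x ≤ 2 * ϱ₀ ^ (t * q - s * p) * ‖x - x₀‖ ^ (-((n:ℝ) + t * q)) := by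
      unfold kap
      have a1 : ‖x - x₀‖ ^ (-((n:ℝ) + s * p)) = ‖x - x₀‖ ^ (t * q - s * p) * ‖x - x₀‖ ^ (-((n:ℝ) + t * q)) := by
        rw [← Real.rpow_add hx0]; congr 1; ring
      have a2 : ‖x - x₀‖ ^ (t * q - s * p) ≤ ϱ₀ ^ (t * q - s * p) :=
        Real.rpow_le_rpow_of_nonpos hϱ (by linarith) (by linarith)
      have a3 : 1 ≤ ϱ₀ ^ (t * q - s * p) := Real.one_le_rpow_of_pos_of_le_one_of_nonpos hϱ hϱ1 (by linarith)
      have a4 : 0 ≤ ‖x - x₀‖ ^ (-((n:ℝ) + t * q)) := by positivity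
      rw [a1]; nlinarith
    calc |u x - A 0| ^ (p - 1) * kap n p q s t x₀ x ≤ |u x - A 0| ^ (p - 1) * (2 * ϱ₀ ^ (t * q - s * p) * ‖x - x₀‖ ^ (-((n:ℝ) + t * q))) :=
          mul_le_mul_of_nonneg_left hk1 (by positivity)
      _ = _ := by ring
  have h2 := dyad hgm x₀ hρ0 (b := (n:ℝ) + t * q) (by positivity)
  have h3 : ∑' j : ℕ, ENNReal.ofReal ((2 ^ j * ρ) ^ (-((n:ℝ) + t * q))) * ∫⁻ x in ball x₀ (2 ^ (j + 1) * ρ), ENNReal.ofReal (|u x - A 0| ^ (p - 1)) ≤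
      ENNReal.ofReal (2 ^ (p - 1 + ((n:ℝ) + t * q))) * (Q + ENNReal.ofReal (om n) * Z) := by
    have h4 : ∀ j : ℕ, ENNReal.ofReal ((2 ^ j * ρ) ^ (-((n:ℝ) + t * q))) * ∫⁻ x in ball x₀ (2 ^ (j + 1) * ρ), ENNReal.ofReal (|u x - A 0| ^ (p - 1)) ≤
        ENNReal.ofReal (2 ^ (p - 1 + ((n:ℝ) + t * q))) * (ENNReal.ofReal ((2 ^ (j + 1) * ρ) ^ (-(t * q)) * y (j + 1)) +
          ENNReal.ofReal (om n) * ENNReal.ofReal ((2 ^ (j + 1) * ρ) ^ (-(t * q)) * |A (j + 1) - A 0| ^ (p - 1))) := by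
      intro j
      have hRj := hR j
      have hRj1 := hR (j + 1)
      have hyj := hy0 (j + 1)
      have h5 : ∫⁻ x in ball x₀ (2 ^ (j + 1) * ρ), ENNReal.ofReal (|u x - A 0| ^ (p - 1)) ≤
          ENNReal.ofReal (2 ^ (p - 1) * ((2 ^ (j + 1) * ρ) ^ (n:ℝ) * y (j + 1) + |A (j + 1) - A 0| ^ (p - 1) * (om n * (2 ^ (j + 1) * ρ) ^ (n:ℝ)))) := by
        have hm1 : Measurable fun x => ENNReal.ofReal (|u x - A (j + 1)| ^ (p - 1)) :=
          ((hu.sub_const (A (j + 1))).norm.pow_const (p - 1)).ennreal_ofReal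
        calc _ ≤ ∫⁻ x in ball x₀ (2 ^ (j + 1) * ρ), ENNReal.ofReal (2 ^ (p - 1)) *
              (ENNReal.ofReal (|u x - A (j + 1)| ^ (p - 1)) + ENNReal.ofReal (|A (j + 1) - A 0| ^ (p - 1))) := by
              refine lintegral_mono fun x => ?_
              rw [← ENNReal.ofReal_add (by positivity) (by positivity), ← ENNReal.ofReal_mul (by positivity)]
              apply ENNReal.ofReal_le_ofReal
              refine le_trans (Real.rpow_le_rpow (abs_nonneg _) ?_ hP0.le) (pow_add_le' hP0.le (abs_nonneg _) (abs_nonneg _))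
              have := abs_add_le (u x - A (j + 1)) (A (j + 1) - A 0)
              rwa [show u x - A (j + 1) + (A (j + 1) - A 0) = u x - A 0 by ring] at this
          _ = ENNReal.ofReal (2 ^ (p - 1)) * ((∫⁻ x in ball x₀ (2 ^ (j + 1) * ρ), ENNReal.ofReal (|u x - A (j + 1)| ^ (p - 1))) +
              ENNReal.ofReal (|A (j + 1) - A 0| ^ (p - 1)) * volume (ball x₀ (2 ^ (j + 1) * ρ))) := by
              have hm2 : Measurable fun x => ENNReal.ofReal (|u x - A (j + 1)| ^ (p - 1)) + ENNReal.ofReal (|A (j + 1) - A 0| ^ (p - 1)) :=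
                hm1.add measurable_const
              rw [lintegral_const_mul _ hm2, lintegral_add_left hm1, lintegral_const, Measure.restrict_apply_univ]
          _ ≤ _ := by
              refine mul_ofR (by positivity) le_rfl (add_ofR (by positivity) (by positivity) (hEk (j + 1)) (mul_ofR (by positivity) le_rfl ?_))
              rw [vol_ball _ hRj1.le h.n0]
      refine (mul_ofR (by positivity) le_rfl h5).trans (le_of_eq ?_)
      rw [← ENNReal.ofReal_mul hom.le, ← ENNReal.ofReal_add (by positivity) (by positivity), ← ENNReal.ofReal_mul (by positivity)]
      congr 1
      have e5 : (2 ^ j * ρ) ^ (-((n:ℝ) + t * q)) = 2 ^ ((n:ℝ) + t * q) * ((2 ^ (j + 1) * ρ) ^ (-(n:ℝ)) * (2 ^ (j + 1) * ρ) ^ (-(t * q))) := by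
        rw [← Real.rpow_add hRj1, show -(n:ℝ) + -(t * q) = -((n:ℝ) + t * q) by ring, pow_succ,
          show (2:ℝ) ^ j * 2 * ρ = 2 * (2 ^ j * ρ) by ring, Real.mul_rpow (x := 2) (by norm_num) hRj.le,
          Real.rpow_neg (by norm_num : (0:ℝ) ≤ 2)]
        field_simp
      have e6 : (2 ^ (j + 1) * ρ) ^ (-(n:ℝ)) * (2 ^ (j + 1) * ρ) ^ (n:ℝ) = 1 := by
        rw [← Real.rpow_add hRj1, neg_add_cancel, Real.rpow_zero]
      rw [e5, Real.rpow_add (by norm_num : (0:ℝ) < 2) (p - 1)]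
      linear_combination (2 ^ ((n:ℝ) + t * q) * (2 ^ (j + 1) * ρ) ^ (-(t * q)) * 2 ^ (p - 1) * (y (j + 1) + |A (j + 1) - A 0| ^ (p - 1) * om n)) * e6
    refine (ENNReal.tsum_le_tsum h4).trans ?_
    rw [ENNReal.tsum_mul_left, ENNReal.tsum_add, ENNReal.tsum_mul_left]
    refine mul_le_mul' le_rfl (add_le_add ?_ (mul_le_mul' le_rfl ?_))
    · rw [hQd, tsum_eq_zero_add' (f := fun k => ENNReal.ofReal ((2 ^ k * ρ) ^ (-(t * q)) * y k)) ENNReal.summable]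
      exact le_add_self
    · rw [hZd, tsum_eq_zero_add' (f := fun k => ENNReal.ofReal ((2 ^ k * ρ) ^ (-(t * q)) * |A k - A 0| ^ (p - 1))) ENNReal.summable]
      exact le_add_self
  rw [hA0]
  have h6 : Q + ENNReal.ofReal (om n) * Z ≤ ENNReal.ofReal ((1 + om n * (D82 (p - 1) (t * q) * K)) * (D81 n p * (g * (ϱ₀ ^ e1 * T)))) := by
    rw [add_mul, one_mul, mul_assoc (om n)]
    exact add_ofR (by positivity) (by positivity) hQ (mul_ofR hom.le le_rfl (hZ.trans (mul_ofR (by positivity) le_rfl hQ)))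
  refine (h1.trans (mul_ofR (by positivity) le_rfl (h2.trans (h3.trans (mul_ofR (by positivity) le_rfl h6))))).trans (le_of_eq ?_)
  congr 1
  have e7 : ϱ₀ ^ ((s + ε) * (p - 1) - s * p) = ϱ₀ ^ (t * q - s * p) * ϱ₀ ^ e1 := by
    rw [← Real.rpow_add hϱ, he1]; congr 1; ring
  rw [e7, C80, ← hK]; ring
end

section
variable {n : ℕ} {p q s t M Λ r δ ε ℓ ϱ₀ r₀ C1 μ κ lam α β : ℝ} {a : En n × En n → ℝ} {u f : En n → ℝ} {c x₀ : En n} {k : ℝ}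

def Ca0 (n : ℕ) (p q t : ℝ) : ℝ := 2 * C71 n * 160 ^ ((n:ℝ) + 1) + D81 n p * 2 ^ ((n:ℝ) + p) + C80 n p q t

lemma pC_one (hp : 2 ≤ p) : 1 ≤ pC p := by
  unfold pC; rw [le_div_iff₀ (by linarith)]; linarith

set_option maxHeartbeats 1000000 in
lemma lev_ok (h : Dat n p q s t M Λ a u f δ) (hE : Eps n p q s t ε) {C2 Ca Θ : ℝ} (hC2 : 1 ≤ C2) (hCa : Ca0 n p q t ≤ Ca)
    (hϱ1 : ϱ₀ ≤ 1) (hr0 : 0 < r₀) (hrϱ : r₀ ≤ ϱ₀ / 2) (hΘ0 : 0 ≤ Θ)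
    (hΘ1 : (⨍ z in bB n x₀ (2 * ϱ₀), Hfun n p q s t ε a u z ^ pC p ∂nu n p ε) ^ (1 / pC p) ≤ Θ)
    (hΘ2 : TailF n p q s t ε a u x₀ (2 * ϱ₀) ≤ Θ) (hlam : 0 < lam)
    (hl : Ca / ε * (ϱ₀ / r₀) ^ (2 * (n:ℝ) + p) * Θ ≤ lam)
    (hℓ : ℓ = C2 * ε ^ (-(1 / etaEx n p s ε)) * lam ^ (1 / (p - 1))) :
    Lev n p q s t ε ℓ u x₀ ϱ₀ r₀ := by
  have hp := h.hp
  have hp0 := h.p0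
  have hε := hE.h0
  have hε1 := h.eps1 hE
  have hεp := h.epsp hE
  have hs0 := h.hs0
  have hs1 := h.hs1
  have h3 := hE.h3
  have hϱ : 0 < ϱ₀ := by linarith
  have hp1 : 0 < p - 1 := by linarith
  have hn : (0:ℝ) < n := by exact_mod_cast h.n0
  have hη1 := eta_one h hE
  have hγ0 := gam_pos h hE
  have hγe := gam_eq n p s ε
  have hpC1 := pC_one hp
  have hpC0 : 0 < pC p := by linarith
  have hC71 := C71_one n
  have hD81 := D81_pos n p
  have hC80 := C80_pos h
  have hpCp : pC p * (p - 1) = p := by unfold pC; field_simp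
  set η := etaEx n p s ε with hη
  set γ := gammaEx n p s ε with hγ
  have hη0 : 0 < η := by linarith
  set g := ε ^ (-(1 / γ)) with hg
  have hg1 : 1 ≤ g := Real.one_le_rpow_of_pos_of_le_one_of_nonpos hε hε1.le (by simp; positivity)
  have hg0 : 0 < g := by linarith
  set X := ϱ₀ / r₀ with hX
  have hX1 : 1 ≤ X := by rw [hX, le_div_iff₀ hr0]; linarith
  have hX0 : 0 < X := by linarith
  have hϱX : ϱ₀ = X * r₀ := by rw [hX]; field_simp
  set Y := X ^ (2 * (n:ℝ) + p) with hY
  have hXY : ∀ e, e ≤ 2 * (n:ℝ) + p → X ^ e ≤ Y := fun e he => Real.rpow_le_rpow_of_exponent_le hX1 he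
  have hY1 : 1 ≤ Y := Real.one_le_rpow hX1 (by positivity)
  have hCaP : 0 < Ca0 n p q t := by unfold Ca0; positivity
  have hCa0 : 0 < Ca := by linarith
  have b160 : 0 < 2 * C71 n * 160 ^ ((n:ℝ) + 1) := by positivity
  have b2 : 0 < D81 n p * 2 ^ ((n:ℝ) + p) := by positivity
  have hCa1 : 2 * C71 n * 160 ^ ((n:ℝ) + 1) ≤ Ca := by unfold Ca0 at hCa; linarith
  have hCa2 : D81 n p * 2 ^ ((n:ℝ) + p) ≤ Ca := by unfold Ca0 at hCa; linarith
  have hCa3 : C80 n p q t ≤ Ca := by unfold Ca0 at hCa; linarith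
  have hCaone : 1 ≤ Ca := by
    have : (1:ℝ) ≤ 160 ^ ((n:ℝ) + 1) := Real.one_le_rpow (by norm_num) (by positivity)
    have h8 : 1 ≤ C71 n * 160 ^ ((n:ℝ) + 1) := one_le_mul_of_one_le_of_one_le hC71 this
    linarith
  have hε' : 1 ≤ 1 / ε := by rw [le_div_iff₀ hε]; linarith
  -- powers of ℓ
  have hℓ0 : 0 < ℓ := by rw [hℓ]; positivity
  have hℓ1 : g * lam ≤ ℓ ^ (p - 1) := by
    rw [hℓ, Real.mul_rpow (x := C2 * ε ^ (-(1 / η))) (by positivity) (by positivity), Real.mul_rpow (x := C2) (by positivity) (by positivity),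
      ← Real.rpow_mul hε.le, ← Real.rpow_mul hlam.le, one_div_mul_cancel hp1.ne', Real.rpow_one]
    have e1 : -(1 / η) * (p - 1) = -(1 / γ) := by rw [hγe]; field_simp
    rw [e1]
    have : 1 ≤ C2 ^ (p - 1) := Real.one_le_rpow hC2 hp1.le
    calc g * lam = 1 * g * lam := by ring
      _ ≤ _ := by rw [← hg]; gcongr
  have hℓ2 : lam ^ pC p ≤ ℓ ^ p := by
    calc lam ^ pC p ≤ (ℓ ^ (p - 1)) ^ pC p := by
          refine Real.rpow_le_rpow hlam.le ?_ hpC0.le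
          exact le_trans (le_mul_of_one_le_left hlam.le hg1) hℓ1
      _ = ℓ ^ p := by rw [← Real.rpow_mul hℓ0.le, mul_comm, hpCp]
  -- key inequalities
  have key0 : 1 ≤ Ca / ε * Y := by
    have : 1 ≤ Ca / ε := by rw [le_div_iff₀ hε]; linarith
    exact one_le_mul_of_one_le_of_one_le this hY1
  have key2 : Ca / ε * Y * Θ ^ pC p ≤ lam ^ pC p := by
    calc Ca / ε * Y * Θ ^ pC p = (Ca / ε * Y) ^ (1:ℝ) * Θ ^ pC p := by rw [Real.rpow_one]
      _ ≤ (Ca / ε * Y) ^ pC p * Θ ^ pC p := by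
          refine mul_le_mul_of_nonneg_right (Real.rpow_le_rpow_of_exponent_le key0 hpC1) (by positivity)
      _ = (Ca / ε * Y * Θ) ^ pC p := by rw [Real.mul_rpow (x := Ca / ε * Y) (by positivity) hΘ0]
      _ ≤ _ := Real.rpow_le_rpow (by positivity) hl hpC0.le
  have key1 : Ca * Y * Θ ≤ lam := by
    refine le_trans ?_ hl
    have : Ca ≤ Ca / ε := le_div_self hCa0.le hε hε1.le
    gcongr
  -- energy bound
  have hϱ2 : 0 < 2 * ϱ₀ := by linarith
  have hHn : ∀ z, 0 ≤ Hfun n p q s t ε a u z ^ pC p := fun z => Real.rpow_nonneg (Hfun_nonneg h.ha0 z) _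
  have hen : eB n p s u x₀ (2 * ϱ₀) ≤ ENNReal.ofReal (C71 n * (2 * ϱ₀) ^ ((n:ℝ) + ε * p) / ε * Θ ^ pC p) := by
    rw [eB_eq (ε := ε) hp h.hW.1]
    calc _ ≤ ∫⁻ z in bB n x₀ (2 * ϱ₀), ENNReal.ofReal (Hfun n p q s t ε a u z ^ pC p) ∂nu n p ε := by
          refine lintegral_mono fun z => ENNReal.ofReal_le_ofReal ?_
          rw [Hfun_pC hp h.ha0 z]; exact Gfun_ge h.ha0 z
      _ = nu n p ε (bB n x₀ (2 * ϱ₀)) * ENNReal.ofReal (⨍ z in bB n x₀ (2 * ϱ₀), Hfun n p q s t ε a u z ^ pC p ∂nu n p ε) := by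
          refine avg_lint (nu_pos h hE x₀ hϱ2).ne' (nu_lt_top h hE x₀ hϱ2).ne ((Hfun_meas h.ha h.hW.1).pow_const _) hHn ?_
          refine lt_of_le_of_lt (lintegral_mono' Measure.restrict_le_self le_rfl) ?_
          simp only [Hfun_pC hp h.ha0]
          exact Gnu_fin h hE
      _ ≤ _ := by
          refine mul_ofR (by positivity) (nu_le h hE x₀ hϱ2) (ENNReal.ofReal_le_ofReal ?_)
          have hA0 : 0 ≤ ⨍ z in bB n x₀ (2 * ϱ₀), Hfun n p q s t ε a u z ^ pC p ∂nu n p ε := by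
            rw [setAverage_eq, smul_eq_mul]
            exact mul_nonneg (by positivity) (integral_nonneg hHn)
          have := Real.rpow_le_rpow (by positivity) hΘ1 hpC0.le
          rwa [← Real.rpow_mul hA0, one_div_mul_cancel hpC0.ne', Real.rpow_one] at this
  have hεp1 : ε * p < 1 := by linarith
  have hsp1 : (s + ε) * (p - 1) ≤ p := by
    have : (s + ε) * (p - 1) ≤ 1 * (p - 1) := mul_le_mul_of_nonneg_right (by linarith) hp1.le
    linarith
  have hΘp : 0 ≤ Θ ^ pC p := by positivity
  refine ⟨hℓ0, hr0, hrϱ, hϱ1, ?_, ?_, ?_, ?_⟩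
  · -- h1a
    refine lt_of_le_of_lt hen ((ENNReal.ofReal_lt_ofReal_iff (by positivity)).2 ?_)
    have e1 : (2 * ϱ₀) ^ ((n:ℝ) + ε * p) = 160 ^ ((n:ℝ) + ε * p) * X ^ ((n:ℝ) + ε * p) * (r₀ / 80) ^ ((n:ℝ) + ε * p) := by
      rw [← Real.mul_rpow (by norm_num) hX0.le, ← Real.mul_rpow (by positivity) (by positivity)]
      congr 1; rw [hϱX]; ring
    have e2 : (160:ℝ) ^ ((n:ℝ) + ε * p) ≤ 160 ^ ((n:ℝ) + 1) := Real.rpow_le_rpow_of_exponent_le (by norm_num) (by linarith)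
    have e3 := hXY ((n:ℝ) + ε * p) (by linarith)
    have hrr : 0 < (r₀ / 80) ^ ((n:ℝ) + ε * p) := by positivity
    have hlp : 0 < lam ^ pC p := by positivity
    calc C71 n * (2 * ϱ₀) ^ ((n:ℝ) + ε * p) / ε * Θ ^ pC p
        = C71 n * (160 ^ ((n:ℝ) + ε * p) * X ^ ((n:ℝ) + ε * p)) / ε * Θ ^ pC p * (r₀ / 80) ^ ((n:ℝ) + ε * p) := by rw [e1]; ring
      _ ≤ C71 n * (160 ^ ((n:ℝ) + 1) * Y) / ε * Θ ^ pC p * (r₀ / 80) ^ ((n:ℝ) + ε * p) := by gcongr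
      _ = 1 / 2 * ((2 * C71 n * 160 ^ ((n:ℝ) + 1)) / ε * Y * Θ ^ pC p) * (r₀ / 80) ^ ((n:ℝ) + ε * p) := by ring
      _ ≤ 1 / 2 * (Ca / ε * Y * Θ ^ pC p) * (r₀ / 80) ^ ((n:ℝ) + ε * p) := by gcongr
      _ ≤ 1 / 2 * lam ^ pC p * (r₀ / 80) ^ ((n:ℝ) + ε * p) := by gcongr
      _ < ℓ ^ p * (r₀ / 80) ^ ((n:ℝ) + ε * p) := by
          refine mul_lt_mul_of_pos_right ?_ hrr
          linarith
  · -- h1b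
    refine le_ofR hen ?_
    have e1 : (2 * ϱ₀) ^ ((n:ℝ) + ε * p) = 2 ^ ((n:ℝ) + ε * p) * X ^ ((n:ℝ) + ε * p + s * p) * (r₀ ^ ((n:ℝ) + (s + ε) * p) * ϱ₀ ^ (-(s * p))) := by
      rw [hϱX, ← mul_assoc, Real.mul_rpow (x := 2 * X) (by positivity) hr0.le, Real.mul_rpow (x := 2) (by positivity) hX0.le,
        Real.mul_rpow (x := X) hX0.le hr0.le, show (n:ℝ) + (s + ε) * p = (n:ℝ) + ε * p + s * p by ring, Real.rpow_add hX0 _ (s * p), Real.rpow_add hr0 _ (s * p),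
        Real.rpow_neg hX0.le, Real.rpow_neg hr0.le]
      have : X ^ (s * p) ≠ 0 := by positivity
      have : r₀ ^ (s * p) ≠ 0 := by positivity
      field_simp
    have e2 : (2:ℝ) ^ ((n:ℝ) + ε * p) ≤ 2 * 160 ^ ((n:ℝ) + 1) := by
      calc (2:ℝ) ^ ((n:ℝ) + ε * p) ≤ 160 ^ ((n:ℝ) + ε * p) := Real.rpow_le_rpow (by norm_num) (by norm_num) (by positivity)
        _ ≤ 160 ^ ((n:ℝ) + 1) := Real.rpow_le_rpow_of_exponent_le (by norm_num) (by linarith)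
        _ ≤ _ := by have : (0:ℝ) < 160 ^ ((n:ℝ) + 1) := by positivity
                    linarith
    have e3 := hXY ((n:ℝ) + ε * p + s * p) (by have := h.hspn; linarith)
    set W := r₀ ^ ((n:ℝ) + (s + ε) * p) * ϱ₀ ^ (-(s * p)) with hW
    have hW0 : 0 ≤ W := by positivity
    calc C71 n * (2 * ϱ₀) ^ ((n:ℝ) + ε * p) / ε * Θ ^ pC p
        = C71 n * (2 ^ ((n:ℝ) + ε * p) * X ^ ((n:ℝ) + ε * p + s * p)) / ε * Θ ^ pC p * W := by rw [e1]; ring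
      _ ≤ C71 n * (2 * 160 ^ ((n:ℝ) + 1) * Y) / ε * Θ ^ pC p * W := by gcongr
      _ = ((2 * C71 n * 160 ^ ((n:ℝ) + 1)) / ε * Y * Θ ^ pC p) * W := by ring
      _ ≤ (Ca / ε * Y * Θ ^ pC p) * W := by gcongr
      _ ≤ ℓ ^ p * W := by gcongr; exact key2.trans hℓ2
      _ = _ := by rw [hW]; ring
  · -- h1c
    refine le_ofR (E_bd h hE x₀ hϱ2) ?_
    have e1 : (2 * ϱ₀) ^ ((n:ℝ) + (s + ε) * (p - 1)) = 2 ^ ((n:ℝ) + (s + ε) * (p - 1)) * X ^ ((n:ℝ) + (s + ε) * (p - 1)) * r₀ ^ ((n:ℝ) + (s + ε) * (p - 1)) := by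
      rw [hϱX, ← mul_assoc, Real.mul_rpow (x := 2 * X) (by positivity) hr0.le, Real.mul_rpow (x := 2) (by positivity) hX0.le]
    have e2 : (2:ℝ) ^ ((n:ℝ) + (s + ε) * (p - 1)) ≤ 2 ^ ((n:ℝ) + p) := Real.rpow_le_rpow_of_exponent_le (by norm_num) (by linarith)
    have e3 := hXY ((n:ℝ) + (s + ε) * (p - 1)) (by linarith)
    have e4 : hk n p q s t ε a u x₀ (2 * ϱ₀) ≤ Θ := (hk_le_Tail h hE x₀ hϱ2).trans hΘ2
    have e5 := hk_nonneg (ε := ε) h x₀ (2 * ϱ₀)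
    set H := hk n p q s t ε a u x₀ (2 * ϱ₀)
    set W := r₀ ^ ((n:ℝ) + (s + ε) * (p - 1)) with hW
    have hW0 : 0 ≤ W := by positivity
    rw [← hγ, ← hg, e1]
    calc D81 n p * (g * (2 ^ ((n:ℝ) + (s + ε) * (p - 1)) * X ^ ((n:ℝ) + (s + ε) * (p - 1)) * W * H))
        ≤ D81 n p * (g * (2 ^ ((n:ℝ) + p) * Y * W * Θ)) := by gcongr
      _ = g * ((D81 n p * 2 ^ ((n:ℝ) + p)) * Y * Θ) * W := by ring
      _ ≤ g * (Ca * Y * Θ) * W := by gcongr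
      _ ≤ g * lam * W := by gcongr
      _ ≤ ℓ ^ (p - 1) * W := by gcongr
  · -- h2
    refine le_ofR (TT_bd h hE x₀ hϱ hϱ1) ?_
    have e0 := eps_sub h hE
    have e1 : ϱ₀ ^ ((s + ε) * (p - 1) - s * p) ≤ r₀ ^ ((s + ε) * (p - 1) - s * p) :=
      Real.rpow_le_rpow_of_nonpos hr0 (by linarith) (by have : 0 < s / p := by positivity
                                                        linarith)
    have e5 := Tail_nonneg (ε := ε) h x₀ (2 * ϱ₀)
    set T := TailF n p q s t ε a u x₀ (2 * ϱ₀)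
    set W := r₀ ^ ((s + ε) * (p - 1) - s * p) with hW
    have hW0 : 0 ≤ W := by positivity
    rw [← hγ, ← hg]
    calc C80 n p q t * (ϱ₀ ^ ((s + ε) * (p - 1) - s * p) * (g * T))
        ≤ Ca * (W * (g * Θ)) := by gcongr
      _ = g * (Ca * 1 * Θ) * W := by ring
      _ ≤ g * (Ca * Y * Θ) * W := by gcongr
      _ ≤ g * lam * W := by gcongr
      _ ≤ ℓ ^ (p - 1) * W := by gcongr
end

section
variable {n : ℕ} {p q s t M Λ r δ ε ℓ ϱ₀ r₀ C1 μ κ lam α β : ℝ} {a : En n × En n → ℝ} {u f : En n → ℝ} {c x₀ : En n} {k : ℝ}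

/-- Integrals of nonnegative functions as lower integrals. -/
lemma int_lint {X : Type*} [MeasurableSpace X] {m : Measure X} {S : Set X} {g : X → ℝ}
    (hgm : Measurable g) (hg0 : ∀ z, 0 ≤ g z) :
    ∫ z in S, g z ∂m = (∫⁻ z in S, ENNReal.ofReal (g z) ∂m).toReal :=
  integral_eq_lintegral_of_nonneg_ae (ae_of_all _ hg0) hgm.aestronglyMeasurable

lemma Jbound (h : Dat n p q s t M Λ a u f δ) (hE : Eps n p q s t ε) {δf Θ lam0 : ℝ} (hδf : 0 < δf) (hδ : pStar n p s + δf ≤ δ)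
    (hϱ : 0 < ϱ₀) (hϱ1 : ϱ₀ ≤ 1) (hα : α ≤ 3 / 2 * ϱ₀) (hκ : 0 < κ) (hκ1 : κ < 1) (hlam : 0 < lam)
    (hΘ : UpsF n p ε (pStar n p s + δf) f x₀ (2 * ϱ₀) ≤ Θ) (hΘ0 : 0 ≤ Θ) (hlam0 : 0 ≤ lam0) (hΘl : Θ ≤ κ * lam0) :
    ∫⁻ z in bB n x₀ α ∩ {z | |f z.1| > κ * lam}, ENNReal.ofReal (|f z.1| ^ pStar n p s) ∂nu n p ε ≤
      ENNReal.ofReal (C71 n * 2 ^ ((n:ℝ) + 1) / ε * (lam ^ (-δf) * lam0 ^ (pStar n p s + δf))) := by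
  have hp := h.hp
  have hε := hE.h0
  have hεp := h.epsp hE
  have hs1 := h.hs1
  have hn : (0:ℝ) < n := by exact_mod_cast h.n0
  have hC71 := C71_one n
  have hPS := pStar_one hp h.hn h.hs0 h.hspn
  have hϱ2 : 0 < 2 * ϱ₀ := by linarith
  set P := pStar n p s with hP
  set Q := P + δf with hQ
  have hQ0 : 0 < Q := by linarith
  have hFn : ∀ z : En n × En n, 0 ≤ |f z.1| ^ Q := fun z => by positivity
  have hκl : 0 < κ * lam := by positivity
  calc _ ≤ ∫⁻ z in bB n x₀ α ∩ {z | |f z.1| > κ * lam}, ENNReal.ofReal ((κ * lam) ^ (-δf)) * ENNReal.ofReal (|f z.1| ^ Q) ∂nu n p ε := by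
        refine setLIntegral_mono ((Fm1 h.hf Q).const_mul _) fun z hz => ?_
        have hz1 : κ * lam < |f z.1| := hz.2
        have hz0 : 0 < |f z.1| := by linarith
        rw [← ENNReal.ofReal_mul (by positivity)]
        apply ENNReal.ofReal_le_ofReal
        rw [hQ, Real.rpow_add hz0, Real.rpow_neg hκl.le]
        have h1 : (κ * lam) ^ δf ≤ |f z.1| ^ δf := Real.rpow_le_rpow hκl.le hz1.le hδf.le
        have h2 : 0 < (κ * lam) ^ δf := by positivity
        have h3 : 0 < |f z.1| ^ P := by positivity
        rw [inv_mul_eq_div, le_div_iff₀ h2]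
        exact mul_le_mul_of_nonneg_left h1 h3.le
    _ ≤ ∫⁻ z in bB n x₀ (2 * ϱ₀), ENNReal.ofReal ((κ * lam) ^ (-δf)) * ENNReal.ofReal (|f z.1| ^ Q) ∂nu n p ε := by
        refine lintegral_mono_set (inter_subset_left.trans ?_)
        exact prod_mono (ball_subset_ball (by linarith)) (ball_subset_ball (by linarith))
    _ = ENNReal.ofReal ((κ * lam) ^ (-δf)) * ∫⁻ z in bB n x₀ (2 * ϱ₀), ENNReal.ofReal (|f z.1| ^ Q) ∂nu n p ε := by
        rw [lintegral_const_mul _ (Fm1 h.hf Q)]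
    _ = ENNReal.ofReal ((κ * lam) ^ (-δf)) * (nu n p ε (bB n x₀ (2 * ϱ₀)) * ENNReal.ofReal (⨍ z in bB n x₀ (2 * ϱ₀), |f z.1| ^ Q ∂nu n p ε)) := by
        have hFQ : Measurable fun z : En n × En n => |f z.1| ^ Q := (h.hf.norm.pow_const Q).comp measurable_fst
        rw [avg_lint (nu_pos h hE x₀ hϱ2).ne' (nu_lt_top h hE x₀ hϱ2).ne hFQ hFn
          (Fnu_fin h hE hQ0.le hδ x₀ hϱ2)]
    _ ≤ ENNReal.ofReal ((κ * lam) ^ (-δf) * (C71 n * (2 * ϱ₀) ^ ((n:ℝ) + ε * p) / ε * Θ ^ Q)) := by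
        refine mul_ofR (by positivity) le_rfl (mul_ofR (by have := h.p0; positivity) (nu_le h hE x₀ hϱ2) (ENNReal.ofReal_le_ofReal ?_))
        have hA0 : 0 ≤ ⨍ z in bB n x₀ (2 * ϱ₀), |f z.1| ^ Q ∂nu n p ε := by
          rw [setAverage_eq, smul_eq_mul]
          exact mul_nonneg (by positivity) (integral_nonneg hFn)
        unfold UpsF at hΘ
        have := Real.rpow_le_rpow (by positivity) hΘ hQ0.le
        rwa [← Real.rpow_mul hA0, one_div_mul_cancel hQ0.ne', Real.rpow_one] at this
    _ ≤ _ := by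
        apply ENNReal.ofReal_le_ofReal
        have e1 : (2 * ϱ₀) ^ ((n:ℝ) + ε * p) ≤ 2 ^ ((n:ℝ) + 1) := by
          have hp0 := h.p0
          calc (2 * ϱ₀) ^ ((n:ℝ) + ε * p) ≤ 2 ^ ((n:ℝ) + ε * p) := Real.rpow_le_rpow hϱ2.le (by linarith) (by positivity)
            _ ≤ _ := Real.rpow_le_rpow_of_exponent_le (by norm_num) (by linarith)
        have e2 : Θ ^ Q ≤ κ ^ δf * lam0 ^ Q := by
          calc Θ ^ Q ≤ (κ * lam0) ^ Q := Real.rpow_le_rpow hΘ0 hΘl hQ0.le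
            _ = κ ^ Q * lam0 ^ Q := Real.mul_rpow hκ.le hlam0
            _ ≤ _ := mul_le_mul_of_nonneg_right (Real.rpow_le_rpow_of_exponent_ge hκ hκ1.le (by linarith)) (by positivity)
        have e3 : (κ * lam) ^ (-δf) * κ ^ δf = lam ^ (-δf) := by
          rw [Real.mul_rpow hκ.le hlam.le, Real.rpow_neg hκ.le]
          have : κ ^ δf ≠ 0 := by positivity
          field_simp
        calc (κ * lam) ^ (-δf) * (C71 n * (2 * ϱ₀) ^ ((n:ℝ) + ε * p) / ε * Θ ^ Q)
            ≤ (κ * lam) ^ (-δf) * (C71 n * 2 ^ ((n:ℝ) + 1) / ε * (κ ^ δf * lam0 ^ Q)) := by gcongr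
          _ = C71 n * 2 ^ ((n:ℝ) + 1) / ε * (((κ * lam) ^ (-δf) * κ ^ δf) * lam0 ^ Q) := by ring
          _ = _ := by rw [e3]

lemma Ups_nonneg (n : ℕ) (p ε pe : ℝ) (f : En n → ℝ) (x₀ : En n) (R : ℝ) : 0 ≤ UpsF n p ε pe f x₀ R := by
  unfold UpsF
  refine Real.rpow_nonneg ?_ _
  rw [setAverage_eq, smul_eq_mul]
  exact mul_nonneg (by positivity) (integral_nonneg fun z => by positivity)

lemma PsiA_nonneg (ha0 : ∀ z, 0 ≤ a z) (x₀ : En n) (R : ℝ) :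
    0 ≤ (⨍ z in bB n x₀ R, Hfun n p q s t ε a u z ^ pC p ∂nu n p ε) ^ (1 / pC p) := by
  refine Real.rpow_nonneg ?_ _
  rw [setAverage_eq, smul_eq_mul]
  exact mul_nonneg (by positivity) (integral_nonneg fun z => Real.rpow_nonneg (Hfun_nonneg ha0 z) _)

lemma Psi_ge (hε : 0 < ε) (x₀ : En n) (R : ℝ) :
    (⨍ z in bB n x₀ R, Hfun n p q s t ε a u z ^ pC p ∂nu n p ε) ^ (1 / pC p) ≤ PsiF n p q s t ε 1 a u f x₀ R := by
  unfold PsiF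
  have h1 : 0 ≤ (⨍ z in bB n x₀ R, |f z.1| ^ pStar n p s ∂nu n p ε) ^ (1 / pStar n p s) := Ups_nonneg n p ε _ f x₀ R
  have h2 : 0 ≤ 1 * (nu n p ε (bB n x₀ R)).toReal ^ thetaEx n p s ε / ε ^ (1 / pStar n p s - 1 / pC p) := by positivity
  have := mul_nonneg h2 h1
  linarith

def Cff (n : ℕ) (p q s t M Λ C1 ε : ℝ) : ℝ :=
  c00 p q s t M Λ * C61 n p s * (C2f n C1 ^ p * ε ^ (-(p / etaEx n p s ε))) *
    (Cb n C1 ^ (1 / (1 - pStar n p s * thetaEx n p s ε)) *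
      (C71 n * 2 ^ ((n:ℝ) + 1) / ε) ^ (pStar n p s * thetaEx n p s ε / (1 - pStar n p s * thetaEx n p s ε)))

set_option maxHeartbeats 1000000 in
lemma fin_step (n : ℕ) (p q s t M Λ : ℝ) : ∃ C1 : ℝ, 1 ≤ C1 ∧
    ∀ {a : En n × En n → ℝ} {u f : En n → ℝ} {δ : ℝ}, Dat n p q s t M Λ a u f δ →
    ∀ {ε ϱ₀ κ lam α β δf Ca lam0 : ℝ} {x₀ : En n}, Eps n p q s t ε →
    0 < κ → κ < 1 → C1 * (2 * om n * 2 ^ (n:ℝ)) ^ (pC p / pStar n p s) * κ ^ pC p < 1 →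
    0 < δf → pStar n p s + δf ≤ δ → Ca0 n p q t ≤ Ca → 1 / κ ≤ Ca →
    0 < ϱ₀ → ϱ₀ ≤ 1 → ϱ₀ < β → β < α → α < 3 / 2 * ϱ₀ →
    lam0 = Ca / ε * (ϱ₀ / (α - β)) ^ (2 * (n : ℝ) + p) * ThetaF n p q s t ε δf a u f x₀ (2 * ϱ₀) → 0 < lam → lam0 ≤ lam →
    (1 / lam ^ pC p) * ∫ z in bB n x₀ β ∩ {z | Hfun n p q s t ε a u z > lam}, Hfun n p q s t ε a u z ^ pC p ∂nu n p ε ≤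
      K1c n p q s t M Λ C1 * C2f n C1 ^ p / (ε ^ (3 * (pC p - gammaEx n p s ε) / gammaEx n p s ε) * lam ^ gammaEx n p s ε) *
          ∫ z in bB n x₀ α ∩ {z | Hfun n p q s t ε a u z > lam}, Hfun n p q s t ε a u z ^ gammaEx n p s ε ∂nu n p ε
        + Cff n p q s t M Λ C1 ε * lam0 ^ ((pStar n p s + δf) * (pStar n p s * thetaEx n p s ε / (1 - pStar n p s * thetaEx n p s ε)))
            / lam ^ (pStar n p s * (1 + thetaEx n p s ε * δf) / (1 - pStar n p s * thetaEx n p s ε)) *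
          ∫ z in bB n x₀ α ∩ {z | |f z.1| > κ * lam}, |f z.1| ^ pStar n p s ∂nu n p ε := by
  obtain ⟨C1, hC1, hcore⟩ := core n p q s t M Λ
  refine ⟨C1, hC1, ?_⟩
  intro a u f δ h ε ϱ₀ κ lam α β δf Ca lam0 x₀ hE hκ hκ1 hκ2 hδf hδ hCa hCaκ hϱ hϱ1 hϱβ hβα hα hlam0 hlam hl
  have hp := h.hp
  have hp0 := h.p0
  have hp1 : 0 < p - 1 := by linarith
  have hε := hE.h0
  have hε1 := h.eps1 hE
  have hn : (0:ℝ) < n := by exact_mod_cast h.n0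
  have hη1 := eta_one h hE
  have hηp := eta_lt h hE
  have hγ0 := gam_pos h hE
  have hγp := gam_lt h hE
  have hγe := gam_eq n p s ε
  have hC71 := C71_one n
  have hom := om_pos n
  have hC2 := C2f_one n hC1
  have hPS := pStar_one hp h.hn h.hs0 h.hspn
  obtain ⟨hth1, hth2⟩ := theta_rng h hE
  have hc00 := h.c00_one
  have hC61 := C61_nonneg (n := n) h.p1 h.hs0
  have hpC1 := pC_one hp
  have hCb : 0 < Cb n C1 := by unfold Cb; positivity
  have hK1 : 0 ≤ K1c n p q s t M Λ C1 := by
    have := C60_pos n h.p1 h.hs0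
    unfold K1c; positivity
  have hϱ2 : 0 < 2 * ϱ₀ := by linarith
  have hα0 : 0 < α := by linarith
  have hr0 : 0 < α - β := by linarith
  have hu := h.hW.1
  have hT0 := Tail_nonneg (ε := ε) h x₀ (2 * ϱ₀)
  have hU0 := Ups_nonneg n p ε (pStar n p s + δf) f x₀ (2 * ϱ₀)
  have hP0 := PsiA_nonneg (p := p) (q := q) (s := s) (t := t) (ε := ε) (u := u) h.ha0 x₀ (2 * ϱ₀)
  have hP1 := Psi_ge (n := n) (p := p) (q := q) (s := s) (t := t) (a := a) (u := u) (f := f) hε x₀ (2 * ϱ₀)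
  set Θ := ThetaF n p q s t ε δf a u f x₀ (2 * ϱ₀) with hΘ
  have hΘe : Θ = UpsF n p ε (pStar n p s + δf) f x₀ (2 * ϱ₀) + TailF n p q s t ε a u x₀ (2 * ϱ₀) + PsiF n p q s t ε 1 a u f x₀ (2 * ϱ₀) := rfl
  have hΘ0 : 0 ≤ Θ := by rw [hΘe]; linarith
  have hΘ1 : (⨍ z in bB n x₀ (2 * ϱ₀), Hfun n p q s t ε a u z ^ pC p ∂nu n p ε) ^ (1 / pC p) ≤ Θ := by rw [hΘe]; linarith
  have hΘ2 : TailF n p q s t ε a u x₀ (2 * ϱ₀) ≤ Θ := by rw [hΘe]; linarith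
  have hΘ3 : UpsF n p ε (pStar n p s + δf) f x₀ (2 * ϱ₀) ≤ Θ := by rw [hΘe]; linarith
  have hκi : 0 < 1 / κ := by positivity
  have hCa0 : 0 < Ca := by linarith
  have hX1 : 1 ≤ ϱ₀ / (α - β) := by rw [le_div_iff₀ hr0]; linarith
  have hl0 : 0 ≤ lam0 := by rw [hlam0]; positivity
  have hΘl : Θ ≤ κ * lam0 := by
    have h1 : 1 ≤ (ϱ₀ / (α - β)) ^ (2 * (n : ℝ) + p) := Real.one_le_rpow hX1 (by positivity)
    have h2 : 1 / κ ≤ Ca / ε := hCaκ.trans (le_div_self hCa0.le hε hε1.le)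
    have h3 : 1 / κ * 1 ≤ Ca / ε * (ϱ₀ / (α - β)) ^ (2 * (n : ℝ) + p) := mul_le_mul h2 h1 (by norm_num) (by positivity)
    have h4 : 1 / κ * 1 * Θ ≤ lam0 := by rw [hlam0]; exact mul_le_mul_of_nonneg_right h3 hΘ0
    calc Θ = κ * (1 / κ * 1 * Θ) := by field_simp
      _ ≤ _ := mul_le_mul_of_nonneg_left h4 hκ.le
  set μ := lam ^ (1 / (p - 1)) with hμ
  have hμ0 : 0 < μ := by positivity
  have hμl : lam = μ ^ (p - 1) := by rw [hμ, ← Real.rpow_mul hlam.le, one_div_mul_cancel hp1.ne', Real.rpow_one]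
  obtain ⟨ℓ, hℓ⟩ : ∃ ℓ, ℓ = C2f n C1 * ε ^ (-(1 / etaEx n p s ε)) * μ := ⟨_, rfl⟩
  have hlev : Lev n p q s t ε ℓ u x₀ ϱ₀ (α - β) :=
    lev_ok h hE hC2 hCa hϱ1 hr0 (by linarith) hΘ0 hΘ1 hΘ2 hlam (by rw [← hlam0]; exact hl) hℓ
  have hJ := Jbound (x₀ := x₀) h hE hδf hδ hϱ hϱ1 hα.le hκ hκ1 hlam hΘ3 hΘ0 hl0 hΘl
  set K3 := C71 n * 2 ^ ((n:ℝ) + 1) / ε with hK3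
  have hK30 : 0 < K3 := by positivity
  have hJt0 : 0 ≤ K3 * (lam ^ (-δf) * lam0 ^ (pStar n p s + δf)) := by positivity
  have hmain := hcore h hE hlev hμ0 hμl hℓ hκ hκ2 hβα hα.le le_rfl hJt0 hJ
  -- pass to Bochner integrals
  have hHn := fun z => Hfun_nonneg (p := p) (q := q) (s := s) (t := t) (ε := ε) (u := u) h.ha0 z
  have hHm := Hfun_meas (p := p) (q := q) (s := s) (t := t) (ε := ε) h.ha hu
  have hFm : Measurable fun z : En n × En n => |f z.1| ^ pStar n p s := (h.hf.norm.pow_const (pStar n p s)).comp measurable_fst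
  rw [int_lint (hHm.pow_const (pC p)) (fun z => Real.rpow_nonneg (hHn z) _), int_lint (hHm.pow_const (gammaEx n p s ε)) (fun z => Real.rpow_nonneg (hHn z) _),
    int_lint hFm (fun z => by positivity)]
  have hI2t : ∫⁻ z in bB n x₀ α ∩ {z | Hfun n p q s t ε a u z > lam}, ENNReal.ofReal (Hfun n p q s t ε a u z ^ gammaEx n p s ε) ∂nu n p ε ≠ ⊤ := by
    refine ((Hg_le h hE _).trans_lt (ENNReal.add_lt_top.2 ⟨?_, Gnu_fin h hE⟩)).ne
    exact (measure_mono inter_subset_left).trans_lt (nu_lt_top h hE x₀ hα0)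
  have hI3t := (hJ.trans_lt ENNReal.ofReal_lt_top).ne
  set I1 := ∫⁻ z in bB n x₀ β ∩ {z | Hfun n p q s t ε a u z > lam}, ENNReal.ofReal (Hfun n p q s t ε a u z ^ pC p) ∂nu n p ε
  set I2 := ∫⁻ z in bB n x₀ α ∩ {z | Hfun n p q s t ε a u z > lam}, ENNReal.ofReal (Hfun n p q s t ε a u z ^ gammaEx n p s ε) ∂nu n p ε
  set I3 := ∫⁻ z in bB n x₀ α ∩ {z | |f z.1| > κ * lam}, ENNReal.ofReal (|f z.1| ^ pStar n p s) ∂nu n p ε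
  have hℓ0 : 0 < ℓ := hlev.hℓ
  set i2 := I2.toReal with hi2
  set i3 := I3.toReal with hi3
  have hi20 : 0 ≤ i2 := ENNReal.toReal_nonneg
  have hi30 : 0 ≤ i3 := ENNReal.toReal_nonneg
  set P := pStar n p s with hPd
  set θ := thetaEx n p s ε with hθd
  set γ := gammaEx n p s ε with hγd
  set η := etaEx n p s ε with hηd
  have hη0 : 0 < η := by linarith
  have hreal : I1.toReal ≤ K1c n p q s t M Λ C1 * ℓ ^ (p - η) * i2 +
      c00 p q s t M Λ * C61 n p s * ℓ ^ p * ((Cb n C1 / lam ^ P) ^ (1 / (1 - P * θ)) *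
        (K3 * (lam ^ (-δf) * lam0 ^ (P + δf))) ^ (P * θ / (1 - P * θ))) * i3 := by
    rw [← ENNReal.ofReal_toReal hI2t, ← ENNReal.ofReal_toReal hI3t, ← hi2, ← hi3, ← ENNReal.ofReal_mul (by positivity),
      ← ENNReal.ofReal_mul (by positivity), ← ENNReal.ofReal_add (by positivity) (by positivity)] at hmain
    exact ENNReal.toReal_le_of_le_ofReal (by positivity) hmain
  have hpγ : pC p - γ = (p - η) / (p - 1) := by rw [hγe]; unfold pC; ring
  have hℓpow : ∀ e : ℝ, ℓ ^ e = C2f n C1 ^ e * ε ^ (-(e / η)) * lam ^ (e / (p - 1)) := by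
    intro e
    rw [hℓ, Real.mul_rpow (x := C2f n C1 * ε ^ (-(1 / η))) (by positivity) hμ0.le, Real.mul_rpow (x := C2f n C1) (by positivity) (by positivity),
      ← Real.rpow_mul hε.le, hμ, ← Real.rpow_mul hlam.le]
    congr 2
    · congr 1; ring
    · ring
  have hlp : 0 < lam ^ pC p := by positivity
  -- first coefficient
  have hc1 : 1 / lam ^ pC p * (K1c n p q s t M Λ C1 * ℓ ^ (p - η)) ≤
      K1c n p q s t M Λ C1 * C2f n C1 ^ p / (ε ^ (3 * (pC p - γ) / γ) * lam ^ γ) := by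
    rw [hℓpow, ← hpγ, Real.rpow_sub hlam]
    have f1 : C2f n C1 ^ (p - η) ≤ C2f n C1 ^ p := Real.rpow_le_rpow_of_exponent_le hC2 (by linarith)
    have f2 : ε ^ (-((p - η) / η)) ≤ ε ^ (-(3 * (pC p - γ) / γ)) := by
      apply Real.rpow_le_rpow_of_exponent_ge hε hε1.le
      have : 3 * (pC p - γ) / γ = 3 * ((p - η) / η) := by rw [hpγ, hγe]; field_simp
      rw [this]
      have : 0 ≤ (p - η) / η := div_nonneg (by linarith) hη0.le
      linarith
    have hlg : 0 < lam ^ γ := by positivity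
    calc 1 / lam ^ pC p * (K1c n p q s t M Λ C1 * (C2f n C1 ^ (p - η) * ε ^ (-((p - η) / η)) * (lam ^ pC p / lam ^ γ)))
        = K1c n p q s t M Λ C1 * (C2f n C1 ^ (p - η) * ε ^ (-((p - η) / η))) / lam ^ γ := by field_simp
      _ ≤ K1c n p q s t M Λ C1 * (C2f n C1 ^ p * ε ^ (-(3 * (pC p - γ) / γ))) / lam ^ γ := by gcongr
      _ = _ := by
          rw [Real.rpow_neg hε.le]
          have : ε ^ (3 * (pC p - γ) / γ) ≠ 0 := by positivity
          field_simp
  -- second coefficient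
  have hc2 : 1 / lam ^ pC p * (c00 p q s t M Λ * C61 n p s * ℓ ^ p * ((Cb n C1 / lam ^ P) ^ (1 / (1 - P * θ)) *
        (K3 * (lam ^ (-δf) * lam0 ^ (P + δf))) ^ (P * θ / (1 - P * θ)))) =
      Cff n p q s t M Λ C1 ε * lam0 ^ ((P + δf) * (P * θ / (1 - P * θ))) / lam ^ (P * (1 + θ * δf) / (1 - P * θ)) := by
    have g1 : lam ^ (p / (p - 1)) = lam ^ pC p := rfl
    have g2 : (Cb n C1 / lam ^ P) ^ (1 / (1 - P * θ)) = Cb n C1 ^ (1 / (1 - P * θ)) * lam ^ (-(P * (1 / (1 - P * θ)))) := by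
      rw [Real.div_rpow hCb.le (by positivity), ← Real.rpow_mul hlam.le, Real.rpow_neg hlam.le, div_eq_mul_inv]
    have g3 : (K3 * (lam ^ (-δf) * lam0 ^ (P + δf))) ^ (P * θ / (1 - P * θ)) =
        K3 ^ (P * θ / (1 - P * θ)) * (lam ^ (-δf * (P * θ / (1 - P * θ))) * lam0 ^ ((P + δf) * (P * θ / (1 - P * θ)))) := by
      rw [Real.mul_rpow (x := K3) hK30.le (by positivity), Real.mul_rpow (x := lam ^ (-δf)) (by positivity) (by positivity),
        ← Real.rpow_mul hlam.le, ← Real.rpow_mul hl0]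
    have g4 : lam ^ (-(P * (1 / (1 - P * θ)))) * lam ^ (-δf * (P * θ / (1 - P * θ))) = (lam ^ (P * (1 + θ * δf) / (1 - P * θ)))⁻¹ := by
      rw [← Real.rpow_add hlam, ← Real.rpow_neg hlam.le]; congr 1
      have := hth2.ne'
      field_simp; ring
    rw [hℓpow, g1, g2, g3, Cff, ← hPd, ← hθd, ← hηd, ← hK3, div_eq_mul_inv _ (lam ^ (P * (1 + θ * δf) / (1 - P * θ))), ← g4]
    field_simp
  calc 1 / lam ^ pC p * I1.toReal ≤ 1 / lam ^ pC p * _ := mul_le_mul_of_nonneg_left hreal (by positivity)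
    _ = (1 / lam ^ pC p * (K1c n p q s t M Λ C1 * ℓ ^ (p - η))) * i2 + (1 / lam ^ pC p * (c00 p q s t M Λ * C61 n p s * ℓ ^ p * ((Cb n C1 / lam ^ P) ^ (1 / (1 - P * θ)) *
        (K3 * (lam ^ (-δf) * lam0 ^ (P + δf))) ^ (P * θ / (1 - P * θ))))) * i3 := by ring
    _ ≤ _ := by
        rw [hc2]
        exact add_le_add (mul_le_mul_of_nonneg_right hc1 hi20) le_rfl
end

/-- **Proposition 4.1, the level set estimate**: under (A1)–(A3) and (A4),
for a bounded weak solution `u` with data `f ∈ L^{p_*+δ₀}(ℝⁿ)`, `δ_f ∈ (0,δ₀)`,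
`0 < ϱ₀ ≤ 1` and `ϱ₀ < β < α < (3/2)ϱ₀`, there are constants `C_α = C_α(data) > 0`,
`C_a = C_a(data) > 0`, `C_f = C_f(data,ε) ≥ 1` and `κ_f = κ_f(data,ε) ∈ (0,1)` such that,
with `ϑ = 3(p'−γ)/γ`, `ϑ_f = (p_*+δ_f)p_*θ/(1−p_*θ)`, `ϑ̃_f = p_*(1+θδ_f)/(1−p_*θ)` and
`λ₀ = (C_a/ε)(ϱ₀/(α−β))^{2n+p} Θ(x₀,2ϱ₀)`, for every `λ ≥ λ₀`:
`λ^{−p'}∫_{𝓑(x₀,β)∩{H>λ}} H^{p'} dν ≤ C_α ε^{−ϑ} λ^{−γ} ∫_{𝓑(x₀,α)∩{H>λ}} H^γ dν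
  + C_f λ₀^{ϑ_f} λ^{−ϑ̃_f} ∫_{𝓑(x₀,α)∩{F>κ_f λ}} F^{p_*} dν`. -/
theorem stmt_11 (n : ℕ) (hn : 2 ≤ n) (p q s t M Λ : ℝ)
    (hp : 2 ≤ p) (hpq : p ≤ q)
    (hs0 : 0 < s) (hs1 : s < 1) (ht0 : 0 < t) (ht1 : t < 1) (hts : t ≤ s)
    (hlow : 1 / pC p ≤ t * q / (s * p)) (hhigh : t * q / (s * p) ≤ 1)
    (hspn : s * p < n) :
    ∃ Cα Ca : ℝ, 0 < Cα ∧ 0 < Ca ∧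
      ∀ ε : ℝ, 0 < ε → ε < s / p → ε < s * (t * q / (s * p) - 1 / pC p) → ε < 1 - s →
        ∃ Cf κf : ℝ, 1 ≤ Cf ∧ 0 < κf ∧ κf < 1 ∧
          ∀ a : En n × En n → ℝ, Measurable a →
            (∀ z, 0 ≤ a z) → (∀ z, a z ≤ M) → (∀ x y, a (x, y) = a (y, x)) →
          ∀ δ₀ δf : ℝ, 0 < δ₀ → 0 < δf → δf < δ₀ →
          ∀ f : En n → ℝ, Measurable f →
            (∫⁻ x, ENNReal.ofReal (|f x| ^ (pStar n p s + δ₀))) < ⊤ →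
          ∀ u : En n → ℝ, MemWsp n s p u → (∀ x, |u x| ≤ Λ) →
            IsBoundedWeakSolution n p q s t a u f →
          ∀ (x₀ : En n) (ϱ₀ β α : ℝ), 0 < ϱ₀ → ϱ₀ ≤ 1 → ϱ₀ < β → β < α →
            α < 3 / 2 * ϱ₀ →
          ∀ lam₀ : ℝ,
            lam₀ = Ca / ε * (ϱ₀ / (α - β)) ^ (2 * (n : ℝ) + p) *
              ThetaF n p q s t ε δf a u f x₀ (2 * ϱ₀) →
          ∀ lam : ℝ, lam₀ ≤ lam →
            (1 / lam ^ pC p) *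
                ∫ z in bB n x₀ β ∩ {z | Hfun n p q s t ε a u z > lam},
                  Hfun n p q s t ε a u z ^ pC p ∂nu n p ε ≤
              Cα / (ε ^ (3 * (pC p - gammaEx n p s ε) / gammaEx n p s ε)
                    * lam ^ gammaEx n p s ε) *
                  ∫ z in bB n x₀ α ∩ {z | Hfun n p q s t ε a u z > lam},
                    Hfun n p q s t ε a u z ^ gammaEx n p s ε ∂nu n p ε
                + Cf * lam₀ ^
                      ((pStar n p s + δf) *
                        (pStar n p s * thetaEx n p s ε /
                          (1 - pStar n p s * thetaEx n p s ε)))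
                    / lam ^
                      (pStar n p s * (1 + thetaEx n p s ε * δf) /
                        (1 - pStar n p s * thetaEx n p s ε)) *
                  ∫ z in bB n x₀ α ∩ {z | |f z.1| > κf * lam},
                    |f z.1| ^ pStar n p s ∂nu n p ε := by
  have hp0 : 0 < p := by linarith
  have hsp : 0 < s * p := by positivity
  have hpC1 := pC_one hp
  have hPS := pStar_one hp hn hs0 hspn
  have hM' : M ≤ |M| + 1 := by linarith [le_abs_self M]
  have hΛ' : Λ ≤ |Λ| + 1 := by linarith [le_abs_self Λ]
  obtain ⟨C1, hC1, hfin⟩ := fin_step n p q s t (|M| + 1) (|Λ| + 1)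
  have hom := om_pos n
  have hC2 := C2f_one n hC1
  obtain ⟨B, hB⟩ : ∃ B, B = C1 * (2 * om n * 2 ^ (n:ℝ)) ^ (pC p / pStar n p s) := ⟨_, rfl⟩
  have hB0 : 0 ≤ B := by rw [hB]; positivity
  obtain ⟨κ, hκd⟩ : ∃ κ, κ = 1 / (B + 2) := ⟨_, rfl⟩
  have hκ : 0 < κ := by rw [hκd]; positivity
  have hκ1 : κ < 1 := by rw [hκd, div_lt_one (by positivity)]; linarith
  have hκ2 : C1 * (2 * om n * 2 ^ (n:ℝ)) ^ (pC p / pStar n p s) * κ ^ pC p < 1 := by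
    rw [← hB]
    have h1 : κ ^ pC p ≤ κ ^ (1:ℝ) := Real.rpow_le_rpow_of_exponent_ge hκ hκ1.le hpC1
    rw [Real.rpow_one] at h1
    have h2 : B * κ < 1 := by rw [hκd, mul_one_div, div_lt_one (by positivity)]; linarith
    exact (mul_le_mul_of_nonneg_left h1 hB0).trans_lt h2
  obtain ⟨Cα, hCα⟩ : ∃ x, x = |K1c n p q s t (|M| + 1) (|Λ| + 1) C1 * C2f n C1 ^ p| + 1 := ⟨_, rfl⟩
  obtain ⟨Ca, hCa⟩ : ∃ x, x = |Ca0 n p q t| + 1 / κ := ⟨_, rfl⟩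
  have hκi : 0 < 1 / κ := by positivity
  have hCα0 : 0 < Cα := by rw [hCα]; positivity
  have hCa0 : 0 < Ca := by rw [hCa]; positivity
  refine ⟨Cα, Ca, hCα0, hCa0, ?_⟩
  intro ε hε hε1 hε2 hε3
  have hE2 : ε * p < t * q - s * (p - 1) := by
    have h1 : s * (t * q / (s * p) - 1 / pC p) = (t * q - s * (p - 1)) / p := by
      have : p - 1 ≠ 0 := by linarith
      unfold pC; field_simp
    rw [h1, lt_div_iff₀ hp0] at hε2
    exact hε2
  have hE : Eps n p q s t ε := ⟨hε, hε1, hE2, hε3⟩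
  obtain ⟨Cf, hCf⟩ : ∃ x, x = |Cff n p q s t (|M| + 1) (|Λ| + 1) C1 ε| + 1 := ⟨_, rfl⟩
  have hCf1 : 1 ≤ Cf := by rw [hCf]; linarith [abs_nonneg (Cff n p q s t (|M| + 1) (|Λ| + 1) C1 ε)]
  refine ⟨Cf, κ, hCf1, hκ, hκ1, ?_⟩
  intro a ha ha0 haM _ δ₀ δf hδ0 hδf hδ f hf hfδ u hu hub hw x₀ ϱ₀ β α hϱ hϱ1 hϱβ hβα hα lam0 hlam0 lam hl
  have h : Dat n p q s t (|M| + 1) (|Λ| + 1) a u f (pStar n p s + δ₀) := by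
    refine ⟨hn, hp, hpq, hs0, hs1, ht0, ?_, ?_, hspn, ?_, ?_, ha, ha0, fun z => (haM z).trans hM', hu,
      fun x => (hub x).trans hΛ', ?_, hf, by linarith, hfδ, hw⟩
    · rwa [div_le_one hsp] at hhigh
    · have : 0 < ε * p := by positivity
      linarith
    · linarith [abs_nonneg M]
    · linarith [abs_nonneg Λ]
    · have := hu.2.2
      unfold ee
      rw [setLIntegral_univ]
      refine lt_of_le_of_lt (le_of_eq (lintegral_congr fun z => ?_)) this
      rw [Real.rpow_neg (norm_nonneg _), div_eq_mul_inv]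
  have hT0 := Tail_nonneg (ε := ε) h x₀ (2 * ϱ₀)
  have hU0 := Ups_nonneg n p ε (pStar n p s + δf) f x₀ (2 * ϱ₀)
  have hP0 := PsiA_nonneg (p := p) (q := q) (s := s) (t := t) (ε := ε) (u := u) h.ha0 x₀ (2 * ϱ₀)
  have hP1 := Psi_ge (n := n) (p := p) (q := q) (s := s) (t := t) (a := a) (u := u) (f := f) hε x₀ (2 * ϱ₀)
  have hΘ0 : 0 ≤ ThetaF n p q s t ε δf a u f x₀ (2 * ϱ₀) := by unfold ThetaF; linarith
  have hX : 0 ≤ ϱ₀ / (α - β) := div_nonneg hϱ.le (by linarith)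
  have hl0 : 0 ≤ lam0 := by rw [hlam0]; positivity
  have hI2 : 0 ≤ ∫ z in bB n x₀ α ∩ {z | Hfun n p q s t ε a u z > lam},
      Hfun n p q s t ε a u z ^ gammaEx n p s ε ∂nu n p ε :=
    integral_nonneg fun z => Real.rpow_nonneg (Hfun_nonneg ha0 z) _
  have hI3 : 0 ≤ ∫ z in bB n x₀ α ∩ {z | |f z.1| > κ * lam}, |f z.1| ^ pStar n p s ∂nu n p ε :=
    integral_nonneg fun z => by positivity
  have hlam : 0 ≤ lam := hl0.trans hl
  have hCf0 : 0 ≤ Cf := by linarith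
  rcases hlam.eq_or_lt with h0 | h0
  · have hz : 1 / lam ^ pC p = 0 := by
      rw [← h0, Real.zero_rpow (by linarith : pC p ≠ 0), div_zero]
    rw [hz, zero_mul]
    positivity
  · refine (hfin h hE hκ hκ1 hκ2 hδf (by linarith) ?_ ?_ hϱ hϱ1 hϱβ hβα hα hlam0 h0 hl).trans ?_
    · rw [hCa]; linarith [le_abs_self (Ca0 n p q t)]
    · rw [hCa]; linarith [abs_nonneg (Ca0 n p q t)]
    · have e1 : K1c n p q s t (|M| + 1) (|Λ| + 1) C1 * C2f n C1 ^ p ≤ Cα := by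
        rw [hCα]; linarith [le_abs_self (K1c n p q s t (|M| + 1) (|Λ| + 1) C1 * C2f n C1 ^ p)]
      have e2 : Cff n p q s t (|M| + 1) (|Λ| + 1) C1 ε ≤ Cf := by
        rw [hCf]; linarith [le_abs_self (Cff n p q s t (|M| + 1) (|Λ| + 1) C1 ε)]
      gcongr

end
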